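/- There exists a constant C depending only on T, q, C₀ and on the initial data ρ₀,u₀,w₀,b₀,θ₀ — specifically on upper bounds for their H²((0,1))-norms, an upper bound for ∫₀¹ ρ₀(|ln ρ₀| + |ln θ₀|) dx, a positive lower bound for ∫₀¹ ρ₀ dx, and upper bounds for the L²(0,1)-norms of the compatibility functions g₁ = (∂ₓ²u₀ − ∂ₓ(ρ₀θ₀ + |b₀|²/2))/√ρ₀, g₂ = (∂ₓ²w₀ − ∂ₓb₀)/√ρ₀, g₃ = (∂ₓ(κ(θ₀)∂ₓθ₀) + (∂ₓu₀)² + |∂ₓw₀|² + |∂ₓb₀|²)/√ρ₀ — but not on the pointwise lower bounds of ρ₀ and θ₀, such that every smooth solution (ρ,u,w,b,θ) of the planar compressible MHD system on Q_T satisfies sup_{t∈[0,T]} ∫₀¹ (ρ_{xx}² + ρ_{xt}²)(x,t) dx + ∬_{Q_T} (ρ_{tt}² + u_{xxx}²) dx dt ≤ C. -/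

import Mathlib

open Real MeasureTheory Set

noncomputable section

/-- Partial derivative in the first (spatial) variable of `f : ℝ → ℝ → ℝ`, `f x t`. -/
def pdx (f : ℝ → ℝ → ℝ) : ℝ → ℝ → ℝ := fun x t => deriv (fun y => f y t) x

/-- Partial derivative in the second (time) variable. -/
def pdt (f : ℝ → ℝ → ℝ) : ℝ → ℝ → ℝ := fun x t => deriv (fun s => f x s) t

/-- The `L²(0,1)` norm of a function. -/
def L2norm (f : ℝ → ℝ) : ℝ := Real.sqrt (∫ x in (0:ℝ)..1, (f x) ^ 2)

/-- The `H²(0,1)` norm of a (smooth) function. -/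
def H2norm (f : ℝ → ℝ) : ℝ :=
  Real.sqrt (∫ x in (0:ℝ)..1, (f x) ^ 2 + (deriv f x) ^ 2 + (deriv (deriv f) x) ^ 2)

/-- A smooth solution of the planar compressible MHD system (all physical constants
normalized to `1`, perfect-gas pressure `P = ρθ`, heat conductivity `κ`) on
`Q_T = [0,1] × [0,T]`:  `ρ, u, θ` are scalar fields, `w, b` are `ℝ²`-valued fields
(given by their two components), everything is smooth, `ρ > 0` and `θ > 0` on `Q_T`,
the five PDEs hold on `Q_T`, and the boundary conditions
`u = 0`, `w = 0`, `b = 0`, `θ_x = 0` hold at `x = 0` and `x = 1`. -/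
structure MHDSol (T : ℝ) (κ : ℝ → ℝ) where
  ρ : ℝ → ℝ → ℝ
  u : ℝ → ℝ → ℝ
  θ : ℝ → ℝ → ℝ
  w : Fin 2 → ℝ → ℝ → ℝ
  b : Fin 2 → ℝ → ℝ → ℝ
  smooth_ρ : ContDiff ℝ (⊤ : ℕ∞) (Function.uncurry ρ)
  smooth_u : ContDiff ℝ (⊤ : ℕ∞) (Function.uncurry u)
  smooth_θ : ContDiff ℝ (⊤ : ℕ∞) (Function.uncurry θ)
  smooth_w : ∀ i, ContDiff ℝ (⊤ : ℕ∞) (Function.uncurry (w i))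
  smooth_b : ∀ i, ContDiff ℝ (⊤ : ℕ∞) (Function.uncurry (b i))
  ρ_pos : ∀ x ∈ Set.Icc (0:ℝ) 1, ∀ t ∈ Set.Icc (0:ℝ) T, 0 < ρ x t
  θ_pos : ∀ x ∈ Set.Icc (0:ℝ) 1, ∀ t ∈ Set.Icc (0:ℝ) T, 0 < θ x t
  eq_mass : ∀ x ∈ Set.Icc (0:ℝ) 1, ∀ t ∈ Set.Icc (0:ℝ) T,
    pdt ρ x t + pdx (fun x t => ρ x t * u x t) x t = 0
  eq_mom : ∀ x ∈ Set.Icc (0:ℝ) 1, ∀ t ∈ Set.Icc (0:ℝ) T,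
    pdt (fun x t => ρ x t * u x t) x t
      + pdx (fun x t =>
          ρ x t * (u x t) ^ 2 + ρ x t * θ x t + (∑ i, (b i x t) ^ 2) / 2) x t
      = pdx (pdx u) x t
  eq_w : ∀ i, ∀ x ∈ Set.Icc (0:ℝ) 1, ∀ t ∈ Set.Icc (0:ℝ) T,
    pdt (fun x t => ρ x t * w i x t) x t
      + pdx (fun x t => ρ x t * u x t * w i x t - b i x t) x t
      = pdx (pdx (w i)) x t
  eq_b : ∀ i, ∀ x ∈ Set.Icc (0:ℝ) 1, ∀ t ∈ Set.Icc (0:ℝ) T,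
    pdt (b i) x t + pdx (fun x t => u x t * b i x t - w i x t) x t
      = pdx (pdx (b i)) x t
  eq_θ : ∀ x ∈ Set.Icc (0:ℝ) 1, ∀ t ∈ Set.Icc (0:ℝ) T,
    pdt (fun x t => ρ x t * θ x t) x t
      + pdx (fun x t => ρ x t * u x t * θ x t) x t
      - pdx (fun x t => κ (θ x t) * pdx θ x t) x t
      = (pdx u x t) ^ 2 + (∑ i, (pdx (w i) x t) ^ 2) + (∑ i, (pdx (b i) x t) ^ 2)
        - ρ x t * θ x t * pdx u x t
  bc_u : ∀ t ∈ Set.Icc (0:ℝ) T, u 0 t = 0 ∧ u 1 t = 0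
  bc_w : ∀ i, ∀ t ∈ Set.Icc (0:ℝ) T, w i 0 t = 0 ∧ w i 1 t = 0
  bc_b : ∀ i, ∀ t ∈ Set.Icc (0:ℝ) T, b i 0 t = 0 ∧ b i 1 t = 0
  bc_θ : ∀ t ∈ Set.Icc (0:ℝ) T, pdx θ 0 t = 0 ∧ pdx θ 1 t = 0

/-- The heat conductivity `κ` is `C²` on `[0,∞)` and satisfies
`C₀⁻¹ (1 + s^q) ≤ κ(s) ≤ C₀ (1 + s^q)` there. -/
def KappaHyp (q C₀ : ℝ) (κ : ℝ → ℝ) : Prop :=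
  ContDiffOn ℝ 2 κ (Set.Ici 0) ∧
  (∀ s : ℝ, 0 ≤ s → C₀⁻¹ * (1 + s ^ q) ≤ κ s) ∧
  (∀ s : ℝ, 0 ≤ s → κ s ≤ C₀ * (1 + s ^ q))

/-- Bounds on the initial data: `A` is an upper bound for the `H²(0,1)` norms of
`ρ₀, u₀, w₀, b₀, θ₀`, `B` is an upper bound for `∫₀¹ ρ₀ (|ln ρ₀| + |ln θ₀|) dx`, and
`M` is a (positive) lower bound for the total mass `∫₀¹ ρ₀ dx`. -/
def InitBounds {T : ℝ} {κ : ℝ → ℝ} (sol : MHDSol T κ) (A B M : ℝ) : Prop :=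
  H2norm (fun x => sol.ρ x 0) ≤ A ∧ H2norm (fun x => sol.u x 0) ≤ A ∧
  H2norm (fun x => sol.θ x 0) ≤ A ∧
  (∀ i, H2norm (fun x => sol.w i x 0) ≤ A) ∧
  (∀ i, H2norm (fun x => sol.b i x 0) ≤ A) ∧
  (∫ x in (0:ℝ)..1, sol.ρ x 0 * (|Real.log (sol.ρ x 0)| + |Real.log (sol.θ x 0)|)) ≤ B ∧
  M ≤ ∫ x in (0:ℝ)..1, sol.ρ x 0

/-- `G` is an upper bound for the `L²(0,1)` norms of the compatibility functions
`g₁ = (∂ₓ²u₀ − ∂ₓ(ρ₀θ₀ + |b₀|²/2))/√ρ₀`, `g₂ = (∂ₓ²w₀ − ∂ₓb₀)/√ρ₀`,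
`g₃ = (∂ₓ(κ(θ₀)∂ₓθ₀) + (∂ₓu₀)² + |∂ₓw₀|² + |∂ₓb₀|²)/√ρ₀`. -/
def CompatBounds {T : ℝ} {κ : ℝ → ℝ} (sol : MHDSol T κ) (G : ℝ) : Prop :=
  L2norm (fun x =>
      (pdx (pdx sol.u) x 0
        - pdx (fun x t => sol.ρ x t * sol.θ x t + (∑ i, (sol.b i x t) ^ 2) / 2) x 0)
      / Real.sqrt (sol.ρ x 0)) ≤ G ∧
  (∀ i, L2norm (fun x =>
      (pdx (pdx (sol.w i)) x 0 - pdx (sol.b i) x 0) / Real.sqrt (sol.ρ x 0)) ≤ G) ∧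
  L2norm (fun x =>
      (pdx (fun x t => κ (sol.θ x t) * pdx sol.θ x t) x 0
        + (pdx sol.u x 0) ^ 2 + (∑ i, (pdx (sol.w i) x 0) ^ 2)
        + (∑ i, (pdx (sol.b i) x 0) ^ 2))
      / Real.sqrt (sol.ρ x 0)) ≤ G

set_option linter.all false

namespace MHD

/-- Bundled smooth functions of `(x,t)`. -/
structure SF where
  f : ℝ → ℝ → ℝ
  sm : ContDiff ℝ (⊤ : ℕ∞) (Function.uncurry f)

instance : CoeFun SF (fun _ => ℝ → ℝ → ℝ) := ⟨SF.f⟩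

@[fun_prop]
theorem SF.cont {X : Type*} [TopologicalSpace X] (F : SF) {g h : X → ℝ} (hg : Continuous g)
    (hh : Continuous h) : Continuous (fun a => F.f (g a) (h a)) :=
  F.sm.continuous.comp (hg.prodMk hh)

theorem SF.diff (F : SF) : Differentiable ℝ (Function.uncurry F.f) :=
  F.sm.differentiable (by simp)

theorem SF.hx_aux (F : SF) (x t : ℝ) :
    HasDerivAt (fun y => F.f y t) (fderiv ℝ (Function.uncurry F.f) (x, t) (1, 0)) x := by
  have h1 : HasDerivAt (fun y : ℝ => (y, t)) ((1 : ℝ), (0 : ℝ)) x :=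
    (hasDerivAt_id x).prodMk (hasDerivAt_const x t)
  exact (F.diff (x, t)).hasFDerivAt.comp_hasDerivAt x h1

theorem SF.ht_aux (F : SF) (x t : ℝ) :
    HasDerivAt (fun s => F.f x s) (fderiv ℝ (Function.uncurry F.f) (x, t) (0, 1)) t := by
  have h1 : HasDerivAt (fun s : ℝ => (x, s)) ((0 : ℝ), (1 : ℝ)) t :=
    (hasDerivAt_const t x).prodMk (hasDerivAt_id t)
  exact (F.diff (x, t)).hasFDerivAt.comp_hasDerivAt t h1

theorem SF.pdx_eq (F : SF) (x t : ℝ) :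
    pdx F.f x t = fderiv ℝ (Function.uncurry F.f) (x, t) (1, 0) := (F.hx_aux x t).deriv

theorem SF.pdt_eq (F : SF) (x t : ℝ) :
    pdt F.f x t = fderiv ℝ (Function.uncurry F.f) (x, t) (0, 1) := (F.ht_aux x t).deriv

theorem SF.sm_fderiv (F : SF) (v : ℝ × ℝ) :
    ContDiff ℝ (⊤ : ℕ∞) (fun p => fderiv ℝ (Function.uncurry F.f) p v) :=
  (F.sm.fderiv_right (m := (⊤ : ℕ∞)) (by simp)).clm_apply contDiff_const

/-- x-derivative -/
def dx (F : SF) : SF := ⟨pdx F.f, by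
  have : Function.uncurry (pdx F.f) = fun p => fderiv ℝ (Function.uncurry F.f) p (1, 0) := by
    funext p; exact F.pdx_eq p.1 p.2
  rw [this]; exact F.sm_fderiv _⟩

/-- t-derivative -/
def dt (F : SF) : SF := ⟨pdt F.f, by
  have : Function.uncurry (pdt F.f) = fun p => fderiv ℝ (Function.uncurry F.f) p (0, 1) := by
    funext p; exact F.pdt_eq p.1 p.2
  rw [this]; exact F.sm_fderiv _⟩

theorem SF.hx (F : SF) (x t : ℝ) : HasDerivAt (fun y => F.f y t) ((dx F).f x t) x := by
  have := F.hx_aux x t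
  rw [← F.pdx_eq] at this; exact this

theorem SF.ht (F : SF) (x t : ℝ) : HasDerivAt (fun s => F.f x s) ((dt F).f x t) t := by
  have := F.ht_aux x t
  rw [← F.pdt_eq] at this; exact this

theorem SF.ext' {F G : SF} (h : ∀ x t, F.f x t = G.f x t) : F = G := by
  cases F; cases G; congr; funext x t; exact h x t

theorem dx_val {F : SF} {x t d : ℝ} (h : HasDerivAt (fun y => F.f y t) d x) :
    (dx F).f x t = d := (F.hx x t).unique h

theorem dt_val {F : SF} {x t d : ℝ} (h : HasDerivAt (fun y => F.f x y) d t) :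
    (dt F).f x t = d := (F.ht x t).unique h

instance : Add SF := ⟨fun F G => ⟨fun x t => F.f x t + G.f x t, F.sm.add G.sm⟩⟩
instance : Sub SF := ⟨fun F G => ⟨fun x t => F.f x t - G.f x t, F.sm.sub G.sm⟩⟩
instance : Mul SF := ⟨fun F G => ⟨fun x t => F.f x t * G.f x t, F.sm.mul G.sm⟩⟩
instance : Neg SF := ⟨fun F => ⟨fun x t => - F.f x t, F.sm.neg⟩⟩
/-- constants -/
def cst (c : ℝ) : SF := ⟨fun _ _ => c, contDiff_const⟩
/-- the coordinate x -/
def xx : SF := ⟨fun x _ => x, contDiff_fst⟩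

theorem add_f (F G : SF) (x t : ℝ) : (F + G).f x t = F.f x t + G.f x t := rfl
theorem sub_f (F G : SF) (x t : ℝ) : (F - G).f x t = F.f x t - G.f x t := rfl
theorem mul_f (F G : SF) (x t : ℝ) : (F * G).f x t = F.f x t * G.f x t := rfl
theorem neg_f (F : SF) (x t : ℝ) : (-F).f x t = - F.f x t := rfl
theorem cst_f (c x t : ℝ) : (cst c).f x t = c := rfl
theorem xx_f (x t : ℝ) : xx.f x t = x := rfl

theorem dx_add (F G : SF) : dx (F + G) = dx F + dx G :=
  SF.ext' fun x t => dx_val ((F.hx x t).fun_add (G.hx x t))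
theorem dt_add (F G : SF) : dt (F + G) = dt F + dt G :=
  SF.ext' fun x t => dt_val ((F.ht x t).fun_add (G.ht x t))
theorem dx_sub (F G : SF) : dx (F - G) = dx F - dx G :=
  SF.ext' fun x t => dx_val ((F.hx x t).fun_sub (G.hx x t))
theorem dt_sub (F G : SF) : dt (F - G) = dt F - dt G :=
  SF.ext' fun x t => dt_val ((F.ht x t).fun_sub (G.ht x t))
theorem dx_neg (F : SF) : dx (-F) = - dx F :=
  SF.ext' fun x t => dx_val ((F.hx x t).fun_neg)
theorem dt_neg (F : SF) : dt (-F) = - dt F :=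
  SF.ext' fun x t => dt_val ((F.ht x t).fun_neg)
theorem dx_mul (F G : SF) : dx (F * G) = dx F * G + F * dx G :=
  SF.ext' fun x t => dx_val ((F.hx x t).fun_mul (G.hx x t))
theorem dt_mul (F G : SF) : dt (F * G) = dt F * G + F * dt G :=
  SF.ext' fun x t => dt_val ((F.ht x t).fun_mul (G.ht x t))
theorem dx_cst (c : ℝ) : dx (cst c) = cst 0 :=
  SF.ext' fun x _ => dx_val (hasDerivAt_const x c)
theorem dt_cst (c : ℝ) : dt (cst c) = cst 0 :=
  SF.ext' fun _ t => dt_val (hasDerivAt_const t c)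
theorem dx_xx : dx xx = cst 1 := SF.ext' fun x _ => dx_val (hasDerivAt_id x)
theorem dt_xx : dt xx = cst 0 := SF.ext' fun x t => dt_val (hasDerivAt_const t x)

theorem dt_dx (F : SF) : dt (dx F) = dx (dt F) := by
  apply SF.ext'
  intro x t
  have hd : Differentiable ℝ (fderiv ℝ (Function.uncurry F.f)) :=
    (F.sm.fderiv_right (m := (⊤ : ℕ∞)) (by simp)).differentiable (by simp)
  have e1 : Function.uncurry (dx F).f = fun p => fderiv ℝ (Function.uncurry F.f) p (1, 0) := by
    funext p; exact F.pdx_eq p.1 p.2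
  have e2 : Function.uncurry (dt F).f = fun p => fderiv ℝ (Function.uncurry F.f) p (0, 1) := by
    funext p; exact F.pdt_eq p.1 p.2
  have h1 : (dt (dx F)).f x t =
      fderiv ℝ (fderiv ℝ (Function.uncurry F.f)) (x, t) (0, 1) (1, 0) := by
    have := (dx F).pdt_eq x t
    rw [e1, fderiv_clm_apply (hd _) (differentiableAt_const _)] at this
    show pdt (dx F).f x t = _
    simpa using this
  have h2 : (dx (dt F)).f x t =
      fderiv ℝ (fderiv ℝ (Function.uncurry F.f)) (x, t) (1, 0) (0, 1) := by
    have := (dt F).pdx_eq x t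
    rw [e2, fderiv_clm_apply (hd _) (differentiableAt_const _)] at this
    show pdx (dt F).f x t = _
    simpa using this
  rw [h1, h2]
  have hs : IsSymmSndFDerivAt ℝ (Function.uncurry F.f) (x, t) :=
    (F.sm.contDiffAt).isSymmSndFDerivAt (by simp; exact WithTop.coe_le_coe.mpr le_top)
  exact hs _ _

theorem dx_f (F : SF) : (dx F).f = pdx F.f := rfl
theorem dt_f (F : SF) : (dt F).f = pdt F.f := rfl

attribute [irreducible] dx dt

/-- equality on a rectangle passes to x-derivatives -/
theorem dx_congr {T : ℝ} {F G : SF}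
    (h : ∀ x ∈ Icc (0:ℝ) 1, ∀ t ∈ Icc (0:ℝ) T, F.f x t = G.f x t) :
    ∀ x ∈ Icc (0:ℝ) 1, ∀ t ∈ Icc (0:ℝ) T, (dx F).f x t = (dx G).f x t := by
  intro x hx t ht
  have h1 := (F.hx x t).hasDerivWithinAt (s := Icc (0:ℝ) 1)
  have h2 := ((G.hx x t).hasDerivWithinAt (s := Icc (0:ℝ) 1)).congr
    (fun y hy => h y hy t ht) (h x hx t ht)
  exact (uniqueDiffOn_Icc zero_lt_one x hx).eq_deriv _ h1 h2

theorem dt_congr {T : ℝ} (hT : 0 < T) {F G : SF}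
    (h : ∀ x ∈ Icc (0:ℝ) 1, ∀ t ∈ Icc (0:ℝ) T, F.f x t = G.f x t) :
    ∀ x ∈ Icc (0:ℝ) 1, ∀ t ∈ Icc (0:ℝ) T, (dt F).f x t = (dt G).f x t := by
  intro x hx t ht
  have h1 := (F.ht x t).hasDerivWithinAt (s := Icc (0:ℝ) T)
  have h2 := ((G.ht x t).hasDerivWithinAt (s := Icc (0:ℝ) T)).congr
    (fun y hy => h x hx y hy) (h x hx t ht)
  exact (uniqueDiffOn_Icc hT t ht).eq_deriv _ h1 h2

/-- vanishing on the boundary passes to t-derivatives -/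
theorem dt_bc {T : ℝ} (hT : 0 < T) {F : SF} {x : ℝ}
    (h : ∀ t ∈ Icc (0:ℝ) T, F.f x t = 0) : ∀ t ∈ Icc (0:ℝ) T, (dt F).f x t = 0 := by
  intro t ht
  have h1 := (F.ht x t).hasDerivWithinAt (s := Icc (0:ℝ) T)
  have h2 := ((hasDerivAt_const t (0:ℝ)).hasDerivWithinAt (s := Icc (0:ℝ) T)).congr
    (f₁ := fun s => F.f x s) (fun y hy => h y hy) (h t ht)
  exact (uniqueDiffOn_Icc hT t ht).eq_deriv _ h1 h2

/-! ### integral tools -/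

theorem ii {f : ℝ → ℝ} (hf : Continuous f) (a b : ℝ) : IntervalIntegrable f volume a b :=
  hf.intervalIntegrable a b

theorem int_mono {a b : ℝ} (hab : a ≤ b) {f g : ℝ → ℝ}
    (h : ∀ x ∈ Icc a b, f x ≤ g x)
    (hf : Continuous f := by fun_prop) (hg : Continuous g := by fun_prop) :
    ∫ x in a..b, f x ≤ ∫ x in a..b, g x :=
  intervalIntegral.integral_mono_on hab (ii hf a b) (ii hg a b) h

theorem int_nonneg {a b : ℝ} (hab : a ≤ b) {f : ℝ → ℝ}
    (h : ∀ x ∈ Icc a b, 0 ≤ f x) : 0 ≤ ∫ x in a..b, f x :=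
  intervalIntegral.integral_nonneg hab h

/-- linear-combination bounds of integrals -/
theorem int_le5 {a b : ℝ} (hab : a ≤ b) {f g₁ g₂ g₃ g₄ g₅ : ℝ → ℝ} (c₁ c₂ c₃ c₄ c₅ : ℝ)
    (h : ∀ x ∈ Icc a b, f x ≤ c₁ * g₁ x + c₂ * g₂ x + c₃ * g₃ x + c₄ * g₄ x + c₅ * g₅ x)
    (hf : Continuous f := by fun_prop) (h₁ : Continuous g₁ := by fun_prop)
    (h₂ : Continuous g₂ := by fun_prop) (h₃ : Continuous g₃ := by fun_prop)
    (h₄ : Continuous g₄ := by fun_prop) (h₅ : Continuous g₅ := by fun_prop) :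
    ∫ x in a..b, f x ≤ c₁ * (∫ x in a..b, g₁ x) + c₂ * (∫ x in a..b, g₂ x)
      + c₃ * (∫ x in a..b, g₃ x) + c₄ * (∫ x in a..b, g₄ x) + c₅ * (∫ x in a..b, g₅ x) := by
  refine (int_mono hab h hf (by fun_prop)).trans (le_of_eq ?_)
  rw [intervalIntegral.integral_add (ii (by fun_prop) _ _) (ii (by fun_prop) _ _),
    intervalIntegral.integral_add (ii (by fun_prop) _ _) (ii (by fun_prop) _ _),
    intervalIntegral.integral_add (ii (by fun_prop) _ _) (ii (by fun_prop) _ _),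
    intervalIntegral.integral_add (ii (by fun_prop) _ _) (ii (by fun_prop) _ _)]
  simp only [intervalIntegral.integral_const_mul]

theorem int_le4 {a b : ℝ} (hab : a ≤ b) {f g₁ g₂ g₃ g₄ : ℝ → ℝ} (c₁ c₂ c₃ c₄ : ℝ)
    (h : ∀ x ∈ Icc a b, f x ≤ c₁ * g₁ x + c₂ * g₂ x + c₃ * g₃ x + c₄ * g₄ x)
    (hf : Continuous f := by fun_prop) (h₁ : Continuous g₁ := by fun_prop)
    (h₂ : Continuous g₂ := by fun_prop) (h₃ : Continuous g₃ := by fun_prop)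
    (h₄ : Continuous g₄ := by fun_prop) :
    ∫ x in a..b, f x ≤ c₁ * (∫ x in a..b, g₁ x) + c₂ * (∫ x in a..b, g₂ x)
      + c₃ * (∫ x in a..b, g₃ x) + c₄ * (∫ x in a..b, g₄ x) := by
  have := int_le5 hab (g₅ := fun _ => 0) c₁ c₂ c₃ c₄ 0 (fun x hx => by simpa using h x hx)
    hf h₁ h₂ h₃ h₄ (by fun_prop)
  simpa using this

theorem int_le3 {a b : ℝ} (hab : a ≤ b) {f g₁ g₂ g₃ : ℝ → ℝ} (c₁ c₂ c₃ : ℝ)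
    (h : ∀ x ∈ Icc a b, f x ≤ c₁ * g₁ x + c₂ * g₂ x + c₃ * g₃ x)
    (hf : Continuous f := by fun_prop) (h₁ : Continuous g₁ := by fun_prop)
    (h₂ : Continuous g₂ := by fun_prop) (h₃ : Continuous g₃ := by fun_prop) :
    ∫ x in a..b, f x ≤ c₁ * (∫ x in a..b, g₁ x) + c₂ * (∫ x in a..b, g₂ x)
      + c₃ * (∫ x in a..b, g₃ x) := by
  have := int_le4 hab (g₄ := fun _ => 0) c₁ c₂ c₃ 0 (fun x hx => by simpa using h x hx)
    hf h₁ h₂ h₃ (by fun_prop)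
  simpa using this

theorem int_le2 {a b : ℝ} (hab : a ≤ b) {f g₁ g₂ : ℝ → ℝ} (c₁ c₂ : ℝ)
    (h : ∀ x ∈ Icc a b, f x ≤ c₁ * g₁ x + c₂ * g₂ x)
    (hf : Continuous f := by fun_prop) (h₁ : Continuous g₁ := by fun_prop)
    (h₂ : Continuous g₂ := by fun_prop) :
    ∫ x in a..b, f x ≤ c₁ * (∫ x in a..b, g₁ x) + c₂ * (∫ x in a..b, g₂ x) := by
  have := int_le3 hab (g₃ := fun _ => 0) c₁ c₂ 0 (fun x hx => by simpa using h x hx)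
    hf h₁ h₂ (by fun_prop)
  simpa using this

theorem int_le1 {a b : ℝ} (hab : a ≤ b) {f g₁ : ℝ → ℝ} (c₁ : ℝ)
    (h : ∀ x ∈ Icc a b, f x ≤ c₁ * g₁ x)
    (hf : Continuous f := by fun_prop) (h₁ : Continuous g₁ := by fun_prop) :
    ∫ x in a..b, f x ≤ c₁ * (∫ x in a..b, g₁ x) := by
  have := int_le2 hab (g₂ := fun _ => 0) c₁ 0 (fun x hx => by simpa using h x hx)
    hf h₁ (by fun_prop)
  simpa using this

/-- enlarging the time interval -/
theorem int_ext {f : ℝ → ℝ} {t T : ℝ} (ht : t ∈ Icc (0:ℝ) T) (h0 : ∀ s ∈ Icc (0:ℝ) T, 0 ≤ f s)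
    (hf : Continuous f := by fun_prop) : ∫ s in (0:ℝ)..t, f s ≤ ∫ s in (0:ℝ)..T, f s := by
  rw [← intervalIntegral.integral_add_adjacent_intervals (ii hf 0 t) (ii hf t T)]
  have := int_nonneg ht.2 (f := f) (fun s hs => h0 s ⟨ht.1.trans hs.1, hs.2⟩)
  linarith

theorem cs1 {f : ℝ → ℝ} (hf : Continuous f) :
    (∫ x in (0:ℝ)..1, f x) ^ 2 ≤ ∫ x in (0:ℝ)..1, (f x) ^ 2 := by
  set m := ∫ x in (0:ℝ)..1, f x with hm
  have := int_le2 (zero_le_one' ℝ) (f := f) (g₁ := fun x => (f x)^2) (g₂ := fun _ => 1)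
    (1/2) (1/2)
  have h2 : ∫ x in (0:ℝ)..1, 2 * m * f x ≤ 1 * (∫ x in (0:ℝ)..1, (f x)^2) +
      m^2 * ∫ x in (0:ℝ)..1, (1:ℝ) :=
    int_le2 (zero_le_one' ℝ) 1 (m^2) (fun x _ => by nlinarith [sq_nonneg (f x - m)])
  rw [intervalIntegral.integral_const_mul, ← hm] at h2
  simp at h2
  nlinarith

theorem ftc {g g' : ℝ → ℝ} {a b : ℝ} (h : ∀ x ∈ Icc a b, HasDerivAt g (g' x) x) (hab : a ≤ b)
    (hc : Continuous g') : ∫ x in a..b, g' x = g b - g a :=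
  intervalIntegral.integral_eq_sub_of_hasDerivAt
    (fun x hx => h x (by rwa [uIcc_of_le hab] at hx)) (ii hc a b)

theorem osc {g g' : ℝ → ℝ} (h : ∀ x ∈ Icc (0:ℝ) 1, HasDerivAt g (g' x) x) (hc : Continuous g')
    {x y : ℝ} (hx : x ∈ Icc (0:ℝ) 1) (hy : y ∈ Icc (0:ℝ) 1) :
    |g x - g y| ≤ ∫ z in (0:ℝ)..1, |g' z| := by
  wlog hxy : y ≤ x generalizing x y
  · rw [abs_sub_comm]; exact this hy hx (le_of_not_ge hxy)
  have h1 := ftc (a := y) (b := x) (fun z hz => h z ⟨hy.1.trans hz.1, hz.2.trans hx.2⟩) hxy hc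
  rw [← h1]
  refine (intervalIntegral.abs_integral_le_integral_abs hxy).trans ?_
  refine intervalIntegral.integral_mono_interval hy.1 hxy hx.2 ?_ (ii (by fun_prop) _ _)
  filter_upwards with z using abs_nonneg _

theorem osc2 {g g' : ℝ → ℝ} (h : ∀ x ∈ Icc (0:ℝ) 1, HasDerivAt g (g' x) x) (hc : Continuous g')
    {x y : ℝ} (hx : x ∈ Icc (0:ℝ) 1) (hy : y ∈ Icc (0:ℝ) 1) :
    (g x - g y)^2 ≤ ∫ z in (0:ℝ)..1, (g' z)^2 := by
  have h1 := osc h hc hx hy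
  have h2 := cs1 (f := fun z => |g' z|) (by fun_prop)
  simp only [sq_abs] at h2
  refine le_trans ?_ h2
  rw [← sq_abs]
  exact pow_le_pow_left₀ (abs_nonneg _) h1 2

theorem sob0 {g g' : ℝ → ℝ} (h : ∀ x ∈ Icc (0:ℝ) 1, HasDerivAt g (g' x) x) (hc : Continuous g')
    (h0 : g 0 = 0) {x : ℝ} (hx : x ∈ Icc (0:ℝ) 1) :
    (g x)^2 ≤ ∫ z in (0:ℝ)..1, (g' z)^2 := by
  have := osc2 h hc hx (y := 0) ⟨le_rfl, zero_le_one⟩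
  simpa [h0] using this

theorem sob {g g' : ℝ → ℝ} (h : ∀ x ∈ Icc (0:ℝ) 1, HasDerivAt g (g' x) x) (hc : Continuous g')
    (hg : Continuous g) {x : ℝ} (hx : x ∈ Icc (0:ℝ) 1) :
    (g x)^2 ≤ 2 * (∫ z in (0:ℝ)..1, (g z)^2) + 2 * ∫ z in (0:ℝ)..1, (g' z)^2 := by
  have h2 : ∫ y in (0:ℝ)..1, (g x)^2 ≤ 2 * (∫ z in (0:ℝ)..1, (g z)^2) +
      (2 * ∫ z in (0:ℝ)..1, (g' z)^2) * ∫ z in (0:ℝ)..1, (1:ℝ) :=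
    int_le2 (zero_le_one' ℝ) 2 (2 * ∫ z in (0:ℝ)..1, (g' z)^2) (fun y hy => by
      have := osc2 h hc hx hy
      nlinarith [sq_nonneg (g x - 2 * g y)])
  simpa using h2

/-! ### the space-time divergence lemma -/

theorem swap_int {f : ℝ → ℝ → ℝ} (hf : Continuous (fun p : ℝ × ℝ => f p.1 p.2)) (a b c d : ℝ) :
    ∫ x in a..b, ∫ s in c..d, f x s = ∫ s in c..d, ∫ x in a..b, f x s := by
  apply intervalIntegral_intervalIntegral_swap
  have h1 : IntegrableOn (Function.uncurry f) (uIcc a b ×ˢ uIcc c d) :=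
    (hf : Continuous (Function.uncurry f)).continuousOn.integrableOn_compact
      (isCompact_uIcc.prod isCompact_uIcc)
  exact h1.mono_set (prod_mono uIoc_subset_uIcc uIoc_subset_uIcc)

theorem master' {T : ℝ} (e φ φx r : ℝ → ℝ → ℝ)
    (he : ∀ x ∈ Icc (0:ℝ) 1, ∀ t ∈ Icc (0:ℝ) T,
      HasDerivAt (fun s => e x s) (r x t - φx x t) t)
    (hφ : ∀ x ∈ Icc (0:ℝ) 1, ∀ t ∈ Icc (0:ℝ) T, HasDerivAt (fun y => φ y t) (φx x t) x)
    {t : ℝ} (ht : t ∈ Icc (0:ℝ) T)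
    (ce : Continuous (fun p : ℝ × ℝ => e p.1 p.2))
    (cφx : Continuous (fun p : ℝ × ℝ => φx p.1 p.2))
    (cr : Continuous (fun p : ℝ × ℝ => r p.1 p.2)) :
    (∫ x in (0:ℝ)..1, e x t) = (∫ x in (0:ℝ)..1, e x 0)
      + (∫ s in (0:ℝ)..t, ∫ x in (0:ℝ)..1, r x s) - ∫ s in (0:ℝ)..t, (φ 1 s - φ 0 s) := by
  have h1 : (∫ x in (0:ℝ)..1, e x t) - (∫ x in (0:ℝ)..1, e x 0)
      = ∫ x in (0:ℝ)..1, ∫ s in (0:ℝ)..t, (r x s - φx x s) := by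
    rw [← intervalIntegral.integral_sub (ii (by fun_prop) _ _) (ii (by fun_prop) _ _)]
    apply intervalIntegral.integral_congr
    intro x hx
    rw [uIcc_of_le zero_le_one] at hx
    exact (ftc (fun s hs => he x hx s ⟨hs.1, hs.2.trans ht.2⟩) ht.1 (by fun_prop)).symm
  have h2 : ∫ s in (0:ℝ)..t, (φ 1 s - φ 0 s) = ∫ s in (0:ℝ)..t, ∫ x in (0:ℝ)..1, φx x s := by
    apply intervalIntegral.integral_congr
    intro s hs
    rw [uIcc_of_le ht.1] at hs
    exact (ftc (fun x hx => hφ x hx s ⟨hs.1, hs.2.trans ht.2⟩) zero_le_one (by fun_prop)).symm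
  rw [swap_int (by fun_prop)] at h1
  have h3 : ∫ s in (0:ℝ)..t, ∫ x in (0:ℝ)..1, (r x s - φx x s) =
      (∫ s in (0:ℝ)..t, ∫ x in (0:ℝ)..1, r x s) - ∫ s in (0:ℝ)..t, ∫ x in (0:ℝ)..1, φx x s := by
    rw [← intervalIntegral.integral_sub (ii (by fun_prop) _ _) (ii (by fun_prop) _ _)]
    apply intervalIntegral.integral_congr
    intro s hs
    exact intervalIntegral.integral_sub (ii (by fun_prop) _ _) (ii (by fun_prop) _ _)
  linarith

/-- divergence lemma with vanishing flux at the boundary -/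
theorem master {T : ℝ} (e φ φx r : ℝ → ℝ → ℝ)
    (he : ∀ x ∈ Icc (0:ℝ) 1, ∀ t ∈ Icc (0:ℝ) T,
      HasDerivAt (fun s => e x s) (r x t - φx x t) t)
    (hφ : ∀ x ∈ Icc (0:ℝ) 1, ∀ t ∈ Icc (0:ℝ) T, HasDerivAt (fun y => φ y t) (φx x t) x)
    (h0 : ∀ t ∈ Icc (0:ℝ) T, φ 0 t = 0) (h1 : ∀ t ∈ Icc (0:ℝ) T, φ 1 t = 0)
    {t : ℝ} (ht : t ∈ Icc (0:ℝ) T)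
    (ce : Continuous (fun p : ℝ × ℝ => e p.1 p.2) := by fun_prop)
    (cφx : Continuous (fun p : ℝ × ℝ => φx p.1 p.2) := by fun_prop)
    (cr : Continuous (fun p : ℝ × ℝ => r p.1 p.2) := by fun_prop) :
    (∫ x in (0:ℝ)..1, e x t) = (∫ x in (0:ℝ)..1, e x 0)
      + ∫ s in (0:ℝ)..t, ∫ x in (0:ℝ)..1, r x s := by
  rw [master' e φ φx r he hφ ht ce cφx cr]
  have : ∫ s in (0:ℝ)..t, (φ 1 s - φ 0 s) = 0 := by
    rw [intervalIntegral.integral_congr (g := fun _ => (0:ℝ))]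
    · simp
    · intro s hs
      rw [uIcc_of_le ht.1] at hs
      simp [h0 s ⟨hs.1, hs.2.trans ht.2⟩, h1 s ⟨hs.1, hs.2.trans ht.2⟩]
  linarith

/-- divergence lemma for bundled smooth functions -/
theorem masterSF {T : ℝ} (e φ : SF) (r : ℝ → ℝ → ℝ)
    (hr : ∀ x ∈ Icc (0:ℝ) 1, ∀ t ∈ Icc (0:ℝ) T, (dt e).f x t + (dx φ).f x t = r x t)
    (h0 : ∀ t ∈ Icc (0:ℝ) T, φ.f 0 t = 0) (h1 : ∀ t ∈ Icc (0:ℝ) T, φ.f 1 t = 0)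
    {t : ℝ} (ht : t ∈ Icc (0:ℝ) T)
    (cr : Continuous (fun p : ℝ × ℝ => r p.1 p.2) := by fun_prop) :
    (∫ x in (0:ℝ)..1, e.f x t) = (∫ x in (0:ℝ)..1, e.f x 0)
      + ∫ s in (0:ℝ)..t, ∫ x in (0:ℝ)..1, r x s := by
  refine master e.f φ.f (dx φ).f r (fun x hx t ht => ?_) (fun x _ t _ => φ.hx x t) h0 h1 ht
  rw [← hr x hx t ht, add_sub_cancel_right]
  exact e.ht x t

/-! ### Gronwall -/

theorem gronwall {T X0 : ℝ} {X β : ℝ → ℝ} (hX : Continuous X) (hβ : Continuous β)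
    (hβ0 : ∀ t ∈ Icc (0:ℝ) T, 0 ≤ β t) (_hX0 : 0 ≤ X0)
    (h : ∀ t ∈ Icc (0:ℝ) T, X t ≤ X0 + ∫ s in (0:ℝ)..t, β s * X s) :
    ∀ t ∈ Icc (0:ℝ) T, X t ≤ X0 * Real.exp (∫ s in (0:ℝ)..t, β s) := by
  intro t ht
  -- Z = X0 + ∫ βX, Z' = βX ≤ βZ
  set Bt : ℝ → ℝ := fun t => ∫ s in (0:ℝ)..t, β s with hBt
  set Z : ℝ → ℝ := fun t => X0 + ∫ s in (0:ℝ)..t, β s * X s with hZ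
  have dB : ∀ t, HasDerivAt Bt (β t) t := fun t =>
    intervalIntegral.integral_hasDerivAt_right (ii hβ _ _)
      hβ.aestronglyMeasurable.stronglyMeasurableAtFilter hβ.continuousAt
  have hβX : Continuous fun s => β s * X s := by fun_prop
  have dZ : ∀ t, HasDerivAt Z (β t * X t) t := fun t =>
    (intervalIntegral.integral_hasDerivAt_right (ii hβX _ _)
      hβX.aestronglyMeasurable.stronglyMeasurableAtFilter hβX.continuousAt).const_add _
  have dW : ∀ t, HasDerivAt (fun t => Z t * Real.exp (-(Bt t)))
      (β t * X t * Real.exp (-(Bt t)) + Z t * (Real.exp (-(Bt t)) * (-(β t)))) t := fun t =>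
    (dZ t).fun_mul ((dB t).fun_neg.exp)
  have anti : AntitoneOn (fun t => Z t * Real.exp (-(Bt t))) (Icc 0 T) := by
    apply antitoneOn_of_deriv_nonpos (convex_Icc _ _)
    · exact fun t _ => (dW t).continuousAt.continuousWithinAt
    · exact fun t _ => (dW t).differentiableAt.differentiableWithinAt
    · intro s hs
      rw [interior_Icc] at hs
      have hs' : s ∈ Icc 0 T := Ioo_subset_Icc_self hs
      rw [(dW s).deriv]
      have e1 : X s ≤ Z s := h s hs'
      have e2 := hβ0 s hs'
      have e3 := Real.exp_pos (-(Bt s))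
      have : β s * X s * rexp (-Bt s) + Z s * (rexp (-Bt s) * -β s)
        = - (β s * (Z s - X s) * rexp (-Bt s)) := by ring
      rw [this]
      have : 0 ≤ β s * (Z s - X s) * rexp (-Bt s) :=
        mul_nonneg (mul_nonneg e2 (by linarith)) e3.le
      linarith
  have h0T : (0:ℝ) ∈ Icc 0 T := ⟨le_rfl, ht.1.trans ht.2⟩
  have := anti h0T ht ht.1
  have hZ0 : Z 0 = X0 := by simp [hZ]
  have hB0 : Bt 0 = 0 := by simp [hBt]
  simp only [hZ0, hB0, neg_zero, Real.exp_zero, mul_one] at this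
  have hm : Z t ≤ X0 * Real.exp (Bt t) := by
    have e3 := Real.exp_pos (Bt t)
    calc Z t = Z t * Real.exp (-(Bt t)) * Real.exp (Bt t) := by
          rw [mul_assoc, ← Real.exp_add]; simp
      _ ≤ X0 * Real.exp (Bt t) := mul_le_mul_of_nonneg_right this e3.le
  exact (h t ht).trans hm

/-- Gronwall with dissipation -/
theorem gronwallD {T X0 b : ℝ} {X D β : ℝ → ℝ} (hX : Continuous X) (hD : Continuous D)
    (hβ : Continuous β)
    (hβ0 : ∀ t ∈ Icc (0:ℝ) T, 0 ≤ β t) (hD0 : ∀ t ∈ Icc (0:ℝ) T, 0 ≤ D t) (hX0 : 0 ≤ X0)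
    (hXp : ∀ t ∈ Icc (0:ℝ) T, 0 ≤ X t)
    (h : ∀ t ∈ Icc (0:ℝ) T, X t + ∫ s in (0:ℝ)..t, D s ≤ X0 + ∫ s in (0:ℝ)..t, β s * X s)
    (hb : ∫ s in (0:ℝ)..T, β s ≤ b) :
    ∀ t ∈ Icc (0:ℝ) T, X t ≤ X0 * Real.exp b ∧
      ∫ s in (0:ℝ)..t, D s ≤ X0 + X0 * Real.exp b * b := by
  have hD1 : ∀ t ∈ Icc (0:ℝ) T, 0 ≤ ∫ s in (0:ℝ)..t, D s := fun t ht =>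
    int_nonneg ht.1 fun s hs => hD0 s ⟨hs.1, hs.2.trans ht.2⟩
  have g := gronwall hX hβ hβ0 hX0 (fun t ht => by
    have := h t ht; have := hD1 t ht; linarith)
  have hbt : ∀ t ∈ Icc (0:ℝ) T, ∫ s in (0:ℝ)..t, β s ≤ b := fun t ht =>
    (int_ext ht hβ0 hβ).trans hb
  have g1 : ∀ t ∈ Icc (0:ℝ) T, X t ≤ X0 * Real.exp b := fun t ht =>
    (g t ht).trans (mul_le_mul_of_nonneg_left (Real.exp_le_exp.mpr (hbt t ht)) hX0)
  intro t ht
  refine ⟨g1 t ht, ?_⟩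
  have e1 : ∫ s in (0:ℝ)..t, β s * X s ≤ (X0 * Real.exp b) * ∫ s in (0:ℝ)..t, β s :=
    int_le1 ht.1 _ (fun s hs => by
      have hs' : s ∈ Icc 0 T := ⟨hs.1, hs.2.trans ht.2⟩
      have := mul_le_mul_of_nonneg_left (g1 s hs') (hβ0 s hs')
      linarith)
  have e2 : (X0 * Real.exp b) * ∫ s in (0:ℝ)..t, β s ≤ X0 * Real.exp b * b :=
    mul_le_mul_of_nonneg_left (hbt t ht) (mul_nonneg hX0 (Real.exp_pos b).le)
  have := h t ht
  have := hXp t ht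
  linarith

end MHD

noncomputable section MHDProof

open Real MeasureTheory Set

namespace MHD

/-! ### parameters and flows -/

/-- fixed parameters: `N` bounds the data, `M` is a lower bound of the mass -/
structure Par where
  T : ℝ
  q : ℝ
  C₀ : ℝ
  κ : ℝ → ℝ
  N : ℝ
  M : ℝ
  hT : 0 < T
  hq : 0 < q
  hC₀ : 1 ≤ C₀
  hκ : KappaHyp q C₀ κ
  hN : 1 ≤ N
  hM : 0 < M

/-- space integral -/
def Ix (f : ℝ → ℝ → ℝ) (t : ℝ) : ℝ := ∫ x in (0:ℝ)..1, f x t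

@[fun_prop]
theorem Ix_cont {f : ℝ → ℝ → ℝ} (hf : Continuous (fun p : ℝ × ℝ => f p.1 p.2)) :
    Continuous (fun t => Ix f t) := by
  unfold Ix; fun_prop

/-- continuous extension of the conductivity -/
def κe (κ : ℝ → ℝ) (s : ℝ) : ℝ := κ |s|

/-- primitive -/
def prim (ψ : ℝ → ℝ) (s : ℝ) : ℝ := ∫ r in (0:ℝ)..s, ψ r

theorem prim_hd {ψ : ℝ → ℝ} (hψ : Continuous ψ) (s : ℝ) : HasDerivAt (prim ψ) (ψ s) s :=
  intervalIntegral.integral_hasDerivAt_right (ii hψ _ _)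
      hψ.aestronglyMeasurable.stronglyMeasurableAtFilter hψ.continuousAt

theorem prim_cont {ψ : ℝ → ℝ} (hψ : Continuous ψ) : Continuous (prim ψ) :=
  continuous_iff_continuousAt.mpr fun s => (prim_hd hψ s).continuousAt

theorem κe_cont (p : Par) : Continuous (κe p.κ) := by
  have h := p.hκ.1.continuousOn
  exact h.comp_continuous (f := fun s : ℝ => |s|) continuous_abs (fun s => abs_nonneg s)

/-- A smooth solution in components, with data bounds. -/
structure Flow (p : Par) where
  ρ : SF
  u : SF
  θ : SF
  w : SF
  v : SF
  b : SF
  c : SF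
  ρp : ∀ x ∈ Icc (0:ℝ) 1, ∀ t ∈ Icc (0:ℝ) p.T, 0 < ρ.f x t
  θp : ∀ x ∈ Icc (0:ℝ) 1, ∀ t ∈ Icc (0:ℝ) p.T, 0 < θ.f x t
  mass : ∀ x ∈ Icc (0:ℝ) 1, ∀ t ∈ Icc (0:ℝ) p.T,
    (dt ρ).f x t = -((dx ρ).f x t * u.f x t + ρ.f x t * (dx u).f x t)
  mom : ∀ x ∈ Icc (0:ℝ) 1, ∀ t ∈ Icc (0:ℝ) p.T,
    ρ.f x t * ((dt u).f x t + u.f x t * (dx u).f x t) = (dx (dx u)).f x t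
      - (dx ρ).f x t * θ.f x t - ρ.f x t * (dx θ).f x t
      - b.f x t * (dx b).f x t - c.f x t * (dx c).f x t
  eqw : ∀ x ∈ Icc (0:ℝ) 1, ∀ t ∈ Icc (0:ℝ) p.T,
    ρ.f x t * ((dt w).f x t + u.f x t * (dx w).f x t) = (dx (dx w)).f x t + (dx b).f x t
  eqv : ∀ x ∈ Icc (0:ℝ) 1, ∀ t ∈ Icc (0:ℝ) p.T,
    ρ.f x t * ((dt v).f x t + u.f x t * (dx v).f x t) = (dx (dx v)).f x t + (dx c).f x t
  eqb : ∀ x ∈ Icc (0:ℝ) 1, ∀ t ∈ Icc (0:ℝ) p.T,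
    (dt b).f x t = (dx (dx b)).f x t - (dx u).f x t * b.f x t - u.f x t * (dx b).f x t
      + (dx w).f x t
  eqc : ∀ x ∈ Icc (0:ℝ) 1, ∀ t ∈ Icc (0:ℝ) p.T,
    (dt c).f x t = (dx (dx c)).f x t - (dx u).f x t * c.f x t - u.f x t * (dx c).f x t
      + (dx v).f x t
  eqθ : ∀ x ∈ Icc (0:ℝ) 1, ∀ t ∈ Icc (0:ℝ) p.T,
    HasDerivAt (fun y => κe p.κ (θ.f y t) * (dx θ).f y t)
      (ρ.f x t * ((dt θ).f x t + u.f x t * (dx θ).f x t) + ρ.f x t * θ.f x t * (dx u).f x t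
        - ((dx u).f x t ^ 2 + (dx w).f x t ^ 2 + (dx v).f x t ^ 2 + (dx b).f x t ^ 2
          + (dx c).f x t ^ 2)) x
  u0 : ∀ t ∈ Icc (0:ℝ) p.T, u.f 0 t = 0
  u1 : ∀ t ∈ Icc (0:ℝ) p.T, u.f 1 t = 0
  w0 : ∀ t ∈ Icc (0:ℝ) p.T, w.f 0 t = 0
  w1 : ∀ t ∈ Icc (0:ℝ) p.T, w.f 1 t = 0
  v0 : ∀ t ∈ Icc (0:ℝ) p.T, v.f 0 t = 0
  v1 : ∀ t ∈ Icc (0:ℝ) p.T, v.f 1 t = 0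
  b0 : ∀ t ∈ Icc (0:ℝ) p.T, b.f 0 t = 0
  b1 : ∀ t ∈ Icc (0:ℝ) p.T, b.f 1 t = 0
  c0 : ∀ t ∈ Icc (0:ℝ) p.T, c.f 0 t = 0
  c1 : ∀ t ∈ Icc (0:ℝ) p.T, c.f 1 t = 0
  θ0 : ∀ t ∈ Icc (0:ℝ) p.T, (dx θ).f 0 t = 0
  θ1 : ∀ t ∈ Icc (0:ℝ) p.T, (dx θ).f 1 t = 0
  iρ : ∀ x ∈ Icc (0:ℝ) 1, |ρ.f x 0| ≤ p.N ∧ |(dx ρ).f x 0| ≤ p.N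
  iu : ∀ x ∈ Icc (0:ℝ) 1, |u.f x 0| ≤ p.N ∧ |(dx u).f x 0| ≤ p.N
  iθ : ∀ x ∈ Icc (0:ℝ) 1, |θ.f x 0| ≤ p.N ∧ |(dx θ).f x 0| ≤ p.N
  iw : ∀ x ∈ Icc (0:ℝ) 1, |w.f x 0| ≤ p.N ∧ |(dx w).f x 0| ≤ p.N
  iv : ∀ x ∈ Icc (0:ℝ) 1, |v.f x 0| ≤ p.N ∧ |(dx v).f x 0| ≤ p.N
  ib : ∀ x ∈ Icc (0:ℝ) 1, |b.f x 0| ≤ p.N ∧ |(dx b).f x 0| ≤ p.N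
  ic : ∀ x ∈ Icc (0:ℝ) 1, |c.f x 0| ≤ p.N ∧ |(dx c).f x 0| ≤ p.N
  jρ : Ix (fun x t => (dx (dx ρ)).f x t ^ 2) 0 ≤ p.N
  jw : Ix (fun x t => (dx (dx w)).f x t ^ 2) 0 ≤ p.N
  jv : Ix (fun x t => (dx (dx v)).f x t ^ 2) 0 ≤ p.N
  jb : Ix (fun x t => (dx (dx b)).f x t ^ 2) 0 ≤ p.N
  jc : Ix (fun x t => (dx (dx c)).f x t ^ 2) 0 ≤ p.N
  jU : Ix (fun x t => ρ.f x t * ((dt u).f x t + u.f x t * (dx u).f x t) ^ 2) 0 ≤ p.N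
  jM : p.M ≤ Ix (fun x t => ρ.f x t) 0

/-- exchange the two transverse components -/
def Flow.swap {p : Par} (S : Flow p) : Flow p where
  ρ := S.ρ
  u := S.u
  θ := S.θ
  w := S.v
  v := S.w
  b := S.c
  c := S.b
  ρp := S.ρp
  θp := S.θp
  mass := S.mass
  mom := fun x hx t ht => by rw [S.mom x hx t ht]; ring
  eqw := S.eqv
  eqv := S.eqw
  eqb := S.eqc
  eqc := S.eqb
  eqθ := fun x hx t ht => (S.eqθ x hx t ht).congr_deriv (by ring)
  u0 := S.u0
  u1 := S.u1
  w0 := S.v0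
  w1 := S.v1
  v0 := S.w0
  v1 := S.w1
  b0 := S.c0
  b1 := S.c1
  c0 := S.b0
  c1 := S.b1
  θ0 := S.θ0
  θ1 := S.θ1
  iρ := S.iρ
  iu := S.iu
  iθ := S.iθ
  iw := S.iv
  iv := S.iw
  ib := S.ic
  ic := S.ib
  jρ := S.jρ
  jw := S.jv
  jv := S.jw
  jb := S.jc
  jc := S.jb
  jU := S.jU
  jM := S.jM

theorem h2sup {F : SF} {A : ℝ} (h : H2norm (fun x => F.f x 0) ≤ A) :
    (∀ x ∈ Icc (0:ℝ) 1, |F.f x 0| ≤ 1 + 4 * A^2 ∧ |(dx F).f x 0| ≤ 1 + 4 * A^2) ∧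
    Ix (fun x t => (dx (dx F)).f x t ^ 2) 0 ≤ 1 + 4 * A^2 := by
  have e : H2norm (fun x => F.f x 0) = Real.sqrt (∫ x in (0:ℝ)..1,
      (F.f x 0) ^ 2 + ((dx F).f x 0) ^ 2 + ((dx (dx F)).f x 0) ^ 2) := by
    simp only [dx_f]; rfl
  rw [e] at h
  set E := ∫ x in (0:ℝ)..1,
      (F.f x 0) ^ 2 + ((dx F).f x 0) ^ 2 + ((dx (dx F)).f x 0) ^ 2 with hE
  have hA : E ≤ A^2 := by
    have h0 : 0 ≤ A := (Real.sqrt_nonneg _).trans h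
    exact (Real.sqrt_le_left h0).mp h
  have a1 : ∫ x in (0:ℝ)..1, (F.f x 0)^2 ≤ 1 * E :=
    int_le1 zero_le_one 1 (fun x _ => by nlinarith [sq_nonneg (F.f x 0), sq_nonneg ((dx F).f x 0), sq_nonneg ((dx (dx F)).f x 0)])
  have a2 : ∫ x in (0:ℝ)..1, ((dx F).f x 0)^2 ≤ 1 * E :=
    int_le1 zero_le_one 1 (fun x _ => by nlinarith [sq_nonneg (F.f x 0), sq_nonneg ((dx F).f x 0), sq_nonneg ((dx (dx F)).f x 0)])
  have a3 : ∫ x in (0:ℝ)..1, ((dx (dx F)).f x 0)^2 ≤ 1 * E :=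
    int_le1 zero_le_one 1 (fun x _ => by nlinarith [sq_nonneg (F.f x 0), sq_nonneg ((dx F).f x 0), sq_nonneg ((dx (dx F)).f x 0)])
  refine ⟨fun x hx => ⟨?_, ?_⟩, ?_⟩
  · have := sob (g := fun y => F.f y 0) (fun y _ => F.hx y 0) (by fun_prop) (by fun_prop) hx
    apply abs_le_of_sq_le_sq _ (by positivity)
    nlinarith
  · have := sob (g := fun y => (dx F).f y 0) (fun y _ => (dx F).hx y 0) (by fun_prop)
      (by fun_prop) hx
    apply abs_le_of_sq_le_sq _ (by positivity)
    nlinarith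
  · unfold Ix; nlinarith

theorem of_sol {T q C₀ : ℝ} (hT : 0 < T) (hq : 0 < q) (hC₀ : 1 ≤ C₀)
    (κ : ℝ → ℝ) (hκ : KappaHyp q C₀ κ) (A B M G : ℝ) (hM : 0 < M) :
    ∃ p : Par, p.T = T ∧ ∀ sol : MHDSol T κ, InitBounds sol A B M → CompatBounds sol G →
      ∃ S : Flow p, S.ρ.f = sol.ρ ∧ S.u.f = sol.u := by
  refine ⟨⟨T, q, C₀, κ, 1 + 4 * A^2 + G^2, M, hT, hq, hC₀, hκ, by nlinarith, hM⟩, rfl, ?_⟩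
  intro sol hI hG
  obtain ⟨hρ, hu, hθ, hw, hb, -, hM'⟩ := hI
  obtain ⟨hg, -, -⟩ := hG
  let ρ : SF := ⟨sol.ρ, sol.smooth_ρ⟩
  let u : SF := ⟨sol.u, sol.smooth_u⟩
  let θ : SF := ⟨sol.θ, sol.smooth_θ⟩
  let w : SF := ⟨sol.w 0, sol.smooth_w 0⟩
  let v : SF := ⟨sol.w 1, sol.smooth_w 1⟩
  let b : SF := ⟨sol.b 0, sol.smooth_b 0⟩
  let c : SF := ⟨sol.b 1, sol.smooth_b 1⟩
  have mass : ∀ x ∈ Icc (0:ℝ) 1, ∀ t ∈ Icc (0:ℝ) T,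
    (dt ρ).f x t = -((dx ρ).f x t * u.f x t + ρ.f x t * (dx u).f x t) := by
    intro x hx t ht
    have h : (dt ρ).f x t + (dx (ρ * u)).f x t = 0 := by
      simp only [dt_f, dx_f]; exact sol.eq_mass x hx t ht
    simp only [add_f, sub_f, mul_f, neg_f, cst_f, xx_f, dx_add, dt_add, dx_sub, dt_sub, dx_neg, dt_neg, dx_mul, dt_mul, dx_cst, dt_cst, dx_xx, dt_xx, dt_dx] at h
    linarith
  have mom : ∀ x ∈ Icc (0:ℝ) 1, ∀ t ∈ Icc (0:ℝ) T,
    ρ.f x t * ((dt u).f x t + u.f x t * (dx u).f x t) = (dx (dx u)).f x t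
      - (dx ρ).f x t * θ.f x t - ρ.f x t * (dx θ).f x t
      - b.f x t * (dx b).f x t - c.f x t * (dx c).f x t := by
    intro x hx t ht
    have h : (dt (ρ * u)).f x t + (dx (ρ * (u * u) + ρ * θ + (b * b + c * c) * cst (1/2))).f x t
        = (dx (dx u)).f x t := by
      have := sol.eq_mom x hx t ht
      simp only [dt_f, dx_f]
      rw [← this]
      congr 3
      funext y s
      simp only [add_f, sub_f, mul_f, neg_f, cst_f, xx_f, dx_add, dt_add, dx_sub, dt_sub, dx_neg, dt_neg, dx_mul, dt_mul, dx_cst, dt_cst, dx_xx, dt_xx, dt_dx, Fin.sum_univ_two]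
      ring
    simp only [add_f, sub_f, mul_f, neg_f, cst_f, xx_f, dx_add, dt_add, dx_sub, dt_sub, dx_neg, dt_neg, dx_mul, dt_mul, dx_cst, dt_cst, dx_xx, dt_xx, dt_dx] at h
    linear_combination h - u.f x t * mass x hx t ht
  have eqw : ∀ i, ∀ x ∈ Icc (0:ℝ) 1, ∀ t ∈ Icc (0:ℝ) T,
      ρ.f x t * ((dt ⟨sol.w i, sol.smooth_w i⟩).f x t
        + u.f x t * (dx ⟨sol.w i, sol.smooth_w i⟩).f x t)
      = (dx (dx ⟨sol.w i, sol.smooth_w i⟩)).f x t + (dx ⟨sol.b i, sol.smooth_b i⟩).f x t := by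
    intro i x hx t ht
    set w : SF := ⟨sol.w i, sol.smooth_w i⟩
    set b : SF := ⟨sol.b i, sol.smooth_b i⟩
    have h : (dt (ρ * w)).f x t + (dx (ρ * u * w - b)).f x t = (dx (dx w)).f x t := by
      simp only [dt_f, dx_f]; exact sol.eq_w i x hx t ht
    simp only [add_f, sub_f, mul_f, neg_f, cst_f, xx_f, dx_add, dt_add, dx_sub, dt_sub, dx_neg, dt_neg, dx_mul, dt_mul, dx_cst, dt_cst, dx_xx, dt_xx, dt_dx] at h
    linear_combination h - w.f x t * mass x hx t ht
  have eqb : ∀ i, ∀ x ∈ Icc (0:ℝ) 1, ∀ t ∈ Icc (0:ℝ) T,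
      (dt ⟨sol.b i, sol.smooth_b i⟩).f x t = (dx (dx ⟨sol.b i, sol.smooth_b i⟩)).f x t
        - (dx u).f x t * sol.b i x t - u.f x t * (dx ⟨sol.b i, sol.smooth_b i⟩).f x t
      + (dx ⟨sol.w i, sol.smooth_w i⟩).f x t := by
    intro i x hx t ht
    set w : SF := ⟨sol.w i, sol.smooth_w i⟩
    set b : SF := ⟨sol.b i, sol.smooth_b i⟩
    have h : (dt b).f x t + (dx (u * b - w)).f x t = (dx (dx b)).f x t := by
      simp only [dt_f, dx_f]; exact sol.eq_b i x hx t ht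
    simp only [add_f, sub_f, mul_f, neg_f, cst_f, xx_f, dx_add, dt_add, dx_sub, dt_sub, dx_neg, dt_neg, dx_mul, dt_mul, dx_cst, dt_cst, dx_xx, dt_xx, dt_dx] at h
    linear_combination h
  have eqθ : ∀ x ∈ Icc (0:ℝ) 1, ∀ t ∈ Icc (0:ℝ) T,
    HasDerivAt (fun y => κe κ (θ.f y t) * (dx θ).f y t)
      (ρ.f x t * ((dt θ).f x t + u.f x t * (dx θ).f x t) + ρ.f x t * θ.f x t * (dx u).f x t
        - ((dx u).f x t ^ 2 + (dx w).f x t ^ 2 + (dx v).f x t ^ 2 + (dx b).f x t ^ 2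
          + (dx c).f x t ^ 2)) x := by
    intro x hx t ht
    have hpos := sol.θ_pos x hx t ht
    have hκd : DifferentiableAt ℝ κ (θ.f x t) :=
      (hκ.1.contDiffAt (Ici_mem_nhds hpos)).differentiableAt (by norm_num)
    have hd : HasDerivAt (fun y => κ (θ.f y t) * (dx θ).f y t) _ x :=
      (hκd.hasDerivAt.comp x (θ.hx x t)).mul ((dx θ).hx x t)
    have ev : (fun y => κe κ (θ.f y t) * (dx θ).f y t)
        =ᶠ[nhds x] (fun y => κ (θ.f y t) * (dx θ).f y t) := by
      have : ∀ᶠ y in nhds x, 0 < θ.f y t :=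
        ((by fun_prop : Continuous fun y => θ.f y t).tendsto x).eventually (lt_mem_nhds hpos)
      filter_upwards [this] with y hy
      rw [κe, abs_of_pos hy]
    refine HasDerivAt.congr_of_eventuallyEq ?_ ev
    refine hd.congr_deriv ?_
    rw [← hd.deriv]
    have h0 := sol.eq_θ x hx t ht
    have h : (dt (ρ * θ)).f x t + (dx (ρ * u * θ)).f x t
        - deriv (fun y => κ (θ.f y t) * (dx θ).f y t) x
        = (dx u).f x t ^ 2 + ((dx w).f x t ^ 2 + (dx v).f x t ^ 2) + ((dx b).f x t ^ 2
          + (dx c).f x t ^ 2) - ρ.f x t * θ.f x t * (dx u).f x t := by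
      simp only [dt_f, dx_f]
      rw [Fin.sum_univ_two, Fin.sum_univ_two] at h0
      exact h0
    simp only [add_f, sub_f, mul_f, neg_f, cst_f, xx_f, dx_add, dt_add, dx_sub, dt_sub, dx_neg, dt_neg, dx_mul, dt_mul, dx_cst, dt_cst, dx_xx, dt_xx, dt_dx] at h
    linear_combination - h + θ.f x t * mass x hx t ht
  have hN : ∀ y, y ≤ 1 + 4 * A^2 → y ≤ 1 + 4 * A^2 + G^2 := fun y hy => by nlinarith
  have key : ∀ F : SF, H2norm (fun x => F.f x 0) ≤ A →
    (∀ x ∈ Icc (0:ℝ) 1, |F.f x 0| ≤ 1 + 4 * A^2 + G^2 ∧ |(dx F).f x 0| ≤ 1 + 4 * A^2 + G^2) ∧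
    Ix (fun x t => (dx (dx F)).f x t ^ 2) 0 ≤ 1 + 4 * A^2 + G^2 := fun F h =>
    ⟨fun x hx => ⟨hN _ ((h2sup h).1 x hx).1, hN _ ((h2sup h).1 x hx).2⟩, hN _ (h2sup h).2⟩
  have h0T : (0:ℝ) ∈ Icc (0:ℝ) T := ⟨le_rfl, hT.le⟩
  have jU : Ix (fun x t => ρ.f x t * ((dt u).f x t + u.f x t * (dx u).f x t) ^ 2) 0
      ≤ 1 + 4 * A^2 + G^2 := by
    have h1 : ∫ x in (0:ℝ)..1, ((pdx (pdx sol.u) x 0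
        - pdx (fun x t => sol.ρ x t * sol.θ x t + (∑ i, (sol.b i x t) ^ 2) / 2) x 0)
        / Real.sqrt (sol.ρ x 0))^2 ≤ G^2 := by
      have h0 : 0 ≤ G := (Real.sqrt_nonneg _).trans hg
      exact (Real.sqrt_le_left h0).mp hg
    have h2 : Ix (fun x t => ρ.f x t * ((dt u).f x t + u.f x t * (dx u).f x t) ^ 2) 0
       = ∫ x in (0:ℝ)..1, ((pdx (pdx sol.u) x 0
        - pdx (fun x t => sol.ρ x t * sol.θ x t + (∑ i, (sol.b i x t) ^ 2) / 2) x 0)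
        / Real.sqrt (sol.ρ x 0))^2 := by
      unfold Ix
      apply intervalIntegral.integral_congr
      intro x hx
      rw [uIcc_of_le zero_le_one] at hx
      have e1 : pdx (pdx sol.u) x 0
        - pdx (fun x t => sol.ρ x t * sol.θ x t + (∑ i, (sol.b i x t) ^ 2) / 2) x 0
        = ρ.f x 0 * ((dt u).f x 0 + u.f x 0 * (dx u).f x 0) := by
        have e2 : pdx (fun x t => sol.ρ x t * sol.θ x t + (∑ i, (sol.b i x t) ^ 2) / 2) x 0
          = (dx (ρ * θ + (b * b + c * c) * cst (1/2))).f x 0 := by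
          simp only [dx_f]
          congr 1
          funext y s
          simp only [add_f, sub_f, mul_f, neg_f, cst_f, xx_f, dx_add, dt_add, dx_sub, dt_sub, dx_neg, dt_neg, dx_mul, dt_mul, dx_cst, dt_cst, dx_xx, dt_xx, dt_dx, Fin.sum_univ_two]
          ring
        have e3 : pdx (pdx sol.u) x 0 = (dx (dx u)).f x 0 := by simp only [dx_f]; rfl
        rw [e2, e3, mom x hx 0 h0T]
        simp only [add_f, sub_f, mul_f, neg_f, cst_f, xx_f, dx_add, dt_add, dx_sub, dt_sub, dx_neg, dt_neg, dx_mul, dt_mul, dx_cst, dt_cst, dx_xx, dt_xx, dt_dx]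
        ring
      have hp : 0 < ρ.f x 0 := sol.ρ_pos x hx 0 h0T
      simp only [e1]
      rw [div_pow, Real.sq_sqrt hp.le]
      field_simp
    rw [h2]; nlinarith
  exact ⟨{
    ρ := ρ
    u := u
    θ := θ
    w := w
    v := v
    b := b
    c := c
    ρp := sol.ρ_pos
    θp := sol.θ_pos
    mass := mass
    mom := mom
    eqw := eqw 0
    eqv := eqw 1
    eqb := eqb 0
    eqc := eqb 1
    eqθ := eqθ
    u0 := fun t ht => (sol.bc_u t ht).1
    u1 := fun t ht => (sol.bc_u t ht).2
    w0 := fun t ht => (sol.bc_w 0 t ht).1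
    w1 := fun t ht => (sol.bc_w 0 t ht).2
    v0 := fun t ht => (sol.bc_w 1 t ht).1
    v1 := fun t ht => (sol.bc_w 1 t ht).2
    b0 := fun t ht => (sol.bc_b 0 t ht).1
    b1 := fun t ht => (sol.bc_b 0 t ht).2
    c0 := fun t ht => (sol.bc_b 1 t ht).1
    c1 := fun t ht => (sol.bc_b 1 t ht).2
    θ0 := fun t ht => by rw [dx_f]; exact (sol.bc_θ t ht).1
    θ1 := fun t ht => by rw [dx_f]; exact (sol.bc_θ t ht).2
    iρ := (key ρ hρ).1
    iu := (key u hu).1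
    iθ := (key θ hθ).1
    iw := (key w (hw 0)).1
    iv := (key v (hw 1)).1
    ib := (key b (hb 0)).1
    ic := (key c (hb 1)).1
    jρ := (key ρ hρ).2
    jw := (key w (hw 0)).2
    jv := (key v (hw 1)).2
    jb := (key b (hb 0)).2
    jc := (key c (hb 1)).2
    jU := jU
    jM := hM' }, rfl, rfl⟩

end MHD

namespace MHD

theorem Ix_nonneg {f : ℝ → ℝ → ℝ} {t : ℝ} (h : ∀ x ∈ Icc (0:ℝ) 1, 0 ≤ f x t) : 0 ≤ Ix f t :=
  int_nonneg zero_le_one h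

theorem Ix_le5 {t : ℝ} {f g₁ g₂ g₃ g₄ g₅ : ℝ → ℝ → ℝ} (c₁ c₂ c₃ c₄ c₅ : ℝ)
    (h : ∀ x ∈ Icc (0:ℝ) 1,
      f x t ≤ c₁ * g₁ x t + c₂ * g₂ x t + c₃ * g₃ x t + c₄ * g₄ x t + c₅ * g₅ x t)
    (hf : Continuous (fun x => f x t) := by fun_prop)
    (h₁ : Continuous (fun x => g₁ x t) := by fun_prop)
    (h₂ : Continuous (fun x => g₂ x t) := by fun_prop)
    (h₃ : Continuous (fun x => g₃ x t) := by fun_prop)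
    (h₄ : Continuous (fun x => g₄ x t) := by fun_prop)
    (h₅ : Continuous (fun x => g₅ x t) := by fun_prop) :
    Ix f t ≤ c₁ * Ix g₁ t + c₂ * Ix g₂ t + c₃ * Ix g₃ t + c₄ * Ix g₄ t + c₅ * Ix g₅ t :=
  int_le5 zero_le_one c₁ c₂ c₃ c₄ c₅ h hf h₁ h₂ h₃ h₄ h₅

theorem Ix_le4 {t : ℝ} {f g₁ g₂ g₃ g₄ : ℝ → ℝ → ℝ} (c₁ c₂ c₃ c₄ : ℝ)
    (h : ∀ x ∈ Icc (0:ℝ) 1, f x t ≤ c₁ * g₁ x t + c₂ * g₂ x t + c₃ * g₃ x t + c₄ * g₄ x t)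
    (hf : Continuous (fun x => f x t) := by fun_prop)
    (h₁ : Continuous (fun x => g₁ x t) := by fun_prop)
    (h₂ : Continuous (fun x => g₂ x t) := by fun_prop)
    (h₃ : Continuous (fun x => g₃ x t) := by fun_prop)
    (h₄ : Continuous (fun x => g₄ x t) := by fun_prop) :
    Ix f t ≤ c₁ * Ix g₁ t + c₂ * Ix g₂ t + c₃ * Ix g₃ t + c₄ * Ix g₄ t :=
  int_le4 zero_le_one c₁ c₂ c₃ c₄ h hf h₁ h₂ h₃ h₄

theorem Ix_le3 {t : ℝ} {f g₁ g₂ g₃ : ℝ → ℝ → ℝ} (c₁ c₂ c₃ : ℝ)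
    (h : ∀ x ∈ Icc (0:ℝ) 1, f x t ≤ c₁ * g₁ x t + c₂ * g₂ x t + c₃ * g₃ x t)
    (hf : Continuous (fun x => f x t) := by fun_prop)
    (h₁ : Continuous (fun x => g₁ x t) := by fun_prop)
    (h₂ : Continuous (fun x => g₂ x t) := by fun_prop)
    (h₃ : Continuous (fun x => g₃ x t) := by fun_prop) :
    Ix f t ≤ c₁ * Ix g₁ t + c₂ * Ix g₂ t + c₃ * Ix g₃ t :=
  int_le3 zero_le_one c₁ c₂ c₃ h hf h₁ h₂ h₃

theorem Ix_le2 {t : ℝ} {f g₁ g₂ : ℝ → ℝ → ℝ} (c₁ c₂ : ℝ)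
    (h : ∀ x ∈ Icc (0:ℝ) 1, f x t ≤ c₁ * g₁ x t + c₂ * g₂ x t)
    (hf : Continuous (fun x => f x t) := by fun_prop)
    (h₁ : Continuous (fun x => g₁ x t) := by fun_prop)
    (h₂ : Continuous (fun x => g₂ x t) := by fun_prop) :
    Ix f t ≤ c₁ * Ix g₁ t + c₂ * Ix g₂ t :=
  int_le2 zero_le_one c₁ c₂ h hf h₁ h₂

theorem Ix_le1 {t : ℝ} {f g₁ : ℝ → ℝ → ℝ} (c₁ : ℝ)
    (h : ∀ x ∈ Icc (0:ℝ) 1, f x t ≤ c₁ * g₁ x t)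
    (hf : Continuous (fun x => f x t) := by fun_prop)
    (h₁ : Continuous (fun x => g₁ x t) := by fun_prop) :
    Ix f t ≤ c₁ * Ix g₁ t :=
  int_le1 zero_le_one c₁ h hf h₁

theorem Ix_one (c t : ℝ) : Ix (fun _ _ => c) t = c := by simp [Ix]

theorem Ix_le_const {t : ℝ} {f : ℝ → ℝ → ℝ} (c : ℝ)
    (h : ∀ x ∈ Icc (0:ℝ) 1, f x t ≤ c)
    (hf : Continuous (fun x => f x t) := by fun_prop) : Ix f t ≤ c := by
  have := Ix_le1 (f := f) (g₁ := fun _ _ => 1) (t := t) c (fun x hx => by simpa using h x hx) hf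
  simpa [Ix_one] using this

theorem Ix_congr {t : ℝ} {f g : ℝ → ℝ → ℝ} (h : ∀ x ∈ Icc (0:ℝ) 1, f x t = g x t) :
    Ix f t = Ix g t := by
  apply intervalIntegral.integral_congr
  intro x hx
  rw [uIcc_of_le zero_le_one] at hx
  exact h x hx

theorem Ix_add {t : ℝ} {f g : ℝ → ℝ → ℝ} 
    (hf : Continuous (fun x => f x t) := by fun_prop)
    (hg : Continuous (fun x => g x t) := by fun_prop) :
    Ix (fun x t => f x t + g x t) t = Ix f t + Ix g t :=
  intervalIntegral.integral_add (ii hf _ _) (ii hg _ _)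

theorem Ix_sub {t : ℝ} {f g : ℝ → ℝ → ℝ} 
    (hf : Continuous (fun x => f x t) := by fun_prop)
    (hg : Continuous (fun x => g x t) := by fun_prop) :
    Ix (fun x t => f x t - g x t) t = Ix f t - Ix g t :=
  intervalIntegral.integral_sub (ii hf _ _) (ii hg _ _)

theorem Ix_mul {t c : ℝ} {f : ℝ → ℝ → ℝ} : Ix (fun x t => c * f x t) t = c * Ix f t :=
  intervalIntegral.integral_const_mul _ _

theorem Ix_neg {t : ℝ} {f : ℝ → ℝ → ℝ} : Ix (fun x t => - f x t) t = - Ix f t :=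
  intervalIntegral.integral_neg

/-- integration by parts in `x` at a fixed time -/
theorem ibp {t : ℝ} {f g f' g' : ℝ → ℝ → ℝ}
    (hf : ∀ x ∈ Icc (0:ℝ) 1, HasDerivAt (fun y => f y t) (f' x t) x)
    (hg : ∀ x ∈ Icc (0:ℝ) 1, HasDerivAt (fun y => g y t) (g' x t) x)
    (h0 : f 0 t * g 0 t = 0) (h1 : f 1 t * g 1 t = 0)
    (cf : Continuous (fun x => f x t) := by fun_prop)
    (cg : Continuous (fun x => g x t) := by fun_prop)
    (cf' : Continuous (fun x => f' x t) := by fun_prop)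
    (cg' : Continuous (fun x => g' x t) := by fun_prop) :
    Ix (fun x t => f x t * g' x t) t = - Ix (fun x t => f' x t * g x t) t := by
  have h := ftc (g := fun y => f y t * g y t) (a := 0) (b := 1)
    (fun x hx => (hf x hx).fun_mul (hg x hx)) zero_le_one (by fun_prop)
  have h2 := Ix_add (t := t) (f := fun x t => f' x t * g x t) (g := fun x t => f x t * g' x t)
  have h3 : Ix (fun x t => f' x t * g x t + f x t * g' x t) t = 0 := by
    unfold Ix; rw [h, h0, h1]; ring
  linarith

theorem masterI {T : ℝ} (e φ : SF) (r : ℝ → ℝ → ℝ)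
    (hr : ∀ x ∈ Icc (0:ℝ) 1, ∀ t ∈ Icc (0:ℝ) T, (dt e).f x t + (dx φ).f x t = r x t)
    (h0 : ∀ t ∈ Icc (0:ℝ) T, φ.f 0 t = 0) (h1 : ∀ t ∈ Icc (0:ℝ) T, φ.f 1 t = 0)
    (cr : Continuous (fun p : ℝ × ℝ => r p.1 p.2) := by fun_prop) :
    ∀ t ∈ Icc (0:ℝ) T, Ix e.f t = Ix e.f 0 + ∫ s in (0:ℝ)..t, Ix r s :=
  fun t ht => masterSF e φ r hr h0 h1 ht cr

theorem sqbd {a N : ℝ} (h : |a| ≤ N) : a ^ 2 ≤ N ^ 2 := by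
  rw [← sq_abs]; exact pow_le_pow_left₀ (abs_nonneg _) h 2

variable {p : Par}

/-- heat flux -/
def Flow.k (S : Flow p) (x t : ℝ) : ℝ := κe p.κ (S.θ.f x t) * (dx S.θ).f x t

@[fun_prop]
theorem Flow.k_cont {X : Type*} [TopologicalSpace X] (S : Flow p) {g h : X → ℝ}
    (hg : Continuous g) (hh : Continuous h) : Continuous (fun a => S.k (g a) (h a)) := by
  have := κe_cont p
  unfold Flow.k; fun_prop

/-- dissipation -/
def Flow.Q (S : Flow p) : SF := dx S.u * dx S.u + dx S.w * dx S.w + dx S.v * dx S.v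
  + dx S.b * dx S.b + dx S.c * dx S.c

/-- divergence of the heat flux -/
def Flow.kx (S : Flow p) : SF := S.ρ * (dt S.θ + S.u * dx S.θ) + S.ρ * S.θ * dx S.u - S.Q

theorem Flow.hk (S : Flow p) : ∀ x ∈ Icc (0:ℝ) 1, ∀ t ∈ Icc (0:ℝ) p.T,
    HasDerivAt (fun y => S.k y t) (S.kx.f x t) x := by
  intro x hx t ht
  refine (S.eqθ x hx t ht).congr_deriv ?_
  simp only [Flow.kx, Flow.Q, add_f, sub_f, mul_f, neg_f, cst_f, xx_f, dx_add, dt_add, dx_sub, dt_sub, dx_neg, dt_neg, dx_mul, dt_mul, dx_cst, dt_cst, dx_xx, dt_xx, dt_dx]; ring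

theorem Flow.k0 (S : Flow p) {t : ℝ} (ht : t ∈ Icc (0:ℝ) p.T) : S.k 0 t = 0 := by
  simp [Flow.k, S.θ0 t ht]

theorem Flow.k1 (S : Flow p) {t : ℝ} (ht : t ∈ Icc (0:ℝ) p.T) : S.k 1 t = 0 := by
  simp [Flow.k, S.θ1 t ht]

/-- integration by parts against the heat flux -/
theorem Flow.ibpk (S : Flow p) {t : ℝ} (ht : t ∈ Icc (0:ℝ) p.T) {g g' : ℝ → ℝ → ℝ}
    (hg : ∀ x ∈ Icc (0:ℝ) 1, HasDerivAt (fun y => g y t) (g' x t) x)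
    (cg : Continuous (fun x => g x t) := by fun_prop)
    (cg' : Continuous (fun x => g' x t) := by fun_prop) :
    Ix (fun x t => g x t * S.kx.f x t) t = - Ix (fun x t => g' x t * S.k x t) t :=
  ibp hg (fun x hx => S.hk x hx t ht) (by simp [S.k0 ht]) (by simp [S.k1 ht])

theorem Flow.Ikx (S : Flow p) {t : ℝ} (ht : t ∈ Icc (0:ℝ) p.T) : Ix S.kx.f t = 0 := by
  have := S.ibpk ht (g := fun _ _ => 1) (g' := fun _ _ => 0) (fun x _ => hasDerivAt_const x _)
  simpa [Ix] using this

/-- renormalized temperature equation -/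
theorem Flow.renorm (S : Flow p) {ψ : ℝ → ℝ} (hψ : Continuous ψ) :
    ∀ t ∈ Icc (0:ℝ) p.T, Ix (fun x t => S.ρ.f x t * prim ψ (S.θ.f x t)) t
      = Ix (fun x t => S.ρ.f x t * prim ψ (S.θ.f x t)) 0 + ∫ s in (0:ℝ)..t,
        Ix (fun x t => ψ (S.θ.f x t) * (S.kx.f x t + S.Q.f x t
          - S.ρ.f x t * S.θ.f x t * (dx S.u).f x t)) s := by
  intro t ht
  have hp := prim_cont hψ
  refine master (T := p.T) (fun x t => S.ρ.f x t * prim ψ (S.θ.f x t))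
    (fun x t => S.u.f x t * (S.ρ.f x t * prim ψ (S.θ.f x t)))
    (fun x t => (dx S.u).f x t * (S.ρ.f x t * prim ψ (S.θ.f x t)) + S.u.f x t *
      ((dx S.ρ).f x t * prim ψ (S.θ.f x t) + S.ρ.f x t * (ψ (S.θ.f x t) * (dx S.θ).f x t))) _
    ?_ ?_ ?_ ?_ ht
  · intro x hx t ht
    refine ((S.ρ.ht x t).fun_mul ((prim_hd hψ _).comp t (S.θ.ht x t))).congr_deriv ?_
    simp only [Function.comp, Flow.kx, Flow.Q, add_f, sub_f, mul_f, neg_f, cst_f, xx_f, dx_add, dt_add, dx_sub, dt_sub, dx_neg, dt_neg, dx_mul, dt_mul, dx_cst, dt_cst, dx_xx, dt_xx, dt_dx]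
    linear_combination prim ψ (S.θ.f x t) * S.mass x hx t ht
  · intro x hx t ht
    exact (S.u.hx x t).fun_mul
      ((S.ρ.hx x t).fun_mul ((prim_hd hψ _).comp x (S.θ.hx x t)))
  · intro t ht; simp [S.u0 t ht]
  · intro t ht; simp [S.u1 t ht]

theorem Par.h0 (p : Par) : (0:ℝ) ∈ Icc (0:ℝ) p.T := ⟨le_rfl, p.hT.le⟩
theorem Par.h1 (p : Par) : p.T ∈ Icc (0:ℝ) p.T := ⟨p.hT.le, le_rfl⟩

/-! ### mass and energy -/

theorem Flow.massI (S : Flow p) : ∀ t ∈ Icc (0:ℝ) p.T,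
    p.M ≤ Ix S.ρ.f t ∧ Ix S.ρ.f t ≤ p.N := by
  intro t ht
  have h := masterI (T := p.T) S.ρ (S.ρ * S.u) (fun _ _ => 0) (fun x hx t ht => by
    simp only [add_f, sub_f, mul_f, neg_f, cst_f, xx_f, dx_add, dt_add, dx_sub, dt_sub, dx_neg, dt_neg, dx_mul, dt_mul, dx_cst, dt_cst, dx_xx, dt_xx, dt_dx]; linear_combination S.mass x hx t ht) (fun t ht => by
    simp only [add_f, sub_f, mul_f, neg_f, cst_f, xx_f, dx_add, dt_add, dx_sub, dt_sub, dx_neg, dt_neg, dx_mul, dt_mul, dx_cst, dt_cst, dx_xx, dt_xx, dt_dx]; simp [S.u0 t ht]) (fun t ht => by simp only [add_f, sub_f, mul_f, neg_f, cst_f, xx_f, dx_add, dt_add, dx_sub, dt_sub, dx_neg, dt_neg, dx_mul, dt_mul, dx_cst, dt_cst, dx_xx, dt_xx, dt_dx]; simp [S.u1 t ht]) (by fun_prop) t ht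
  have h2 : Ix S.ρ.f t = Ix S.ρ.f 0 := by simpa [Ix] using h
  rw [h2]
  exact ⟨S.jM, Ix_le_const _ fun x hx => (le_abs_self _).trans (S.iρ x hx).1⟩

theorem stepA (p : Par) : ∃ C, 0 < C ∧ ∀ S : Flow p, ∀ t ∈ Icc (0:ℝ) p.T,
    Ix (fun x t => S.ρ.f x t * S.θ.f x t) t ≤ C ∧
    Ix (fun x t => S.ρ.f x t * S.u.f x t ^ 2) t ≤ C ∧
    Ix (fun x t => S.b.f x t ^ 2 + S.c.f x t ^ 2) t ≤ C := by
  have hN := p.hN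
  refine ⟨2 * (p.N * p.N + (1/2) * (p.N * (3 * p.N^2)) + p.N^2), by positivity, fun S t ht => ?_⟩
  set e : SF := S.ρ * S.θ + cst (1/2) * (S.ρ * (S.u * S.u + S.w * S.w + S.v * S.v))
    + cst (1/2) * (S.b * S.b + S.c * S.c) with he
  set φ : SF := S.u * e + S.u * S.ρ * S.θ + cst (1/2) * (S.u * (S.b * S.b + S.c * S.c))
    - S.w * S.b - S.v * S.c - S.u * dx S.u - S.w * dx S.w - S.v * dx S.v - S.b * dx S.b
    - S.c * dx S.c with hφ
  have h := masterI (T := p.T) e φ S.kx.f (fun x hx t ht => by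
    simp only [he, hφ, Flow.kx, Flow.Q, add_f, sub_f, mul_f, neg_f, cst_f, xx_f, dx_add, dt_add, dx_sub, dt_sub, dx_neg, dt_neg, dx_mul, dt_mul, dx_cst, dt_cst, dx_xx, dt_xx, dt_dx]
    linear_combination (S.θ.f x t + (1/2) * (S.u.f x t ^2 + S.w.f x t ^ 2 + S.v.f x t ^ 2))
      * S.mass x hx t ht + S.u.f x t * S.mom x hx t ht + S.w.f x t * S.eqw x hx t ht
      + S.v.f x t * S.eqv x hx t ht + S.b.f x t * S.eqb x hx t ht
      + S.c.f x t * S.eqc x hx t ht) (fun t ht => by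
    simp only [hφ, add_f, sub_f, mul_f, neg_f, cst_f, xx_f, dx_add, dt_add, dx_sub, dt_sub, dx_neg, dt_neg, dx_mul, dt_mul, dx_cst, dt_cst, dx_xx, dt_xx, dt_dx]; simp [S.u0 t ht, S.w0 t ht, S.v0 t ht, S.b0 t ht, S.c0 t ht])
    (fun t ht => by
    simp only [hφ, add_f, sub_f, mul_f, neg_f, cst_f, xx_f, dx_add, dt_add, dx_sub, dt_sub, dx_neg, dt_neg, dx_mul, dt_mul, dx_cst, dt_cst, dx_xx, dt_xx, dt_dx]; simp [S.u1 t ht, S.w1 t ht, S.v1 t ht, S.b1 t ht, S.c1 t ht])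
  have hE : Ix e.f t = Ix e.f 0 := by
    rw [h t ht]
    have : ∫ s in (0:ℝ)..t, Ix S.kx.f s = 0 := by
      rw [intervalIntegral.integral_congr (g := fun _ => (0:ℝ))]
      · simp
      · intro s hs
        rw [uIcc_of_le ht.1] at hs
        exact S.Ikx ⟨hs.1, hs.2.trans ht.2⟩
    rw [this]; ring
  have h0 : Ix e.f 0 ≤ p.N * p.N + (1/2) * (p.N * (3 * p.N^2)) + p.N^2 := by
    refine Ix_le_const _ fun x hx => ?_
    simp only [he, add_f, sub_f, mul_f, neg_f, cst_f, xx_f, dx_add, dt_add, dx_sub, dt_sub, dx_neg, dt_neg, dx_mul, dt_mul, dx_cst, dt_cst, dx_xx, dt_xx, dt_dx]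
    have r := S.ρp x hx 0 p.h0
    have r1 := (le_abs_self _).trans (S.iρ x hx).1
    have r2 := (le_abs_self _).trans (S.iθ x hx).1
    have r3 := sqbd (S.iu x hx).1
    have r4 := sqbd (S.iw x hx).1
    have r5 := sqbd (S.iv x hx).1
    have r6 := sqbd (S.ib x hx).1
    have r7 := sqbd (S.ic x hx).1
    have a1 : S.ρ.f x 0 * S.θ.f x 0 ≤ p.N * p.N :=
      mul_le_mul r1 r2 (S.θp x hx 0 p.h0).le (by linarith)
    have a2 : S.ρ.f x 0 * (S.u.f x 0 * S.u.f x 0 + S.w.f x 0 * S.w.f x 0 + S.v.f x 0 * S.v.f x 0)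
        ≤ p.N * (3 * p.N^2) :=
      mul_le_mul r1 (by nlinarith) (by nlinarith [sq_nonneg (S.u.f x 0), sq_nonneg (S.w.f x 0), sq_nonneg (S.v.f x 0)]) (by linarith)
    nlinarith
  rw [← hE] at h0
  have key : ∀ g : ℝ → ℝ → ℝ, Continuous (fun x => g x t) → (∀ x ∈ Icc (0:ℝ) 1, g x t ≤ 2 * e.f x t) →
      Ix g t ≤ 2 * (p.N * p.N + (1/2) * (p.N * (3 * p.N^2)) + p.N^2) := by
    intro g cg hg
    have := Ix_le1 (f := g) (g₁ := e.f) (t := t) 2 hg cg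
    linarith
  have pos : ∀ x ∈ Icc (0:ℝ) 1, 0 ≤ S.ρ.f x t * S.θ.f x t ∧ 0 ≤ S.ρ.f x t * S.u.f x t ^ 2 ∧
      0 ≤ S.ρ.f x t * S.w.f x t ^ 2 ∧ 0 ≤ S.ρ.f x t * S.v.f x t ^ 2 := fun x hx => by
    have a := (S.ρp x hx t ht).le
    have b := (S.θp x hx t ht).le
    exact ⟨by positivity, by positivity, by positivity, by positivity⟩
  refine ⟨key _ (by fun_prop) ?_, key _ (by fun_prop) ?_, key _ (by fun_prop) ?_⟩ <;>
  · intro x hx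
    obtain ⟨p1, p2, p3, p4⟩ := pos x hx
    simp only [he, add_f, sub_f, mul_f, neg_f, cst_f, xx_f, dx_add, dt_add, dx_sub, dt_sub, dx_neg, dt_neg, dx_mul, dt_mul, dx_cst, dt_cst, dx_xx, dt_xx, dt_dx]
    nlinarith [sq_nonneg (S.b.f x t), sq_nonneg (S.c.f x t)]

end MHD

namespace MHD

variable {p : Par}

theorem prim_param (f : SF) (t x : ℝ) :
    HasDerivAt (fun y => ∫ s in (0:ℝ)..t, f.f y s) (∫ s in (0:ℝ)..t, (dx f).f x s) x := by
  have h : ∀ y, ∫ s in (0:ℝ)..t, f.f y s = (∫ s in (0:ℝ)..t, f.f 0 s)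
      + prim (fun z => ∫ s in (0:ℝ)..t, (dx f).f z s) y := by
    intro y
    unfold prim
    rw [swap_int (by fun_prop)]
    rw [← intervalIntegral.integral_add (ii (by fun_prop) _ _) (ii (by fun_prop) _ _)]
    apply intervalIntegral.integral_congr
    intro s _
    have : ∫ z in (0:ℝ)..y, (dx f).f z s = f.f y s - f.f 0 s :=
      intervalIntegral.integral_eq_sub_of_hasDerivAt (fun z _ => f.hx z s) (ii (by fun_prop) _ _)
    simp only [this]; ring
  have h2 := (prim_hd (ψ := fun z => ∫ s in (0:ℝ)..t, (dx f).f z s) (by fun_prop) x).const_add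
    (∫ s in (0:ℝ)..t, f.f 0 s)
  rwa [← funext h] at h2

/-- positive-part primitive -/
def gp (m : ℝ) : ℝ → ℝ := prim (fun r => max (r - m) 0)

theorem gp_zero {m s : ℝ} (h0 : 0 ≤ s) (h : s ≤ m) : gp m s = 0 := by
  unfold gp prim
  rw [intervalIntegral.integral_congr (g := fun _ => (0:ℝ))]
  · simp
  · intro r hr
    rw [uIcc_of_le h0] at hr
    exact max_eq_right (by linarith [hr.2])

theorem gp_nonneg {m s : ℝ} (h0 : 0 ≤ s) : 0 ≤ gp m s :=
  int_nonneg h0 fun r _ => le_max_right _ _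

theorem gp_pos {m s : ℝ} (hm : 0 < m) (h : m < s) : 0 < gp m s := by
  unfold gp prim
  refine intervalIntegral.integral_pos (by linarith) (by fun_prop) (fun r _ => le_max_right _ _)
    ⟨s, ⟨by linarith, le_rfl⟩, ?_⟩
  exact lt_max_of_lt_left (by linarith)

/-- viscous flux -/
def Flow.F (S : Flow p) : SF :=
  dx S.u - S.ρ * S.θ - cst (1/2) * (S.b * S.b + S.c * S.c)

/-- potential of the momentum -/
def Flow.pot (S : Flow p) (x t : ℝ) : ℝ :=
  (∫ y in (0:ℝ)..x, S.ρ.f y 0 * S.u.f y 0)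
    + ∫ s in (0:ℝ)..t, (S.F - S.ρ * (S.u * S.u)).f x s

theorem Flow.pot_cont (S : Flow p) : Continuous (fun q : ℝ × ℝ => S.pot q.1 q.2) := by
  unfold Flow.pot
  have h1 := prim_cont (ψ := fun y => S.ρ.f y 0 * S.u.f y 0) (by fun_prop)
  have h2 : Continuous (fun q : ℝ × ℝ => ∫ s in (0:ℝ)..q.2, (S.F - S.ρ * (S.u * S.u)).f q.1 s) := by
    fun_prop
  exact (h1.comp continuous_fst).add h2

theorem Flow.pot_t (S : Flow p) (x t : ℝ) :
    HasDerivAt (fun s => S.pot x s) ((S.F - S.ρ * (S.u * S.u)).f x t) t :=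
  (prim_hd (ψ := fun s => (S.F - S.ρ * (S.u * S.u)).f x s) (by fun_prop) t).const_add _

theorem Flow.pot_x (S : Flow p) : ∀ x ∈ Icc (0:ℝ) 1, ∀ t ∈ Icc (0:ℝ) p.T,
    HasDerivAt (fun y => S.pot y t) (S.ρ.f x t * S.u.f x t) x := by
  intro x hx t ht
  have h1 := prim_hd (ψ := fun y => S.ρ.f y 0 * S.u.f y 0) (by fun_prop) x
  have h2 := prim_param (S.F - S.ρ * (S.u * S.u)) t x
  refine (h1.add h2).congr_deriv ?_
  have h3 : ∫ s in (0:ℝ)..t, (dx (S.F - S.ρ * (S.u * S.u))).f x s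
      = ∫ s in (0:ℝ)..t, (dt (S.ρ * S.u)).f x s := by
    apply intervalIntegral.integral_congr
    intro s hs
    rw [uIcc_of_le ht.1] at hs
    have hs' : s ∈ Icc 0 p.T := ⟨hs.1, hs.2.trans ht.2⟩
    simp only [Flow.F, add_f, sub_f, mul_f, neg_f, cst_f, xx_f, dx_add, dt_add, dx_sub, dt_sub, dx_neg, dt_neg, dx_mul, dt_mul, dx_cst, dt_cst, dx_xx, dt_xx, dt_dx]
    linear_combination - S.mom x hx s hs' - S.u.f x s * S.mass x hx s hs'
  rw [h3, ftc (fun s _ => (S.ρ * S.u).ht x s) ht.1 (by fun_prop)]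
  simp only [add_f, sub_f, mul_f, neg_f, cst_f, xx_f, dx_add, dt_add, dx_sub, dt_sub, dx_neg, dt_neg, dx_mul, dt_mul, dx_cst, dt_cst, dx_xx, dt_xx, dt_dx]; ring

theorem stepB (p : Par) : ∃ C, 1 ≤ C ∧ ∀ S : Flow p, ∀ x ∈ Icc (0:ℝ) 1, ∀ t ∈ Icc (0:ℝ) p.T,
    S.ρ.f x t ≤ C := by
  obtain ⟨E, hE, hA⟩ := stepA p
  have hN := p.hN
  have hT := p.hT
  set D : ℝ := (p.N + E) / 2 with hD
  set Cψ : ℝ := 2 * D + 3 * E * p.T with hCψ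
  have hCψ0 : 0 ≤ Cψ := by positivity
  refine ⟨p.N * Real.exp Cψ * Real.exp Cψ, ?_, fun S => ?_⟩
  · have h1 : 1 ≤ Real.exp Cψ := Real.one_le_exp hCψ0
    have : 1 ≤ p.N * Real.exp Cψ := one_le_mul_of_one_le_of_one_le hN h1
    exact one_le_mul_of_one_le_of_one_le this h1
  have cpot := S.pot_cont
  have cpx : ∀ t, Continuous (fun y => S.pot y t) := fun t => by
    have : Continuous (fun y : ℝ => (y, t)) := by fun_prop
    exact cpot.comp this
  have oscp : ∀ x ∈ Icc (0:ℝ) 1, ∀ y ∈ Icc (0:ℝ) 1, ∀ t ∈ Icc (0:ℝ) p.T,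
      |S.pot x t - S.pot y t| ≤ D := by
    intro x hx y hy t ht
    have h1 := osc (g := fun y => S.pot y t) (fun z hz => S.pot_x z hz t ht) (by fun_prop) hx hy
    have h2 := Ix_le2 (f := fun z t => |S.ρ.f z t * S.u.f z t|) (g₁ := S.ρ.f)
      (g₂ := fun x t => S.ρ.f x t * S.u.f x t ^ 2) (t := t) (1/2) (1/2) (fun z hz => by
        have r := S.ρp z hz t ht
        rw [abs_mul, abs_of_pos r, ← sq_abs (S.u.f z t)]
        nlinarith [mul_nonneg r.le (sq_nonneg (|S.u.f z t| - 1))])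
    have h3 := (S.massI t ht).2
    have h4 := (hA S t ht).2.1
    refine h1.trans (h2.trans ?_)
    linarith
  have pot0 : S.pot 0 0 = 0 := by simp [Flow.pot]
  have avg : ∀ t ∈ Icc (0:ℝ) p.T, ∀ c : ℝ, (∀ y ∈ Icc (0:ℝ) 1, |S.pot y t - c| ≤ D) →
      |Ix S.pot t - c| ≤ D := by
    intro t ht c h
    have e : Ix S.pot t - c = ∫ y in (0:ℝ)..1, (S.pot y t - c) := by
      rw [intervalIntegral.integral_sub (ii (cpx t) _ _) (ii (by fun_prop) _ _)]
      simp [Ix]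
    rw [e]
    have hc := cpx t
    refine (intervalIntegral.abs_integral_le_integral_abs zero_le_one).trans ?_
    exact Ix_le_const (f := fun y t => |S.pot y t - c|) (t := t) D h
  have hm := fun (t : ℝ) (ht : t ∈ Icc (0:ℝ) p.T) => master (T := p.T) S.pot (fun _ _ => 0)
    (fun _ _ => 0) (fun x t => (S.F - S.ρ * (S.u * S.u)).f x t) (fun x _ t _ => by
      simpa using S.pot_t x t) (fun x _ t _ => hasDerivAt_const x _) (fun _ _ => rfl)
      (fun _ _ => rfl) ht
  have hIF : ∀ t ∈ Icc (0:ℝ) p.T, -(3 * E) ≤ Ix (fun x t => (S.F - S.ρ * (S.u * S.u)).f x t) t ∧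
      Ix (fun x t => (S.F - S.ρ * (S.u * S.u)).f x t) t ≤ 0 := by
    intro t ht
    obtain ⟨a1, a2, a3⟩ := hA S t ht
    have hux : Ix (dx S.u).f t = 0 := by
      have := ftc (a := 0) (b := 1) (fun x _ => S.u.hx x t) zero_le_one (by fun_prop)
      unfold Ix
      rw [this, S.u0 t ht, S.u1 t ht]; ring
    have e1 : Ix (fun x t => (S.F - S.ρ * (S.u * S.u)).f x t) t = Ix (dx S.u).f t -
        Ix (fun x t => S.ρ.f x t * S.θ.f x t + 1/2 * (S.b.f x t ^ 2 + S.c.f x t ^ 2)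
        + S.ρ.f x t * S.u.f x t ^ 2) t := by
      rw [← Ix_sub]
      apply Ix_congr
      intro x _
      simp only [Flow.F, add_f, sub_f, mul_f, neg_f, cst_f, xx_f, dx_add, dt_add, dx_sub, dt_sub, dx_neg, dt_neg, dx_mul, dt_mul, dx_cst, dt_cst, dx_xx, dt_xx, dt_dx]; ring
    have e2 := Ix_le3 (f := fun x t => S.ρ.f x t * S.θ.f x t + 1/2 * (S.b.f x t ^ 2
        + S.c.f x t ^ 2) + S.ρ.f x t * S.u.f x t ^ 2)
        (g₁ := fun x t => S.ρ.f x t * S.θ.f x t) (g₂ := fun x t => S.b.f x t ^ 2 + S.c.f x t ^ 2)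
        (g₃ := fun x t => S.ρ.f x t * S.u.f x t ^ 2) (t := t) 1 (1/2) 1 (fun x _ => by linarith)
    have e3 : 0 ≤ Ix (fun x t => S.ρ.f x t * S.θ.f x t + 1/2 * (S.b.f x t ^ 2 + S.c.f x t ^ 2)
        + S.ρ.f x t * S.u.f x t ^ 2) t := Ix_nonneg fun x hx => by
      have a := S.ρp x hx t ht
      have b := S.θp x hx t ht
      positivity
    rw [e1, hux]
    constructor <;> linarith
  have hpot : ∀ x ∈ Icc (0:ℝ) 1, ∀ t ∈ Icc (0:ℝ) p.T, |S.pot x t| ≤ Cψ := by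
    intro x hx t ht
    have b1 := avg t ht (S.pot x t) (fun y hy => oscp y hy x hx t ht)
    have b2 := avg 0 p.h0 0 (fun y hy => by
      have := oscp y hy 0 ⟨le_rfl, zero_le_one⟩ 0 p.h0
      rwa [pot0] at this)
    have b3 := hm t ht
    have b4 : ∫ s in (0:ℝ)..t, Ix (fun x t => (S.F - S.ρ * (S.u * S.u)).f x t) s
        ≤ 0 * ∫ s in (0:ℝ)..t, (1:ℝ) := int_le1 ht.1 _ (fun s hs => by
          simpa using (hIF s ⟨hs.1, hs.2.trans ht.2⟩).2)
    have b5 : ∫ s in (0:ℝ)..t, -(Ix (fun x t => (S.F - S.ρ * (S.u * S.u)).f x t) s)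
        ≤ (3 * E) * ∫ s in (0:ℝ)..t, (1:ℝ) := int_le1 ht.1 _ (fun s hs => by
          have := (hIF s ⟨hs.1, hs.2.trans ht.2⟩).1
          linarith)
    rw [intervalIntegral.integral_neg] at b5
    simp only [intervalIntegral.integral_const, smul_eq_mul, mul_one, sub_zero, zero_mul] at b4 b5
    have b6 : 3 * E * t ≤ 3 * E * p.T := mul_le_mul_of_nonneg_left ht.2 (by positivity)
    unfold Ix at b1 b2 b4 b5
    rw [abs_le] at b1 b2 ⊢
    constructor <;> linarith [b1.1, b1.2, b2.1, b2.2]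
  -- the renormalised estimate
  set m : ℝ := p.N * Real.exp Cψ with hmdef
  have hm0 : 0 < m := by positivity
  have cmax : Continuous (fun r : ℝ => max (r - m) 0) := by fun_prop
  have cgp : Continuous (gp m) := prim_cont cmax
  have hdgp := fun s => prim_hd cmax s
  intro x hx t ht
  have key := master (T := p.T) (fun x t => S.ρ.f x t * gp m (S.ρ.f x t * Real.exp (S.pot x t)))
    (fun x t => S.u.f x t * (S.ρ.f x t * gp m (S.ρ.f x t * Real.exp (S.pot x t))))
    (fun x t => (dx S.u).f x t * (S.ρ.f x t * gp m (S.ρ.f x t * Real.exp (S.pot x t)))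
      + S.u.f x t * ((dx S.ρ).f x t * gp m (S.ρ.f x t * Real.exp (S.pot x t))
      + S.ρ.f x t * (max (S.ρ.f x t * Real.exp (S.pot x t) - m) 0
       * ((dx S.ρ).f x t * Real.exp (S.pot x t) + S.ρ.f x t * (Real.exp (S.pot x t)
        * (S.ρ.f x t * S.u.f x t))))))
    (fun x t => -(S.ρ.f x t * (max (S.ρ.f x t * Real.exp (S.pot x t) - m) 0
      * (S.ρ.f x t * Real.exp (S.pot x t)
        * (S.ρ.f x t * S.θ.f x t + 1/2 * (S.b.f x t ^ 2 + S.c.f x t ^ 2))))))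
    (fun x hx t ht => by
      refine ((S.ρ.ht x t).fun_mul ((hdgp _).comp t ((S.ρ.ht x t).fun_mul
        (S.pot_t x t).exp))).congr_deriv ?_
      simp only [Function.comp, Flow.F, add_f, sub_f, mul_f, neg_f, cst_f, xx_f, dx_add, dt_add, dx_sub, dt_sub, dx_neg, dt_neg, dx_mul, dt_mul, dx_cst, dt_cst, dx_xx, dt_xx, dt_dx, S.mass x hx t ht]
      change _ * gp m _ + _ = _
      ring)
    (fun x hx t ht => (S.u.hx x t).fun_mul ((S.ρ.hx x t).fun_mul ((hdgp _).comp x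
      ((S.ρ.hx x t).fun_mul (S.pot_x x hx t ht).exp))))
    (fun t ht => by simp [S.u0 t ht]) (fun t ht => by simp [S.u1 t ht]) ht
  have z0 : ∫ x in (0:ℝ)..1, S.ρ.f x 0 * gp m (S.ρ.f x 0 * Real.exp (S.pot x 0)) = 0 := by
    rw [intervalIntegral.integral_congr (g := fun _ => (0:ℝ))]
    · simp
    · intro y hy
      rw [uIcc_of_le zero_le_one] at hy
      have r := S.ρp y hy 0 p.h0
      have : gp m (S.ρ.f y 0 * Real.exp (S.pot y 0)) = 0 := by
        apply gp_zero (by positivity)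
        apply mul_le_mul ((le_abs_self _).trans (S.iρ y hy).1) _ (Real.exp_pos _).le (by linarith)
        exact Real.exp_le_exp.mpr ((le_abs_self _).trans (hpot y hy 0 p.h0))
      simp [this]
  have z1 : ∫ s in (0:ℝ)..t, ∫ x in (0:ℝ)..1, -(S.ρ.f x s * (max (S.ρ.f x s *
      Real.exp (S.pot x s) - m) 0 * (S.ρ.f x s * Real.exp (S.pot x s)
        * (S.ρ.f x s * S.θ.f x s + 1/2 * (S.b.f x s ^ 2 + S.c.f x s ^ 2))))) ≤ 0 := by
    have hneg : ∀ s ∈ Icc (0:ℝ) t, 0 ≤ -(∫ x in (0:ℝ)..1, -(S.ρ.f x s * (max (S.ρ.f x s *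
      Real.exp (S.pot x s) - m) 0 * (S.ρ.f x s * Real.exp (S.pot x s)
        * (S.ρ.f x s * S.θ.f x s + 1/2 * (S.b.f x s ^ 2 + S.c.f x s ^ 2)))))) := by
      intro s hs
      have hs' : s ∈ Icc 0 p.T := ⟨hs.1, hs.2.trans ht.2⟩
      rw [intervalIntegral.integral_neg, neg_neg]
      refine int_nonneg zero_le_one fun y hy => ?_
      have r := S.ρp y hy s hs'
      have r2 := S.θp y hy s hs'
      have r3 := le_max_right (S.ρ.f y s * Real.exp (S.pot y s) - m) 0
      positivity
    have := int_nonneg ht.1 hneg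
    rw [intervalIntegral.integral_neg] at this
    linarith
  have z2 : S.ρ.f x t * Real.exp (S.pot x t) ≤ m := by
    by_contra hcon
    rw [not_le] at hcon
    have := intervalIntegral.integral_pos (zero_lt_one' ℝ)
      (f := fun x => S.ρ.f x t * gp m (S.ρ.f x t * Real.exp (S.pot x t)))
      (by have := cpx t; fun_prop) (fun y hy => by
        have hy' : y ∈ Icc (0:ℝ) 1 := ⟨hy.1.le, hy.2⟩
        have r := S.ρp y hy' t ht
        exact mul_nonneg r.le (gp_nonneg (by positivity))) ⟨x, hx, by
        exact mul_pos (S.ρp x hx t ht) (gp_pos hm0 hcon)⟩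
    linarith
  have z3 : Real.exp (-Cψ) ≤ Real.exp (S.pot x t) :=
    Real.exp_le_exp.mpr (abs_le.mp (hpot x hx t ht)).1
  have r := S.ρp x hx t ht
  calc S.ρ.f x t = S.ρ.f x t * Real.exp (-Cψ) * Real.exp Cψ := by
        rw [mul_assoc, ← Real.exp_add]; simp
    _ ≤ m * Real.exp Cψ := by
        apply mul_le_mul_of_nonneg_right _ (Real.exp_pos _).le
        exact (mul_le_mul_of_nonneg_left z3 r.le).trans z2

end MHD

namespace MHD

variable {p : Par}

/-- shifted powers -/
def hp (c s : ℝ) : ℝ := (1 + |s|) ^ c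

theorem hp_base (s : ℝ) : 1 ≤ 1 + |s| := by linarith [abs_nonneg s]

theorem hp_pos (c s : ℝ) : 0 < hp c s := Real.rpow_pos_of_pos (by linarith [hp_base s]) _

@[fun_prop]
theorem hp_cont {X : Type*} [TopologicalSpace X] (c : ℝ) {g : X → ℝ} (hg : Continuous g) :
    Continuous (fun a => hp c (g a)) := by
  unfold hp
  exact (by fun_prop : Continuous fun a => 1 + |g a|).rpow_const
    (fun a => Or.inl (by linarith [hp_base (g a)]))

theorem hp_mul (a b s : ℝ) : hp a s * hp b s = hp (a + b) s :=
  (Real.rpow_add (by linarith [hp_base s]) a b).symm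

theorem hp_one {s : ℝ} (hs : 0 < s) : hp 1 s = 1 + s := by
  unfold hp; rw [Real.rpow_one, abs_of_pos hs]

theorem hp_zero {s : ℝ} : hp 0 s = 1 := by
  unfold hp; rw [Real.rpow_zero]

theorem hp_hd (c : ℝ) {s : ℝ} (hs : 0 < s) : HasDerivAt (hp c) (c * hp (c - 1) s) s := by
  have h1 : HasDerivAt (fun r : ℝ => 1 + |r|) 1 s := (hasDerivAt_abs_pos hs).const_add 1
  have h2 := h1.rpow_const (p := c) (Or.inl (by linarith [hp_base s]))
  refine h2.congr_deriv ?_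
  unfold hp; ring

theorem hp_le_one {c s : ℝ} (hc : c ≤ 0) : hp c s ≤ 1 :=
  Real.rpow_le_one_of_one_le_of_nonpos (hp_base s) hc

/-- sublinear interpolation -/
theorem hp_interp {α ε : ℝ} (hα : 0 < α) (hε : 0 < ε) (hε1 : ε ≤ 1) (s : ℝ) :
    hp (1 - α) s ≤ ε * (1 + |s|) + ε ^ (-1 / α) := by
  set L := ε ^ (-1 / α) with hL
  have hb := hp_base s
  have hL0 : 0 < L := Real.rpow_pos_of_pos hε _
  have e : hp (1 - α) s = (1 + |s|) * (1 + |s|) ^ (-α) := by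
    unfold hp
    rw [sub_eq_add_neg, Real.rpow_add (by linarith), Real.rpow_one]
  rcases le_total L (1 + |s|) with h | h
  · have h1 : (1 + |s|) ^ (-α) ≤ L ^ (-α) :=
      Real.rpow_le_rpow_of_nonpos hL0 h (by linarith)
    have h2 : L ^ (-α) = ε := by
      rw [hL, ← Real.rpow_mul hε.le]
      have : -1 / α * -α = 1 := by field_simp
      rw [this, Real.rpow_one]
    rw [e]
    nlinarith
  · have h1 : (1 + |s|) ^ (-α) ≤ 1 := hp_le_one (by linarith)
    rw [e]
    nlinarith [mul_pos hε (by linarith : 0 < 1 + |s|)]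

/-- the exponent -/
def Par.α (p : Par) : ℝ := min p.q (1/2)

theorem Par.α_pos (p : Par) : 0 < p.α := lt_min p.hq (by norm_num)

theorem κ_lower (p : Par) {s : ℝ} (hs : 0 < s) : (2 * p.C₀)⁻¹ * hp p.α s ≤ κe p.κ s := by
  have h1 := p.hκ.2.1 s hs.le
  have hC := p.hC₀
  have ha := p.α_pos
  have ha1 : p.α ≤ 1/2 := min_le_right _ _
  have haq : p.α ≤ p.q := min_le_left _ _
  have h2 : hp p.α s ≤ 2 * (1 + s ^ p.q) := by
    unfold hp; rw [abs_of_pos hs]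
    have hsq : 0 ≤ s ^ p.q := Real.rpow_nonneg hs.le _
    have h2a : (2:ℝ) ^ p.α ≤ 2 := by
      calc (2:ℝ) ^ p.α ≤ 2 ^ (1:ℝ) := Real.rpow_le_rpow_of_exponent_le (by norm_num) (by linarith)
        _ = 2 := Real.rpow_one _
    rcases le_total s 1 with h | h
    · have : (1 + s) ^ p.α ≤ 2 ^ p.α := Real.rpow_le_rpow (by linarith) (by linarith) ha.le
      linarith
    · have : (1 + s) ^ p.α ≤ (2 * s) ^ p.α := Real.rpow_le_rpow (by linarith) (by linarith) ha.le
      rw [Real.mul_rpow (by norm_num) hs.le] at this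
      have h3 : s ^ p.α ≤ s ^ p.q := Real.rpow_le_rpow_of_exponent_le h haq
      have h4 : 0 ≤ s ^ p.α := Real.rpow_nonneg hs.le _
      nlinarith
  rw [κe, abs_of_pos hs]
  refine le_trans ?_ h1
  have : (2 * p.C₀)⁻¹ = p.C₀⁻¹ * (1/2) := by rw [mul_inv]; ring
  rw [this]
  have hi : 0 ≤ p.C₀⁻¹ := inv_nonneg.mpr (by linarith)
  nlinarith

/-- first temperature dissipation -/
def Flow.Z (S : Flow p) (t : ℝ) : ℝ := Ix (fun x t => hp (-1) (S.θ.f x t) * (dx S.θ).f x t ^ 2) t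

theorem Flow.Z_cont (S : Flow p) : Continuous S.Z := by unfold Flow.Z; fun_prop

theorem Flow.Z_nonneg (S : Flow p) (t : ℝ) : 0 ≤ S.Z t := Ix_nonneg fun x _ =>
  mul_nonneg (hp_pos _ _).le (sq_nonneg _)

theorem stepC1 (p : Par) : ∃ C, 1 ≤ C ∧ ∀ S : Flow p, ∀ x ∈ Icc (0:ℝ) 1, ∀ t ∈ Icc (0:ℝ) p.T,
    1 + S.θ.f x t ≤ C * (1 + S.Z t) := by
  obtain ⟨E, hE, hA⟩ := stepA p
  have hN := p.hN
  have hM := p.hM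
  refine ⟨1 + 2 * (p.N + E) / p.M, by
    have : 0 ≤ 2 * (p.N + E) / p.M := by positivity
    linarith, fun S x hx t ht => ?_⟩
  have hZ := S.Z_nonneg t
  have h1 : ∀ y ∈ Icc (0:ℝ) 1, 1 + S.θ.f x t ≤ 2 * (1 + S.θ.f y t) + S.Z t / 2 := by
    intro y hy
    have h := osc2 (g := fun y => hp (1/2) (S.θ.f y t))
      (g' := fun y => (1/2) * hp (1/2 - 1) (S.θ.f y t) * (dx S.θ).f y t)
      (fun z hz => HasDerivAt.comp (h₂ := hp (1/2)) z (hp_hd (1/2) (S.θp z hz t ht)) (S.θ.hx z t)) (by fun_prop) hx hy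
    have h2 : (∫ z in (0:ℝ)..1, ((1/2) * hp (1/2 - 1) (S.θ.f z t) * (dx S.θ).f z t)^2)
        = (1/4) * S.Z t := by
      unfold Flow.Z Ix
      rw [← intervalIntegral.integral_const_mul]
      apply intervalIntegral.integral_congr
      intro z _
      have := hp_mul (1/2 - 1) (1/2 - 1) (S.θ.f z t)
      norm_num at this
      simp only
      norm_num
      linear_combination (1/4) * (dx S.θ).f z t ^ 2 * this
    rw [h2] at h
    have a1 := hp_mul (1/2) (1/2) (S.θ.f x t)
    have a2 := hp_mul (1/2) (1/2) (S.θ.f y t)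
    norm_num at a1 a2 h
    rw [hp_one (S.θp x hx t ht)] at a1
    rw [hp_one (S.θp y hy t ht)] at a2
    nlinarith [sq_nonneg (hp (1/2) (S.θ.f x t) - 2 * hp (1/2) (S.θ.f y t))]
  have h2 := Ix_le3 (f := fun y s => (1 + S.θ.f x t) * S.ρ.f y s) (g₁ := S.ρ.f)
    (g₂ := fun y s => S.ρ.f y s * S.θ.f y s) (g₃ := S.ρ.f) (t := t) 2 2 (S.Z t / 2) (fun y hy => by
      have := mul_le_mul_of_nonneg_right (h1 y hy) (S.ρp y hy t ht).le
      linarith)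
  rw [Ix_mul] at h2
  obtain ⟨m1, m2⟩ := S.massI t ht
  have a1 := (hA S t ht).1
  have hθ := S.θp x hx t ht
  have h3 : p.M * (1 + S.θ.f x t) ≤ 2 * (p.N + E) * (1 + S.Z t) := by
    have e1 : (1 + S.θ.f x t) * p.M ≤ (1 + S.θ.f x t) * Ix S.ρ.f t :=
      mul_le_mul_of_nonneg_left m1 (by linarith)
    have e2 : S.Z t / 2 * Ix S.ρ.f t ≤ S.Z t / 2 * p.N :=
      mul_le_mul_of_nonneg_left m2 (by linarith)
    nlinarith [mul_nonneg hZ hE.le, mul_nonneg hZ (by linarith : 0 ≤ p.N)]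
  have h4 : 1 + S.θ.f x t ≤ 2 * (p.N + E) * (1 + S.Z t) / p.M := by
    rw [le_div_iff₀ hM]; linarith
  have h5 : 2 * (p.N + E) * (1 + S.Z t) / p.M = 2 * (p.N + E) / p.M * (1 + S.Z t) := by ring
  nlinarith

theorem stepC (p : Par) : ∃ C, 0 < C ∧ ∀ S : Flow p, ∫ s in (0:ℝ)..p.T, S.Z s ≤ C := by
  obtain ⟨E, hE, hA⟩ := stepA p
  obtain ⟨B, hB, hρ⟩ := stepB p
  obtain ⟨C₁, hC₁, hθ⟩ := stepC1 p
  have hT := p.hT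
  have hC := p.hC₀
  have hα := p.α_pos
  -- coefficient of the good term
  set a : ℝ := p.α * (2 * p.C₀)⁻¹ with ha
  have ha0 : 0 < a := by positivity
  set ε : ℝ := min 1 (a / (B * E * C₁)) with hε
  have hε0 : 0 < ε := lt_min one_pos (by positivity)
  have hε1 : ε ≤ 1 := min_le_left _ _
  have hε2 : B * E * C₁ * ε ≤ a := by
    have : ε ≤ a / (B * E * C₁) := min_le_right _ _
    rw [le_div_iff₀ (by positivity)] at this
    linarith
  set L : ℝ := ε ^ (-1 / p.α) with hL
  have hL0 : 0 < L := Real.rpow_pos_of_pos hε0 _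
  refine ⟨(E + p.T * (a + B * E * L)) * 2 / a, by positivity, fun S => ?_⟩
  have cZ := S.Z_cont
  have hr := S.renorm (ψ := hp (-p.α)) (by fun_prop) p.T p.h1
  have cprim : Continuous (prim (hp (-p.α))) := prim_cont (by fun_prop)
  have i0 : 0 ≤ Ix (fun x t => S.ρ.f x t * prim (hp (-p.α)) (S.θ.f x t)) 0 := Ix_nonneg fun x hx =>
    mul_nonneg (S.ρp x hx 0 p.h0).le (int_nonneg (S.θp x hx 0 p.h0).le fun r _ => (hp_pos _ _).le)
  have i1 : Ix (fun x t => S.ρ.f x t * prim (hp (-p.α)) (S.θ.f x t)) p.T ≤ E := by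
    have := Ix_le1 (f := fun x t => S.ρ.f x t * prim (hp (-p.α)) (S.θ.f x t))
      (g₁ := fun x t => S.ρ.f x t * S.θ.f x t) (t := p.T) 1 (fun x hx => by
        have h1 : prim (hp (-p.α)) (S.θ.f x p.T) ≤ 1 * ∫ r in (0:ℝ)..(S.θ.f x p.T), (1:ℝ) :=
          int_le1 (S.θp x hx p.T p.h1).le 1 (fun r _ => by
            have := hp_le_one (c := -p.α) (s := r) (by linarith)
            linarith)
        simp only [intervalIntegral.integral_const, smul_eq_mul, mul_one, sub_zero, one_mul] at h1
        have := mul_le_mul_of_nonneg_left h1 (S.ρp x hx p.T p.h1).le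
        linarith)
    have := (hA S p.T p.h1).1
    linarith
  have low : ∀ s ∈ Icc (0:ℝ) p.T, a / 2 * S.Z s ≤ Ix (fun x t => hp (-p.α) (S.θ.f x t) *
      (S.kx.f x t + S.Q.f x t - S.ρ.f x t * S.θ.f x t * (dx S.u).f x t)) s + (a + B * E * L) := by
    intro s hs
    set Y : ℝ := ε * (C₁ * (1 + S.Z s)) + L with hY
    have e1 : Ix (fun x t => hp (-p.α) (S.θ.f x t) *
      (S.kx.f x t + S.Q.f x t - S.ρ.f x t * S.θ.f x t * (dx S.u).f x t)) s
      = Ix (fun x t => hp (-p.α) (S.θ.f x t) * S.kx.f x t) s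
        - Ix (fun x t => hp (-p.α) (S.θ.f x t) * (S.ρ.f x t * S.θ.f x t * (dx S.u).f x t
          - S.Q.f x t)) s := by
      rw [← Ix_sub]
      exact Ix_congr fun x _ => by ring
    have e2 := S.ibpk hs (g := fun x t => hp (-p.α) (S.θ.f x t))
      (g' := fun x t => (-p.α) * hp (-p.α - 1) (S.θ.f x t) * (dx S.θ).f x t)
      (fun x hx => HasDerivAt.comp (h₂ := hp (-p.α)) x (hp_hd (-p.α) (S.θp x hx s hs)) (S.θ.hx x s))
    have e3 := Ix_le1 (f := fun x t => a * (hp (-1) (S.θ.f x t) * (dx S.θ).f x t ^ 2))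
      (g₁ := fun x t => (-p.α) * hp (-p.α - 1) (S.θ.f x t) * (dx S.θ).f x t * S.k x t)
      (t := s) (-1) (fun x hx => by
        have h1 := κ_lower p (S.θp x hx s hs)
        have h2 : hp (-1) (S.θ.f x s) = hp (-p.α - 1) (S.θ.f x s) * hp p.α (S.θ.f x s) := by
          rw [hp_mul]; ring_nf
        have h3 : 0 ≤ p.α * hp (-p.α - 1) (S.θ.f x s) * (dx S.θ).f x s ^ 2 :=
          mul_nonneg (mul_nonneg hα.le (hp_pos _ _).le) (sq_nonneg _)
        have h4 := mul_le_mul_of_nonneg_left h1 h3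
        simp only [Flow.k, h2, ha]
        linarith)
    rw [Ix_mul] at e3
    have e4 := Ix_le1 (f := fun x t => hp (-p.α) (S.θ.f x t) * (S.ρ.f x t * S.θ.f x t *
        (dx S.u).f x t - S.Q.f x t)) (g₁ := fun x t => S.ρ.f x t * S.θ.f x t) (t := s)
        (1/4 * B * Y) (fun x hx => by
        have r := S.ρp x hx s hs
        have r1 := S.θp x hx s hs
        have r2 := hρ S x hx s hs
        have h5 := hp_pos (-p.α) (S.θ.f x s)
        have h1 : S.ρ.f x s * S.θ.f x s * (dx S.u).f x s - S.Q.f x s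
            ≤ 1/4 * (S.ρ.f x s * S.θ.f x s)^2 := by
          simp only [Flow.Q, add_f, sub_f, mul_f, neg_f, cst_f, xx_f, dx_add, dt_add, dx_sub, dt_sub, dx_neg, dt_neg, dx_mul, dt_mul, dx_cst, dt_cst, dx_xx, dt_xx, dt_dx]
          nlinarith [sq_nonneg (S.ρ.f x s * S.θ.f x s - 2 * (dx S.u).f x s),
            sq_nonneg ((dx S.w).f x s), sq_nonneg ((dx S.v).f x s), sq_nonneg ((dx S.b).f x s),
            sq_nonneg ((dx S.c).f x s)]
        have h2 := mul_le_mul_of_nonneg_left h1 h5.le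
        have h3 : hp (-p.α) (S.θ.f x s) * S.θ.f x s ≤ Y := by
          have i1 := hp_interp hα hε0 hε1 (S.θ.f x s)
          have i2 := hp_mul (-p.α) 1 (S.θ.f x s)
          rw [hp_one r1] at i2
          have i3 : -p.α + 1 = 1 - p.α := by ring
          rw [i3] at i2
          rw [abs_of_pos r1] at i1
          have i4 := mul_le_mul_of_nonneg_left (hθ S x hx s hs) hε0.le
          nlinarith
        have h4 : S.ρ.f x s * (hp (-p.α) (S.θ.f x s) * S.θ.f x s) ≤ B * Y :=
          mul_le_mul r2 h3 (mul_nonneg h5.le r1.le) (by linarith)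
        have h6 := mul_le_mul_of_nonneg_left h4 (mul_pos r r1).le
        linarith)
    have hY0 : 0 ≤ Y := by
      have := S.Z_nonneg s
      positivity
    have e5 : 1/4 * B * Y * Ix (fun x t => S.ρ.f x t * S.θ.f x t) s ≤ 1/4 * B * Y * E :=
      mul_le_mul_of_nonneg_left (hA S s hs).1 (by positivity)
    have e6 : 1/4 * B * Y * E ≤ 1/4 * a * (1 + S.Z s) + 1/4 * B * E * L := by
      have := mul_le_mul_of_nonneg_right hε2 (by linarith [S.Z_nonneg s] : 0 ≤ 1 + S.Z s)
      rw [hY]; linarith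
    have e7 : a * S.Z s = a * Ix (fun x t => hp (-1) (S.θ.f x t) * (dx S.θ).f x t ^ 2) s := rfl
    rw [e1]
    have : 0 ≤ a * S.Z s := mul_nonneg ha0.le (S.Z_nonneg s)
    have : 0 ≤ B * E * L := by positivity
    linarith
  have fin := int_le2 (a := 0) (b := p.T) hT.le (f := fun s => a / 2 * S.Z s)
    (g₁ := fun s => Ix (fun x t => hp (-p.α) (S.θ.f x t) *
      (S.kx.f x t + S.Q.f x t - S.ρ.f x t * S.θ.f x t * (dx S.u).f x t)) s) (g₂ := fun _ => 1)
      1 (a + B * E * L) (fun s hs => by have := low s hs; linarith)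
  rw [intervalIntegral.integral_const_mul] at fin
  simp only [intervalIntegral.integral_const, smul_eq_mul, mul_one, sub_zero, one_mul] at fin
  rw [le_div_iff₀ ha0]
  linarith

end MHD

namespace MHD

variable {p : Par}

theorem Ix_le8 {t : ℝ} {f g₁ g₂ g₃ g₄ g₅ g₆ g₇ g₈ : ℝ → ℝ → ℝ} (c₁ c₂ c₃ c₄ c₅ c₆ c₇ c₈ : ℝ)
    (h : ∀ x ∈ Icc (0:ℝ) 1,
      f x t ≤ c₁ * g₁ x t + c₂ * g₂ x t + c₃ * g₃ x t + c₄ * g₄ x t + c₅ * g₅ x t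
        + c₆ * g₆ x t + c₇ * g₇ x t + c₈ * g₈ x t)
    (hf : Continuous (fun x => f x t) := by fun_prop)
    (h₁ : Continuous (fun x => g₁ x t) := by fun_prop)
    (h₂ : Continuous (fun x => g₂ x t) := by fun_prop)
    (h₃ : Continuous (fun x => g₃ x t) := by fun_prop)
    (h₄ : Continuous (fun x => g₄ x t) := by fun_prop)
    (h₅ : Continuous (fun x => g₅ x t) := by fun_prop)
    (h₆ : Continuous (fun x => g₆ x t) := by fun_prop)
    (h₇ : Continuous (fun x => g₇ x t) := by fun_prop)
    (h₈ : Continuous (fun x => g₈ x t) := by fun_prop) :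
    Ix f t ≤ c₁ * Ix g₁ t + c₂ * Ix g₂ t + c₃ * Ix g₃ t + c₄ * Ix g₄ t + c₅ * Ix g₅ t
      + c₆ * Ix g₆ t + c₇ * Ix g₇ t + c₈ * Ix g₈ t := by
  have e1 := Ix_le5 (t := t) (f := f)
    (g₁ := fun x t => c₁ * g₁ x t + c₂ * g₂ x t + c₃ * g₃ x t + c₄ * g₄ x t)
    (g₂ := g₅) (g₃ := g₆) (g₄ := g₇) (g₅ := g₈) 1 c₅ c₆ c₇ c₈ (fun x hx => by
      have := h x hx; linarith)
  have e2 := Ix_le4 (t := t) (f := fun x t => c₁ * g₁ x t + c₂ * g₂ x t + c₃ * g₃ x t + c₄ * g₄ x t)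
    (g₁ := g₁) (g₂ := g₂) (g₃ := g₃) (g₄ := g₄) c₁ c₂ c₃ c₄ (fun x hx => le_rfl)
  linarith

theorem Ix_le7 {t : ℝ} {f g₁ g₂ g₃ g₄ g₅ g₆ g₇ : ℝ → ℝ → ℝ} (c₁ c₂ c₃ c₄ c₅ c₆ c₇ : ℝ)
    (h : ∀ x ∈ Icc (0:ℝ) 1,
      f x t ≤ c₁ * g₁ x t + c₂ * g₂ x t + c₃ * g₃ x t + c₄ * g₄ x t + c₅ * g₅ x t
        + c₆ * g₆ x t + c₇ * g₇ x t)
    (hf : Continuous (fun x => f x t) := by fun_prop)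
    (h₁ : Continuous (fun x => g₁ x t) := by fun_prop)
    (h₂ : Continuous (fun x => g₂ x t) := by fun_prop)
    (h₃ : Continuous (fun x => g₃ x t) := by fun_prop)
    (h₄ : Continuous (fun x => g₄ x t) := by fun_prop)
    (h₅ : Continuous (fun x => g₅ x t) := by fun_prop)
    (h₆ : Continuous (fun x => g₆ x t) := by fun_prop)
    (h₇ : Continuous (fun x => g₇ x t) := by fun_prop) :
    Ix f t ≤ c₁ * Ix g₁ t + c₂ * Ix g₂ t + c₃ * Ix g₃ t + c₄ * Ix g₄ t + c₅ * Ix g₅ t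
      + c₆ * Ix g₆ t + c₇ * Ix g₇ t := by
  have e1 := Ix_le5 (t := t) (f := f)
    (g₁ := fun x t => c₁ * g₁ x t + c₂ * g₂ x t + c₃ * g₃ x t)
    (g₂ := g₄) (g₃ := g₅) (g₄ := g₆) (g₅ := g₇) 1 c₄ c₅ c₆ c₇ (fun x hx => by
      have := h x hx; linarith)
  have e2 := Ix_le3 (t := t) (f := fun x t => c₁ * g₁ x t + c₂ * g₂ x t + c₃ * g₃ x t)
    (g₁ := g₁) (g₂ := g₂) (g₃ := g₃) c₁ c₂ c₃ (fun x hx => le_rfl)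
  linarith

theorem Ix_le6 {t : ℝ} {f g₁ g₂ g₃ g₄ g₅ g₆ : ℝ → ℝ → ℝ} (c₁ c₂ c₃ c₄ c₅ c₆ : ℝ)
    (h : ∀ x ∈ Icc (0:ℝ) 1,
      f x t ≤ c₁ * g₁ x t + c₂ * g₂ x t + c₃ * g₃ x t + c₄ * g₄ x t + c₅ * g₅ x t
        + c₆ * g₆ x t)
    (hf : Continuous (fun x => f x t) := by fun_prop)
    (h₁ : Continuous (fun x => g₁ x t) := by fun_prop)
    (h₂ : Continuous (fun x => g₂ x t) := by fun_prop)
    (h₃ : Continuous (fun x => g₃ x t) := by fun_prop)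
    (h₄ : Continuous (fun x => g₄ x t) := by fun_prop)
    (h₅ : Continuous (fun x => g₅ x t) := by fun_prop)
    (h₆ : Continuous (fun x => g₆ x t) := by fun_prop) :
    Ix f t ≤ c₁ * Ix g₁ t + c₂ * Ix g₂ t + c₃ * Ix g₃ t + c₄ * Ix g₄ t + c₅ * Ix g₅ t
      + c₆ * Ix g₆ t := by
  have e1 := Ix_le5 (t := t) (f := f)
    (g₁ := fun x t => c₁ * g₁ x t + c₂ * g₂ x t)
    (g₂ := g₃) (g₃ := g₄) (g₄ := g₅) (g₅ := g₆) 1 c₃ c₄ c₅ c₆ (fun x hx => by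
      have := h x hx; linarith)
  have e2 := Ix_le2 (t := t) (f := fun x t => c₁ * g₁ x t + c₂ * g₂ x t)
    (g₁ := g₁) (g₂ := g₂) c₁ c₂ (fun x hx => le_rfl)
  linarith

theorem Flow.Q_nonneg (S : Flow p) (x t : ℝ) : 0 ≤ S.Q.f x t := by
  simp only [Flow.Q, add_f, sub_f, mul_f, neg_f, cst_f, xx_f, dx_add, dt_add, dx_sub, dt_sub, dx_neg, dt_neg, dx_mul, dt_mul, dx_cst, dt_cst, dx_xx, dt_xx, dt_dx]; nlinarith [sq_nonneg ((dx S.u).f x t), sq_nonneg ((dx S.w).f x t),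
    sq_nonneg ((dx S.v).f x t), sq_nonneg ((dx S.b).f x t), sq_nonneg ((dx S.c).f x t)]

theorem Flow.IQ_nonneg (S : Flow p) (t : ℝ) : 0 ≤ Ix S.Q.f t := Ix_nonneg fun x _ => S.Q_nonneg x t

/-- a differential inequality in integrated form -/
theorem int_bd {T X0 b : ℝ} {D g : ℝ → ℝ} (h : ∀ t ∈ Icc (0:ℝ) T, D t ≤ g t)
    (hT : 0 ≤ T) (hb : ∫ s in (0:ℝ)..T, g s ≤ b) (hD : Continuous D) (hg : Continuous g) :
    ∫ s in (0:ℝ)..T, D s ≤ b := (int_mono hT h hD hg).trans hb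

theorem stepD0 (p : Par) : ∃ C, 0 < C ∧ ∀ S : Flow p, ∫ s in (0:ℝ)..p.T, Ix S.Q.f s ≤ C := by
  obtain ⟨E, hE, hA⟩ := stepA p
  obtain ⟨B, hB, hρ⟩ := stepB p
  obtain ⟨C₁, hC₁, hθ⟩ := stepC1 p
  obtain ⟨CZ, hCZ, hZ⟩ := stepC p
  have hN := p.hN
  have hT := p.hT
  refine ⟨2 * ((1/2) * (p.N * (3 * p.N^2)) + p.N^2) + B * E * C₁ * (p.T + CZ), by positivity, fun S => ?_⟩
  set e : SF := cst (1/2) * (S.ρ * (S.u * S.u + S.w * S.w + S.v * S.v))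
    + cst (1/2) * (S.b * S.b + S.c * S.c) with he
  set φ : SF := S.u * e + S.u * S.ρ * S.θ + cst (1/2) * (S.u * (S.b * S.b + S.c * S.c))
    - S.w * S.b - S.v * S.c - S.u * dx S.u - S.w * dx S.w - S.v * dx S.v - S.b * dx S.b
    - S.c * dx S.c with hφ
  have h := masterI (T := p.T) e φ (fun x t => S.ρ.f x t * S.θ.f x t * (dx S.u).f x t - S.Q.f x t)
    (fun x hx t ht => by
    simp only [he, hφ, Flow.kx, Flow.Q, add_f, sub_f, mul_f, neg_f, cst_f, xx_f, dx_add, dt_add, dx_sub, dt_sub, dx_neg, dt_neg, dx_mul, dt_mul, dx_cst, dt_cst, dx_xx, dt_xx, dt_dx]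
    linear_combination ((1/2) * (S.u.f x t ^2 + S.w.f x t ^ 2 + S.v.f x t ^ 2))
      * S.mass x hx t ht + S.u.f x t * S.mom x hx t ht + S.w.f x t * S.eqw x hx t ht
      + S.v.f x t * S.eqv x hx t ht + S.b.f x t * S.eqb x hx t ht
      + S.c.f x t * S.eqc x hx t ht) (fun t ht => by
    simp only [hφ, add_f, sub_f, mul_f, neg_f, cst_f, xx_f, dx_add, dt_add, dx_sub, dt_sub, dx_neg, dt_neg, dx_mul, dt_mul, dx_cst, dt_cst, dx_xx, dt_xx, dt_dx]; simp [S.u0 t ht, S.w0 t ht, S.v0 t ht, S.b0 t ht, S.c0 t ht])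
    (fun t ht => by
    simp only [hφ, add_f, sub_f, mul_f, neg_f, cst_f, xx_f, dx_add, dt_add, dx_sub, dt_sub, dx_neg, dt_neg, dx_mul, dt_mul, dx_cst, dt_cst, dx_xx, dt_xx, dt_dx]; simp [S.u1 t ht, S.w1 t ht, S.v1 t ht, S.b1 t ht, S.c1 t ht])
    (by fun_prop) p.T p.h1
  have h0 : Ix e.f 0 ≤ (1/2) * (p.N * (3 * p.N^2)) + p.N^2 := by
    refine Ix_le_const _ fun x hx => ?_
    simp only [he, add_f, sub_f, mul_f, neg_f, cst_f, xx_f, dx_add, dt_add, dx_sub, dt_sub, dx_neg, dt_neg, dx_mul, dt_mul, dx_cst, dt_cst, dx_xx, dt_xx, dt_dx]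
    have r := S.ρp x hx 0 p.h0
    have r1 := (le_abs_self _).trans (S.iρ x hx).1
    have r3 := sqbd (S.iu x hx).1
    have r4 := sqbd (S.iw x hx).1
    have r5 := sqbd (S.iv x hx).1
    have r6 := sqbd (S.ib x hx).1
    have r7 := sqbd (S.ic x hx).1
    have a2 : S.ρ.f x 0 * (S.u.f x 0 * S.u.f x 0 + S.w.f x 0 * S.w.f x 0 + S.v.f x 0 * S.v.f x 0)
        ≤ p.N * (3 * p.N^2) :=
      mul_le_mul r1 (by nlinarith) (by nlinarith [sq_nonneg (S.u.f x 0), sq_nonneg (S.w.f x 0), sq_nonneg (S.v.f x 0)]) (by linarith)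
    nlinarith
  have h1 : 0 ≤ Ix e.f p.T := Ix_nonneg fun x hx => by
    have a := (S.ρp x hx p.T p.h1).le
    simp only [he, add_f, sub_f, mul_f, neg_f, cst_f, xx_f, dx_add, dt_add, dx_sub, dt_sub, dx_neg, dt_neg, dx_mul, dt_mul, dx_cst, dt_cst, dx_xx, dt_xx, dt_dx]
    nlinarith [sq_nonneg (S.b.f x p.T), sq_nonneg (S.c.f x p.T), mul_nonneg a (sq_nonneg (S.u.f x p.T)),
      mul_nonneg a (sq_nonneg (S.w.f x p.T)), mul_nonneg a (sq_nonneg (S.v.f x p.T))]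
  have cZ := S.Z_cont
  have h2 := int_le3 (a := 0) (b := p.T) hT.le
    (f := fun s => Ix (fun x t => S.ρ.f x t * S.θ.f x t * (dx S.u).f x t - S.Q.f x t) s)
    (g₁ := fun s => Ix S.Q.f s) (g₂ := fun _ => 1) (g₃ := S.Z) (-1/2) (1/2 * (B * E * C₁)) (1/2 * (B * E * C₁))
    (fun s hs => by
      have := Ix_le2 (f := fun x t => S.ρ.f x t * S.θ.f x t * (dx S.u).f x t - S.Q.f x t)
        (g₁ := S.Q.f) (g₂ := fun x t => S.ρ.f x t * S.θ.f x t) (t := s)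
        (-1/2) (1/2 * (B * (C₁ * (1 + S.Z s)))) (fun x hx => by
          have r := S.ρp x hx s hs
          have r1 := S.θp x hx s hs
          have r2 := hρ S x hx s hs
          have r3 := hθ S x hx s hs
          have i1 : S.ρ.f x s * S.θ.f x s ≤ B * (C₁ * (1 + S.Z s)) :=
            mul_le_mul r2 (by linarith) r1.le (by linarith)
          have i2 := mul_le_mul_of_nonneg_left i1 (mul_pos r r1).le
          have i3 : (dx S.u).f x s ^ 2 ≤ S.Q.f x s := by
            simp only [Flow.Q, add_f, sub_f, mul_f, neg_f, cst_f, xx_f, dx_add, dt_add, dx_sub, dt_sub, dx_neg, dt_neg, dx_mul, dt_mul, dx_cst, dt_cst, dx_xx, dt_xx, dt_dx]; nlinarith [sq_nonneg ((dx S.w).f x s),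
              sq_nonneg ((dx S.v).f x s), sq_nonneg ((dx S.b).f x s), sq_nonneg ((dx S.c).f x s)]
          nlinarith [sq_nonneg (S.ρ.f x s * S.θ.f x s - (dx S.u).f x s)])
      have a1 : 1/2 * (B * (C₁ * (1 + S.Z s))) * Ix (fun x t => S.ρ.f x t * S.θ.f x t) s
        ≤ 1/2 * (B * (C₁ * (1 + S.Z s))) * E := mul_le_mul_of_nonneg_left (hA S s hs).1 (by
          have := S.Z_nonneg s
          positivity)
      linarith)
  simp only [intervalIntegral.integral_const, smul_eq_mul, mul_one, sub_zero] at h2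
  have h3 := mul_le_mul_of_nonneg_left (hZ S) (by positivity : 0 ≤ B * E * C₁)
  linarith

/-! ### the Kirchhoff transform -/

/-- primitive of the conductivity -/
def Par.K (p : Par) : ℝ → ℝ := prim (κe p.κ)

theorem Par.K_hd (p : Par) (s : ℝ) : HasDerivAt p.K (κe p.κ s) s := prim_hd (κe_cont p) s

theorem Par.K_cont0 (p : Par) : Continuous p.K := prim_cont (κe_cont p)

@[fun_prop]
theorem Par.K_cont (p : Par) {X : Type*} [TopologicalSpace X] {g : X → ℝ} (hg : Continuous g) :
    Continuous (fun a => p.K (g a)) := p.K_cont0.comp hg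

@[fun_prop]
theorem Par.κe_cont' (p : Par) {X : Type*} [TopologicalSpace X] {g : X → ℝ} (hg : Continuous g) :
    Continuous (fun a => κe p.κ (g a)) := (κe_cont p).comp hg

theorem Par.κ_ge (p : Par) (s : ℝ) : p.C₀⁻¹ ≤ κe p.κ s := by
  refine le_trans ?_ (p.hκ.2.1 |s| (abs_nonneg s))
  have : 0 ≤ |s| ^ p.q := Real.rpow_nonneg (abs_nonneg s) _
  have : 0 ≤ p.C₀⁻¹ := inv_nonneg.mpr (by linarith [p.hC₀])
  nlinarith

theorem Par.κ_pos (p : Par) (s : ℝ) : 0 < κe p.κ s :=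
  lt_of_lt_of_le (inv_pos.mpr (by linarith [p.hC₀])) (p.κ_ge s)

theorem Par.K_ge (p : Par) {s : ℝ} (hs : 0 ≤ s) : p.C₀⁻¹ * s ≤ p.K s := by
  have := int_mono (a := 0) (b := s) hs (f := fun _ => p.C₀⁻¹) (g := κe p.κ) (fun r _ => p.κ_ge r)
    (by fun_prop) (κe_cont p)
  simp only [intervalIntegral.integral_const, smul_eq_mul, sub_zero] at this
  unfold Par.K prim
  linarith

theorem Par.K_nonneg (p : Par) {s : ℝ} (hs : 0 ≤ s) : 0 ≤ p.K s :=
  int_nonneg hs fun r _ => (p.κ_pos r).le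

theorem Par.K_mono (p : Par) : StrictMono p.K := by
  apply strictMono_of_deriv_pos
  intro s
  rw [(p.K_hd s).deriv]
  exact p.κ_pos s

theorem Flow.K_hx (S : Flow p) (x t : ℝ) :
    HasDerivAt (fun y => p.K (S.θ.f y t)) (S.k x t) x :=
  HasDerivAt.comp (h₂ := p.K) x (p.K_hd _) (S.θ.hx x t)

theorem Kbd (p : Par) : ∃ C, 1 ≤ C ∧ ∀ S : Flow p, ∀ x ∈ Icc (0:ℝ) 1, ∀ t ∈ Icc (0:ℝ) p.T,
    p.K (S.θ.f x t) ^ 2 ≤ C + 2 * Ix (fun x t => S.k x t ^ 2) t := by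
  obtain ⟨E, hE, hA⟩ := stepA p
  have hM := p.hM
  refine ⟨1 + 2 * p.K (E / p.M + 1) ^ 2, by nlinarith [sq_nonneg (p.K (E / p.M + 1))],
    fun S x hx t ht => ?_⟩
  have : ∃ y ∈ Icc (0:ℝ) 1, S.θ.f y t ≤ E / p.M + 1 := by
    by_contra hcon
    have h1 : ∀ y ∈ Icc (0:ℝ) 1, E / p.M + 1 < S.θ.f y t := by
      intro y hy
      by_contra h2
      exact hcon ⟨y, hy, not_lt.mp h2⟩
    have h2 := Ix_le1 (f := fun x t => (E / p.M + 1) * S.ρ.f x t)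
      (g₁ := fun x t => S.ρ.f x t * S.θ.f x t) (t := t) 1 (fun y hy => by
        nlinarith [h1 y hy, S.ρp y hy t ht])
    rw [Ix_mul] at h2
    have h3 := (S.massI t ht).1
    have h4 := (hA S t ht).1
    have h5 : (E / p.M + 1) * p.M ≤ (E / p.M + 1) * Ix S.ρ.f t :=
      mul_le_mul_of_nonneg_left h3 (by positivity)
    have h6 : (E / p.M + 1) * p.M = E + p.M := by field_simp
    linarith
  obtain ⟨y, hy, hy1⟩ := this
  have h1 := osc2 (g := fun y => p.K (S.θ.f y t)) (g' := fun y => S.k y t) (fun z _ => S.K_hx z t)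
    (by fun_prop) hx hy
  have h2 : p.K (S.θ.f y t) ≤ p.K (E / p.M + 1) := p.K_mono.monotone hy1
  have h3 := p.K_nonneg (S.θp y hy t ht).le
  have h4 : p.K (S.θ.f y t) ^ 2 ≤ p.K (E / p.M + 1) ^ 2 := pow_le_pow_left₀ h3 h2 2
  have h5 : Ix (fun x t => S.k x t ^ 2) t = ∫ z in (0:ℝ)..1, S.k z t ^ 2 := rfl
  rw [← h5] at h1
  nlinarith [sq_nonneg (p.K (S.θ.f x t) - 2 * p.K (S.θ.f y t))]

/-- second primitive -/
def Par.Φ (p : Par) : ℝ → ℝ := prim p.K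

@[fun_prop]
theorem Par.Φ_cont (p : Par) {X : Type*} [TopologicalSpace X] {g : X → ℝ} (hg : Continuous g) :
    Continuous (fun a => p.Φ (g a)) := (prim_cont p.K_cont0).comp hg

theorem Par.Φ_ge (p : Par) {s : ℝ} (hs : 0 ≤ s) : p.C₀⁻¹ * (s ^ 2 / 2) ≤ p.Φ s := by
  have := int_mono (a := 0) (b := s) hs (f := fun r => p.C₀⁻¹ * r) (g := p.K) (fun r hr => p.K_ge hr.1)
    (by fun_prop) p.K_cont0
  rw [intervalIntegral.integral_const_mul, integral_id] at this
  unfold Par.Φ prim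
  linarith

theorem Par.Φ_mono (p : Par) {s r : ℝ} (hs : 0 ≤ s) (h : s ≤ r) : p.Φ s ≤ p.Φ r := by
  have h1 := intervalIntegral.integral_add_adjacent_intervals (ii p.K_cont0 0 s) (ii p.K_cont0 s r)
  have h2 : 0 ≤ ∫ x in s..r, p.K x := int_nonneg h fun x hx => p.K_nonneg (hs.trans hx.1)
  unfold Par.Φ prim
  linarith

/-- energy identity for the temperature -/
theorem Flow.Φ_id (S : Flow p) : ∀ t ∈ Icc (0:ℝ) p.T, Ix (fun x t => S.ρ.f x t * p.Φ (S.θ.f x t)) t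
      = Ix (fun x t => S.ρ.f x t * p.Φ (S.θ.f x t)) 0 + ∫ s in (0:ℝ)..t,
        Ix (fun x t => p.K (S.θ.f x t) * (S.Q.f x t
          - S.ρ.f x t * S.θ.f x t * (dx S.u).f x t) - S.k x t ^ 2) s := by
  intro t ht
  have h := S.renorm p.K_cont0 t ht
  unfold Par.Φ
  rw [h]
  congr 1
  apply intervalIntegral.integral_congr
  intro s hs
  rw [uIcc_of_le ht.1] at hs
  have hs' : s ∈ Icc (0:ℝ) p.T := ⟨hs.1, hs.2.trans ht.2⟩
  have h1 := S.ibpk hs' (g := fun x t => p.K (S.θ.f x t)) (g' := S.k) (fun x hx => S.K_hx x s)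
  have h2 : Ix (fun x t => p.K (S.θ.f x t) * (S.kx.f x t + S.Q.f x t
          - S.ρ.f x t * S.θ.f x t * (dx S.u).f x t)) s
      = Ix (fun x t => p.K (S.θ.f x t) * S.kx.f x t) s + Ix (fun x t => p.K (S.θ.f x t) * (S.Q.f x t
          - S.ρ.f x t * S.θ.f x t * (dx S.u).f x t)) s := by
    rw [← Ix_add]; exact Ix_congr fun x _ => by ring
  have h3 : Ix (fun x t => p.K (S.θ.f x t) * (S.Q.f x t
          - S.ρ.f x t * S.θ.f x t * (dx S.u).f x t) - S.k x t ^ 2) s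
      = Ix (fun x t => p.K (S.θ.f x t) * (S.Q.f x t
          - S.ρ.f x t * S.θ.f x t * (dx S.u).f x t)) s - Ix (fun x t => S.k x t * S.k x t) s := by
    rw [← Ix_sub]; exact Ix_congr fun x _ => by ring
  rw [h2, h3, h1]
  ring

end MHD

namespace MHD

variable {p : Par}

def Flow.U (S : Flow p) : SF := dt S.u + S.u * dx S.u
def Flow.W (S : Flow p) : SF := dt S.w + S.u * dx S.w
def Flow.V (S : Flow p) : SF := dt S.v + S.u * dx S.v
def Flow.Bd (S : Flow p) : SF := dt S.b + S.u * dx S.b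
def Flow.Cd (S : Flow p) : SF := dt S.c + S.u * dx S.c

theorem Flow.U0 (S : Flow p) {t : ℝ} (ht : t ∈ Icc (0:ℝ) p.T) : S.U.f 0 t = 0 := by
  simp only [Flow.U, add_f, sub_f, mul_f, neg_f, cst_f, xx_f, dx_add, dt_add, dx_sub, dt_sub, dx_neg, dt_neg, dx_mul, dt_mul, dx_cst, dt_cst, dx_xx, dt_xx, dt_dx]; simp [S.u0 t ht, dt_bc p.hT S.u0 t ht]
theorem Flow.U1 (S : Flow p) {t : ℝ} (ht : t ∈ Icc (0:ℝ) p.T) : S.U.f 1 t = 0 := by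
  simp only [Flow.U, add_f, sub_f, mul_f, neg_f, cst_f, xx_f, dx_add, dt_add, dx_sub, dt_sub, dx_neg, dt_neg, dx_mul, dt_mul, dx_cst, dt_cst, dx_xx, dt_xx, dt_dx]; simp [S.u1 t ht, dt_bc p.hT S.u1 t ht]
theorem Flow.W0 (S : Flow p) {t : ℝ} (ht : t ∈ Icc (0:ℝ) p.T) : S.W.f 0 t = 0 := by
  simp only [Flow.W, add_f, sub_f, mul_f, neg_f, cst_f, xx_f, dx_add, dt_add, dx_sub, dt_sub, dx_neg, dt_neg, dx_mul, dt_mul, dx_cst, dt_cst, dx_xx, dt_xx, dt_dx]; simp [S.u0 t ht, dt_bc p.hT S.w0 t ht]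
theorem Flow.W1 (S : Flow p) {t : ℝ} (ht : t ∈ Icc (0:ℝ) p.T) : S.W.f 1 t = 0 := by
  simp only [Flow.W, add_f, sub_f, mul_f, neg_f, cst_f, xx_f, dx_add, dt_add, dx_sub, dt_sub, dx_neg, dt_neg, dx_mul, dt_mul, dx_cst, dt_cst, dx_xx, dt_xx, dt_dx]; simp [S.u1 t ht, dt_bc p.hT S.w1 t ht]
theorem Flow.V0 (S : Flow p) {t : ℝ} (ht : t ∈ Icc (0:ℝ) p.T) : S.V.f 0 t = 0 := by
  simp only [Flow.V, add_f, sub_f, mul_f, neg_f, cst_f, xx_f, dx_add, dt_add, dx_sub, dt_sub, dx_neg, dt_neg, dx_mul, dt_mul, dx_cst, dt_cst, dx_xx, dt_xx, dt_dx]; simp [S.u0 t ht, dt_bc p.hT S.v0 t ht]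
theorem Flow.V1 (S : Flow p) {t : ℝ} (ht : t ∈ Icc (0:ℝ) p.T) : S.V.f 1 t = 0 := by
  simp only [Flow.V, add_f, sub_f, mul_f, neg_f, cst_f, xx_f, dx_add, dt_add, dx_sub, dt_sub, dx_neg, dt_neg, dx_mul, dt_mul, dx_cst, dt_cst, dx_xx, dt_xx, dt_dx]; simp [S.u1 t ht, dt_bc p.hT S.v1 t ht]
theorem Flow.Bd0 (S : Flow p) {t : ℝ} (ht : t ∈ Icc (0:ℝ) p.T) : S.Bd.f 0 t = 0 := by
  simp only [Flow.Bd, add_f, sub_f, mul_f, neg_f, cst_f, xx_f, dx_add, dt_add, dx_sub, dt_sub, dx_neg, dt_neg, dx_mul, dt_mul, dx_cst, dt_cst, dx_xx, dt_xx, dt_dx]; simp [S.u0 t ht, dt_bc p.hT S.b0 t ht]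
theorem Flow.Bd1 (S : Flow p) {t : ℝ} (ht : t ∈ Icc (0:ℝ) p.T) : S.Bd.f 1 t = 0 := by
  simp only [Flow.Bd, add_f, sub_f, mul_f, neg_f, cst_f, xx_f, dx_add, dt_add, dx_sub, dt_sub, dx_neg, dt_neg, dx_mul, dt_mul, dx_cst, dt_cst, dx_xx, dt_xx, dt_dx]; simp [S.u1 t ht, dt_bc p.hT S.b1 t ht]
theorem Flow.Cd0 (S : Flow p) {t : ℝ} (ht : t ∈ Icc (0:ℝ) p.T) : S.Cd.f 0 t = 0 := by
  simp only [Flow.Cd, add_f, sub_f, mul_f, neg_f, cst_f, xx_f, dx_add, dt_add, dx_sub, dt_sub, dx_neg, dt_neg, dx_mul, dt_mul, dx_cst, dt_cst, dx_xx, dt_xx, dt_dx]; simp [S.u0 t ht, dt_bc p.hT S.c0 t ht]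
theorem Flow.Cd1 (S : Flow p) {t : ℝ} (ht : t ∈ Icc (0:ℝ) p.T) : S.Cd.f 1 t = 0 := by
  simp only [Flow.Cd, add_f, sub_f, mul_f, neg_f, cst_f, xx_f, dx_add, dt_add, dx_sub, dt_sub, dx_neg, dt_neg, dx_mul, dt_mul, dx_cst, dt_cst, dx_xx, dt_xx, dt_dx]; simp [S.u1 t ht, dt_bc p.hT S.c1 t ht]

theorem Flow.Fx (S : Flow p) : ∀ x ∈ Icc (0:ℝ) 1, ∀ t ∈ Icc (0:ℝ) p.T,
    (dx S.F).f x t = S.ρ.f x t * S.U.f x t := by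
  intro x hx t ht
  simp only [Flow.F, Flow.U, add_f, sub_f, mul_f, neg_f, cst_f, xx_f, dx_add, dt_add, dx_sub, dt_sub, dx_neg, dt_neg, dx_mul, dt_mul, dx_cst, dt_cst, dx_xx, dt_xx, dt_dx]
  linear_combination -S.mom x hx t ht

theorem Flow.F_eq (S : Flow p) (x t : ℝ) : S.F.f x t = (dx S.u).f x t - S.ρ.f x t * S.θ.f x t
    - (1/2) * (S.b.f x t ^ 2 + S.c.f x t ^ 2) := by
  simp only [Flow.F, add_f, sub_f, mul_f, neg_f, cst_f, xx_f, dx_add, dt_add, dx_sub, dt_sub, dx_neg, dt_neg, dx_mul, dt_mul, dx_cst, dt_cst, dx_xx, dt_xx, dt_dx]; ring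

/-- energy density of the second estimate -/
def Flow.e1 (S : Flow p) : SF := cst (1/2) * (S.F * S.F)
  + (cst (1/2) * (dx S.w * dx S.w) + S.b * dx S.w) + (cst (1/2) * (dx S.v * dx S.v) + S.c * dx S.v)
  + cst (1/2) * (dx S.b * dx S.b) + cst (1/2) * (dx S.c * dx S.c)

theorem Flow.e1_id (S : Flow p) : ∀ t ∈ Icc (0:ℝ) p.T, Ix S.e1.f t = Ix S.e1.f 0 + ∫ s in (0:ℝ)..t,
    Ix (fun x t => -(S.ρ.f x t * S.U.f x t ^ 2) - S.ρ.f x t * S.W.f x t ^ 2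
      - S.ρ.f x t * S.V.f x t ^ 2 - S.Bd.f x t ^ 2 - S.Cd.f x t ^ 2
      + 1/2 * (dx S.u).f x t * S.F.f x t ^ 2
      - S.F.f x t * ((dx S.u).f x t ^ 2 + S.Q.f x t - 2 * (S.ρ.f x t * S.θ.f x t) * (dx S.u).f x t
        + S.b.f x t * S.Bd.f x t + S.c.f x t * S.Cd.f x t)
      + S.ρ.f x t * S.U.f x t * S.k x t
      - 1/2 * (dx S.u).f x t * ((dx S.w).f x t ^ 2 + (dx S.v).f x t ^ 2 + (dx S.b).f x t ^ 2
        + (dx S.c).f x t ^ 2)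
      + (2 * (dx S.w).f x t - (dx S.u).f x t * S.b.f x t) * S.Bd.f x t
      + (2 * (dx S.v).f x t - (dx S.u).f x t * S.c.f x t) * S.Cd.f x t) s := by
  intro t ht
  set φ : SF := cst (1/2) * (S.u * (S.F * S.F)) - S.F * S.U
    + (cst (1/2) * (S.u * (dx S.w * dx S.w)) + S.u * S.b * dx S.w - (dx S.w + S.b) * S.W)
    + (cst (1/2) * (S.u * (dx S.v * dx S.v)) + S.u * S.c * dx S.v - (dx S.v + S.c) * S.V)
    + (cst (1/2) * (S.u * (dx S.b * dx S.b)) - dx S.b * S.Bd)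
    + (cst (1/2) * (S.u * (dx S.c * dx S.c)) - dx S.c * S.Cd) with hφ
  set r : ℝ → ℝ → ℝ := fun x t => -(S.ρ.f x t * S.U.f x t ^ 2) - S.ρ.f x t * S.W.f x t ^ 2
      - S.ρ.f x t * S.V.f x t ^ 2 - S.Bd.f x t ^ 2 - S.Cd.f x t ^ 2
      + 1/2 * (dx S.u).f x t * S.F.f x t ^ 2
      - S.F.f x t * ((dx S.u).f x t ^ 2 + S.Q.f x t - 2 * (S.ρ.f x t * S.θ.f x t) * (dx S.u).f x t
        + S.b.f x t * S.Bd.f x t + S.c.f x t * S.Cd.f x t)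
      - 1/2 * (dx S.u).f x t * ((dx S.w).f x t ^ 2 + (dx S.v).f x t ^ 2 + (dx S.b).f x t ^ 2
        + (dx S.c).f x t ^ 2)
      + (2 * (dx S.w).f x t - (dx S.u).f x t * S.b.f x t) * S.Bd.f x t
      + (2 * (dx S.v).f x t - (dx S.u).f x t * S.c.f x t) * S.Cd.f x t with hr
  have h := masterI (T := p.T) S.e1 φ (fun x t => r x t - S.F.f x t * S.kx.f x t)
    (fun x hx t ht => by
      have m1 := S.mass x hx t ht
      have m2 := S.mom x hx t ht
      have m3 := S.eqw x hx t ht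
      have m4 := S.eqv x hx t ht
      have m5 := S.eqb x hx t ht
      have m6 := S.eqc x hx t ht
      simp only [hr, hφ, Flow.e1, Flow.F, Flow.U, Flow.W, Flow.V, Flow.Bd, Flow.Cd, Flow.kx, Flow.Q, add_f, sub_f, mul_f, neg_f, cst_f, xx_f, dx_add, dt_add, dx_sub, dt_sub, dx_neg, dt_neg, dx_mul, dt_mul, dx_cst, dt_cst, dx_xx, dt_xx, dt_dx]
      linear_combination (-(dx S.u).f x t + S.ρ.f x t * S.θ.f x t + (1/2) * (S.b.f x t ^ 2 + S.c.f x t ^ 2))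
          * S.θ.f x t * m1
        + ((dt S.u).f x t + S.u.f x t * (dx S.u).f x t) * m2
        + ((dt S.w).f x t + S.u.f x t * (dx S.w).f x t) * m3
        + ((dt S.v).f x t + S.u.f x t * (dx S.v).f x t) * m4
        + ((dt S.b).f x t + S.u.f x t * (dx S.b).f x t) * m5
        + ((dt S.c).f x t + S.u.f x t * (dx S.c).f x t) * m6)
    (fun t ht => by
      simp only [hφ, add_f, sub_f, mul_f, cst_f]
      simp [S.u0 t ht, S.U0 ht, S.W0 ht, S.V0 ht, S.Bd0 ht, S.Cd0 ht])
    (fun t ht => by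
      simp only [hφ, add_f, sub_f, mul_f, cst_f]
      simp [S.u1 t ht, S.U1 ht, S.W1 ht, S.V1 ht, S.Bd1 ht, S.Cd1 ht])
    (by fun_prop) t ht
  rw [h]
  congr 1
  apply intervalIntegral.integral_congr
  intro s hs
  rw [uIcc_of_le ht.1] at hs
  have hs' : s ∈ Icc (0:ℝ) p.T := ⟨hs.1, hs.2.trans ht.2⟩
  have h1 := S.ibpk hs' (g := S.F.f) (g' := (dx S.F).f) (fun x hx => S.F.hx x s)
  have h2 : Ix (fun x t => r x t - S.F.f x t * S.kx.f x t) s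
    = Ix r s - Ix (fun x t => S.F.f x t * S.kx.f x t) s := Ix_sub
  have h3 : Ix (fun x t => r x t + (dx S.F).f x t * S.k x t) s
    = Ix r s + Ix (fun x t => (dx S.F).f x t * S.k x t) s := Ix_add
  have h4 : Ix (fun x t => r x t - S.F.f x t * S.kx.f x t) s
     = Ix (fun x t => r x t + (dx S.F).f x t * S.k x t) s := by rw [h2, h3, h1]; ring
  refine h4.trans ?_
  refine Ix_congr fun x hx => ?_
  rw [S.Fx x hx s hs', hr]
  ring

theorem am {x y a i ε : ℝ} (ha : 0 < a) (hi : i * a = 1) (hε : 0 < ε) :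
    x * y ≤ ε * i * x ^ 2 + a / (4 * ε) * y ^ 2 := by
  have h : ε * i * x ^ 2 + a / (4 * ε) * y ^ 2 - x * y
      = (2 * ε * i * x - y) ^ 2 * (a / (4 * ε)) := by
    field_simp
    have : i = 1 / a := by field_simp; exact hi
    subst this
    field_simp
    ring
  have h2 : 0 ≤ (2 * ε * i * x - y) ^ 2 * (a / (4 * ε)) := by positivity
  linarith

end MHD

namespace MHD

variable {p : Par}

set_option maxHeartbeats 2000000 in
theorem d1_pt {ρ U W V β γ ux wx vx bx cx F P b c k K s s2 a i B Q : ℝ}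
    (hρ : 0 ≤ ρ) (hρB : ρ ≤ B) (hB : 1 ≤ B) (hF : F = ux - P - (1/2) * (b ^ 2 + c ^ 2))
    (hP : 0 ≤ P) (hs : |F| ≤ s) (hK : 0 ≤ K) (hK2 : K ≤ s2) (ha : 1 ≤ a) (hi : i * a = 1)
    (hb : b ^ 2 + c ^ 2 ≤ a) (hQ : Q = ux ^ 2 + wx ^ 2 + vx ^ 2 + bx ^ 2 + cx ^ 2) :
    (-(ρ * U ^ 2) - ρ * W ^ 2 - ρ * V ^ 2 - β ^ 2 - γ ^ 2 + 1/2 * ux * F ^ 2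
      - F * (ux ^ 2 + Q - 2 * P * ux + b * β + c * γ) + ρ * U * k
      - 1/2 * ux * (wx ^ 2 + vx ^ 2 + bx ^ 2 + cx ^ 2)
      + (2 * wx - ux * b) * β + (2 * vx - ux * c) * γ) + 4 * B * (K * (Q - P * ux) - k ^ 2)
    ≤ -(3/4) * (ρ * U ^ 2) - ρ * W ^ 2 - ρ * V ^ 2 - (3/8) * (β ^ 2 + γ ^ 2) - 3 * B * k ^ 2
      + i * (s ^ 2 / (8 * B) + B * s2 ^ 2) * Q
      + a * (4 * B * F ^ 2 + 32 * B * P ^ 2 + 67 * B * Q) := by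
  have ha0 : 0 < a := by linarith
  have hB0 : 0 < B := by linarith
  have hs0 : 0 ≤ s := (abs_nonneg _).trans hs
  have hs20 : 0 ≤ s2 := hK.trans hK2
  have hi0 : 0 < i := by
    have : i = 1 / a := by field_simp; exact hi
    rw [this]; positivity
  have hux : ux ^ 2 ≤ Q := by rw [hQ]; linarith [sq_nonneg wx, sq_nonneg vx, sq_nonneg bx, sq_nonneg cx]
  have hQ0 : 0 ≤ Q := (sq_nonneg _).trans hux
  have hw : wx ^ 2 + vx ^ 2 + bx ^ 2 + cx ^ 2 ≤ Q := by rw [hQ]; linarith [sq_nonneg ux]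
  have hw0 : 0 ≤ wx ^ 2 + vx ^ 2 + bx ^ 2 + cx ^ 2 := by positivity
  have e6 : a / (4 * (1 / (24 * B))) = 6 * B * a := by field_simp; ring
  have e2 : a / (4 * (1 / 8)) = 2 * a := by ring
  have c0 : 0 ≤ i * s ^ 2 := by positivity
  have c1 : 0 ≤ i * s2 ^ 2 := by positivity
  -- term 1
  have t1 : 1/2 * ux * F ^ 2 ≤ 1 / (24 * B) * i * s ^ 2 * ux ^ 2 + 6 * B * a * (F ^ 2 / 4) := by
    have h1 : 1/2 * ux * F ^ 2 ≤ (s * |ux|) * (|F| / 2) := by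
      have : ux * F ^ 2 ≤ |ux| * |F| * |F| := by
        have : |ux| * |F| * |F| = |ux * F ^ 2| := by rw [abs_mul, abs_pow]; ring
        rw [this]; exact le_abs_self _
      have h2 : |ux| * |F| * |F| ≤ |ux| * |F| * s := mul_le_mul_of_nonneg_left hs (by positivity)
      linarith
    have h2 := am (x := s * |ux|) (y := |F| / 2) ha0 hi (by positivity : 0 < 1 / (24 * B))
    rw [e6, mul_pow, sq_abs, div_pow, sq_abs] at h2
    linarith
  have t2 : 2 * F * P * ux ≤ 1 / (24 * B) * i * s ^ 2 * ux ^ 2 + 6 * B * a * (4 * P ^ 2) := by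
    have h1 : 2 * F * P * ux ≤ (s * |ux|) * (2 * P) := by
      have : F * ux ≤ |F| * |ux| := by rw [← abs_mul]; exact le_abs_self _
      have h2 : |F| * |ux| ≤ s * |ux| := mul_le_mul_of_nonneg_right hs (abs_nonneg _)
      have h3 := mul_le_mul_of_nonneg_right (this.trans h2) hP
      linarith
    have h2 := am (x := s * |ux|) (y := 2 * P) ha0 hi (by positivity : 0 < 1 / (24 * B))
    rw [e6, mul_pow, sq_abs, mul_pow] at h2
    linarith
  have t3 : -F * (ux ^ 2 + Q) - 1/2 * ux * (wx ^ 2 + vx ^ 2 + bx ^ 2 + cx ^ 2)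
      ≤ 1 / (24 * B) * i * s ^ 2 * Q + 6 * B * a * 9 * Q := by
    have f1 : -F ≤ s := (neg_le_abs F).trans hs
    have f2 : -ux ≤ s := by linarith [sq_nonneg b, sq_nonneg c]
    have h1 : -F * (ux ^ 2 + Q) ≤ s * (2 * Q) :=
      (mul_le_mul_of_nonneg_right f1 (by positivity)).trans
        (mul_le_mul_of_nonneg_left (by linarith) hs0)
    have h2 : -ux * (wx ^ 2 + vx ^ 2 + bx ^ 2 + cx ^ 2) ≤ s * Q :=
      (mul_le_mul_of_nonneg_right f2 hw0).trans (mul_le_mul_of_nonneg_left hw hs0)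
    have h3 := am (x := s) (y := 3) ha0 hi (by positivity : 0 < 1 / (24 * B))
    rw [e6] at h3
    have h4 := mul_le_mul_of_nonneg_right h3 hQ0
    have h5 := mul_nonneg hs0 hQ0
    linarith
  have t4 : ρ * U * k ≤ 1/4 * (ρ * U ^ 2) + B * k ^ 2 := by
    have h1 : U * k ≤ 1/4 * U ^ 2 + k ^ 2 := by linarith [sq_nonneg (U - 2 * k)]
    have h2 := mul_le_mul_of_nonneg_left h1 hρ
    have h3 := mul_le_mul_of_nonneg_right hρB (sq_nonneg k)
    linarith
  have t5 : K * (Q - P * ux) ≤ 1/8 * i * s2 ^ 2 * Q + 2 * a * Q + 1/8 * i * s2 ^ 2 * ux ^ 2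
      + 2 * a * P ^ 2 := by
    have h1 : K * Q ≤ s2 * Q := mul_le_mul_of_nonneg_right hK2 hQ0
    have h2 := am (x := s2) (y := 1) ha0 hi (by norm_num : (0:ℝ) < 1/8)
    have h3 := am (x := s2 * |ux|) (y := P) ha0 hi (by norm_num : (0:ℝ) < 1/8)
    rw [e2, mul_pow, sq_abs] at h3
    rw [e2] at h2
    have h4 := mul_le_mul_of_nonneg_right h2 hQ0
    have h5 : -(K * (P * ux)) ≤ s2 * |ux| * P := by
      have : -(K * (P * ux)) = K * P * (-ux) := by ring
      rw [this]
      calc K * P * (-ux) ≤ K * P * |ux| := mul_le_mul_of_nonneg_left (neg_le_abs _) (by positivity)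
        _ = K * (P * |ux|) := by ring
        _ ≤ s2 * (P * |ux|) := mul_le_mul_of_nonneg_right hK2 (by positivity)
        _ = _ := by ring
    linarith
  have t5' := mul_le_mul_of_nonneg_left t5 (by positivity : 0 ≤ 4 * B)
  have t6 : -F * (b * β + c * γ) ≤ 1/8 * (β ^ 2 + γ ^ 2) + 2 * a * F ^ 2 := by
    have h1 := mul_le_mul_of_nonneg_right hb (sq_nonneg F)
    linarith [sq_nonneg (β + 4 * F * b), sq_nonneg (γ + 4 * F * c)]
  have t7 : (2 * wx - ux * b) * β + (2 * vx - ux * c) * γ ≤ 1/2 * (β ^ 2 + γ ^ 2) + 5 * a * Q := by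
    have h1 := mul_le_mul_of_nonneg_right hb (sq_nonneg ux)
    have h2 : wx ^ 2 + vx ^ 2 ≤ Q := by rw [hQ]; linarith [sq_nonneg ux, sq_nonneg bx, sq_nonneg cx]
    have h3 : 1 * (4 * (wx ^ 2 + vx ^ 2)) ≤ a * (4 * Q) := mul_le_mul ha (by linarith) (by positivity) ha0.le
    have h4 := mul_le_mul_of_nonneg_left hux ha0.le
    linarith [sq_nonneg (β - 4 * wx), sq_nonneg (γ - 4 * vx), sq_nonneg (β + 2 * ux * b),
      sq_nonneg (γ + 2 * ux * c)]
  have x1 : i * s ^ 2 * ux ^ 2 ≤ i * s ^ 2 * Q := mul_le_mul_of_nonneg_left hux c0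
  have x2 : i * s2 ^ 2 * ux ^ 2 ≤ i * s2 ^ 2 * Q := mul_le_mul_of_nonneg_left hux c1
  have x1' := mul_le_mul_of_nonneg_left x1 (by positivity : 0 ≤ 1 / (24 * B))
  have x2' := mul_le_mul_of_nonneg_left x2 (by positivity : 0 ≤ B)
  have y1 : i * (s ^ 2 / (8 * B) + B * s2 ^ 2) * Q = 3 * (1 / (24 * B) * (i * s ^ 2 * Q))
      + B * (i * s2 ^ 2 * Q) := by field_simp; ring
  have y2 : 0 ≤ a * F ^ 2 * (B - 1) := mul_nonneg (by positivity) (by linarith)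
  have y3 : 0 ≤ a * Q * (B - 1) := mul_nonneg (by positivity) (by linarith)
  have y4 : 0 ≤ a * F ^ 2 * B := by positivity
  rw [y1]
  linarith

theorem Flow.bsup (S : Flow p) {x t : ℝ} (hx : x ∈ Icc (0:ℝ) 1) (ht : t ∈ Icc (0:ℝ) p.T) :
    S.b.f x t ^ 2 + S.c.f x t ^ 2 ≤ Ix (fun x t => (dx S.b).f x t ^ 2) t
      + Ix (fun x t => (dx S.c).f x t ^ 2) t :=
  add_le_add
    (sob0 (g := fun x => S.b.f x t) (g' := fun x => (dx S.b).f x t) (fun z _ => S.b.hx z t)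
      (by fun_prop) (S.b0 t ht) hx)
    (sob0 (g := fun x => S.c.f x t) (g' := fun x => (dx S.c).f x t) (fun z _ => S.c.hx z t)
      (by fun_prop) (S.c0 t ht) hx)

theorem Flow.IQ (S : Flow p) (t : ℝ) : Ix S.Q.f t = Ix (fun x t => (dx S.u).f x t ^ 2) t
    + Ix (fun x t => (dx S.w).f x t ^ 2) t + Ix (fun x t => (dx S.v).f x t ^ 2) t
    + Ix (fun x t => (dx S.b).f x t ^ 2) t + Ix (fun x t => (dx S.c).f x t ^ 2) t := by
  rw [← Ix_add, ← Ix_add, ← Ix_add, ← Ix_add]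
  exact Ix_congr fun x _ => by simp only [Flow.Q, add_f, sub_f, mul_f, neg_f, cst_f, xx_f, dx_add, dt_add, dx_sub, dt_sub, dx_neg, dt_neg, dx_mul, dt_mul, dx_cst, dt_cst, dx_xx, dt_xx, dt_dx]; ring

theorem Ix_sq_nonneg (f : SF) (t : ℝ) : 0 ≤ Ix (fun x t => f.f x t ^ 2) t :=
  Ix_nonneg fun x _ => sq_nonneg _

theorem Flow.ρsq_nonneg (S : Flow p) (f : SF) {t : ℝ} (ht : t ∈ Icc (0:ℝ) p.T) :
    0 ≤ Ix (fun x t => S.ρ.f x t * f.f x t ^ 2) t :=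
  Ix_nonneg fun x hx => mul_nonneg (S.ρp x hx t ht).le (sq_nonneg _)

theorem Flow.ksq_nonneg (S : Flow p) (t : ℝ) : 0 ≤ Ix (fun x t => S.k x t ^ 2) t :=
  Ix_nonneg fun x _ => sq_nonneg _

/-- second energy -/
def Flow.Y (S : Flow p) (B t : ℝ) : ℝ :=
  Ix S.e1.f t + 4 * B * Ix (fun x t => S.ρ.f x t * p.Φ (S.θ.f x t)) t

theorem d1_low (p : Par) {B E : ℝ} (hB : 1 ≤ B) (hE : 0 < E)
    (hA : ∀ S : Flow p, ∀ t ∈ Icc (0:ℝ) p.T, Ix (fun x t => S.b.f x t ^ 2 + S.c.f x t ^ 2) t ≤ E)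
    (S : Flow p) (t : ℝ) (ht : t ∈ Icc (0:ℝ) p.T) :
    Ix (fun x t => S.F.f x t ^ 2) t + (Ix (fun x t => (dx S.w).f x t ^ 2) t
      + Ix (fun x t => (dx S.v).f x t ^ 2) t) + (Ix (fun x t => (dx S.b).f x t ^ 2) t
      + Ix (fun x t => (dx S.c).f x t ^ 2) t) + Ix (fun x t => S.ρ.f x t * S.θ.f x t ^ 2) t
      ≤ 4 * p.C₀ * (S.Y B t + E) := by
  have hC := p.hC₀
  have h1 := Ix_le7 (t := t) (f := fun x t => S.F.f x t ^ 2) (g₁ := S.e1.f)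
    (g₂ := fun x t => (dx S.w).f x t ^ 2) (g₃ := fun x t => (dx S.v).f x t ^ 2)
    (g₄ := fun x t => (dx S.b).f x t ^ 2) (g₅ := fun x t => (dx S.c).f x t ^ 2)
    (g₆ := fun x t => S.b.f x t ^ 2 + S.c.f x t ^ 2) (g₇ := fun x t => 0)
    2 (-1/2) (-1/2) (-1) (-1) 2 0 (fun x hx => by
      simp only [Flow.e1, add_f, mul_f, cst_f]
      nlinarith [sq_nonneg ((dx S.w).f x t + 2 * S.b.f x t), sq_nonneg ((dx S.v).f x t + 2 * S.c.f x t)])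
  have h2 := Ix_le1 (t := t) (f := fun x t => S.ρ.f x t * S.θ.f x t ^ 2)
    (g₁ := fun x t => S.ρ.f x t * p.Φ (S.θ.f x t)) (2 * p.C₀) (fun x hx => by
      have r := S.ρp x hx t ht
      have r1 := p.Φ_ge (S.θp x hx t ht).le
      have r2 := mul_le_mul_of_nonneg_left r1 (by positivity : 0 ≤ 2 * p.C₀)
      have r3 : 2 * p.C₀ * (p.C₀⁻¹ * (S.θ.f x t ^ 2 / 2)) = S.θ.f x t ^ 2 := by field_simp
      rw [r3] at r2
      have r4 := mul_le_mul_of_nonneg_left r2 r.le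
      linarith)
  have h3 := hA S t ht
  have a1 := Ix_sq_nonneg S.F t
  have a2 := Ix_sq_nonneg (dx S.w) t
  have a3 := Ix_sq_nonneg (dx S.v) t
  have a4 := Ix_sq_nonneg (dx S.b) t
  have a5 := Ix_sq_nonneg (dx S.c) t
  have a6 : 0 ≤ Ix (fun x t => S.ρ.f x t * p.Φ (S.θ.f x t)) t := Ix_nonneg fun x hx =>
    mul_nonneg (S.ρp x hx t ht).le (int_nonneg (S.θp x hx t ht).le fun r hr => p.K_nonneg hr.1)
  have a7 := S.ρsq_nonneg S.θ ht
  simp only [zero_mul, add_zero] at h1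
  have h4 : Ix (fun x t => S.F.f x t ^ 2) t + (Ix (fun x t => (dx S.w).f x t ^ 2) t
      + Ix (fun x t => (dx S.v).f x t ^ 2) t) + (Ix (fun x t => (dx S.b).f x t ^ 2) t
      + Ix (fun x t => (dx S.c).f x t ^ 2) t) ≤ 4 * (Ix S.e1.f t + E) := by linarith
  have h5 : 0 ≤ (p.C₀ - 1) * (Ix S.e1.f t + E) := mul_nonneg (by linarith) (by linarith)
  have h6 : 0 ≤ (B - 1) * (p.C₀ * Ix (fun x t => S.ρ.f x t * p.Φ (S.θ.f x t)) t) :=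
    mul_nonneg (by linarith) (by positivity)
  have h7 : 0 ≤ p.C₀ * Ix (fun x t => S.ρ.f x t * p.Φ (S.θ.f x t)) t := by positivity
  unfold Flow.Y
  linarith

theorem d1_q (p : Par) {B E : ℝ} (hB : 1 ≤ B) (hE : 0 < E)
    (hρ : ∀ S : Flow p, ∀ x ∈ Icc (0:ℝ) 1, ∀ t ∈ Icc (0:ℝ) p.T, S.ρ.f x t ≤ B)
    (hA : ∀ S : Flow p, ∀ t ∈ Icc (0:ℝ) p.T, Ix (fun x t => S.b.f x t ^ 2 + S.c.f x t ^ 2) t ≤ E)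
    (S : Flow p) (t : ℝ) (ht : t ∈ Icc (0:ℝ) p.T) :
    Ix S.Q.f t ≤ 3 * Ix (fun x t => S.F.f x t ^ 2) t + (Ix (fun x t => (dx S.w).f x t ^ 2) t
      + Ix (fun x t => (dx S.v).f x t ^ 2) t) + (1 + E) * (Ix (fun x t => (dx S.b).f x t ^ 2) t
      + Ix (fun x t => (dx S.c).f x t ^ 2) t) + 3 * B * Ix (fun x t => S.ρ.f x t * S.θ.f x t ^ 2) t := by
  rw [S.IQ]
  set b' := Ix (fun x t => (dx S.b).f x t ^ 2) t + Ix (fun x t => (dx S.c).f x t ^ 2) t with hb'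
  have hb0 : 0 ≤ b' := add_nonneg (Ix_sq_nonneg _ _) (Ix_sq_nonneg _ _)
  have h1 := Ix_le3 (t := t) (f := fun x t => (dx S.u).f x t ^ 2) (g₁ := fun x t => S.F.f x t ^ 2)
    (g₂ := fun x t => S.ρ.f x t * S.θ.f x t ^ 2) (g₃ := fun x t => S.b.f x t ^ 2 + S.c.f x t ^ 2)
    3 (3 * B) (b') (fun x hx => by
      have r := S.ρp x hx t ht
      have r1 := S.θp x hx t ht
      have r2 := hρ S x hx t ht
      have r3 := S.bsup hx ht
      rw [← hb'] at r3
      have r4 := mul_le_mul_of_nonneg_right r3 (by positivity : 0 ≤ S.b.f x t ^ 2 + S.c.f x t ^ 2)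
      have r5 := mul_le_mul_of_nonneg_right r2 (by positivity : 0 ≤ S.ρ.f x t * S.θ.f x t ^ 2)
      have r6 := S.F_eq x t
      have r7 : (dx S.u).f x t = S.F.f x t + S.ρ.f x t * S.θ.f x t
        + (1/2) * (S.b.f x t ^ 2 + S.c.f x t ^ 2) := by linarith
      rw [r7]
      set f := S.F.f x t
      set P := S.ρ.f x t * S.θ.f x t with hP
      set g := S.b.f x t ^ 2 + S.c.f x t ^ 2
      have r8 : S.ρ.f x t * (S.ρ.f x t * S.θ.f x t ^ 2) = P ^ 2 := by rw [hP]; ring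
      rw [r8] at r5
      nlinarith [sq_nonneg (f - P), sq_nonneg (f - g/2), sq_nonneg (P - g/2), sq_nonneg g])
  have h2 := mul_le_mul_of_nonneg_left (hA S t ht) hb0
  linarith

end MHD

namespace MHD

variable {p : Par}

theorem Flow.Fsup (S : Flow p) {B : ℝ} 
    (hρ : ∀ x ∈ Icc (0:ℝ) 1, ∀ t ∈ Icc (0:ℝ) p.T, S.ρ.f x t ≤ B)
    {x t : ℝ} (hx : x ∈ Icc (0:ℝ) 1) (ht : t ∈ Icc (0:ℝ) p.T) :
    S.F.f x t ^ 2 ≤ 2 * Ix (fun x t => S.F.f x t ^ 2) t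
      + 2 * (B * Ix (fun x t => S.ρ.f x t * S.U.f x t ^ 2) t) := by
  have h1 := sob (g := fun x => S.F.f x t) (g' := fun x => (dx S.F).f x t) (fun z _ => S.F.hx z t)
    (by fun_prop) (by fun_prop) hx
  have h2 := Ix_le1 (t := t) (f := fun x t => (dx S.F).f x t ^ 2)
    (g₁ := fun x t => S.ρ.f x t * S.U.f x t ^ 2) B (fun y hy => by
      simp only [S.Fx y hy t ht]
      have r := S.ρp y hy t ht
      have := mul_le_mul_of_nonneg_right (hρ y hy t ht) (by positivity : 0 ≤ S.ρ.f y t * S.U.f y t ^ 2)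
      linarith)
  have h3 : Ix (fun x t => S.F.f x t ^ 2) t = ∫ z in (0:ℝ)..1, S.F.f z t ^ 2 := rfl
  have h4 : Ix (fun x t => (dx S.F).f x t ^ 2) t = ∫ z in (0:ℝ)..1, (dx S.F).f z t ^ 2 := rfl
  rw [← h3, ← h4] at h1
  linarith

theorem Flow.e1_cont (S : Flow p) : Continuous S.e1.f.uncurry := by
  have : S.e1.f.uncurry = fun q : ℝ × ℝ => S.e1.f q.1 q.2 := rfl
  rw [this]; fun_prop

theorem Flow.Y_cont (S : Flow p) (B : ℝ) : Continuous (S.Y B) := by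
  unfold Flow.Y; fun_prop

theorem d1_init (p : Par) : ∃ C, 0 < C ∧ ∀ B, 1 ≤ B → ∀ S : Flow p, S.Y B 0 ≤ B * C := by
  have hN := p.hN
  have hΦ : 0 ≤ p.Φ p.N := int_nonneg (by linarith) fun r hr => p.K_nonneg hr.1
  refine ⟨(1/2 * (3 * (p.N^2 + (p.N * p.N)^2 + p.N^4)) + 4 * p.N^2) + 4 * (p.N * p.Φ p.N), by positivity, fun B hB S => ?_⟩
  have h1 : Ix S.e1.f 0 ≤ 1/2 * (3 * (p.N^2 + (p.N * p.N)^2 + p.N^4)) + 4 * p.N^2 :=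
    Ix_le_const _ fun x hx => by
    have r := S.ρp x hx 0 p.h0
    have r0 := S.θp x hx 0 p.h0
    have r1 := (le_abs_self _).trans (S.iρ x hx).1
    have r2 := (le_abs_self _).trans (S.iθ x hx).1
    have r3 := sqbd (S.iu x hx).2
    have r4 := sqbd (S.iw x hx).2
    have r5 := sqbd (S.iv x hx).2
    have r6 := sqbd (S.ib x hx).1
    have r7 := sqbd (S.ic x hx).1
    have r8 := sqbd (S.ib x hx).2
    have r9 := sqbd (S.ic x hx).2
    have a1 : (S.ρ.f x 0 * S.θ.f x 0) ^ 2 ≤ (p.N * p.N) ^ 2 := pow_le_pow_left₀ (by positivity) 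
      (mul_le_mul r1 r2 r0.le (by linarith)) 2
    have a2 : ((1/2) * (S.b.f x 0 ^ 2 + S.c.f x 0 ^ 2)) ^ 2 ≤ (p.N ^ 2) ^ 2 :=
      pow_le_pow_left₀ (by positivity) (by linarith) 2
    have a3 : S.F.f x 0 ^ 2 ≤ 3 * (p.N^2 + (p.N * p.N)^2 + p.N^4) := by
      rw [S.F_eq]
      set P := S.ρ.f x 0 * S.θ.f x 0
      set g := (1/2) * (S.b.f x 0 ^ 2 + S.c.f x 0 ^ 2)
      have : (p.N ^ 2) ^ 2 = p.N ^ 4 := by ring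
      nlinarith [sq_nonneg ((dx S.u).f x 0 + P), sq_nonneg ((dx S.u).f x 0 + g), sq_nonneg (P - g)]
    simp only [Flow.e1, add_f, mul_f, cst_f]
    nlinarith [sq_nonneg (S.b.f x 0 - (dx S.w).f x 0), sq_nonneg (S.c.f x 0 - (dx S.v).f x 0)]
  have h2 : Ix (fun x t => S.ρ.f x t * p.Φ (S.θ.f x t)) 0 ≤ p.N * p.Φ p.N :=
    Ix_le_const _ fun x hx => by
    have r := S.ρp x hx 0 p.h0
    have r0 := S.θp x hx 0 p.h0
    have r1 := (le_abs_self _).trans (S.iρ x hx).1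
    have r2 := (le_abs_self _).trans (S.iθ x hx).1
    exact mul_le_mul r1 (p.Φ_mono r0.le r2) (int_nonneg r0.le fun r hr => p.K_nonneg hr.1) (by linarith)
  unfold Flow.Y
  have h3 := mul_le_mul_of_nonneg_left h2 (by positivity : 0 ≤ 4 * B)
  have h4 : 0 ≤ 1/2 * (3 * (p.N^2 + (p.N * p.N)^2 + p.N^4)) + 4 * p.N^2 := by positivity
  have h5 := mul_le_mul_of_nonneg_right hB h4
  linarith

set_option maxHeartbeats 1000000 in
/-- differential inequality for the second energy, right-hand side -/
theorem d1_rate (p : Par) : ∃ B E C, 1 ≤ B ∧ 0 < E ∧ 1 ≤ C ∧ ∀ S : Flow p, 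
    (∀ x ∈ Icc (0:ℝ) 1, ∀ t ∈ Icc (0:ℝ) p.T, S.ρ.f x t ≤ B) ∧
    (∀ t ∈ Icc (0:ℝ) p.T, 0 ≤ S.Y B t + E) ∧
    (∀ t ∈ Icc (0:ℝ) p.T, Ix (fun x t => S.F.f x t ^ 2) t ≤ C * (S.Y B t + E + 1)) ∧
    (∀ t ∈ Icc (0:ℝ) p.T, Ix S.Q.f t ≤ C * (S.Y B t + E + 1)) ∧
    (∀ t ∈ Icc (0:ℝ) p.T, Ix (fun x t => S.ρ.f x t * S.θ.f x t ^ 2) t ≤ C * (S.Y B t + E + 1)) ∧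
    (∀ t ∈ Icc (0:ℝ) p.T, S.Y B t + ∫ s in (0:ℝ)..t, (1/4) * (
      Ix (fun x t => S.ρ.f x t * S.U.f x t ^ 2) s + Ix (fun x t => S.ρ.f x t * S.W.f x t ^ 2) s
      + Ix (fun x t => S.ρ.f x t * S.V.f x t ^ 2) s + Ix (fun x t => S.Bd.f x t ^ 2) s
      + Ix (fun x t => S.Cd.f x t ^ 2) s + Ix (fun x t => S.k x t ^ 2) s)
      ≤ S.Y B 0 + ∫ s in (0:ℝ)..t, C * (1 + Ix S.Q.f s) * (S.Y B s + E + 1)) := by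
  obtain ⟨E, hE, hA⟩ := stepA p
  obtain ⟨B, hB, hρ⟩ := stepB p
  obtain ⟨Ck, hCk, hK⟩ := Kbd p
  have hC := p.hC₀
  have hA3 : ∀ S : Flow p, ∀ t ∈ Icc (0:ℝ) p.T, Ix (fun x t => S.b.f x t ^ 2 + S.c.f x t ^ 2) t ≤ E :=
    fun S t ht => (hA S t ht).2.2
  set Λ : ℝ := 5 * B + 32 * B ^ 2 + 67 * B * (4 + E + 3 * B) with hΛ
  have hΛ0 : 0 ≤ Λ := by positivity
  refine ⟨B, E, B * Ck + Λ * (4 * p.C₀), hB, hE, by nlinarith [mul_nonneg hΛ0 (by positivity : 0 ≤ 4 * p.C₀)],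
    fun S => ?_⟩
  have low : ∀ t ∈ Icc (0:ℝ) p.T, _ := d1_low p hB hE hA3 S
  have hq : ∀ t ∈ Icc (0:ℝ) p.T, _ := d1_q p hB hE hρ hA3 S
  have Y0 : ∀ t ∈ Icc (0:ℝ) p.T, 0 ≤ S.Y B t + E := fun t ht => by
    have h := low t ht
    have a1 := Ix_sq_nonneg S.F t
    have a2 := Ix_sq_nonneg (dx S.w) t
    have a3 := Ix_sq_nonneg (dx S.v) t
    have a4 := Ix_sq_nonneg (dx S.b) t
    have a5 := Ix_sq_nonneg (dx S.c) t
    have a7 := S.ρsq_nonneg S.θ ht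
    have : 0 ≤ 4 * p.C₀ * (S.Y B t + E) := by linarith
    exact nonneg_of_mul_nonneg_right this (by positivity)
  have hQY : ∀ t ∈ Icc (0:ℝ) p.T, Ix S.Q.f t ≤ (4 + E + 3 * B) * (4 * p.C₀ * (S.Y B t + E)) := fun t ht => by
    have h := low t ht
    have h' := hq t ht
    have a1 := Ix_sq_nonneg S.F t
    have a2 := Ix_sq_nonneg (dx S.w) t
    have a3 := Ix_sq_nonneg (dx S.v) t
    have a4 := Ix_sq_nonneg (dx S.b) t
    have a5 := Ix_sq_nonneg (dx S.c) t
    have a7 := S.ρsq_nonneg S.θ ht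
    set A := Ix (fun x t => S.F.f x t ^ 2) t
    set w' := Ix (fun x t => (dx S.w).f x t ^ 2) t + Ix (fun x t => (dx S.v).f x t ^ 2) t
    set b' := Ix (fun x t => (dx S.b).f x t ^ 2) t + Ix (fun x t => (dx S.c).f x t ^ 2) t
    set θ2 := Ix (fun x t => S.ρ.f x t * S.θ.f x t ^ 2) t
    have h1 := mul_le_mul_of_nonneg_left h (by positivity : 0 ≤ 4 + E + 3 * B)
    have w0 : 0 ≤ w' := add_nonneg a2 a3
    have b0 : 0 ≤ b' := add_nonneg a4 a5
    have x1 := mul_nonneg hE.le a1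
    have x2 := mul_nonneg (by linarith : 0 ≤ B) a1
    have x3 := mul_nonneg hE.le w0
    have x4 := mul_nonneg (by linarith : 0 ≤ B) w0
    have x5 := mul_nonneg (by linarith : 0 ≤ B) b0
    have x6 := mul_nonneg hE.le a7
    linarith
  have cE : ∀ t ∈ Icc (0:ℝ) p.T, ∀ x, x ≤ 4 * p.C₀ * (S.Y B t + E) * Λ →
      x ≤ (B * Ck + Λ * (4 * p.C₀)) * (S.Y B t + E + 1) := fun t ht x hx => by
    have := Y0 t ht
    have y1 : 0 ≤ B * Ck * (S.Y B t + E + 1) := by positivity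
    have y2 : 0 ≤ Λ * (4 * p.C₀) := by positivity
    linarith
  have Λ1 : 1 ≤ Λ := by rw [hΛ]; nlinarith
  have Λ2 : 4 + E + 3 * B ≤ Λ := by
    rw [hΛ]
    have : 0 ≤ (B - 1) * (4 + E + 3 * B) := mul_nonneg (by linarith) (by linarith)
    nlinarith
  refine ⟨hρ S, Y0, fun t ht => cE t ht _ ?_, fun t ht => cE t ht _ ?_, fun t ht => cE t ht _ ?_, fun t ht => ?_⟩
  · have h := low t ht
    have a2 := Ix_sq_nonneg (dx S.w) t
    have a3 := Ix_sq_nonneg (dx S.v) t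
    have a4 := Ix_sq_nonneg (dx S.b) t
    have a5 := Ix_sq_nonneg (dx S.c) t
    have a7 := S.ρsq_nonneg S.θ ht
    have a8 : 0 ≤ 4 * p.C₀ * (S.Y B t + E) := by have := Y0 t ht; positivity
    have := mul_le_mul_of_nonneg_left Λ1 a8
    linarith
  · have a8 : 0 ≤ 4 * p.C₀ * (S.Y B t + E) := by have := Y0 t ht; positivity
    have := mul_le_mul_of_nonneg_left Λ2 a8
    have := hQY t ht
    linarith
  · have h := low t ht
    have a1 := Ix_sq_nonneg S.F t
    have a2 := Ix_sq_nonneg (dx S.w) t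
    have a3 := Ix_sq_nonneg (dx S.v) t
    have a4 := Ix_sq_nonneg (dx S.b) t
    have a5 := Ix_sq_nonneg (dx S.c) t
    have a8 : 0 ≤ 4 * p.C₀ * (S.Y B t + E) := by have := Y0 t ht; positivity
    have := mul_le_mul_of_nonneg_left Λ1 a8
    linarith
  have h1 := S.e1_id t ht
  have h2 := S.Φ_id t ht
  have cY := S.Y_cont B
  set r1 : ℝ → ℝ → ℝ := _ with hr1
  change Ix S.e1.f t = Ix S.e1.f 0 + ∫ s in (0:ℝ)..t, Ix r1 s at h1
  have cr1 : Continuous (fun q : ℝ × ℝ => r1 q.1 q.2) := by rw [hr1]; fun_prop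
  have key := int_le2 ht.1 (f := fun s => Ix r1 s + 4 * B * Ix (fun x t => p.K (S.θ.f x t) * (S.Q.f x t
          - S.ρ.f x t * S.θ.f x t * (dx S.u).f x t) - S.k x t ^ 2) s)
      (g₁ := fun s => (1/4) * (
      Ix (fun x t => S.ρ.f x t * S.U.f x t ^ 2) s + Ix (fun x t => S.ρ.f x t * S.W.f x t ^ 2) s
      + Ix (fun x t => S.ρ.f x t * S.V.f x t ^ 2) s + Ix (fun x t => S.Bd.f x t ^ 2) s
      + Ix (fun x t => S.Cd.f x t ^ 2) s + Ix (fun x t => S.k x t ^ 2) s))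
      (g₂ := fun s => (B * Ck + Λ * (4 * p.C₀)) * (1 + Ix S.Q.f s) * (S.Y B s + E + 1)) (-1) 1
      (fun s hs => by
        have hs' : s ∈ Icc (0:ℝ) p.T := ⟨hs.1, hs.2.trans ht.2⟩
        set q := Ix S.Q.f s with hq'
        have q0 : 0 ≤ q := S.IQ_nonneg s
        set m := 2 * Ix (fun x t => S.F.f x t ^ 2) s
          + 2 * (B * Ix (fun x t => S.ρ.f x t * S.U.f x t ^ 2) s) with hm
        set m2 := Ck + 2 * Ix (fun x t => S.k x t ^ 2) s with hm2
        have R0 := S.ρsq_nonneg S.U hs'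
        have A0 := Ix_sq_nonneg S.F s
        have k0 := S.ksq_nonneg s
        have m0 : 0 ≤ m := by positivity
        have m20 : 0 ≤ m2 := by positivity
        have hi : (1 + q)⁻¹ * (1 + q) = 1 := inv_mul_cancel₀ (by linarith)
        have e := Ix_le8 (t := s) (f := fun x t => r1 x t + 4 * B * (p.K (S.θ.f x t) * (S.Q.f x t
          - S.ρ.f x t * S.θ.f x t * (dx S.u).f x t) - S.k x t ^ 2))
          (g₁ := fun x t => S.ρ.f x t * S.U.f x t ^ 2) (g₂ := fun x t => S.ρ.f x t * S.W.f x t ^ 2)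
          (g₃ := fun x t => S.ρ.f x t * S.V.f x t ^ 2) 
          (g₄ := fun x t => S.Bd.f x t ^ 2 + S.Cd.f x t ^ 2) (g₅ := fun x t => S.k x t ^ 2)
          (g₆ := S.Q.f) (g₇ := fun x t => S.F.f x t ^ 2) (g₈ := fun x t => S.ρ.f x t * S.θ.f x t ^ 2)
          (-(3/4)) (-1) (-1) (-(3/8)) (-(3 * B)) ((1 + q)⁻¹ * (m / (8 * B) + B * m2) + (1 + q) * (67 * B))
          ((1 + q) * (4 * B)) ((1 + q) * (32 * B ^ 2)) (fun x hx => by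
            have r := S.ρp x hx s hs'
            have r0 := S.θp x hx s hs'
            have rB := hρ S x hx s hs'
            have hFs : |S.F.f x s| ≤ Real.sqrt m := Real.abs_le_sqrt (S.Fsup (hρ S) hx hs')
            have hKs : p.K (S.θ.f x s) ≤ Real.sqrt m2 :=
              (le_abs_self _).trans (Real.abs_le_sqrt (hK S x hx s hs'))
            have bq : S.b.f x s ^ 2 + S.c.f x s ^ 2 ≤ 1 + q := by
              have := S.bsup hx hs'
              have h5 := S.IQ s
              have a1 := Ix_sq_nonneg (dx S.u) s
              have a2 := Ix_sq_nonneg (dx S.w) s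
              have a3 := Ix_sq_nonneg (dx S.v) s
              linarith
            have := d1_pt (W := S.W.f x s) (V := S.V.f x s) (β := S.Bd.f x s) (γ := S.Cd.f x s)
              (U := S.U.f x s) (k := S.k x s)
              r.le rB hB (S.F_eq x s) (mul_pos r r0).le hFs (p.K_nonneg r0.le) hKs
              (by linarith : 1 ≤ 1 + q) hi bq
              (by simp only [Flow.Q, add_f, sub_f, mul_f, neg_f, cst_f, xx_f, dx_add, dt_add, dx_sub, dt_sub, dx_neg, dt_neg, dx_mul, dt_mul, dx_cst, dt_cst, dx_xx, dt_xx, dt_dx]; ring : S.Q.f x s = (dx S.u).f x s ^ 2 + (dx S.w).f x s ^ 2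
                + (dx S.v).f x s ^ 2 + (dx S.b).f x s ^ 2 + (dx S.c).f x s ^ 2)
            rw [Real.sq_sqrt m0, Real.sq_sqrt m20] at this
            have P2 : (S.ρ.f x s * S.θ.f x s) ^ 2 ≤ B * (S.ρ.f x s * S.θ.f x s ^ 2) := by
              have := mul_le_mul_of_nonneg_right rB (by positivity : 0 ≤ S.ρ.f x s * S.θ.f x s ^ 2)
              linarith
            have P3 := mul_le_mul_of_nonneg_left P2 (by positivity : 0 ≤ (1 + q) * (32 * B))
            simp only [hr1]
            linarith)
        have e0 : Ix (fun x t => r1 x t + 4 * B * (p.K (S.θ.f x t) * (S.Q.f x t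
          - S.ρ.f x t * S.θ.f x t * (dx S.u).f x t) - S.k x t ^ 2)) s = 
          Ix r1 s + 4 * B * Ix (fun x t => p.K (S.θ.f x t) * (S.Q.f x t
          - S.ρ.f x t * S.θ.f x t * (dx S.u).f x t) - S.k x t ^ 2) s := by
          rw [← Ix_mul, ← Ix_add]
        have e3 : Ix (fun x t => S.Bd.f x t ^ 2 + S.Cd.f x t ^ 2) s
          = Ix (fun x t => S.Bd.f x t ^ 2) s + Ix (fun x t => S.Cd.f x t ^ 2) s := Ix_add
        rw [e0, e3, ← hq'] at e
        have W0 := S.ρsq_nonneg S.W hs'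
        have V0 := S.ρsq_nonneg S.V hs'
        have β0 := Ix_sq_nonneg S.Bd s
        have γ0 := Ix_sq_nonneg S.Cd s
        have θ0 := S.ρsq_nonneg S.θ hs'
        have lo := low s hs'
        have hQ' := hQY s hs'
        have hY := Y0 s hs'
        have a2 := Ix_sq_nonneg (dx S.w) s
        have a3 := Ix_sq_nonneg (dx S.v) s
        have a4 := Ix_sq_nonneg (dx S.b) s
        have a5 := Ix_sq_nonneg (dx S.c) s
        set A := Ix (fun x t => S.F.f x t ^ 2) s
        set R := Ix (fun x t => S.ρ.f x t * S.U.f x t ^ 2) s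
        set Kk := Ix (fun x t => S.k x t ^ 2) s
        set Θ2 := Ix (fun x t => S.ρ.f x t * S.θ.f x t ^ 2) s
        set G := 4 * p.C₀ * (S.Y B s + E) with hG
        have G0 : 0 ≤ G := by positivity
        have f1 : (1 + q)⁻¹ * (m / (8 * B) + B * m2) * q ≤ A / 4 + R / 4 + B * Ck + 2 * B * Kk := by
          have g1 : (1 + q)⁻¹ * q ≤ 1 := by
            have : 0 ≤ (1 + q)⁻¹ := inv_nonneg.mpr (by linarith)
            linarith
          have g2 : 0 ≤ m / (8 * B) + B * m2 := by positivity
          have g3 := mul_le_mul_of_nonneg_right g1 g2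
          have g4 : m / (8 * B) ≤ A / 4 + R / 4 := by
            rw [hm, div_le_iff₀ (by positivity)]
            have := mul_nonneg A0 (by linarith : 0 ≤ B - 1)
            linarith
          have g5 : B * m2 = B * Ck + 2 * B * Kk := by rw [hm2]; ring
          linarith
        have f2 : A ≤ G := by linarith
        have f3 : Θ2 ≤ G := by linarith
        have f4 : (1 + q) * (67 * B * q + 4 * B * A + 32 * B ^ 2 * Θ2 + B * A) ≤ (1 + q) * (Λ * G) := by
          refine mul_le_mul_of_nonneg_left ?_ (by linarith)
          have g1 := mul_le_mul_of_nonneg_left hQ' (by positivity : 0 ≤ 67 * B)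
          have g2 := mul_le_mul_of_nonneg_left f2 (by positivity : 0 ≤ 5 * B)
          have g3 := mul_le_mul_of_nonneg_left f3 (by positivity : 0 ≤ 32 * B ^ 2)
          rw [hΛ]; linarith
        have f5 : A / 4 ≤ (1 + q) * (B * A) := by
          have g1 : 0 ≤ q * (B * A) := by positivity
          have g2 := mul_le_mul_of_nonneg_right hB A0
          linarith
        have f6 : B * Ck + (1 + q) * (Λ * G) ≤ (B * Ck + Λ * (4 * p.C₀)) * (1 + q) * (S.Y B s + E + 1) := by
          have g1 : 0 ≤ B * Ck * (q + (1 + q) * (S.Y B s + E)) := by positivity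
          have g2 : 0 ≤ Λ * (4 * p.C₀) * (1 + q) := by positivity
          rw [hG]; linarith
        have f7 := mul_le_mul_of_nonneg_right hB k0
        linarith)
  have i1 : ∫ s in (0:ℝ)..t, (Ix r1 s + 4 * B * Ix (fun x t => p.K (S.θ.f x t) * (S.Q.f x t
          - S.ρ.f x t * S.θ.f x t * (dx S.u).f x t) - S.k x t ^ 2) s)
      = (∫ s in (0:ℝ)..t, Ix r1 s) + 4 * B * ∫ s in (0:ℝ)..t, Ix (fun x t => p.K (S.θ.f x t) * (S.Q.f x t
          - S.ρ.f x t * S.θ.f x t * (dx S.u).f x t) - S.k x t ^ 2) s := by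
    rw [← intervalIntegral.integral_const_mul, ← intervalIntegral.integral_add (ii (by fun_prop) _ _)
      (ii (by fun_prop) _ _)]
  rw [i1] at key
  unfold Flow.Y
  rw [h1, h2]
  unfold Flow.Y at key
  linarith

end MHD

namespace MHD

variable {p : Par}

abbrev I2 (F : SF) : ℝ → ℝ := Ix (fun x t => F.f x t ^ 2)
abbrev IR (S : Flow p) (F : SF) : ℝ → ℝ := Ix (fun x t => S.ρ.f x t * F.f x t ^ 2)
abbrev Ik (S : Flow p) : ℝ → ℝ := Ix (fun x t => S.k x t ^ 2)

theorem I2_nonneg (F : SF) (t : ℝ) : 0 ≤ I2 F t := Ix_sq_nonneg F t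

/-- the first-order bounds -/
structure H1 (S : Flow p) (C : ℝ) : Prop where
  one : 1 ≤ C
  ρ : ∀ x ∈ Icc (0:ℝ) 1, ∀ t ∈ Icc (0:ℝ) p.T, S.ρ.f x t ≤ C
  F : ∀ t ∈ Icc (0:ℝ) p.T, I2 S.F t ≤ C
  Q : ∀ t ∈ Icc (0:ℝ) p.T, Ix S.Q.f t ≤ C
  ρθ : ∀ t ∈ Icc (0:ℝ) p.T, IR S S.θ t ≤ C
  D : ∫ s in (0:ℝ)..p.T, (IR S S.U s + IR S S.W s + IR S S.V s + I2 S.Bd s + I2 S.Cd s + Ik S s) ≤ C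
  K : ∀ x ∈ Icc (0:ℝ) 1, ∀ t ∈ Icc (0:ℝ) p.T, p.K (S.θ.f x t) ^ 2 ≤ C * (1 + Ik S t)

set_option maxHeartbeats 1000000 in
theorem stepD1 (p : Par) : ∃ C, ∀ S : Flow p, H1 S C := by
  obtain ⟨B, E, C, hB, hE, hC, h⟩ := d1_rate p
  obtain ⟨Ci, hCi, hi⟩ := d1_init p
  obtain ⟨Cq, hCq, hq⟩ := stepD0 p
  obtain ⟨Ck, hCk, hK⟩ := Kbd p
  have hT := p.hT
  set X0 := B * Ci + E + 1 with hX0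
  set b := C * (p.T + Cq) with hb
  have hX00 : 0 ≤ X0 := by positivity
  have hb0 : 0 ≤ b := by positivity
  refine ⟨B + Ck + 2 + C * (X0 * Real.exp b) + 4 * (X0 + X0 * Real.exp b * b), fun S => ?_⟩
  obtain ⟨h1, h2, h3, h4, h5, h6⟩ := h S
  have e1 : 0 ≤ X0 * Real.exp b := by positivity
  have e2 : 0 ≤ C * (X0 * Real.exp b) := by positivity
  have e3 : 0 ≤ X0 * Real.exp b * b := by positivity
  have g := gronwallD (T := p.T) (X0 := X0) (b := b) (X := fun t => S.Y B t + E + 1)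
    (D := fun s => (1/4) * (
      Ix (fun x t => S.ρ.f x t * S.U.f x t ^ 2) s + Ix (fun x t => S.ρ.f x t * S.W.f x t ^ 2) s
      + Ix (fun x t => S.ρ.f x t * S.V.f x t ^ 2) s + Ix (fun x t => S.Bd.f x t ^ 2) s
      + Ix (fun x t => S.Cd.f x t ^ 2) s + Ix (fun x t => S.k x t ^ 2) s))
    (β := fun s => C * (1 + Ix S.Q.f s))
    (by have := S.Y_cont B; fun_prop) (by fun_prop) (by fun_prop)
    (fun t ht => by have := S.IQ_nonneg t; positivity)
    (fun t ht => by
      have a1 := S.ρsq_nonneg S.U ht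
      have a2 := S.ρsq_nonneg S.W ht
      have a3 := S.ρsq_nonneg S.V ht
      have a4 := Ix_sq_nonneg S.Bd t
      have a5 := Ix_sq_nonneg S.Cd t
      have a6 := S.ksq_nonneg t
      positivity) hX00 (fun t ht => by have := h2 t ht; linarith)
    (fun t ht => by
      have := h6 t ht
      have h0 := hi B hB S
      linarith)
    (by
      have := int_le2 p.hT.le (f := fun s => C * (1 + Ix S.Q.f s)) (g₁ := fun _ => (1:ℝ)) (g₂ := Ix S.Q.f) C C
        (fun s hs => by linarith)
      simp only [intervalIntegral.integral_const, sub_zero, smul_eq_mul, mul_one] at this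
      have h' := mul_le_mul_of_nonneg_left (hq S) (by linarith : 0 ≤ C)
      linarith)
  have gC : ∀ t ∈ Icc (0:ℝ) p.T, ∀ x, x ≤ C * (S.Y B t + E + 1) →
    x ≤ B + Ck + 2 + C * (X0 * Real.exp b) + 4 * (X0 + X0 * Real.exp b * b) := fun t ht x hx => by
    have := mul_le_mul_of_nonneg_left (g t ht).1 (by linarith : 0 ≤ C)
    linarith
  refine ⟨by linarith, fun x hx t ht => by have := h1 x hx t ht; linarith,
    fun t ht => gC t ht _ (h3 t ht), fun t ht => gC t ht _ (h4 t ht), fun t ht => gC t ht _ (h5 t ht), ?_, ?_⟩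
  · have := (g p.T p.h1).2
    rw [intervalIntegral.integral_const_mul] at this
    have h' : ∀ x y : ℝ, 1/4 * x ≤ y → x ≤ 4 * y := fun x y h => by linarith
    have := h' _ _ this
    refine this.trans (by linarith)
  · intro x hx t ht
    have := hK S x hx t ht
    have a6 : 0 ≤ Ik S t := S.ksq_nonneg t
    have : (Ck + 2) * (1 + Ik S t) ≤ (B + Ck + 2 + C * (X0 * Real.exp b) + 4 * (X0 + X0 * Real.exp b * b)) * (1 + Ik S t) :=
      mul_le_mul_of_nonneg_right (by linarith) (by linarith)
    have : 0 ≤ Ck * Ik S t := by positivity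
    linarith

namespace H1

variable {S : Flow p} {C : ℝ}

theorem nn (h : H1 S C) : 0 ≤ C := zero_le_one.trans h.one

theorem Ik0 (S : Flow p) (t : ℝ) : 0 ≤ Ik S t := S.ksq_nonneg t

theorem Ux (h : H1 S C) {t : ℝ} (ht : t ∈ Icc (0:ℝ) p.T) : I2 (dx S.u) t ≤ C ∧ I2 (dx S.w) t ≤ C ∧
    I2 (dx S.v) t ≤ C ∧ I2 (dx S.b) t ≤ C ∧ I2 (dx S.c) t ≤ C := by
  have h1 := h.Q t ht
  rw [S.IQ] at h1
  have a1 := I2_nonneg (dx S.u) t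
  have a2 := I2_nonneg (dx S.w) t
  have a3 := I2_nonneg (dx S.v) t
  have a4 := I2_nonneg (dx S.b) t
  have a5 := I2_nonneg (dx S.c) t
  refine ⟨?_, ?_, ?_, ?_, ?_⟩ <;> linarith

theorem sup0 {f : SF} {x t : ℝ} (h0 : f.f 0 t = 0) (hf : I2 (dx f) t ≤ C) (hx : x ∈ Icc (0:ℝ) 1) :
    f.f x t ^ 2 ≤ C :=
  (sob0 (g := fun x => f.f x t) (g' := fun x => (dx f).f x t) (fun z _ => f.hx z t) (by fun_prop) h0 hx).trans hf

theorem us (h : H1 S C) {x t : ℝ} (hx : x ∈ Icc (0:ℝ) 1) (ht : t ∈ Icc (0:ℝ) p.T) : S.u.f x t ^ 2 ≤ C :=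
  sup0 (S.u0 t ht) (h.Ux ht).1 hx
theorem ws (h : H1 S C) {x t : ℝ} (hx : x ∈ Icc (0:ℝ) 1) (ht : t ∈ Icc (0:ℝ) p.T) : S.w.f x t ^ 2 ≤ C :=
  sup0 (S.w0 t ht) (h.Ux ht).2.1 hx
theorem vs (h : H1 S C) {x t : ℝ} (hx : x ∈ Icc (0:ℝ) 1) (ht : t ∈ Icc (0:ℝ) p.T) : S.v.f x t ^ 2 ≤ C :=
  sup0 (S.v0 t ht) (h.Ux ht).2.2.1 hx
theorem bs (h : H1 S C) {x t : ℝ} (hx : x ∈ Icc (0:ℝ) 1) (ht : t ∈ Icc (0:ℝ) p.T) : S.b.f x t ^ 2 ≤ C :=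
  sup0 (S.b0 t ht) (h.Ux ht).2.2.2.1 hx
theorem cs (h : H1 S C) {x t : ℝ} (hx : x ∈ Icc (0:ℝ) 1) (ht : t ∈ Icc (0:ℝ) p.T) : S.c.f x t ^ 2 ≤ C :=
  sup0 (S.c0 t ht) (h.Ux ht).2.2.2.2 hx

theorem θs (h : H1 S C) {x t : ℝ} (hx : x ∈ Icc (0:ℝ) 1) (ht : t ∈ Icc (0:ℝ) p.T) :
    S.θ.f x t ^ 2 ≤ p.C₀ ^ 2 * (C * (1 + Ik S t)) := by
  have h1 := h.K x hx t ht
  have hC := p.hC₀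
  have r := S.θp x hx t ht
  have h2 := p.K_ge r.le
  have h3 : S.θ.f x t ≤ p.C₀ * p.K (S.θ.f x t) := by
    have := mul_le_mul_of_nonneg_left h2 (by linarith : 0 ≤ p.C₀)
    rwa [← mul_assoc, mul_inv_cancel₀ (by positivity), one_mul] at this
  calc S.θ.f x t ^ 2 ≤ (p.C₀ * p.K (S.θ.f x t)) ^ 2 := pow_le_pow_left₀ r.le h3 2
    _ = p.C₀ ^ 2 * p.K (S.θ.f x t) ^ 2 := by ring
    _ ≤ _ := mul_le_mul_of_nonneg_left h1 (by positivity)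

theorem Fs (h : H1 S C) {x t : ℝ} (hx : x ∈ Icc (0:ℝ) 1) (ht : t ∈ Icc (0:ℝ) p.T) :
    S.F.f x t ^ 2 ≤ 2 * C * (1 + IR S S.U t) := by
  have := S.Fsup h.ρ hx ht
  have := h.F t ht
  simp only [I2, IR] at *
  linarith

theorem IR0 {f : SF} {t : ℝ} (ht : t ∈ Icc (0:ℝ) p.T) : 0 ≤ IR S f t := S.ρsq_nonneg f ht

/-- the basic time-integrable weight -/
def m (S : Flow p) (t : ℝ) : ℝ :=
  1 + (IR S S.U t + IR S S.W t + IR S S.V t + I2 S.Bd t + I2 S.Cd t + Ik S t)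

@[fun_prop] theorem m_cont (S : Flow p) : Continuous (m S) := by unfold m; fun_prop

theorem m_int (h : H1 S C) : ∫ s in (0:ℝ)..p.T, m S s ≤ p.T + C := by
  have := int_le2 p.hT.le (f := m S) (g₁ := fun _ => (1:ℝ)) (g₂ := fun s => (IR S S.U s + IR S S.W s + IR S S.V s + I2 S.Bd s + I2 S.Cd s + Ik S s)) 1 1
        (fun s hs => by unfold m; linarith)
  simp only [intervalIntegral.integral_const, sub_zero, smul_eq_mul, mul_one] at this
  have := h.D
  linarith

theorem m_ge (S : Flow p) {t : ℝ} (ht : t ∈ Icc (0:ℝ) p.T) : 1 ≤ m S t ∧ IR S S.U t ≤ m S t ∧ IR S S.W t ≤ m S t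
    ∧ IR S S.V t ≤ m S t ∧ I2 S.Bd t ≤ m S t ∧ I2 S.Cd t ≤ m S t ∧ 1 + Ik S t ≤ m S t ∧ 1 + IR S S.U t ≤ m S t := by
  have a1 : 0 ≤ IR S S.U t := IR0 ht
  have a2 : 0 ≤ IR S S.W t := IR0 ht
  have a3 : 0 ≤ IR S S.V t := IR0 ht
  have a4 := I2_nonneg S.Bd t
  have a5 := I2_nonneg S.Cd t
  have a6 := Ik0 S t
  unfold m
  refine ⟨?_, ?_, ?_, ?_, ?_, ?_, ?_, ?_⟩ <;> linarith

end H1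

end MHD

namespace MHD

variable {p : Par}

/-- Gronwall in the form used below -/
theorem gw {T c M a : ℝ} {X D m : ℝ → ℝ} (hc : 0 ≤ c) (ha : 0 ≤ a) (hT : 0 ≤ T)
    (hX0 : ∀ t ∈ Icc (0:ℝ) T, 0 ≤ X t) (hD0 : ∀ t ∈ Icc (0:ℝ) T, 0 ≤ D t)
    (hm0 : ∀ t ∈ Icc (0:ℝ) T, 0 ≤ m t) (hm : ∫ s in (0:ℝ)..T, m s ≤ M)
    (h : ∀ t ∈ Icc (0:ℝ) T, X t + ∫ s in (0:ℝ)..t, D s ≤ a + ∫ s in (0:ℝ)..t, c * m s * (1 + X s))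
    (hX : Continuous X := by fun_prop) (hD : Continuous D := by fun_prop)
    (cm : Continuous m := by fun_prop) :
    ∀ t ∈ Icc (0:ℝ) T, X t ≤ (a + 1) * (1 + Real.exp (c * M) * (1 + c * M)) ∧
      ∫ s in (0:ℝ)..t, D s ≤ (a + 1) * (1 + Real.exp (c * M) * (1 + c * M)) := by
  have g := gronwallD (T := T) (X0 := a + 1) (b := c * M) (X := fun t => 1 + X t) (D := D)
    (β := fun s => c * m s) (by fun_prop) hD (by fun_prop)
    (fun t ht => mul_nonneg hc (hm0 t ht)) hD0 (by linarith) (fun t ht => by have := hX0 t ht; linarith)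
    (fun t ht => by have := h t ht; linarith) (by
      rw [intervalIntegral.integral_const_mul]; exact mul_le_mul_of_nonneg_left hm hc)
  intro t ht
  have g1 := g t ht
  have hM : 0 ≤ M := (int_nonneg hT hm0).trans hm
  have e1 : 0 ≤ (a+1) * Real.exp (c * M) := by positivity
  have e2 : 0 ≤ (a+1) * Real.exp (c * M) * (c * M) := by positivity
  constructor <;> linarith [g1.1, g1.2]

theorem H1.mono {S : Flow p} {C C' : ℝ} (h : H1 S C) (hC : C ≤ C') : H1 S C' := by
  refine ⟨h.one.trans hC, fun x hx t ht => (h.ρ x hx t ht).trans hC, fun t ht => (h.F t ht).trans hC,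
    fun t ht => (h.Q t ht).trans hC, fun t ht => (h.ρθ t ht).trans hC, h.D.trans hC,
    fun x hx t ht => (h.K x hx t ht).trans ?_⟩
  have := H1.Ik0 S t
  exact mul_le_mul_of_nonneg_right hC (by linarith)

theorem Flow.θx_le (S : Flow p) (x t : ℝ) : (dx S.θ).f x t ^ 2 ≤ p.C₀ ^ 2 * S.k x t ^ 2 := by
  have h1 := p.κ_ge (S.θ.f x t)
  have hC := p.hC₀
  have hκ := p.κ_pos (S.θ.f x t)
  have h2 : 1 ≤ p.C₀ * κe p.κ (S.θ.f x t) := by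
    have := mul_le_mul_of_nonneg_left h1 (by linarith : 0 ≤ p.C₀)
    rwa [mul_inv_cancel₀ (by positivity)] at this
  have h3 : 1 ≤ (p.C₀ * κe p.κ (S.θ.f x t)) ^ 2 := one_le_pow₀ h2
  have := mul_le_mul_of_nonneg_right h3 (sq_nonneg ((dx S.θ).f x t))
  unfold Flow.k
  linarith

theorem Flow.uxx_eq (S : Flow p) {x t : ℝ} (hx : x ∈ Icc (0:ℝ) 1) (ht : t ∈ Icc (0:ℝ) p.T) :
    (dx (dx S.u)).f x t = S.ρ.f x t * S.U.f x t + (dx S.ρ).f x t * S.θ.f x t + S.ρ.f x t * (dx S.θ).f x t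
      + S.b.f x t * (dx S.b).f x t + S.c.f x t * (dx S.c).f x t := by
  have := S.mom x hx t ht
  simp only [Flow.U, add_f, sub_f, mul_f, neg_f, cst_f, xx_f, dx_add, dt_add, dx_sub, dt_sub, dx_neg, dt_neg, dx_mul, dt_mul, dx_cst, dt_cst, dx_xx, dt_xx, dt_dx]
  linarith

theorem sq5 (a b c d e : ℝ) : (a + b + c + d + e) ^ 2 ≤ 5 * (a^2 + b^2 + c^2 + d^2 + e^2) := by
  nlinarith [sq_nonneg (a-b), sq_nonneg (a-c), sq_nonneg (a-d), sq_nonneg (a-e), sq_nonneg (b-c),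
    sq_nonneg (b-d), sq_nonneg (b-e), sq_nonneg (c-d), sq_nonneg (c-e), sq_nonneg (d-e)]

theorem sq3 (a b c : ℝ) : (a + b + c) ^ 2 ≤ 3 * (a^2 + b^2 + c^2) := by
  nlinarith [sq_nonneg (a-b), sq_nonneg (a-c), sq_nonneg (b-c)]

theorem sq2 (a b : ℝ) : (a + b) ^ 2 ≤ 2 * (a^2 + b^2) := by
  nlinarith [sq_nonneg (a-b)]

set_option maxHeartbeats 1000000 in
/-- pointwise rate for the density gradient -/
theorem d2_pt {S : Flow p} {C : ℝ} (h : H1 S C) {x t : ℝ} (hx : x ∈ Icc (0:ℝ) 1) (ht : t ∈ Icc (0:ℝ) p.T) :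
    -(3/2 * ((dx S.u).f x t * (dx S.ρ).f x t ^ 2)) - S.ρ.f x t * (dx S.ρ).f x t * (dx (dx S.u)).f x t
    ≤ (3 + 3 * C) * H1.m S t * (dx S.ρ).f x t ^ 2 + C ^ 3 * (S.ρ.f x t * S.U.f x t ^ 2)
      + C ^ 4 * p.C₀ ^ 2 * S.k x t ^ 2 + C ^ 3 * (dx S.b).f x t ^ 2 + C ^ 3 * (dx S.c).f x t ^ 2 := by
  have hC := h.one
  have hρ := h.ρ x hx t ht
  have rp := S.ρp x hx t ht
  have θp := S.θp x hx t ht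
  obtain ⟨m1, -, -, -, -, -, -, m2⟩ := H1.m_ge S ht
  have f1 := h.Fs hx ht
  have f2 := S.F_eq x t
  have f3 := S.uxx_eq hx ht
  have b1 := h.bs hx ht
  have c1 := h.cs hx ht
  have k1 := S.θx_le x t
  have F1 : -(S.F.f x t) ≤ (1 + C) * H1.m S t := by
    have := mul_le_mul_of_nonneg_left m2 (by linarith : 0 ≤ 2 * C)
    linarith [sq_nonneg (S.F.f x t + 1)]
  set r := S.ρ.f x t
  set rx := (dx S.ρ).f x t
  set θ := S.θ.f x t
  set θx := (dx S.θ).f x t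
  set U := S.U.f x t
  set b := S.b.f x t
  set c := S.c.f x t
  set bx := (dx S.b).f x t
  set cx := (dx S.c).f x t
  have n1 : 0 ≤ r * θ := by positivity
  have g1 : -(dx S.u).f x t ≤ (1 + C) * H1.m S t := by
    linarith [sq_nonneg b, sq_nonneg c]
  have g2 := mul_le_mul_of_nonneg_right g1 (sq_nonneg rx)
  have g3 := mul_le_mul_of_nonneg_right m1 (sq_nonneg rx)
  have r3 : r ^ 3 ≤ C ^ 3 := pow_le_pow_left₀ rp.le hρ 3
  have r4 : r ^ 4 ≤ C ^ 4 := pow_le_pow_left₀ rp.le hρ 4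
  have r2 : r ^ 2 ≤ C ^ 2 := pow_le_pow_left₀ rp.le hρ 2
  have t1 : -(r * rx * (r * U)) ≤ rx ^ 2 / 4 + C ^ 3 * (r * U ^ 2) := by
    have := mul_le_mul_of_nonneg_right r3 (by positivity : 0 ≤ r * U ^ 2)
    linarith [sq_nonneg (rx / 2 + r ^ 2 * U)]
  have t2 : -(r * rx * (r * θx)) ≤ rx ^ 2 / 4 + C ^ 4 * p.C₀ ^ 2 * S.k x t ^ 2 := by
    have a := mul_le_mul_of_nonneg_right r4 (sq_nonneg θx)
    have b := mul_le_mul_of_nonneg_left k1 (by positivity : 0 ≤ C ^ 4)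
    linarith [sq_nonneg (rx / 2 + r ^ 2 * θx)]
  have t3 : ∀ b bx : ℝ, b ^ 2 ≤ C → -(r * rx * (b * bx)) ≤ rx ^ 2 / 4 + C ^ 3 * bx ^ 2 := fun b bx hb => by
    have a := mul_le_mul r2 hb (sq_nonneg b) (by positivity)
    have a := mul_le_mul_of_nonneg_right a (sq_nonneg bx)
    linarith [sq_nonneg (rx / 2 + r * b * bx)]
  have t4 := t3 b bx b1
  have t5 := t3 c cx c1
  have t6 : 0 ≤ r * rx * (rx * θ) := by
    have : r * rx * (rx * θ) = r * θ * rx ^ 2 := by ring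
    rw [this]; positivity
  have t7 : 0 ≤ (1 + C) * H1.m S t * rx ^ 2 := by
    have : 0 ≤ H1.m S t := by linarith
    positivity
  have t8 : 0 ≤ C * (H1.m S t * rx ^ 2) := by
    have : 0 ≤ H1.m S t := by linarith
    positivity
  rw [f3]
  linarith

set_option maxHeartbeats 1000000 in
theorem stepD2 (p : Par) : ∃ C, 1 ≤ C ∧ ∀ S : Flow p, H1 S C ∧ ∫ s in (0:ℝ)..p.T, H1.m S s ≤ C ∧
    ∀ t ∈ Icc (0:ℝ) p.T, I2 (dx S.ρ) t ≤ C := by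
  obtain ⟨C, h⟩ := stepD1 p
  have hT := p.hT
  by_cases hne : Nonempty (Flow p)
  swap
  · exact ⟨1, le_rfl, fun S => (hne ⟨S⟩).elim⟩
  have hC : 1 ≤ C := hne.elim fun S => (h S).one
  have hC1 := p.hC₀
  have hN := p.hN
  set L := 2 * (3 + 3 * C) + C ^ 3 + C ^ 4 * p.C₀ ^ 2 + 2 * C ^ 4 with hL
  have hL0 : 0 ≤ L := by positivity
  set R := (1/2 * p.N ^ 2 + 1) * (1 + Real.exp (L * (p.T + C)) * (1 + L * (p.T + C))) with hR
  have hR0 : 0 ≤ R := by positivity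
  refine ⟨C + p.T + 2 * R, by linarith, fun S => ⟨(h S).mono (by linarith), by linarith [(h S).m_int], ?_⟩⟩
  have id := masterI (T := p.T) (cst (1/2) * (dx S.ρ * dx S.ρ)) (cst (1/2) * (S.u * (dx S.ρ * dx S.ρ)))
    (fun x t => -(3/2 * ((dx S.u).f x t * (dx S.ρ).f x t ^ 2)) - S.ρ.f x t * (dx S.ρ).f x t * (dx (dx S.u)).f x t)
    (fun x hx t ht => by
      have m1 := dx_congr (F := dt S.ρ) (G := -(dx S.ρ * S.u + S.ρ * dx S.u)) (T := p.T) S.mass x hx t ht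
      simp only [add_f, sub_f, mul_f, neg_f, cst_f, xx_f, dx_add, dt_add, dx_sub, dt_sub, dx_neg, dt_neg, dx_mul, dt_mul, dx_cst, dt_cst, dx_xx, dt_xx, dt_dx] at m1 ⊢
      rw [m1]; ring)
    (fun t ht => by simp only [add_f, sub_f, mul_f, neg_f, cst_f, xx_f, dx_add, dt_add, dx_sub, dt_sub, dx_neg, dt_neg, dx_mul, dt_mul, dx_cst, dt_cst, dx_xx, dt_xx, dt_dx]; rw [S.u0 t ht]; ring)
    (fun t ht => by simp only [add_f, sub_f, mul_f, neg_f, cst_f, xx_f, dx_add, dt_add, dx_sub, dt_sub, dx_neg, dt_neg, dx_mul, dt_mul, dx_cst, dt_cst, dx_xx, dt_xx, dt_dx]; rw [S.u1 t ht]; ring)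
  have hX : ∀ t, Ix (cst (1/2) * (dx S.ρ * dx S.ρ)).f t = 1/2 * I2 (dx S.ρ) t := fun t => by
    rw [← Ix_mul]; apply Ix_congr; intro x hx; simp only [add_f, sub_f, mul_f, neg_f, cst_f, xx_f, dx_add, dt_add, dx_sub, dt_sub, dx_neg, dt_neg, dx_mul, dt_mul, dx_cst, dt_cst, dx_xx, dt_xx, dt_dx]; ring
  have g := gw (T := p.T) (c := L) (M := p.T + C) (a := 1/2 * p.N ^ 2) (X := fun t => 1/2 * I2 (dx S.ρ) t)
    (D := fun _ => 0) (m := H1.m S) hL0 (by positivity) hT.le (fun t ht => by have := I2_nonneg (dx S.ρ) t; positivity)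
    (fun _ _ => le_rfl) (fun t ht => by linarith [(H1.m_ge S ht).1]) (h S).m_int (fun t ht => by
      have i := id t ht
      rw [hX, hX] at i
      rw [i]
      have i0 : I2 (dx S.ρ) 0 ≤ p.N ^ 2 := Ix_le_const _ (fun x hx => sqbd (S.iρ x hx).2)
      have i1 := int_mono ht.1 (f := Ix (fun x t => -(3/2 * ((dx S.u).f x t * (dx S.ρ).f x t ^ 2)) - S.ρ.f x t * (dx S.ρ).f x t * (dx (dx S.u)).f x t)) 
        (g := fun s => L * H1.m S s * (1 + 1/2 * I2 (dx S.ρ) s)) (fun s hs => by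
          have hs' : s ∈ Icc (0:ℝ) p.T := ⟨hs.1, hs.2.trans ht.2⟩
          have j := Ix_le5 (t := s) (f := fun x t => -(3/2 * ((dx S.u).f x t * (dx S.ρ).f x t ^ 2)) - S.ρ.f x t * (dx S.ρ).f x t * (dx (dx S.u)).f x t)
            (g₁ := fun x t => (dx S.ρ).f x t ^ 2) (g₂ := fun x t => S.ρ.f x t * S.U.f x t ^ 2)
            (g₃ := fun x t => S.k x t ^ 2) (g₄ := fun x t => (dx S.b).f x t ^ 2) (g₅ := fun x t => (dx S.c).f x t ^ 2)
            ((3 + 3 * C) * H1.m S s) (C ^ 3) (C ^ 4 * p.C₀ ^ 2) (C ^ 3) (C ^ 3) (fun x hx => d2_pt (h S) hx hs')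
          refine j.trans ?_
          obtain ⟨m1, m2, -, -, -, -, m3, -⟩ := H1.m_ge S hs'
          obtain ⟨-, -, -, b1, c1⟩ := (h S).Ux hs'
          have q0 := I2_nonneg (dx S.ρ) s
          have q1 := mul_le_mul_of_nonneg_left m2 (by positivity : 0 ≤ C ^ 3)
          have q2 := mul_le_mul_of_nonneg_left (by linarith : Ik S s ≤ H1.m S s) (by positivity : 0 ≤ C ^ 4 * p.C₀ ^ 2)
          have q3 := mul_le_mul_of_nonneg_left b1 (by positivity : 0 ≤ C ^ 3)
          have q4 := mul_le_mul_of_nonneg_left c1 (by positivity : 0 ≤ C ^ 3)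
          have q5 := mul_le_mul_of_nonneg_left m1 (by positivity : 0 ≤ C ^ 4)
          have q6 : 0 ≤ (3 + 3 * C) * H1.m S s := by
            have : 0 ≤ H1.m S s := by linarith
            positivity
          have q7 : 0 ≤ (C ^ 3 + C ^ 4 * p.C₀ ^ 2 + 2 * C ^ 4) * H1.m S s * (1/2 * I2 (dx S.ρ) s) := by
            have : 0 ≤ H1.m S s := by linarith
            positivity
          rw [hL]
          linarith)
      simp only [intervalIntegral.integral_zero]
      linarith)
  intro t ht
  have := (g t ht).1
  linarith

end MHD

namespace MHD

variable {p : Par}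

theorem Par.κ_le (p : Par) {s : ℝ} (hs : 0 ≤ s) : κe p.κ s ≤ 2 * p.C₀ + p.C₀ ^ 2 * (p.q + 1) * p.K s := by
  have hC := p.hC₀
  have hq := p.hq
  have h1 : κe p.κ s ≤ p.C₀ * (1 + s ^ p.q) := by
    have := p.hκ.2.2 |s| (abs_nonneg s)
    unfold κe
    rwa [abs_of_nonneg hs] at this ⊢
  have h2 : ∫ r in (0:ℝ)..s, p.C₀⁻¹ * r ^ p.q ≤ p.K s := by
    apply int_mono hs _ _ (κe_cont p)
    · intro r hr
      refine le_trans ?_ (p.hκ.2.1 |r| (abs_nonneg r))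
      rw [abs_of_nonneg hr.1]
      have : 0 ≤ p.C₀⁻¹ := inv_nonneg.mpr (by linarith [p.hC₀])
      linarith
    · exact continuous_const.mul (Real.continuous_rpow_const hq.le)
  rw [intervalIntegral.integral_const_mul, integral_rpow (Or.inl (by linarith)), Real.zero_rpow (by linarith), sub_zero] at h2
  have h3 : s ^ (p.q + 1) ≤ p.C₀ * (p.q + 1) * p.K s := by
    have := mul_le_mul_of_nonneg_left h2 (by positivity : 0 ≤ p.C₀ * (p.q + 1))
    have e : p.C₀ * (p.q + 1) * (p.C₀⁻¹ * (s ^ (p.q + 1) / (p.q + 1))) = s ^ (p.q + 1) := by field_simp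
    rwa [e] at this
  have h4 : s ^ p.q ≤ 1 + s ^ (p.q + 1) := by
    rcases le_total s 1 with h | h
    · have := Real.rpow_le_one hs h hq.le
      have := Real.rpow_nonneg hs (p.q + 1)
      linarith
    · have := Real.rpow_le_rpow_of_exponent_le h (by linarith : p.q ≤ p.q + 1)
      linarith
  have := mul_le_mul_of_nonneg_left (h4.trans (by linarith : _ ≤ 1 + p.C₀ * (p.q + 1) * p.K s)) (by linarith : 0 ≤ p.C₀)
  linarith

/-- second-order bounds -/
structure H2 (S : Flow p) (C : ℝ) : Prop where
  h1 : H1 S C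
  mI : ∫ s in (0:ℝ)..p.T, H1.m S s ≤ C
  rx : ∀ t ∈ Icc (0:ℝ) p.T, I2 (dx S.ρ) t ≤ C
  uxx : ∀ t ∈ Icc (0:ℝ) p.T, I2 (dx (dx S.u)) t ≤ C * H1.m S t
  wxx : ∀ t ∈ Icc (0:ℝ) p.T, I2 (dx (dx S.w)) t ≤ C * H1.m S t
  vxx : ∀ t ∈ Icc (0:ℝ) p.T, I2 (dx (dx S.v)) t ≤ C * H1.m S t
  bxx : ∀ t ∈ Icc (0:ℝ) p.T, I2 (dx (dx S.b)) t ≤ C * H1.m S t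
  cxx : ∀ t ∈ Icc (0:ℝ) p.T, I2 (dx (dx S.c)) t ≤ C * H1.m S t
  ux : ∀ x ∈ Icc (0:ℝ) 1, ∀ t ∈ Icc (0:ℝ) p.T, (dx S.u).f x t ^ 2 ≤ C * H1.m S t
  wx : ∀ x ∈ Icc (0:ℝ) 1, ∀ t ∈ Icc (0:ℝ) p.T, (dx S.w).f x t ^ 2 ≤ C * H1.m S t
  vx : ∀ x ∈ Icc (0:ℝ) 1, ∀ t ∈ Icc (0:ℝ) p.T, (dx S.v).f x t ^ 2 ≤ C * H1.m S t
  bx : ∀ x ∈ Icc (0:ℝ) 1, ∀ t ∈ Icc (0:ℝ) p.T, (dx S.b).f x t ^ 2 ≤ C * H1.m S t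
  cx : ∀ x ∈ Icc (0:ℝ) 1, ∀ t ∈ Icc (0:ℝ) p.T, (dx S.c).f x t ^ 2 ≤ C * H1.m S t
  F : ∀ x ∈ Icc (0:ℝ) 1, ∀ t ∈ Icc (0:ℝ) p.T, S.F.f x t ^ 2 ≤ C * H1.m S t
  θ : ∀ x ∈ Icc (0:ℝ) 1, ∀ t ∈ Icc (0:ℝ) p.T, S.θ.f x t ^ 2 ≤ C * H1.m S t
  K : ∀ x ∈ Icc (0:ℝ) 1, ∀ t ∈ Icc (0:ℝ) p.T, p.K (S.θ.f x t) ^ 2 ≤ C * H1.m S t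
  κ : ∀ x ∈ Icc (0:ℝ) 1, ∀ t ∈ Icc (0:ℝ) p.T, κe p.κ (S.θ.f x t) ^ 2 ≤ C * H1.m S t

theorem supf {f : SF} {A B m x t : ℝ} (h1 : I2 f t ≤ A) (h2 : I2 (dx f) t ≤ B * m) (hx : x ∈ Icc (0:ℝ) 1)
    (hA : 0 ≤ A) (hm : 1 ≤ m) : f.f x t ^ 2 ≤ (2 * A + 2 * B) * m := by
  have := sob (g := fun x => f.f x t) (g' := fun x => (dx f).f x t) (fun z _ => f.hx z t) (by fun_prop) (by fun_prop) hx
  have e1 : I2 f t = ∫ z in (0:ℝ)..1, f.f z t ^ 2 := rfl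
  have e2 : I2 (dx f) t = ∫ z in (0:ℝ)..1, (dx f).f z t ^ 2 := rfl
  rw [← e1, ← e2] at this
  have := mul_le_mul_of_nonneg_left hm hA
  linarith

theorem wxx_aux {S : Flow p} {C t : ℝ} (h : H1 S C) (ht : t ∈ Icc (0:ℝ) p.T) :
    I2 (dx (dx S.w)) t ≤ 2 * C * IR S S.W t + 2 * I2 (dx S.b) t :=
  Ix_le2 _ _ (fun x hx => by
    have m := S.eqw x hx t ht
    have hρ := h.ρ x hx t ht
    have rp := S.ρp x hx t ht
    have e : (dx (dx S.w)).f x t = S.ρ.f x t * S.W.f x t + -(dx S.b).f x t := by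
      simp only [Flow.W, add_f, sub_f, mul_f, neg_f, cst_f, xx_f, dx_add, dt_add, dx_sub, dt_sub, dx_neg, dt_neg, dx_mul, dt_mul, dx_cst, dt_cst, dx_xx, dt_xx, dt_dx]; linarith
    rw [e]
    have := sq2 (S.ρ.f x t * S.W.f x t) (-(dx S.b).f x t)
    have := mul_le_mul_of_nonneg_right hρ (by positivity : 0 ≤ S.ρ.f x t * S.W.f x t ^ 2)
    linarith)

theorem bxx_aux {S : Flow p} {C t : ℝ} (h : H1 S C) (ht : t ∈ Icc (0:ℝ) p.T) :
    I2 (dx (dx S.b)) t ≤ 3 * I2 S.Bd t + 3 * C * I2 (dx S.u) t + 3 * I2 (dx S.w) t :=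
  Ix_le3 _ _ _ (fun x hx => by
    have m := S.eqb x hx t ht
    have hb := h.bs hx ht
    have e : (dx (dx S.b)).f x t = S.Bd.f x t + (dx S.u).f x t * S.b.f x t + -(dx S.w).f x t := by
      simp only [Flow.Bd, add_f, sub_f, mul_f, neg_f, cst_f, xx_f, dx_add, dt_add, dx_sub, dt_sub, dx_neg, dt_neg, dx_mul, dt_mul, dx_cst, dt_cst, dx_xx, dt_xx, dt_dx]; linarith
    rw [e]
    have := sq3 (S.Bd.f x t) ((dx S.u).f x t * S.b.f x t) (-(dx S.w).f x t)
    have := mul_le_mul_of_nonneg_right hb (sq_nonneg ((dx S.u).f x t))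
    linarith)

set_option maxHeartbeats 1000000 in
theorem uxx_aux {S : Flow p} {C t R : ℝ} (h : H1 S C) (ht : t ∈ Icc (0:ℝ) p.T)
    (hR : ∀ x ∈ Icc (0:ℝ) 1, S.θ.f x t ^ 2 ≤ R) :
    I2 (dx (dx S.u)) t ≤ 5 * C * IR S S.U t + 5 * R * I2 (dx S.ρ) t + 5 * (C ^ 2 * p.C₀ ^ 2) * Ik S t
      + 5 * C * I2 (dx S.b) t + 5 * C * I2 (dx S.c) t :=
  Ix_le5 _ _ _ _ _ (fun x hx => by
    have hb := h.bs hx ht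
    have hc := h.cs hx ht
    have hρ := h.ρ x hx t ht
    have rp := S.ρp x hx t ht
    have hθ := hR x hx
    have k1 := S.θx_le x t
    rw [S.uxx_eq hx ht]
    have := sq5 (S.ρ.f x t * S.U.f x t) ((dx S.ρ).f x t * S.θ.f x t) (S.ρ.f x t * (dx S.θ).f x t)
      (S.b.f x t * (dx S.b).f x t) (S.c.f x t * (dx S.c).f x t)
    have a1 := mul_le_mul_of_nonneg_right hρ (by positivity : 0 ≤ S.ρ.f x t * S.U.f x t ^ 2)
    have a2 := mul_le_mul_of_nonneg_right hθ (sq_nonneg ((dx S.ρ).f x t))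
    have a3 := mul_le_mul (pow_le_pow_left₀ rp.le hρ 2) k1 (sq_nonneg _) (by positivity)
    have a4 := mul_le_mul_of_nonneg_right hb (sq_nonneg ((dx S.b).f x t))
    have a5 := mul_le_mul_of_nonneg_right hc (sq_nonneg ((dx S.c).f x t))
    linarith)

set_option maxHeartbeats 1000000 in
theorem stepH2 (p : Par) : ∃ C, ∀ S : Flow p, H2 S C := by
  obtain ⟨C, hC, h⟩ := stepD2 p
  have hC1 := p.hC₀
  have hq := p.hq
  set A1 := 5 * C + 5 * (p.C₀ ^ 2 * C) * C + 5 * (C ^ 2 * p.C₀ ^ 2) + 10 * C * C with hA1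
  set A2 := 2 * C + 2 * A1 with hA2
  set A3 := 3 + 3 * C * C + 3 * C with hA3
  set A4 := 8 * p.C₀ ^ 2 + 2 * (p.C₀ ^ 2 * (p.q + 1)) ^ 2 * C with hA4
  have p1 : 0 ≤ A1 := by positivity
  have p3 : 0 ≤ A3 := by positivity
  have p4 : 0 ≤ A4 := by positivity
  have p5 : 0 ≤ p.C₀ ^ 2 * C := by positivity
  refine ⟨10 * C + 2 * A1 + 2 * A3 + A4 + p.C₀ ^ 2 * C, fun S => ?_⟩
  set D := 10 * C + 2 * A1 + 2 * A3 + A4 + p.C₀ ^ 2 * C with hD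
  obtain ⟨h1, hmI, hrx⟩ := h S
  have hs : H1 S.swap C := (h S.swap).1
  have up : ∀ t ∈ Icc (0:ℝ) p.T, ∀ x y, y ≤ D → x ≤ y * H1.m S t → x ≤ D * H1.m S t := fun t ht x y hy hx =>
    hx.trans (mul_le_mul_of_nonneg_right hy (by linarith [(H1.m_ge S ht).1]))
  have hθ : ∀ x ∈ Icc (0:ℝ) 1, ∀ t ∈ Icc (0:ℝ) p.T, S.θ.f x t ^ 2 ≤ p.C₀ ^ 2 * C * H1.m S t := by
    intro x hx t ht
    have := h1.θs hx ht
    have := mul_le_mul_of_nonneg_left (H1.m_ge S ht).2.2.2.2.2.2.1 p5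
    linarith
  have hK : ∀ x ∈ Icc (0:ℝ) 1, ∀ t ∈ Icc (0:ℝ) p.T, p.K (S.θ.f x t) ^ 2 ≤ C * H1.m S t := by
    intro x hx t ht
    have := h1.K x hx t ht
    have := mul_le_mul_of_nonneg_left (H1.m_ge S ht).2.2.2.2.2.2.1 h1.nn
    linarith
  have huxx : ∀ t ∈ Icc (0:ℝ) p.T, I2 (dx (dx S.u)) t ≤ A1 * H1.m S t := fun t ht => by
    have a := uxx_aux h1 ht (R := p.C₀ ^ 2 * C * H1.m S t) (fun x hx => hθ x hx t ht)
    obtain ⟨m1, m2, -, -, -, -, m3, -⟩ := H1.m_ge S ht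
    obtain ⟨-, -, -, b1, c1⟩ := h1.Ux ht
    have m0 : 0 ≤ H1.m S t := by linarith
    have q1 := mul_le_mul_of_nonneg_left m2 (by positivity : 0 ≤ 5 * C)
    have q2 := mul_le_mul_of_nonneg_left (hrx t ht) (by positivity : 0 ≤ 5 * (p.C₀ ^ 2 * C * H1.m S t))
    have q3 := mul_le_mul_of_nonneg_left (by linarith : Ik S t ≤ H1.m S t) (by positivity : 0 ≤ 5 * (C ^ 2 * p.C₀ ^ 2))
    have q4 := mul_le_mul_of_nonneg_left b1 (by positivity : 0 ≤ 5 * C)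
    have q5 := mul_le_mul_of_nonneg_left c1 (by positivity : 0 ≤ 5 * C)
    have q6 := mul_le_mul_of_nonneg_left m1 (by positivity : 0 ≤ 10 * C * C)
    rw [hA1]
    linarith
  have hwxx : ∀ t ∈ Icc (0:ℝ) p.T, I2 (dx (dx S.w)) t ≤ (4 * C) * H1.m S t := fun t ht => by
    have a := wxx_aux h1 ht
    obtain ⟨m1, -, m2, -, -, -, m3, -⟩ := H1.m_ge S ht
    obtain ⟨-, -, -, b1, c1⟩ := h1.Ux ht
    have q1 := mul_le_mul_of_nonneg_left m2 (by positivity : 0 ≤ 2 * C)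
    have q6 := mul_le_mul_of_nonneg_left m1 (by positivity : 0 ≤ 2 * C)
    linarith
  have hvxx : ∀ t ∈ Icc (0:ℝ) p.T, I2 (dx (dx S.v)) t ≤ (4 * C) * H1.m S t := fun t ht => by
    have a : I2 (dx (dx S.v)) t ≤ 2 * C * IR S S.V t + 2 * I2 (dx S.c) t := wxx_aux hs ht
    obtain ⟨m1, -, -, m2, -, -, m3, -⟩ := H1.m_ge S ht
    obtain ⟨-, -, -, b1, c1⟩ := h1.Ux ht
    have q1 := mul_le_mul_of_nonneg_left m2 (by positivity : 0 ≤ 2 * C)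
    have q6 := mul_le_mul_of_nonneg_left m1 (by positivity : 0 ≤ 2 * C)
    linarith
  have hbxx : ∀ t ∈ Icc (0:ℝ) p.T, I2 (dx (dx S.b)) t ≤ A3 * H1.m S t := fun t ht => by
    have a := bxx_aux h1 ht
    obtain ⟨m1, -, -, -, m2, -, m3, -⟩ := H1.m_ge S ht
    obtain ⟨u1, w1, v1, b1, c1⟩ := h1.Ux ht
    have q1 := mul_le_mul_of_nonneg_left u1 (by positivity : 0 ≤ 3 * C)
    have q6 := mul_le_mul_of_nonneg_left m1 (by positivity : 0 ≤ 3 * C + 3 * C * C)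
    rw [hA3]
    linarith
  have hcxx : ∀ t ∈ Icc (0:ℝ) p.T, I2 (dx (dx S.c)) t ≤ A3 * H1.m S t := fun t ht => by
    have a : I2 (dx (dx S.c)) t ≤ 3 * I2 S.Cd t + 3 * C * I2 (dx S.u) t + 3 * I2 (dx S.v) t := bxx_aux hs ht
    obtain ⟨m1, -, -, -, -, m2, m3, -⟩ := H1.m_ge S ht
    obtain ⟨u1, w1, v1, b1, c1⟩ := h1.Ux ht
    have q1 := mul_le_mul_of_nonneg_left u1 (by positivity : 0 ≤ 3 * C)
    have q6 := mul_le_mul_of_nonneg_left m1 (by positivity : 0 ≤ 3 * C + 3 * C * C)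
    rw [hA3]
    linarith
  have mm : ∀ t ∈ Icc (0:ℝ) p.T, 1 ≤ H1.m S t := fun t ht => (H1.m_ge S ht).1
  refine ⟨h1.mono (by linarith), hmI.trans (by linarith), fun t ht => (hrx t ht).trans (by linarith),
    fun t ht => up t ht _ _ (by linarith) (huxx t ht), fun t ht => up t ht _ _ (by linarith) (hwxx t ht),
    fun t ht => up t ht _ _ (by linarith) (hvxx t ht), fun t ht => up t ht _ _ (by linarith) (hbxx t ht),
    fun t ht => up t ht _ _ (by linarith) (hcxx t ht), 
    fun x hx t ht => up t ht _ _ ?_ (supf (h1.Ux ht).1 (huxx t ht) hx h1.nn (mm t ht)),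
    fun x hx t ht => up t ht _ _ ?_ (supf (h1.Ux ht).2.1 (hwxx t ht) hx h1.nn (mm t ht)),
    fun x hx t ht => up t ht _ _ ?_ (supf (h1.Ux ht).2.2.1 (hvxx t ht) hx h1.nn (mm t ht)),
    fun x hx t ht => up t ht _ _ ?_ (supf (h1.Ux ht).2.2.2.1 (hbxx t ht) hx h1.nn (mm t ht)),
    fun x hx t ht => up t ht _ _ ?_ (supf (h1.Ux ht).2.2.2.2 (hcxx t ht) hx h1.nn (mm t ht)),
    fun x hx t ht => up t ht _ (2 * C) ?_ ?_,
    fun x hx t ht => up t ht _ _ ?_ (hθ x hx t ht),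
    fun x hx t ht => up t ht _ _ ?_ (hK x hx t ht),
    fun x hx t ht => up t ht _ A4 ?_ ?_⟩
  any_goals linarith
  · have := h1.Fs hx ht
    have := mul_le_mul_of_nonneg_left (H1.m_ge S ht).2.2.2.2.2.2.2 (by linarith : 0 ≤ 2 * C)
    linarith
  · have r := p.κ_le (S.θp x hx t ht).le
    have r1 := pow_le_pow_left₀ (p.κ_pos (S.θ.f x t)).le r 2
    have r2 := sq2 (2 * p.C₀) (p.C₀ ^ 2 * (p.q + 1) * p.K (S.θ.f x t))
    have r3 := mul_le_mul_of_nonneg_left (hK x hx t ht) (by positivity : 0 ≤ 2 * (p.C₀ ^ 2 * (p.q + 1)) ^ 2)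
    have r4 := mul_le_mul_of_nonneg_left (mm t ht) (by positivity : 0 ≤ 8 * p.C₀ ^ 2)
    rw [hA4]
    linarith

end MHD

namespace MHD

variable {p : Par}

/-- weight vanishing at the boundary -/
def GG : SF := xx * (cst 1 - xx)

theorem GG_f (x t : ℝ) : GG.f x t = x * (1 - x) := rfl

theorem GG_bd {x : ℝ} (hx : x ∈ Icc (0:ℝ) 1) (t : ℝ) : 0 ≤ GG.f x t ∧ GG.f x t ≤ 1 := by
  rw [GG_f]
  have := mul_nonneg hx.1 (by linarith [hx.2] : 0 ≤ 1 - x)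
  exact ⟨this, by nlinarith [sq_nonneg x, hx.2]⟩

theorem dGG_f (x t : ℝ) : (dx GG).f x t = 1 - 2 * x := by
  simp only [GG, add_f, sub_f, mul_f, neg_f, cst_f, xx_f, dx_add, dt_add, dx_sub, dt_sub, dx_neg, dt_neg, dx_mul, dt_mul, dx_cst, dt_cst, dx_xx, dt_xx, dt_dx]; ring

theorem dtGG_f (x t : ℝ) : (dt GG).f x t = 0 := by
  simp only [GG, add_f, sub_f, mul_f, neg_f, cst_f, xx_f, dx_add, dt_add, dx_sub, dt_sub, dx_neg, dt_neg, dx_mul, dt_mul, dx_cst, dt_cst, dx_xx, dt_xx, dt_dx]; ring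

theorem D3_arith {G G' bxx bxt ub wxx : ℝ} (hG0 : 0 ≤ G) (hG1 : G ≤ 1) (hG' : G' ^ 2 ≤ 1) :
    -(G ^ 2 * bxt ^ 2) - G ^ 2 * (ub - wxx) * bxt - 2 * (G * G') * bxx * bxt ≤
    -(1/2) * (G * bxt) ^ 2 + 2 * ub ^ 2 + 2 * wxx ^ 2 + 4 * bxx ^ 2 := by
  have a : 0 ≤ (1 - G ^ 2) := by nlinarith
  have h1 := mul_nonneg a (sq_nonneg (ub - wxx))
  have h2 := mul_nonneg (by linarith : 0 ≤ 1 - G' ^ 2) (sq_nonneg bxx)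
  linarith [sq_nonneg (1/2 * G * bxt + G * (ub - wxx)), sq_nonneg (1/2 * G * bxt + 2 * G' * bxx), sq_nonneg (ub + wxx)]

set_option maxHeartbeats 1000000 in
theorem D3a {S : Flow p} {C : ℝ} (h : H2 S C) {t : ℝ} (ht : t ∈ Icc (0:ℝ) p.T) :
    1/2 * I2 (GG * dx (dx S.b)) t + ∫ s in (0:ℝ)..t, 1/2 * I2 (GG * dx (dt S.b)) s ≤ 
      1/2 * p.N + (12 * C ^ 2 + 24 * C ^ 2 + 6 * C) * C := by
  have hC := h.h1.one
  have id := masterI (T := p.T) (cst (1/2) * (GG * dx (dx S.b)) * (GG * dx (dx S.b)))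
    (-(GG * GG * dx (dx S.b) * dx (dt S.b)))
    (fun x t => -(GG.f x t ^ 2 * (dx (dt S.b)).f x t ^ 2) 
      - GG.f x t ^ 2 * ((dx (dx (S.u * S.b))).f x t - (dx (dx S.w)).f x t) * (dx (dt S.b)).f x t
      - 2 * (GG.f x t * (dx GG).f x t) * (dx (dx S.b)).f x t * (dx (dt S.b)).f x t)
    (fun x hx t ht => by
      have m1 := dx_congr (F := dt S.b) (G := dx (dx S.b) - dx S.u * S.b - S.u * dx S.b + dx S.w) (T := p.T) S.eqb x hx t ht
      simp only [add_f, sub_f, mul_f, neg_f, cst_f, xx_f, dx_add, dt_add, dx_sub, dt_sub, dx_neg, dt_neg, dx_mul, dt_mul, dx_cst, dt_cst, dx_xx, dt_xx, dt_dx] at m1 ⊢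
      have e : (dx (dx (dx S.b))).f x t = (dx (dt S.b)).f x t 
        + ((dx (dx S.u)).f x t * S.b.f x t + (dx S.u).f x t * (dx S.b).f x t + ((dx S.u).f x t * (dx S.b).f x t + S.u.f x t * (dx (dx S.b)).f x t))
        - (dx (dx S.w)).f x t := by linarith
      rw [e, dtGG_f]; ring)
    (fun t ht => by simp only [add_f, sub_f, mul_f, neg_f, cst_f, xx_f, dx_add, dt_add, dx_sub, dt_sub, dx_neg, dt_neg, dx_mul, dt_mul, dx_cst, dt_cst, dx_xx, dt_xx, dt_dx, GG_f]; ring)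
    (fun t ht => by simp only [add_f, sub_f, mul_f, neg_f, cst_f, xx_f, dx_add, dt_add, dx_sub, dt_sub, dx_neg, dt_neg, dx_mul, dt_mul, dx_cst, dt_cst, dx_xx, dt_xx, dt_dx, GG_f]; ring)
  replace id := id t ht
  have hX : ∀ t, Ix (cst (1/2) * (GG * dx (dx S.b)) * (GG * dx (dx S.b))).f t = 1/2 * I2 (GG * dx (dx S.b)) t := fun t => by
    rw [← Ix_mul]; apply Ix_congr; intro x hx; simp only [add_f, sub_f, mul_f, neg_f, cst_f, xx_f, dx_add, dt_add, dx_sub, dt_sub, dx_neg, dt_neg, dx_mul, dt_mul, dx_cst, dt_cst, dx_xx, dt_xx, dt_dx]; ring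
  rw [hX, hX] at id
  have i0 : I2 (GG * dx (dx S.b)) 0 ≤ 1 * p.N := by
    have := Ix_le1 (t := 0) (f := fun x t => (GG * dx (dx S.b)).f x t ^ 2) (g₁ := fun x t => (dx (dx S.b)).f x t ^ 2) 1 (fun x hx => by
      have := GG_bd hx 0
      simp only [mul_f]
      rw [mul_pow]
      exact mul_le_mul_of_nonneg_right (pow_le_one₀ this.1 this.2) (sq_nonneg _))
    have := S.jb
    simp only [I2] at *
    linarith
  have i1 := int_le2 ht.1 (f := Ix (fun x t => -(GG.f x t ^ 2 * (dx (dt S.b)).f x t ^ 2) 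
      - GG.f x t ^ 2 * ((dx (dx (S.u * S.b))).f x t - (dx (dx S.w)).f x t) * (dx (dt S.b)).f x t
      - 2 * (GG.f x t * (dx GG).f x t) * (dx (dx S.b)).f x t * (dx (dt S.b)).f x t))
      (g₁ := fun s => 1/2 * I2 (GG * dx (dt S.b)) s) (g₂ := H1.m S) (-1) (12 * C ^ 2 + 24 * C ^ 2 + 6 * C) (fun s hs => by
    have hs' : s ∈ Icc (0:ℝ) p.T := ⟨hs.1, hs.2.trans ht.2⟩
    have j := Ix_le5 (t := s) (f := fun x t => -(GG.f x t ^ 2 * (dx (dt S.b)).f x t ^ 2) 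
      - GG.f x t ^ 2 * ((dx (dx (S.u * S.b))).f x t - (dx (dx S.w)).f x t) * (dx (dt S.b)).f x t
      - 2 * (GG.f x t * (dx GG).f x t) * (dx (dx S.b)).f x t * (dx (dt S.b)).f x t)
      (g₁ := fun x t => (GG * dx (dt S.b)).f x t ^ 2) (g₂ := fun x t => (dx (dx S.u)).f x t ^ 2)
      (g₃ := fun x t => (dx S.b).f x t ^ 2) (g₄ := fun x t => (dx (dx S.w)).f x t ^ 2) (g₅ := fun x t => (dx (dx S.b)).f x t ^ 2)
      (-(1/2)) (6 * C) (24 * (C * H1.m S s)) 2 (4 + 6 * C) (fun x hx => by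
        have g1 := GG_bd hx s
        have g2 : (dx GG).f x s ^ 2 ≤ 1 := by
          rw [dGG_f]; nlinarith [hx.1, hx.2]
        have a := D3_arith (bxx := (dx (dx S.b)).f x s) (bxt := (dx (dt S.b)).f x s)
          (ub := (dx (dx (S.u * S.b))).f x s) (wxx := (dx (dx S.w)).f x s) g1.1 g1.2 g2
        refine a.trans ?_
        simp only [add_f, sub_f, mul_f, neg_f, cst_f, xx_f, dx_add, dt_add, dx_sub, dt_sub, dx_neg, dt_neg, dx_mul, dt_mul, dx_cst, dt_cst, dx_xx, dt_xx, dt_dx]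
        have b1 := sq3 ((dx (dx S.u)).f x s * S.b.f x s) (2 * ((dx S.u).f x s * (dx S.b).f x s)) (S.u.f x s * (dx (dx S.b)).f x s)
        have e : (dx (dx S.u)).f x s * S.b.f x s + (dx S.u).f x s * (dx S.b).f x s + ((dx S.u).f x s * (dx S.b).f x s + S.u.f x s * (dx (dx S.b)).f x s)
          = (dx (dx S.u)).f x s * S.b.f x s + 2 * ((dx S.u).f x s * (dx S.b).f x s) + S.u.f x s * (dx (dx S.b)).f x s := by ring
        rw [e]
        have c1 := mul_le_mul_of_nonneg_right (h.h1.bs hx hs') (sq_nonneg ((dx (dx S.u)).f x s))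
        have c2 := mul_le_mul_of_nonneg_right (h.h1.us hx hs') (sq_nonneg ((dx (dx S.b)).f x s))
        have c3 := mul_le_mul_of_nonneg_right (h.ux x hx s hs') (sq_nonneg ((dx S.b).f x s))
        linarith)
    refine j.trans ?_
    have m1 := (H1.m_ge S hs').1
    have q1 := mul_le_mul_of_nonneg_left (h.uxx s hs') (by positivity : 0 ≤ 6 * C)
    have q2 := mul_le_mul_of_nonneg_left (h.h1.Ux hs').2.2.2.1 (by positivity : 0 ≤ 24 * (C * H1.m S s))
    have q3 := h.wxx s hs'
    have q4 := mul_le_mul_of_nonneg_left (h.bxx s hs') (by positivity : 0 ≤ 4 + 6 * C)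
    linarith)
  have i2 := (int_ext ht (f := H1.m S) (fun s hs => by linarith [(H1.m_ge S hs).1])).trans h.mI
  have i3 := mul_le_mul_of_nonneg_left i2 (by positivity : 0 ≤ 12 * C ^ 2 + 24 * C ^ 2 + 6 * C)
  linarith

theorem Gsup {f : SF} {x t : ℝ} (hx : x ∈ Icc (0:ℝ) 1) : GG.f x t * f.f x t ^ 2 ≤ 2 * I2 f t + I2 (GG * dx f) t := by
  have h1 := ftc (g := fun x => (GG * f * f).f x t) (g' := fun x => (dx (GG * f * f)).f x t) (a := 0) (b := x)
    (fun y _ => SF.hx _ y t) hx.1 (by fun_prop)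
  have h2 := int_le2 (a := 0) (b := x) hx.1 (f := fun x => (dx (GG * f * f)).f x t) (g₁ := fun x => f.f x t ^ 2)
    (g₂ := fun x => (GG * dx f).f x t ^ 2) 2 1 (fun y hy => by
      have := dGG_f y t
      have hy' : y ∈ Icc (0:ℝ) 1 := ⟨hy.1, hy.2.trans hx.2⟩
      simp only [dx_mul, add_f, mul_f]
      rw [this]
      have := mul_nonneg hy'.1 (sq_nonneg (f.f y t))
      linarith [sq_nonneg (f.f y t - GG.f y t * (dx f).f y t)])
  have h3 := int_ext (T := 1) hx (f := fun x => f.f x t ^ 2) (fun _ _ => sq_nonneg _)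
  have h4 := int_ext (T := 1) hx (f := fun x => (GG * dx f).f x t ^ 2) (fun _ _ => sq_nonneg _)
  have e1 : I2 f t = ∫ z in (0:ℝ)..1, f.f z t ^ 2 := rfl
  have e2 : I2 (GG * dx f) t = ∫ z in (0:ℝ)..1, (GG * dx f).f z t ^ 2 := rfl
  simp only [mul_f] at h1 h2 h4 e2
  rw [GG_f 0] at h1
  simp only [mul_f, I2] at *
  linarith

theorem stepD3 (p : Par) : ∃ C, 1 ≤ C ∧ ∀ S : Flow p, H2 S C ∧
    (∀ x ∈ Icc (0:ℝ) 1, ∀ t ∈ Icc (0:ℝ) p.T, GG.f x t * (dx S.b).f x t ^ 2 ≤ C ∧ GG.f x t * (dx S.c).f x t ^ 2 ≤ C) ∧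
    ∫ s in (0:ℝ)..p.T, I2 (GG * dx (dt S.b)) s ≤ C := by
  obtain ⟨C, h⟩ := stepH2 p
  have hN := p.hN
  by_cases hne : Nonempty (Flow p)
  swap
  · exact ⟨1, le_rfl, fun S => (hne ⟨S⟩).elim⟩
  have hC : 1 ≤ C := hne.elim fun S => (h S).h1.one
  set A := 1/2 * p.N + (12 * C ^ 2 + 24 * C ^ 2 + 6 * C) * C with hA
  have hA0 : C ≤ A := by rw [hA]; nlinarith
  have hmono : ∀ S : Flow p, H2 S (4 * A) := fun S => by
    have h1 := h S
    have up : ∀ t ∈ Icc (0:ℝ) p.T, C * H1.m S t ≤ 4 * A * H1.m S t := fun t ht =>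
      mul_le_mul_of_nonneg_right (by linarith) (by linarith [(H1.m_ge S ht).1])
    exact ⟨h1.h1.mono (by linarith), h1.mI.trans (by linarith), fun t ht => (h1.rx t ht).trans (by linarith),
      fun t ht => (h1.uxx t ht).trans (up t ht), fun t ht => (h1.wxx t ht).trans (up t ht),
      fun t ht => (h1.vxx t ht).trans (up t ht), fun t ht => (h1.bxx t ht).trans (up t ht),
      fun t ht => (h1.cxx t ht).trans (up t ht), fun x hx t ht => (h1.ux x hx t ht).trans (up t ht),
      fun x hx t ht => (h1.wx x hx t ht).trans (up t ht), fun x hx t ht => (h1.vx x hx t ht).trans (up t ht),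
      fun x hx t ht => (h1.bx x hx t ht).trans (up t ht), fun x hx t ht => (h1.cx x hx t ht).trans (up t ht),
      fun x hx t ht => (h1.F x hx t ht).trans (up t ht), fun x hx t ht => (h1.θ x hx t ht).trans (up t ht),
      fun x hx t ht => (h1.K x hx t ht).trans (up t ht), fun x hx t ht => (h1.κ x hx t ht).trans (up t ht)⟩
  have key : ∀ S : Flow p, ∀ x ∈ Icc (0:ℝ) 1, ∀ t ∈ Icc (0:ℝ) p.T, GG.f x t * (dx S.b).f x t ^ 2 ≤ 4 * A := by
    intro S x hx t ht
    have a := D3a (h S) ht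
    have b := Gsup (f := dx S.b) (t := t) hx
    have c : 0 ≤ ∫ s in (0:ℝ)..t, 1/2 * I2 (GG * dx (dt S.b)) s := int_nonneg ht.1 fun s hs => by
      have := I2_nonneg (GG * dx (dt S.b)) s
      linarith
    have d := ((h S).h1.Ux ht).2.2.2.1
    linarith
  refine ⟨4 * A, by linarith, fun S => ⟨hmono S, fun x hx t ht => ⟨key S x hx t ht, key S.swap x hx t ht⟩, ?_⟩⟩
  have a := D3a (h S) p.h1
  have b := I2_nonneg (GG * dx (dx S.b)) p.T
  rw [intervalIntegral.integral_const_mul] at a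
  linarith

end MHD

namespace MHD

variable {p : Par}

theorem int_isqrt {η : ℝ} (h0 : 0 < η) (h1 : η ≤ 1) : ∫ x in (0:ℝ)..1, 1 / √(|x| + η) ≤ 4 := by
  have hc : Continuous (fun x : ℝ => 1 / √(|x| + η)) := by
    refine continuous_const.div (by fun_prop) fun x => ?_
    have : 0 < |x| + η := by positivity
    positivity
  have e : ∫ x in (0:ℝ)..1, 1 / √(|x| + η) = ∫ x in (0:ℝ)..1, 2 * (1 / (2 * √(x + η))) := by
    apply intervalIntegral.integral_congr
    intro x hx
    rw [uIcc_of_le zero_le_one] at hx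
    have : 0 < x + η := by linarith [hx.1]
    have : 0 < √(x + η) := by positivity
    simp only [abs_of_nonneg hx.1]
    field_simp
  have d : ∀ x ∈ Icc (0:ℝ) 1, HasDerivAt (fun x => 2 * √(x + η)) (2 * (1 / (2 * √(x + η)))) x := fun x hx => by
    have : 0 < x + η := by linarith [hx.1]
    have := ((hasDerivAt_id x).add_const η).sqrt (by simp only [id]; exact this.ne')
    simpa using this.const_mul 2
  have := intervalIntegral.integral_eq_sub_of_hasDerivAt (a := 0) (b := 1) (f := fun x => 2 * √(x + η)) (f' := fun x => 2 * (1 / (2 * √(x + η))))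
    (by rw [uIcc_of_le zero_le_one]; exact d) (by
      refine ((ii hc 0 1).congr ?_)
      intro x hx
      rw [uIoc_of_le zero_le_one] at hx
      have : 0 < x + η := by linarith [hx.1]
      have : 0 < √(x + η) := by positivity
      simp only [abs_of_nonneg hx.1.le]
      field_simp)
  rw [e, this]
  have a : √(1 + η) ≤ 2 := Real.sqrt_le_iff.mpr ⟨by norm_num, by linarith⟩
  have b := Real.sqrt_nonneg (0 + η)
  linarith

theorem weight {η : ℝ} (h0 : 0 < η) (h1 : η ≤ 1) : ∃ h h' f : ℝ → ℝ, Continuous h ∧ Continuous h' ∧ Continuous f ∧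
    (∀ x, HasDerivAt h (h' x) x) ∧ (∀ x, HasDerivAt h' (-f x) x) ∧ h 0 = 0 ∧ h 1 = 0 ∧
    ∀ x ∈ Icc (0:ℝ) 1, 0 ≤ h x ∧ h x ≤ 16 * (x * (1 - x)) ∧ |h' x| ≤ 8 ∧ 1 / √(x + η) ≤ f x ∧ 1 / √(1 - x + η) ≤ f x := by
  have hc : Continuous (fun x : ℝ => 1 / √(|x| + η)) := by
    refine continuous_const.div (by fun_prop) fun x => ?_
    have : 0 < |x| + η := by positivity
    positivity
  have hc2 : Continuous (fun x : ℝ => 1 / √(|1 - x| + η)) := 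
    hc.comp (by fun_prop : Continuous fun x : ℝ => 1 - x)
  set f : ℝ → ℝ := fun x => 1 / √(|x| + η) + 1 / √(|1 - x| + η) with hf
  have cf : Continuous f := hc.add hc2
  have f0 : ∀ x, 0 ≤ f x := fun x => by rw [hf]; positivity
  have fI : ∫ x in (0:ℝ)..1, f x ≤ 8 := by
    rw [hf, intervalIntegral.integral_add (ii hc 0 1) (ii hc2 0 1)]
    have := int_isqrt h0 h1
    have e := intervalIntegral.integral_comp_sub_left (fun x : ℝ => 1 / √(|x| + η)) (1:ℝ) (a := 0) (b := 1)
    simp only [sub_self, sub_zero] at e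
    rw [e]; linarith
  set F := prim f with hF
  have dF : ∀ x, HasDerivAt F (f x) x := fun x => prim_hd cf x
  have cF : Continuous F := prim_cont cf
  have F0 : ∀ x ∈ Icc (0:ℝ) 1, 0 ≤ F x ∧ F x ≤ 8 := fun x hx => 
    ⟨int_nonneg hx.1 fun r _ => f0 r, (int_ext hx (fun r _ => f0 r) cf).trans fI⟩
  have Fm : ∀ x y, x ≤ y → F x ≤ F y := fun x y hxy => by
    have := intervalIntegral.integral_interval_sub_left (ii cf 0 y) (ii cf 0 x)
    have h2 := int_nonneg hxy (f := f) fun r _ => f0 r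
    simp only [hF, prim]; linarith
  set c := ∫ x in (0:ℝ)..1, F x with hcc
  have c0 : 0 ≤ c := int_nonneg zero_le_one fun x hx => (F0 x hx).1
  have c1 : c ≤ 8 := by
    have := int_mono zero_le_one (f := F) (g := fun _ => 8) (fun x hx => (F0 x hx).2) cF continuous_const
    simpa using this
  have dh : ∀ x, HasDerivAt (fun x => c * x - prim F x) (c - F x) x := fun x => by
    simpa using ((hasDerivAt_id x).const_mul c).fun_sub (prim_hd cF x)
  refine ⟨fun x => c * x - prim F x, fun x => c - F x, f, ?_, by fun_prop, cf, dh, ?_, ?_, ?_, fun x hx => ⟨?_, ?_, ?_, ?_, ?_⟩⟩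
  · have := prim_cont cF; fun_prop
  · intro x; simpa using (dF x).const_sub c
  · simp [prim]
  · simp [prim, hcc]
  · have a : prim F x ≤ F x * x := by
      have := int_mono hx.1 (f := F) (g := fun _ => F x) (fun r hr => Fm r x hr.2) cF continuous_const
      simp only [intervalIntegral.integral_const, sub_zero, smul_eq_mul] at this
      unfold prim; linarith
    have b : F x * (1 - x) ≤ c - prim F x := by
      have := int_mono hx.2 (f := fun _ => F x) (g := F) (fun r hr => Fm x r hr.1) continuous_const cF
      simp only [intervalIntegral.integral_const, smul_eq_mul] at this
      have e := intervalIntegral.integral_add_adjacent_intervals (ii cF 0 x) (ii cF x 1)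
      unfold prim; linarith
    have a1 := mul_le_mul_of_nonneg_left b hx.1
    have a2 := mul_le_mul_of_nonneg_left a (by linarith [hx.2] : 0 ≤ 1 - x)
    simp only
    linarith
  · have a : 0 ≤ prim F x := int_nonneg hx.1 fun r hr => (F0 r ⟨hr.1, hr.2.trans hx.2⟩).1
    have b : c - prim F x ≤ 8 * (1 - x) := by
      have := int_mono hx.2 (f := F) (g := fun _ => 8) (fun r hr => (F0 r ⟨hx.1.trans hr.1, hr.2⟩).2) cF continuous_const 
      simp only [intervalIntegral.integral_const, smul_eq_mul] at this
      have e := intervalIntegral.integral_add_adjacent_intervals (ii cF 0 x) (ii cF x 1)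
      unfold prim; linarith
    have a1 := mul_le_mul_of_nonneg_right c1 hx.1
    have a2 := mul_nonneg c0 (by linarith [hx.2] : 0 ≤ 1 - x)
    simp only
    rcases le_total x (1/2) with h | h
    · have := mul_nonneg hx.1 (by linarith : 0 ≤ 1/2 - x)
      linarith
    · have := mul_nonneg (by linarith [hx.2] : 0 ≤ 1 - x) (by linarith : 0 ≤ x - 1/2)
      linarith
  · have := F0 x hx
    rw [abs_le]; constructor <;> simp only <;> linarith
  · rw [hf]; simp only [abs_of_nonneg hx.1]
    have : 0 ≤ 1 / √(|1 - x| + η) := by positivity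
    linarith
  · rw [hf]; simp only [abs_of_nonneg (by linarith [hx.2] : 0 ≤ 1 - x)]
    have : 0 ≤ 1 / √(|x| + η) := by positivity
    linarith

/-- regularized modulus of the transverse acceleration -/
def Flow.PW (S : Flow p) : SF := ⟨fun x t => √(1 + S.W.f x t ^ 2), by
  have h : ContDiff ℝ _ (Function.uncurry S.W.f) := S.W.sm
  have : Function.uncurry (fun x t => √(1 + S.W.f x t ^ 2)) = fun q => √(1 + (Function.uncurry S.W.f q) ^ 2) := by
    ext ⟨x, t⟩; rfl
  rw [this]
  exact ContDiff.sqrt (contDiff_const.add (h.pow 2)) fun q => by positivity⟩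

theorem Flow.PW_sq (S : Flow p) : S.PW * S.PW = cst 1 + S.W * S.W := SF.ext' fun x t => by
  simp only [add_f, sub_f, mul_f, neg_f, cst_f, xx_f, dx_add, dt_add, dx_sub, dt_sub, dx_neg, dt_neg, dx_mul, dt_mul, dx_cst, dt_cst, dx_xx, dt_xx, dt_dx]
  have : S.PW.f x t = √(1 + S.W.f x t ^ 2) := rfl
  rw [this, Real.mul_self_sqrt (by positivity)]; ring

theorem Flow.PW_ge (S : Flow p) (x t : ℝ) : 1 ≤ S.PW.f x t ∧ |S.W.f x t| ≤ S.PW.f x t := by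
  have : S.PW.f x t = √(1 + S.W.f x t ^ 2) := rfl
  rw [this]
  constructor
  · rw [Real.one_le_sqrt]; linarith [sq_nonneg (S.W.f x t)]
  · apply Real.abs_le_sqrt; linarith

theorem PN_arith {P Pt Px Pxx W Wt Wx Wxx r u g : ℝ} (hP : 1 ≤ P) (hWP : |W| ≤ P) (hr : 0 < r)
    (e0 : P * P = 1 + W * W) (e1 : P * Pt = W * Wt) (e2 : P * Px = W * Wx) (e3 : P * Pxx + Px * Px = W * Wxx + Wx * Wx)
    (e4 : r * (Wt + u * Wx) = Wxx + g) : r * (Pt + u * Px) - Pxx ≤ |g| := by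
  have h1 : P * (r * (Pt + u * Px) - Pxx) = W * g - (Wx ^ 2 - Px ^ 2) := by
    linear_combination r * e1 + r * u * e2 - e3 + W * e4
  have h2 : Px ^ 2 ≤ Wx ^ 2 := by
    have : P ^ 2 * (Wx ^ 2 - Px ^ 2) = Wx ^ 2 := by
      have : (P * Px) ^ 2 = (W * Wx) ^ 2 := by rw [e2]
      linear_combination -this + Wx ^ 2 * e0
    by_contra hh
    push Not at hh
    have : P ^ 2 * (Wx ^ 2 - Px ^ 2) < 0 := mul_neg_of_pos_of_neg (by positivity) (by linarith)
    linarith [sq_nonneg Wx]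
  have h3 : W * g ≤ P * |g| := by
    calc W * g ≤ |W * g| := le_abs_self _
      _ = |W| * |g| := abs_mul _ _
      _ ≤ P * |g| := mul_le_mul_of_nonneg_right hWP (abs_nonneg _)
  have : P * (r * (Pt + u * Px) - Pxx) ≤ P * |g| := by linarith
  exact le_of_mul_le_mul_left this (by linarith)

def Flow.gW (S : Flow p) : SF := -(dx (dx S.u * dx S.w)) + dx (dt S.b) + dx (S.u * dx S.b)

theorem Flow.W_eq (S : Flow p) : ∀ x ∈ Icc (0:ℝ) 1, ∀ t ∈ Icc (0:ℝ) p.T,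
    S.ρ.f x t * ((dt S.W).f x t + S.u.f x t * (dx S.W).f x t) = (dx (dx S.W)).f x t + S.gW.f x t := by
  intro x hx t ht
  have m := S.mass x hx t ht
  have h0 : ∀ x ∈ Icc (0:ℝ) 1, ∀ t ∈ Icc (0:ℝ) p.T, (S.ρ * S.W).f x t = (dx (dx S.w) + dx S.b).f x t := by
    intro x hx t ht
    have := S.eqw x hx t ht
    simp only [Flow.W, add_f, sub_f, mul_f, neg_f, cst_f, xx_f, dx_add, dt_add, dx_sub, dt_sub, dx_neg, dt_neg, dx_mul, dt_mul, dx_cst, dt_cst, dx_xx, dt_xx, dt_dx]; linarith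
  have h1 := dx_congr h0 x hx t ht
  have h2 := dt_congr p.hT h0 x hx t ht
  have h3 := h0 x hx t ht
  simp only [Flow.gW, Flow.W, add_f, sub_f, mul_f, neg_f, cst_f, xx_f, dx_add, dt_add, dx_sub, dt_sub, dx_neg, dt_neg, dx_mul, dt_mul, dx_cst, dt_cst, dx_xx, dt_xx, dt_dx] at h1 h2 h3 ⊢
  rw [m] at h2
  linear_combination h2 + S.u.f x t * h1 + (dx S.u).f x t * h3

theorem Flow.NW_le (S : Flow p) : ∀ x ∈ Icc (0:ℝ) 1, ∀ t ∈ Icc (0:ℝ) p.T,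
    (dt (S.ρ * S.PW) + dx (S.u * S.ρ * S.PW - dx S.PW)).f x t ≤ |S.gW.f x t| := by
  intro x hx t ht
  have m := S.mass x hx t ht
  have r := S.ρp x hx t ht
  have h0 := S.PW_sq
  have ht' := congrArg (fun F => F.f x t) (congrArg dt h0)
  have hx' := congrArg (fun F => F.f x t) (congrArg dx h0)
  have hxx' := congrArg (fun F => F.f x t) (congrArg dx (congrArg dx h0))
  have h00 := congrArg (fun F => F.f x t) h0
  simp only [add_f, sub_f, mul_f, neg_f, cst_f, xx_f, dx_add, dt_add, dx_sub, dt_sub, dx_neg, dt_neg, dx_mul, dt_mul, dx_cst, dt_cst, dx_xx, dt_xx, dt_dx] at ht' hx' hxx' h00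
  obtain ⟨q1, q2⟩ := S.PW_ge x t
  have a := PN_arith (Pt := (dt S.PW).f x t) (Px := (dx S.PW).f x t) (Pxx := (dx (dx S.PW)).f x t) 
    (Wt := (dt S.W).f x t) (u := S.u.f x t) q1 q2 r h00 (by linarith) (by linarith) (by linarith) (S.W_eq x hx t ht)
  simp only [add_f, sub_f, mul_f, neg_f, cst_f, xx_f, dx_add, dt_add, dx_sub, dt_sub, dx_neg, dt_neg, dx_mul, dt_mul, dx_cst, dt_cst, dx_xx, dt_xx, dt_dx]
  rw [m]
  linarith

end MHD

namespace MHD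

variable {p : Par}

theorem Ix_le10 {t : ℝ} {f a₁ a₂ a₃ a₄ a₅ a₆ a₇ a₈ a₉ a₁₀ : ℝ → ℝ → ℝ} (c : ℝ)
    (h : ∀ x ∈ Icc (0:ℝ) 1, f x t ≤ c * (a₁ x t + a₂ x t + a₃ x t + a₄ x t + a₅ x t + a₆ x t + a₇ x t + a₈ x t + a₉ x t + a₁₀ x t))
    (hf : Continuous (fun x => f x t) := by fun_prop)
    (h₁ : Continuous (fun x => a₁ x t) := by fun_prop)
    (h₂ : Continuous (fun x => a₂ x t) := by fun_prop)
    (h₃ : Continuous (fun x => a₃ x t) := by fun_prop)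
    (h₄ : Continuous (fun x => a₄ x t) := by fun_prop)
    (h₅ : Continuous (fun x => a₅ x t) := by fun_prop)
    (h₆ : Continuous (fun x => a₆ x t) := by fun_prop)
    (h₇ : Continuous (fun x => a₇ x t) := by fun_prop)
    (h₈ : Continuous (fun x => a₈ x t) := by fun_prop)
    (h₉ : Continuous (fun x => a₉ x t) := by fun_prop)
    (h₁₀ : Continuous (fun x => a₁₀ x t) := by fun_prop) :
    Ix f t ≤ c * (Ix a₁ t + Ix a₂ t + Ix a₃ t + Ix a₄ t + Ix a₅ t + Ix a₆ t + Ix a₇ t + Ix a₈ t + Ix a₉ t + Ix a₁₀ t) := by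
  have h1 := Ix_le1 (t := t) (f := f) (g₁ := fun x t => a₁ x t + a₂ x t + a₃ x t + a₄ x t + a₅ x t + (a₆ x t + a₇ x t + a₈ x t + a₉ x t + a₁₀ x t)) c
    (fun x hx => by have := h x hx; linarith)
  have h2 := Ix_le5 (t := t) (f := fun x t => a₁ x t + a₂ x t + a₃ x t + a₄ x t + a₅ x t) (g₁ := a₁) (g₂ := a₂) (g₃ := a₃) (g₄ := a₄) (g₅ := a₅) 1 1 1 1 1 (fun x hx => by linarith)
  have h3 := Ix_le5 (t := t) (f := fun x t => a₆ x t + a₇ x t + a₈ x t + a₉ x t + a₁₀ x t) (g₁ := a₆) (g₂ := a₇) (g₃ := a₈) (g₄ := a₉) (g₅ := a₁₀) 1 1 1 1 1 (fun x hx => by linarith)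
  have e1 : Ix (fun x t => a₁ x t + a₂ x t + a₃ x t + a₄ x t + a₅ x t) t = Ix a₁ t + Ix a₂ t + Ix a₃ t + Ix a₄ t + Ix a₅ t := by
    rw [Ix_add, Ix_add, Ix_add, Ix_add]
  have e2 : Ix (fun x t => a₆ x t + a₇ x t + a₈ x t + a₉ x t + a₁₀ x t) t = Ix a₆ t + Ix a₇ t + Ix a₈ t + Ix a₉ t + Ix a₁₀ t := by
    rw [Ix_add, Ix_add, Ix_add, Ix_add]
  have e3 : Ix (fun x t => a₁ x t + a₂ x t + a₃ x t + a₄ x t + a₅ x t + (a₆ x t + a₇ x t + a₈ x t + a₉ x t + a₁₀ x t)) t = 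
     Ix (fun x t => a₁ x t + a₂ x t + a₃ x t + a₄ x t + a₅ x t) t + Ix (fun x t => a₆ x t + a₇ x t + a₈ x t + a₉ x t + a₁₀ x t) t := by
    rw [Ix_add]
  rw [e3, e1, e2] at h1
  linarith

theorem gW_pt {S : Flow p} {x t : ℝ} (hx : x ∈ Icc (0:ℝ) 1) {h : ℝ} (h0 : 0 ≤ h) (h1 : h ≤ 16 * GG.f x t) :
    h * |S.gW.f x t| ≤ 8 * ((dx (dx S.u)).f x t ^ 2 + (dx S.w).f x t ^ 2 + (dx S.u).f x t ^ 2 + (dx (dx S.w)).f x t ^ 2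
      + 1 + (GG * dx (dt S.b)).f x t ^ 2 + (dx S.u).f x t ^ 2 + (dx S.b).f x t ^ 2 + S.u.f x t ^ 2 + (dx (dx S.b)).f x t ^ 2) := by
  obtain ⟨g0, g1⟩ := GG_bd hx t
  have s1 := mul_le_mul_of_nonneg_right h1 (abs_nonneg (S.gW.f x t))
  have e : GG.f x t * |S.gW.f x t| = |GG.f x t * S.gW.f x t| := by rw [abs_mul, abs_of_nonneg g0]
  have am : ∀ a b : ℝ, |GG.f x t * (a * b)| ≤ 1/2 * (a ^ 2 + b ^ 2) := fun a b => by
    rw [abs_mul, abs_of_nonneg g0]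
    have : |a * b| ≤ 1/2 * (a ^ 2 + b ^ 2) := by
      rw [abs_le]; constructor <;> linarith [sq_nonneg (a - b), sq_nonneg (a + b)]
    have := mul_le_mul_of_nonneg_right g1 (abs_nonneg (a * b))
    linarith
  have q1 := abs_le.mp (am ((dx (dx S.u)).f x t) ((dx S.w).f x t))
  have q2 := abs_le.mp (am ((dx S.u).f x t) ((dx (dx S.w)).f x t))
  have q3 := abs_le.mp (am ((dx S.u).f x t) ((dx S.b).f x t))
  have q4 := abs_le.mp (am (S.u.f x t) ((dx (dx S.b)).f x t))
  have q5 : |GG.f x t * S.gW.f x t| ≤ 1/2 * ((dx (dx S.u)).f x t ^ 2 + (dx S.w).f x t ^ 2 + (dx S.u).f x t ^ 2 + (dx (dx S.w)).f x t ^ 2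
      + 1 + (GG * dx (dt S.b)).f x t ^ 2 + (dx S.u).f x t ^ 2 + (dx S.b).f x t ^ 2 + S.u.f x t ^ 2 + (dx (dx S.b)).f x t ^ 2) := by
    simp only [Flow.gW, add_f, sub_f, mul_f, neg_f, cst_f, xx_f, dx_add, dt_add, dx_sub, dt_sub, dx_neg, dt_neg, dx_mul, dt_mul, dx_cst, dt_cst, dx_xx, dt_xx, dt_dx]
    rw [abs_le]
    constructor <;> linarith [sq_nonneg (GG.f x t * (dx (dt S.b)).f x t - 1), sq_nonneg (GG.f x t * (dx (dt S.b)).f x t + 1)]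
  linarith

set_option maxHeartbeats 1000000 in
theorem D4a {S : Flow p} {C : ℝ} (h : H2 S C) (hD : ∫ s in (0:ℝ)..p.T, I2 (GG * dx (dt S.b)) s ≤ C)
    {w w' f : ℝ → ℝ} (cw : Continuous w) (cw' : Continuous w') (cf : Continuous f)
    (dw : ∀ x, HasDerivAt w (w' x) x) (dw' : ∀ x, HasDerivAt w' (-f x) x) (w0 : w 0 = 0) (w1 : w 1 = 0)
    (hw : ∀ x ∈ Icc (0:ℝ) 1, 0 ≤ w x ∧ w x ≤ 16 * (x * (1 - x)) ∧ |w' x| ≤ 8) :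
    ∫ s in (0:ℝ)..p.T, Ix (fun x t => f x * S.PW.f x t) s ≤ 16 * (2 * p.N + 1 + p.N ^ 2) + 16 * p.T
      + ((64 * C + 8) + (4 * (C ^ 2 + C) + 4)) * C + 8 * C := by
  have hC := h.h1.one
  set Nn : SF := dt (S.ρ * S.PW) + dx (S.u * S.ρ * S.PW - dx S.PW) with hNn
  set al : SF := S.u * S.ρ * S.PW - dx S.PW with hal
  have id := master' (T := p.T) (fun x t => w x * (S.ρ * S.PW).f x t) (fun x t => w x * al.f x t + w' x * S.PW.f x t)
    (fun x t => (w' x * al.f x t + w x * (dx al).f x t) + (-f x * S.PW.f x t + w' x * (dx S.PW).f x t))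
    (fun x t => w x * Nn.f x t + w' x * (S.u.f x t * S.ρ.f x t * S.PW.f x t) - f x * S.PW.f x t)
    (fun x hx t ht => by
      refine ((SF.ht (S.ρ * S.PW) x t).const_mul (w x)).congr_deriv ?_
      have e1 : Nn.f x t = (dt (S.ρ*S.PW)).f x t + (dx al).f x t := rfl
      have e2 : al.f x t = S.u.f x t*S.ρ.f x t*S.PW.f x t - (dx S.PW).f x t := rfl
      rw [e1, e2]
      ring)
    (fun x hx t ht => ((dw x).mul (SF.hx al x t)).add ((dw' x).mul (SF.hx S.PW x t))) p.h1
    (by fun_prop) (by fun_prop) (by fun_prop)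
  have e1 : (0:ℝ) ≤ ∫ x in (0:ℝ)..1, w x * (S.ρ * S.PW).f x p.T := int_nonneg zero_le_one fun x hx => by
    have := S.ρp x hx p.T p.h1
    have := (S.PW_ge x p.T).1
    have := (hw x hx).1
    simp only [mul_f]
    positivity
  have e2 : ∫ x in (0:ℝ)..1, w x * (S.ρ * S.PW).f x 0 ≤ 16 * (2 * p.N + 1 + p.N ^ 2) := by
    have a := Ix_le2 (t := 0) (f := fun x t => w x * (S.ρ * S.PW).f x t) (g₁ := fun x t => (dx (dx S.w)).f x t ^ 2)
      (g₂ := fun _ _ => 1) 16 (16 * (p.N + 1 + p.N ^ 2)) (fun x hx => by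
        have r := S.ρp x hx 0 p.h0
        have r1 := (le_abs_self _).trans (S.iρ x hx).1
        have r2 := sqbd (S.ib x hx).2
        have m := S.eqw x hx 0 p.h0
        have q : S.PW.f x 0 ≤ 1 + |S.W.f x 0| := by
          have : S.PW.f x 0 = √(1 + S.W.f x 0 ^ 2) := rfl
          rw [this]
          apply Real.sqrt_le_iff.mpr ⟨by positivity, ?_⟩
          have := sq_abs (S.W.f x 0)
          have := abs_nonneg (S.W.f x 0)
          nlinarith
        have m2 : S.ρ.f x 0 * |S.W.f x 0| = |(dx (dx S.w)).f x 0 + (dx S.b).f x 0| := by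
          rw [← m]; simp only [Flow.W, add_f, sub_f, mul_f, neg_f, cst_f, xx_f, dx_add, dt_add, dx_sub, dt_sub, dx_neg, dt_neg, dx_mul, dt_mul, dx_cst, dt_cst, dx_xx, dt_xx, dt_dx]; rw [abs_mul, abs_of_pos r]
        have m3 : |(dx (dx S.w)).f x 0 + (dx S.b).f x 0| ≤ 1 + (dx (dx S.w)).f x 0 ^ 2 + (dx S.b).f x 0 ^ 2 := by
          rw [abs_le]; constructor <;> linarith [sq_nonneg ((dx (dx S.w)).f x 0 - 1/2), sq_nonneg ((dx (dx S.w)).f x 0 + 1/2), sq_nonneg ((dx S.b).f x 0 - 1/2), sq_nonneg ((dx S.b).f x 0 + 1/2)]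
        have m4 : (S.ρ * S.PW).f x 0 ≤ p.N + 1 + (dx (dx S.w)).f x 0 ^ 2 + p.N ^ 2 := by
          simp only [mul_f]
          have := mul_le_mul_of_nonneg_left q r.le
          linarith
        obtain ⟨w2, w3, -⟩ := hw x hx
        have w4 : w x ≤ 16 := by nlinarith [sq_nonneg x, hx.1, hx.2]
        have := mul_le_mul w4 m4 (by have := (S.PW_ge x 0).1; simp only [mul_f]; positivity) (by norm_num)
        linarith)
    rw [Ix_one] at a
    have b := S.jw
    simp only [Ix] at a b ⊢
    linarith
  have e3 : -∫ s in (0:ℝ)..p.T, ((w 1 * al.f 1 s + w' 1 * S.PW.f 1 s) - (w 0 * al.f 0 s + w' 0 * S.PW.f 0 s)) ≤ 16 * p.T := by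
    have := int_mono p.hT.le (f := fun s => -((w 1 * al.f 1 s + w' 1 * S.PW.f 1 s) - (w 0 * al.f 0 s + w' 0 * S.PW.f 0 s))) (g := fun _ => 16) (fun s hs => by
      have a1 : S.PW.f 1 s = 1 := by
        have : S.PW.f 1 s = √(1 + S.W.f 1 s ^ 2) := rfl
        rw [this, S.W1 hs]; simp
      have a0 : S.PW.f 0 s = 1 := by
        have : S.PW.f 0 s = √(1 + S.W.f 0 s ^ 2) := rfl
        rw [this, S.W0 hs]; simp
      rw [a1, a0, w0, w1]
      have := abs_le.mp (hw 0 (by simp)).2.2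
      have := abs_le.mp (hw 1 (by simp)).2.2
      linarith) (by fun_prop) (by fun_prop)
    rw [intervalIntegral.integral_neg] at this
    simp only [intervalIntegral.integral_const, smul_eq_mul, sub_zero] at this
    linarith
  have e4 := int_le3 p.hT.le (f := Ix (fun x t => w x * Nn.f x t + w' x * (S.u.f x t * S.ρ.f x t * S.PW.f x t) - f x * S.PW.f x t))
    (g₁ := H1.m S) (g₂ := fun s => I2 (GG * dx (dt S.b)) s) (g₃ := Ix (fun x t => f x * S.PW.f x t)) ((64 * C + 8) + (4 * (C ^ 2 + C) + 4)) 8 (-1) (fun s hs => by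
    rw [Ix_sub, Ix_add]
    have a := Ix_le10 (t := s) (f := fun x t => w x * Nn.f x t) (a₁ := fun x t => (dx (dx S.u)).f x t ^ 2)
      (a₂ := fun x t => (dx S.w).f x t ^ 2) (a₃ := fun x t => (dx S.u).f x t ^ 2) (a₄ := fun x t => (dx (dx S.w)).f x t ^ 2)
      (a₅ := fun _ _ => 1) (a₆ := fun x t => (GG * dx (dt S.b)).f x t ^ 2) (a₇ := fun x t => (dx S.u).f x t ^ 2) 
      (a₈ := fun x t => (dx S.b).f x t ^ 2) (a₉ := fun x t => S.u.f x t ^ 2) (a₁₀ := fun x t => (dx (dx S.b)).f x t ^ 2) 8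
      (fun x hx => by
        have := S.NW_le x hx s hs
        obtain ⟨w2, w3, -⟩ := hw x hx
        exact (mul_le_mul_of_nonneg_left this w2).trans (gW_pt hx w2 w3))
    have b := Ix_le2 (t := s) (f := fun x t => w' x * (S.u.f x t * S.ρ.f x t * S.PW.f x t)) 
      (g₁ := fun x t => S.ρ.f x t * S.W.f x t ^ 2) (g₂ := fun _ _ => 1) 4 (4 * (C ^ 2 + C)) (fun x hx => by
        have r := S.ρp x hx s hs
        have r1 := h.h1.ρ x hx s hs
        have r2 := h.h1.us hx hs
        have q := congrArg (fun F => F.f x s) S.PW_sq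
        simp only [add_f, sub_f, mul_f, neg_f, cst_f, xx_f, dx_add, dt_add, dx_sub, dt_sub, dx_neg, dt_neg, dx_mul, dt_mul, dx_cst, dt_cst, dx_xx, dt_xx, dt_dx] at q
        have q' := (S.PW_ge x s).1
        have w2 := (hw x hx).2.2
        have : w' x * (S.u.f x s * S.ρ.f x s * S.PW.f x s) ≤ 8 * (S.ρ.f x s * S.PW.f x s) * |S.u.f x s| := by
          calc _ ≤ |w' x * (S.u.f x s * S.ρ.f x s * S.PW.f x s)| := le_abs_self _
            _ = |w' x| * ((S.ρ.f x s * S.PW.f x s) * |S.u.f x s|) := by 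
              rw [abs_mul, abs_mul, abs_mul, abs_of_pos r, abs_of_pos (by linarith : 0 < S.PW.f x s)]; ring
            _ ≤ 8 * ((S.ρ.f x s * S.PW.f x s) * |S.u.f x s|) := mul_le_mul_of_nonneg_right w2 (by positivity)
            _ = _ := by ring
        have q2 : 2 * (S.PW.f x s * |S.u.f x s|) ≤ 1 + S.W.f x s * S.W.f x s + C := by
          have := sq_abs (S.u.f x s)
          linarith [sq_nonneg (S.PW.f x s - |S.u.f x s|)]
        have q3 := mul_le_mul_of_nonneg_left q2 r.le
        have q4 := mul_le_mul_of_nonneg_right r1 (by linarith : 0 ≤ 1 + C)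
        linarith)
    rw [Ix_one] at a b
    obtain ⟨m1, -, m2, -⟩ := H1.m_ge S hs
    obtain ⟨u1, w1, v1, b1, c1⟩ := h.h1.Ux hs
    have u2 := h.uxx s hs
    have w2 := h.wxx s hs
    have b2 := h.bxx s hs
    have z : Ix (fun x t => S.u.f x t ^ 2) s ≤ C := Ix_le_const _ fun x hx => h.h1.us hx hs
    have q1 := mul_le_mul_of_nonneg_left m1 (by positivity : 0 ≤ C)
    have q2 := mul_le_mul_of_nonneg_left m1 (by positivity : 0 ≤ C ^ 2)
    simp only [I2, IR] at *
    linarith)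
  have e5 := mul_le_mul_of_nonneg_left h.mI (by positivity : 0 ≤ (64 * C + 8) + (4 * (C ^ 2 + C) + 4))
  have e6 : (∫ s in (0:ℝ)..p.T, ∫ x in (0:ℝ)..1, w x * Nn.f x s + w' x * (S.u.f x s * S.ρ.f x s * S.PW.f x s) - f x * S.PW.f x s)
    = ∫ s in (0:ℝ)..p.T, Ix (fun x t => w x * Nn.f x t + w' x * (S.u.f x t * S.ρ.f x t * S.PW.f x t) - f x * S.PW.f x t) s := rfl
  rw [e6] at id
  linarith

end MHD

namespace MHD

variable {p : Par}

theorem H2.mono {S : Flow p} {C D : ℝ} (h : H2 S C) (hCD : C ≤ D) : H2 S D := by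
  have up : ∀ t ∈ Icc (0:ℝ) p.T, C * H1.m S t ≤ D * H1.m S t := fun t ht =>
    mul_le_mul_of_nonneg_right hCD (by linarith [(H1.m_ge S ht).1])
  exact
   { h1 := h.h1.mono hCD
     mI := h.mI.trans hCD
     rx := fun t ht => (h.rx t ht).trans hCD
     uxx := fun t ht => (h.uxx t ht).trans (up t ht)
     wxx := fun t ht => (h.wxx t ht).trans (up t ht)
     vxx := fun t ht => (h.vxx t ht).trans (up t ht)
     bxx := fun t ht => (h.bxx t ht).trans (up t ht)
     cxx := fun t ht => (h.cxx t ht).trans (up t ht)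
     ux := fun x hx t ht => (h.ux x hx t ht).trans (up t ht)
     wx := fun x hx t ht => (h.wx x hx t ht).trans (up t ht)
     vx := fun x hx t ht => (h.vx x hx t ht).trans (up t ht)
     bx := fun x hx t ht => (h.bx x hx t ht).trans (up t ht)
     cx := fun x hx t ht => (h.cx x hx t ht).trans (up t ht)
     F := fun x hx t ht => (h.F x hx t ht).trans (up t ht)
     θ := fun x hx t ht => (h.θ x hx t ht).trans (up t ht)
     K := fun x hx t ht => (h.K x hx t ht).trans (up t ht)
     κ := fun x hx t ht => (h.κ x hx t ht).trans (up t ht) }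

theorem D4b {S : Flow p} {C : ℝ} (h : H2 S C) (hG : ∀ x ∈ Icc (0:ℝ) 1, ∀ t ∈ Icc (0:ℝ) p.T, GG.f x t * (dx S.b).f x t ^ 2 ≤ C)
    (hD : ∫ s in (0:ℝ)..p.T, I2 (GG * dx (dt S.b)) s ≤ C) :
    ∫ s in (0:ℝ)..p.T, Ix (fun x t => |S.W.f x t * (dx S.b).f x t|) s ≤ √(3 * C) * (16 * (2 * p.N + 1 + p.N ^ 2) + 16 * p.T
      + ((64 * C + 8) + (4 * (C ^ 2 + C) + 4)) * C + 8 * C) := by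
  have hC := h.h1.one
  have hc : Continuous (fun z : ℝ × ℝ => (dx S.b).f z.1 z.2) := by fun_prop
  obtain ⟨A, hA⟩ := ((isCompact_Icc (a := (0:ℝ)) (b := 1)).prod (isCompact_Icc (a := (0:ℝ)) (b := p.T))).exists_bound_of_continuousOn hc.continuousOn
  have hA' : ∀ x ∈ Icc (0:ℝ) 1, ∀ t ∈ Icc (0:ℝ) p.T, (dx S.b).f x t ^ 2 ≤ 1 + A ^ 2 := fun x hx t ht => by
    have h1 : |(dx S.b).f x t| ≤ A := hA (x, t) ⟨hx, ht⟩
    have := sqbd h1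
    linarith
  have hA1 : 0 < 1 + A ^ 2 := by positivity
  have hA2 : 1 ≤ 1 + A ^ 2 := by linarith [sq_nonneg A]
  set η := 1 / (1 + A ^ 2) with hη
  have η0 : 0 < η := by positivity
  have η1 : η ≤ 1 := by rw [hη, div_le_one hA1]; exact hA2
  have ηA : η * (1 + A ^ 2) = 1 := by rw [hη]; field_simp
  obtain ⟨w, w', f, cw, cw', cf, dw, dw', w0, w1, hw⟩ := weight η0 η1
  have main := D4a h hD cw cw' cf dw dw' w0 w1 (fun x hx => ⟨(hw x hx).1, (hw x hx).2.1, (hw x hx).2.2.1⟩)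
  have key : ∀ x ∈ Icc (0:ℝ) 1, ∀ t ∈ Icc (0:ℝ) p.T, |(dx S.b).f x t| ≤ √(3 * C) * f x := fun x hx t ht => by
    have e1 : η * (dx S.b).f x t ^ 2 ≤ C := by
      have := mul_le_mul_of_nonneg_left (hA' x hx t ht) η0.le
      linarith
    have e2 := hG x hx t ht
    rw [GG_f] at e2
    have fin : ∀ y : ℝ, 0 < y → y * (dx S.b).f x t ^ 2 ≤ 3 * C → 1 / √y ≤ f x → |(dx S.b).f x t| ≤ √(3 * C) * f x := fun y hy h1 h2 => by
      have h3 : (dx S.b).f x t ^ 2 ≤ 3 * C / y := by rw [le_div_iff₀ hy]; linarith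
      have h4 := Real.sqrt_le_sqrt h3
      rw [Real.sqrt_sq_eq_abs, Real.sqrt_div (by positivity)] at h4
      refine h4.trans ?_
      rw [div_eq_mul_one_div]
      exact mul_le_mul_of_nonneg_left h2 (Real.sqrt_nonneg _)
    have s0 := sq_nonneg ((dx S.b).f x t)
    rcases le_total x (1/2) with hx2 | hx2
    · refine fin (x + η) (by linarith [hx.1]) ?_ (hw x hx).2.2.2.1
      have : x * (dx S.b).f x t ^ 2 ≤ 2 * (x * (1 - x)) * (dx S.b).f x t ^ 2 :=
        mul_le_mul_of_nonneg_right (by nlinarith [hx.1]) s0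
      linarith
    · refine fin (1 - x + η) (by linarith [hx.2]) ?_ (hw x hx).2.2.2.2
      have : (1 - x) * (dx S.b).f x t ^ 2 ≤ 2 * (x * (1 - x)) * (dx S.b).f x t ^ 2 :=
        mul_le_mul_of_nonneg_right (by nlinarith [hx.2]) s0
      linarith
  have fin := int_le1 p.hT.le (f := fun s => Ix (fun x t => |S.W.f x t * (dx S.b).f x t|) s) 
    (g₁ := fun s => Ix (fun x t => f x * S.PW.f x t) s) (√(3 * C)) (fun s hs => 
      Ix_le1 (√(3 * C)) (fun x hx => by
        rw [abs_mul]
        have k1 := key x hx s hs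
        obtain ⟨q0, q1⟩ := S.PW_ge x s
        have := mul_le_mul q1 k1 (abs_nonneg _) (by linarith)
        linarith))
  exact fin.trans (mul_le_mul_of_nonneg_left main (Real.sqrt_nonneg _))

structure H4 (S : Flow p) (C : ℝ) : Prop where
  h2 : H2 S C
  gw : ∫ s in (0:ℝ)..p.T, Ix (fun x t => |S.W.f x t * (dx S.b).f x t|) s ≤ C
  gv : ∫ s in (0:ℝ)..p.T, Ix (fun x t => |S.V.f x t * (dx S.c).f x t|) s ≤ C

theorem stepD4 (p : Par) : ∃ C, 1 ≤ C ∧ ∀ S : Flow p, H4 S C := by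
  obtain ⟨C, hC, h⟩ := stepD3 p
  have hN := p.hN
  have hT := p.hT
  set D := √(3 * C) * (16 * (2 * p.N + 1 + p.N ^ 2) + 16 * p.T
      + ((64 * C + 8) + (4 * (C ^ 2 + C) + 4)) * C + 8 * C) with hD
  have hD0 : 0 ≤ D := by positivity
  refine ⟨C + D, by linarith, fun S => ⟨(h S).1.mono (by linarith), ?_, ?_⟩⟩
  · have := D4b (h S).1 (fun x hx t ht => ((h S).2.1 x hx t ht).1) (h S).2.2
    linarith
  · have hs := h S.swap
    have : ∫ s in (0:ℝ)..p.T, Ix (fun x t => |S.V.f x t * (dx S.c).f x t|) s ≤ D := 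
      D4b hs.1 (fun x hx t ht => (hs.2.1 x hx t ht).1) hs.2.2
    linarith

end MHD

namespace MHD

variable {p : Par}

/-- derivative of the conductivity -/
def Par.κd (p : Par) (s : ℝ) : ℝ := derivWithin p.κ (Ici 0) |s|

theorem Par.κd_cont0 (p : Par) : Continuous p.κd := by
  have h := p.hκ.1.continuousOn_derivWithin (uniqueDiffOn_Ici 0) (by norm_num)
  exact h.comp_continuous (f := fun s : ℝ => |s|) continuous_abs (fun s => abs_nonneg s)

@[fun_prop]
theorem Par.κd_cont (p : Par) {X : Type*} [TopologicalSpace X] {g : X → ℝ} (hg : Continuous g) :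
    Continuous (fun a => p.κd (g a)) := p.κd_cont0.comp hg

theorem Par.κe_hd (p : Par) {s : ℝ} (hs : 0 < s) : HasDerivAt (κe p.κ) (p.κd s) s := by
  have h1 : DifferentiableWithinAt ℝ p.κ (Ici 0) s := (p.hκ.1.differentiableOn (by norm_num)) s hs.le
  have h2 := h1.hasDerivWithinAt.hasDerivAt (Ici_mem_nhds hs)
  have e : p.κd s = derivWithin p.κ (Ici 0) s := by unfold Par.κd; rw [abs_of_pos hs]
  rw [e]
  refine h2.congr_of_eventuallyEq ?_
  filter_upwards [lt_mem_nhds hs] with r hr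
  unfold κe
  rw [abs_of_pos hr]

def Flow.Td (S : Flow p) : SF := dt S.θ + S.u * dx S.θ
def Flow.z (S : Flow p) : SF := S.w * S.W + S.v * S.V
def Flow.f1 (S : Flow p) : SF := dx S.u * dx S.u + dx S.b * dx S.b + dx S.c * dx S.c + S.w * dx S.b + S.v * dx S.c
def Flow.J (S : Flow p) (x t : ℝ) : ℝ := p.K (S.θ.f x t) + 1/2 * (S.w.f x t ^ 2 + S.v.f x t ^ 2)
def Flow.YJ (S : Flow p) : SF := S.w * dx S.w + S.v * dx S.v
def Flow.Jx (S : Flow p) (x t : ℝ) : ℝ := S.k x t + S.YJ.f x t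
def Flow.Jd (S : Flow p) (x t : ℝ) : ℝ := κe p.κ (S.θ.f x t) * S.Td.f x t + S.z.f x t
def Flow.GJ (S : Flow p) : SF := (cst 2 * dx S.b + S.w) * S.Bd + (cst 2 * dx S.c + S.v) * S.Cd - S.u * S.f1

@[fun_prop]
theorem Flow.J_cont {X : Type*} [TopologicalSpace X] (S : Flow p) {g h : X → ℝ}
    (hg : Continuous g) (hh : Continuous h) : Continuous (fun a => S.J (g a) (h a)) := by
  unfold Flow.J; fun_prop
@[fun_prop]
theorem Flow.Jx_cont {X : Type*} [TopologicalSpace X] (S : Flow p) {g h : X → ℝ}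
    (hg : Continuous g) (hh : Continuous h) : Continuous (fun a => S.Jx (g a) (h a)) := by
  unfold Flow.Jx; fun_prop
@[fun_prop]
theorem Flow.Jd_cont {X : Type*} [TopologicalSpace X] (S : Flow p) {g h : X → ℝ}
    (hg : Continuous g) (hh : Continuous h) : Continuous (fun a => S.Jd (g a) (h a)) := by
  have := κe_cont p
  unfold Flow.Jd; fun_prop

theorem Flow.kx_eq (S : Flow p) {x t : ℝ} (hx : x ∈ Icc (0:ℝ) 1) (ht : t ∈ Icc (0:ℝ) p.T) :
    S.kx.f x t = p.κd (S.θ.f x t) * (dx S.θ).f x t ^ 2 + κe p.κ (S.θ.f x t) * (dx (dx S.θ)).f x t := by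
  have h1 := S.hk x hx t ht
  have h2 : HasDerivAt (fun y => κe p.κ (S.θ.f y t)) (p.κd (S.θ.f x t) * (dx S.θ).f x t) x :=
    HasDerivAt.comp (h₂ := κe p.κ) x (p.κe_hd (S.θp x hx t ht)) (S.θ.hx x t)
  have h3 := h2.fun_mul ((dx S.θ).hx x t)
  have := h1.unique h3
  rw [this]; ring

/-- right-hand side of the second temperature estimate -/
def Flow.rJ (S : Flow p) (x t : ℝ) : ℝ :=
  -(1/2) * ((dx S.u).f x t * S.Jx x t ^ 2) - S.ρ.f x t * (S.Td.f x t + S.z.f x t) * S.Jd x t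
    - S.ρ.f x t * S.θ.f x t * (dx S.u).f x t * S.Jd x t
    - (2 * (dx S.u).f x t * (dx S.U).f x t - (dx S.u).f x t ^ 3 - (dx S.u).f x t * ((dx S.b).f x t ^ 2 + (dx S.c).f x t ^ 2)
      + S.W.f x t * (dx S.b).f x t + S.V.f x t * (dx S.c).f x t) * S.J x t
    + S.Bd.f x t * ((2 * (dx (dx S.b)).f x t + (dx S.w).f x t) * S.J x t + (2 * (dx S.b).f x t + S.w.f x t) * S.Jx x t)
    + S.Cd.f x t * ((2 * (dx (dx S.c)).f x t + (dx S.v).f x t) * S.J x t + (2 * (dx S.c).f x t + S.v.f x t) * S.Jx x t)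

@[fun_prop]
theorem Flow.rJ_cont {X : Type*} [TopologicalSpace X] (S : Flow p) {g h : X → ℝ}
    (hg : Continuous g) (hh : Continuous h) : Continuous (fun a => S.rJ (g a) (h a)) := by
  unfold Flow.rJ; fun_prop

set_option maxHeartbeats 2000000 in
theorem Flow.Jid (S : Flow p) {t : ℝ} (ht : t ∈ Icc (0:ℝ) p.T) :
    Ix (fun x t => 1/2 * S.Jx x t ^ 2 - S.f1.f x t * S.J x t) t = Ix (fun x t => 1/2 * S.Jx x t ^ 2 - S.f1.f x t * S.J x t) 0
      + ∫ s in (0:ℝ)..t, Ix S.rJ s := by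
  have hκc := κe_cont p
  have id := master' (T := p.T) (fun x t => 1/2 * S.Jx x t ^ 2 - S.f1.f x t * S.J x t)
    (fun x t => 1/2 * (S.u.f x t * S.Jx x t ^ 2) - S.Jx x t * S.Jd x t + S.GJ.f x t * S.J x t)
    (fun x t => 1/2 * ((dx S.u).f x t * S.Jx x t ^ 2 + S.u.f x t * (2 * S.Jx x t * (S.kx.f x t + (dx S.YJ).f x t)))
      - ((S.kx.f x t + (dx S.YJ).f x t) * S.Jd x t + S.Jx x t * 
        (p.κd (S.θ.f x t) * (dx S.θ).f x t * S.Td.f x t + κe p.κ (S.θ.f x t) * (dx S.Td).f x t + (dx S.z).f x t))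
      + ((dx S.GJ).f x t * S.J x t + S.GJ.f x t * S.Jx x t))
    S.rJ
    (fun x hx t ht => by
      have a1 : HasDerivAt (fun s => κe p.κ (S.θ.f x s)) (p.κd (S.θ.f x t) * (dt S.θ).f x t) t :=
        HasDerivAt.comp (h₂ := κe p.κ) t (p.κe_hd (S.θp x hx t ht)) (S.θ.ht x t)
      have a2 : HasDerivAt (fun s => S.Jx x s) (p.κd (S.θ.f x t) * (dt S.θ).f x t * (dx S.θ).f x t
          + κe p.κ (S.θ.f x t) * (dt (dx S.θ)).f x t + (dt S.YJ).f x t) t := 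
        (a1.fun_mul ((dx S.θ).ht x t)).fun_add (S.YJ.ht x t)
      have a3 : HasDerivAt (fun s => S.J x s) (κe p.κ (S.θ.f x t) * (dt S.θ).f x t
          + 1/2 * (2 * S.w.f x t * (dt S.w).f x t + 2 * S.v.f x t * (dt S.v).f x t)) t := by
        have b1 : HasDerivAt (fun s => p.K (S.θ.f x s)) (κe p.κ (S.θ.f x t) * (dt S.θ).f x t) t :=
          HasDerivAt.comp (h₂ := p.K) t (p.K_hd _) (S.θ.ht x t)
        have b2 := (((S.w.ht x t).fun_pow 2).fun_add ((S.v.ht x t).fun_pow 2)).const_mul (1/2)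
        refine (b1.fun_add b2).congr_deriv ?_
        norm_num
      have a4 := ((a2.fun_pow 2).const_mul (1/2)).fun_sub ((S.f1.ht x t).fun_mul a3)
      refine a4.congr_deriv ?_
      have e1 := S.kx_eq hx ht
      have e2 : S.kx.f x t + (dx S.YJ).f x t = S.ρ.f x t * (S.Td.f x t + S.z.f x t) - S.f1.f x t + S.ρ.f x t * S.θ.f x t * (dx S.u).f x t := by
        have := S.eqw x hx t ht
        have := S.eqv x hx t ht
        simp only [Flow.kx, Flow.Q, Flow.YJ, Flow.z, Flow.f1, Flow.W, Flow.V, Flow.Td, add_f, sub_f, mul_f, neg_f, cst_f, xx_f, dx_add, dt_add, dx_sub, dt_sub, dx_neg, dt_neg, dx_mul, dt_mul, dx_cst, dt_cst, dx_xx, dt_xx, dt_dx]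
        linear_combination - S.w.f x t * S.eqw x hx t ht - S.v.f x t * S.eqv x hx t ht
      have l1 : S.Jd x t = κe p.κ (S.θ.f x t) * S.Td.f x t + S.z.f x t := rfl
      have l2 : S.Jx x t = κe p.κ (S.θ.f x t) * (dx S.θ).f x t + S.YJ.f x t := rfl
      have g1 : p.κd (S.θ.f x t) * (dt S.θ).f x t * (dx S.θ).f x t
          + κe p.κ (S.θ.f x t) * (dt (dx S.θ)).f x t + (dt S.YJ).f x t - (p.κd (S.θ.f x t) * (dx S.θ).f x t * S.Td.f x t + κe p.κ (S.θ.f x t) * (dx S.Td).f x t + (dx S.z).f x t)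
          + S.u.f x t * (S.kx.f x t + (dx S.YJ).f x t) = - (dx S.u).f x t * S.Jx x t := by
        rw [e1, l2]
        simp only [Flow.YJ, Flow.z, Flow.W, Flow.V, Flow.Td, add_f, sub_f, mul_f, neg_f, cst_f, xx_f, dx_add, dt_add, dx_sub, dt_sub, dx_neg, dt_neg, dx_mul, dt_mul, dx_cst, dt_cst, dx_xx, dt_xx, dt_dx]
        ring
      have g2 : κe p.κ (S.θ.f x t) * (dt S.θ).f x t
          + 1/2 * (2 * S.w.f x t * (dt S.w).f x t + 2 * S.v.f x t * (dt S.v).f x t) = S.Jd x t - S.u.f x t * S.Jx x t := by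
        rw [l1, l2]
        simp only [Flow.YJ, Flow.z, Flow.W, Flow.V, Flow.Td, add_f, sub_f, mul_f, neg_f, cst_f, xx_f, dx_add, dt_add, dx_sub, dt_sub, dx_neg, dt_neg, dx_mul, dt_mul, dx_cst, dt_cst, dx_xx, dt_xx, dt_dx]
        ring
      have g3 : (dx S.GJ).f x t - (dt S.f1).f x t = 
         -(2 * (dx S.u).f x t * (dx S.U).f x t - (dx S.u).f x t ^ 3 - (dx S.u).f x t * ((dx S.b).f x t ^ 2 + (dx S.c).f x t ^ 2)
      + S.W.f x t * (dx S.b).f x t + S.V.f x t * (dx S.c).f x t) + S.Bd.f x t * (2 * (dx (dx S.b)).f x t + (dx S.w).f x t)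
         + S.Cd.f x t * (2 * (dx (dx S.c)).f x t + (dx S.v).f x t) := by
        simp only [Flow.GJ, Flow.f1, Flow.U, Flow.Bd, Flow.Cd, Flow.W, Flow.V, add_f, sub_f, mul_f, neg_f, cst_f, xx_f, dx_add, dt_add, dx_sub, dt_sub, dx_neg, dt_neg, dx_mul, dt_mul, dx_cst, dt_cst, dx_xx, dt_xx, dt_dx]
        ring
      have g4 : S.GJ.f x t = (2 * (dx S.b).f x t + S.w.f x t) * S.Bd.f x t + (2 * (dx S.c).f x t + S.v.f x t) * S.Cd.f x t
        - S.u.f x t * S.f1.f x t := by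
        simp only [Flow.GJ, add_f, sub_f, mul_f, neg_f, cst_f, xx_f, dx_add, dt_add, dx_sub, dt_sub, dx_neg, dt_neg, dx_mul, dt_mul, dx_cst, dt_cst, dx_xx, dt_xx, dt_dx]
      rw [g2, g4]
      unfold Flow.rJ
      push_cast
      linear_combination S.Jx x t * g1 + S.J x t * g3 + (-S.Jd x t) * e2)
    (fun x hx t ht => by
      have a1 : HasDerivAt (fun y => κe p.κ (S.θ.f y t)) (p.κd (S.θ.f x t) * (dx S.θ).f x t) x :=
        HasDerivAt.comp (h₂ := κe p.κ) x (p.κe_hd (S.θp x hx t ht)) (S.θ.hx x t)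
      have a2 : HasDerivAt (fun y => S.Jd y t) (p.κd (S.θ.f x t) * (dx S.θ).f x t * S.Td.f x t + κe p.κ (S.θ.f x t) * (dx S.Td).f x t + (dx S.z).f x t) x :=
        (a1.fun_mul (S.Td.hx x t)).fun_add (S.z.hx x t)
      have a3 : HasDerivAt (fun y => S.Jx y t) (S.kx.f x t + (dx S.YJ).f x t) x := (S.hk x hx t ht).fun_add (S.YJ.hx x t)
      have a4 : HasDerivAt (fun y => S.J y t) (S.Jx x t) x := by
        have b2 := (((S.w.hx x t).fun_pow 2).fun_add ((S.v.hx x t).fun_pow 2)).const_mul (1/2)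
        refine ((S.K_hx x t).fun_add b2).congr_deriv ?_
        unfold Flow.Jx
        simp only [Flow.YJ, add_f, sub_f, mul_f, neg_f, cst_f, xx_f, dx_add, dt_add, dx_sub, dt_sub, dx_neg, dt_neg, dx_mul, dt_mul, dx_cst, dt_cst, dx_xx, dt_xx, dt_dx]
        push_cast
        ring
      refine (((((S.u.hx x t).fun_mul (a3.fun_pow 2)).const_mul (1/2)).fun_sub (a3.fun_mul a2)).fun_add ((S.GJ.hx x t).fun_mul a4)).congr_deriv ?_
      push_cast
      ring) ht (by fun_prop) (by fun_prop) (by fun_prop)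
  have z : ∫ s in (0:ℝ)..t, ((1/2 * (S.u.f 1 s * S.Jx 1 s ^ 2) - S.Jx 1 s * S.Jd 1 s + S.GJ.f 1 s * S.J 1 s)
     - (1/2 * (S.u.f 0 s * S.Jx 0 s ^ 2) - S.Jx 0 s * S.Jd 0 s + S.GJ.f 0 s * S.J 0 s)) = 0 := by
    rw [intervalIntegral.integral_congr (g := fun _ => (0:ℝ))]
    · simp
    · intro s hs
      rw [uIcc_of_le ht.1] at hs
      have hs' : s ∈ Icc (0:ℝ) p.T := ⟨hs.1, hs.2.trans ht.2⟩
      have q1 : S.GJ.f 1 s = 0 := by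
        simp only [Flow.GJ, add_f, sub_f, mul_f, neg_f, cst_f, xx_f, dx_add, dt_add, dx_sub, dt_sub, dx_neg, dt_neg, dx_mul, dt_mul, dx_cst, dt_cst, dx_xx, dt_xx, dt_dx]; rw [S.u1 s hs', S.Bd1 hs', S.Cd1 hs']; ring
      have q0 : S.GJ.f 0 s = 0 := by
        simp only [Flow.GJ, add_f, sub_f, mul_f, neg_f, cst_f, xx_f, dx_add, dt_add, dx_sub, dt_sub, dx_neg, dt_neg, dx_mul, dt_mul, dx_cst, dt_cst, dx_xx, dt_xx, dt_dx]; rw [S.u0 s hs', S.Bd0 hs', S.Cd0 hs']; ring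
      have r1 : S.Jx 1 s = 0 := by
        unfold Flow.Jx; rw [S.k1 hs']; simp only [Flow.YJ, add_f, sub_f, mul_f, neg_f, cst_f, xx_f, dx_add, dt_add, dx_sub, dt_sub, dx_neg, dt_neg, dx_mul, dt_mul, dx_cst, dt_cst, dx_xx, dt_xx, dt_dx]; rw [S.w1 s hs', S.v1 s hs']; ring
      have r0 : S.Jx 0 s = 0 := by
        unfold Flow.Jx; rw [S.k0 hs']; simp only [Flow.YJ, add_f, sub_f, mul_f, neg_f, cst_f, xx_f, dx_add, dt_add, dx_sub, dt_sub, dx_neg, dt_neg, dx_mul, dt_mul, dx_cst, dt_cst, dx_xx, dt_xx, dt_dx]; rw [S.w0 s hs', S.v0 s hs']; ring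
      simp [q1, q0, r1, r0]
  rw [z, sub_zero] at id
  exact id

end MHD

namespace MHD

variable {p : Par}

/-- temperature dissipation -/
abbrev ID (S : Flow p) : ℝ → ℝ := Ix (fun x t => S.ρ.f x t * κe p.κ (S.θ.f x t) * S.Td.f x t ^ 2)

@[fun_prop] theorem ID_cont (S : Flow p) : Continuous (fun t => ID S t) := by
  have := κe_cont p
  unfold ID; fun_prop

theorem ID_nonneg (S : Flow p) {t : ℝ} (ht : t ∈ Icc (0:ℝ) p.T) : 0 ≤ ID S t :=
  int_nonneg zero_le_one fun x hx => by
    have := S.ρp x hx t ht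
    have := p.κ_pos (S.θ.f x t)
    positivity

theorem Flow.one_le_κ (S : Flow p) (x t : ℝ) : 1 ≤ p.C₀ * κe p.κ (S.θ.f x t) := by
  have h1 := p.κ_ge (S.θ.f x t)
  have hC := p.hC₀
  have := mul_le_mul_of_nonneg_left h1 (by linarith : 0 ≤ p.C₀)
  rwa [mul_inv_cancel₀ (by positivity)] at this

def Flow.Fd (S : Flow p) : SF := dx S.U - dx S.u * dx S.u - S.ρ * S.Td + S.ρ * S.θ * dx S.u - S.b * S.Bd - S.c * S.Cd

theorem Flow.Fd_x (S : Flow p) : ∀ x ∈ Icc (0:ℝ) 1, ∀ t ∈ Icc (0:ℝ) p.T,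
    (dx S.Fd).f x t = S.ρ.f x t * ((dt S.U).f x t + S.u.f x t * (dx S.U).f x t) := by
  intro x hx t ht
  have e : ∀ x ∈ Icc (0:ℝ) 1, ∀ t ∈ Icc (0:ℝ) p.T, S.Fd.f x t = (dt S.F + S.u * dx S.F).f x t := fun x hx t ht => by
    simp only [Flow.Fd, Flow.F, Flow.U, Flow.Td, Flow.Bd, Flow.Cd, add_f, sub_f, mul_f, neg_f, cst_f, xx_f, dx_add, dt_add, dx_sub, dt_sub, dx_neg, dt_neg, dx_mul, dt_mul, dx_cst, dt_cst, dx_xx, dt_xx, dt_dx]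
    linear_combination S.θ.f x t * S.mass x hx t ht
  rw [dx_congr (T := p.T) e x hx t ht]
  have h1 := dt_congr p.hT (F := dx S.F) (G := S.ρ * S.U) (fun x hx t ht => by rw [S.Fx x hx t ht]; rfl) x hx t ht
  have h2 := dx_congr (T := p.T) (F := dx S.F) (G := S.ρ * S.U) (fun x hx t ht => by rw [S.Fx x hx t ht]; rfl) x hx t ht
  have h3 := S.Fx x hx t ht
  have m := S.mass x hx t ht
  simp only [add_f, sub_f, mul_f, neg_f, cst_f, xx_f, dx_add, dt_add, dx_sub, dt_sub, dx_neg, dt_neg, dx_mul, dt_mul, dx_cst, dt_cst, dx_xx, dt_xx, dt_dx] at h1 h2 h3 ⊢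
  rw [h1, h2, h3, m]; ring

set_option maxHeartbeats 1000000 in
theorem D5u {S : Flow p} {C : ℝ} (h : H2 S C) {t : ℝ} (ht : t ∈ Icc (0:ℝ) p.T) :
    IR S S.U t + ∫ s in (0:ℝ)..t, I2 (dx S.U) s ≤ p.N + 5 * (C ^ 2 + C ^ 3 + 2 * C) * C
      + 5 * (C * p.C₀) * ∫ s in (0:ℝ)..t, ID S s := by
  have hC := h.h1.one
  have hC0 := p.hC₀
  have hκc := κe_cont p
  have id := masterI (T := p.T) (cst (1/2) * (S.ρ * (S.U * S.U))) (cst (1/2) * (S.u * (S.ρ * (S.U * S.U))) - S.U * S.Fd)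
    (fun x t => -((dx S.U).f x t * S.Fd.f x t)) (fun x hx t ht => by
      have m := S.mass x hx t ht
      have f := S.Fd_x x hx t ht
      simp only [mul_f, sub_f, add_f, cst_f, dx_mul, dt_mul, dx_sub, dx_cst, dt_cst]
      rw [f, m]; ring)
    (fun t ht => by simp only [mul_f, sub_f, cst_f]; rw [S.u0 t ht, S.U0 ht]; ring)
    (fun t ht => by simp only [mul_f, sub_f, cst_f]; rw [S.u1 t ht, S.U1 ht]; ring)
  replace id := id t ht
  have hX : ∀ t, Ix (cst (1/2) * (S.ρ * (S.U * S.U))).f t = 1/2 * IR S S.U t := fun t => by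
    rw [← Ix_mul]; apply Ix_congr; intro x hx; simp only [add_f, sub_f, mul_f, neg_f, cst_f, xx_f, dx_add, dt_add, dx_sub, dt_sub, dx_neg, dt_neg, dx_mul, dt_mul, dx_cst, dt_cst, dx_xx, dt_xx, dt_dx]; ring
  rw [hX, hX] at id
  have j : IR S S.U 0 ≤ p.N := by
    refine le_trans (le_of_eq ?_) S.jU
    apply Ix_congr; intro x hx; simp only [Flow.U, add_f, sub_f, mul_f, neg_f, cst_f, xx_f, dx_add, dt_add, dx_sub, dt_sub, dx_neg, dt_neg, dx_mul, dt_mul, dx_cst, dt_cst, dx_xx, dt_xx, dt_dx]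
  have main := int_le3 ht.1 (f := Ix (fun x t => -((dx S.U).f x t * S.Fd.f x t))) (g₁ := fun s => I2 (dx S.U) s)
    (g₂ := H1.m S) (g₃ := ID S) (-(1/2)) (5/2 * (C ^ 2 + C ^ 3 + 2 * C)) (5/2 * (C * p.C₀)) (fun s hs' => by
      have hs : s ∈ Icc (0:ℝ) p.T := ⟨hs'.1, hs'.2.trans ht.2⟩
      obtain ⟨m1, -, -, -, m4, m5, -⟩ := H1.m_ge S hs
      have a := Ix_le6 (t := s) (f := fun x t => -((dx S.U).f x t * S.Fd.f x t)) (g₁ := fun x t => (dx S.U).f x t ^ 2)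
        (g₂ := fun x t => (dx S.u).f x t ^ 2) (g₃ := fun x t => S.ρ.f x t * κe p.κ (S.θ.f x t) * S.Td.f x t ^ 2)
        (g₄ := fun x t => S.ρ.f x t * S.θ.f x t ^ 2) (g₅ := fun x t => S.Bd.f x t ^ 2) (g₆ := fun x t => S.Cd.f x t ^ 2)
        (-(1/2)) (5/2 * (C * H1.m S s)) (5/2 * (C * p.C₀)) (5/2 * (C * (C * H1.m S s))) (5/2 * C) (5/2 * C) (fun x hx => by
          have r := S.ρp x hx s hs
          have r1 := h.h1.ρ x hx s hs
          have hu := h.ux x hx s hs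
          have hb := h.h1.bs hx hs
          have hc := h.h1.cs hx hs
          have k1 := S.one_le_κ x s
          have hκ := p.κ_pos (S.θ.f x s)
          have e : -((dx S.U).f x s * S.Fd.f x s) = -(dx S.U).f x s ^ 2 + (dx S.U).f x s * ((dx S.u).f x s ^ 2 + S.ρ.f x s * S.Td.f x s
            + -(S.ρ.f x s * S.θ.f x s * (dx S.u).f x s) + S.b.f x s * S.Bd.f x s + S.c.f x s * S.Cd.f x s) := by
            simp only [Flow.Fd, mul_f, sub_f, add_f]; ring
          rw [e]
          have q0 := sq5 ((dx S.u).f x s ^ 2) (S.ρ.f x s * S.Td.f x s)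
            (-(S.ρ.f x s * S.θ.f x s * (dx S.u).f x s)) (S.b.f x s * S.Bd.f x s) (S.c.f x s * S.Cd.f x s)
          have q1 := mul_le_mul_of_nonneg_right hu (sq_nonneg ((dx S.u).f x s))
          have q2 := mul_le_mul r1 k1 zero_le_one (by linarith)
          have q3 := mul_le_mul_of_nonneg_right q2 (by positivity : 0 ≤ S.ρ.f x s * S.Td.f x s ^ 2)
          have q4 := mul_le_mul r1 hu (sq_nonneg _) (by linarith)
          have q5 := mul_le_mul_of_nonneg_right q4 (by positivity : 0 ≤ S.ρ.f x s * S.θ.f x s ^ 2)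
          have q6 := mul_le_mul_of_nonneg_right hb (sq_nonneg (S.Bd.f x s))
          have q7 := mul_le_mul_of_nonneg_right hc (sq_nonneg (S.Cd.f x s))
          have q3' := mul_le_mul_of_nonneg_right r1 (by positivity : 0 ≤ S.ρ.f x s * S.Td.f x s ^ 2)
          have q8 := mul_le_mul_of_nonneg_left k1 (by positivity : 0 ≤ C * (S.ρ.f x s * S.Td.f x s ^ 2))
          linarith [sq_nonneg ((dx S.U).f x s - ((dx S.u).f x s ^ 2 + S.ρ.f x s * S.Td.f x s
            + -(S.ρ.f x s * S.θ.f x s * (dx S.u).f x s) + S.b.f x s * S.Bd.f x s + S.c.f x s * S.Cd.f x s))])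
      have u1 := (h.h1.Ux hs).1
      have t1 := h.h1.ρθ s hs
      have m0 : 0 ≤ H1.m S s := by linarith
      have p1 := mul_le_mul_of_nonneg_left u1 (by positivity : 0 ≤ C * H1.m S s)
      have p2 := mul_le_mul_of_nonneg_left t1 (by positivity : 0 ≤ C * (C * H1.m S s))
      have p3 := mul_le_mul_of_nonneg_left m4 (by linarith : 0 ≤ C)
      have p4 := mul_le_mul_of_nonneg_left m5 (by linarith : 0 ≤ C)
      simp only [I2, IR, ID] at *
      linarith)
  have mm := (int_ext ht (f := H1.m S) (fun s hs => by linarith [(H1.m_ge S hs).1])).trans h.mI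
  have := mul_le_mul_of_nonneg_left mm (by positivity : 0 ≤ 5/2 * (C ^ 2 + C ^ 3 + 2 * C))
  linarith

end MHD

namespace MHD

variable {p : Par}

abbrev XJ (S : Flow p) : ℝ → ℝ := Ix (fun x t => S.Jx x t ^ 2)

theorem XJ_nonneg (S : Flow p) (t : ℝ) : 0 ≤ XJ S t := int_nonneg zero_le_one fun x _ => sq_nonneg _

/-- the constant controlling everything by `1 + XJ` -/
def JL (p : Par) (C : ℝ) : ℝ := 20 * C ^ 3 + 2 * p.C₀ + p.C₀ ^ 2 * (p.q + 1) * (1 + 20 * C ^ 3)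

theorem JL_ge (p : Par) {C : ℝ} (hC : 1 ≤ C) : 20 * C ^ 3 ≤ JL p C ∧ 20 ≤ JL p C ∧ C ≤ JL p C := by
  have h0 := p.hC₀
  have h1 := p.hq
  have h2 : 1 ≤ C ^ 3 := one_le_pow₀ hC
  have h3 : C ≤ C ^ 3 := by nlinarith [mul_self_nonneg (C - 1)]
  have : 0 ≤ p.C₀ ^ 2 * (p.q + 1) * (1 + 20 * C ^ 3) := by positivity
  unfold JL
  refine ⟨?_, ?_, ?_⟩ <;> linarith

theorem Flow.YJ_sq {S : Flow p} {C : ℝ} (h : H1 S C) {x t : ℝ} (hx : x ∈ Icc (0:ℝ) 1) (ht : t ∈ Icc (0:ℝ) p.T) :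
    S.YJ.f x t ^ 2 ≤ 2 * C * (dx S.w).f x t ^ 2 + 2 * C * (dx S.v).f x t ^ 2 := by
  have hw := h.ws hx ht
  have hv := h.vs hx ht
  have e : S.YJ.f x t = S.w.f x t * (dx S.w).f x t + S.v.f x t * (dx S.v).f x t := rfl
  rw [e]
  have := sq2 (S.w.f x t * (dx S.w).f x t) (S.v.f x t * (dx S.v).f x t)
  have := mul_le_mul_of_nonneg_right hw (sq_nonneg ((dx S.w).f x t))
  have := mul_le_mul_of_nonneg_right hv (sq_nonneg ((dx S.v).f x t))
  linarith

theorem Ik_le {S : Flow p} {C : ℝ} (h : H1 S C) {t : ℝ} (ht : t ∈ Icc (0:ℝ) p.T) :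
    Ik S t ≤ 2 * XJ S t + 8 * C ^ 2 := by
  have a := Ix_le3 (t := t) (f := fun x t => S.k x t ^ 2) (g₁ := fun x t => S.Jx x t ^ 2) (g₂ := fun x t => (dx S.w).f x t ^ 2)
    (g₃ := fun x t => (dx S.v).f x t ^ 2) 2 (4 * C) (4 * C) (fun x hx => by
      have h1 := Flow.YJ_sq h hx ht
      have e : S.Jx x t = S.k x t + S.YJ.f x t := rfl
      rw [e]
      linarith [sq_nonneg (S.k x t + 2 * S.YJ.f x t)])
  have hw := (h.Ux ht).2.1
  have hv := (h.Ux ht).2.2.1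
  have hC := h.nn
  have := mul_le_mul_of_nonneg_left hw hC
  have := mul_le_mul_of_nonneg_left hv hC
  simp only [I2, Ik, XJ] at *
  linarith

theorem J_bd {S : Flow p} {C : ℝ} (h : H1 S C) {x t : ℝ} (hx : x ∈ Icc (0:ℝ) 1) (ht : t ∈ Icc (0:ℝ) p.T) :
    0 ≤ S.J x t ∧ S.J x t ^ 2 ≤ JL p C * (1 + XJ S t) ∧ κe p.κ (S.θ.f x t) ≤ JL p C * (1 + XJ S t) ∧ Ik S t ≤ JL p C * (1 + XJ S t) := by
  have hC := h.one
  have h0 := p.hC₀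
  have hq := p.hq
  have i := Ik_le h ht
  have k0 := p.K_nonneg (S.θp x hx t ht).le
  have kk := h.K x hx t ht
  have κκ := p.κ_le (S.θp x hx t ht).le
  have hw := h.ws hx ht
  have hv := h.vs hx ht
  have X0 := XJ_nonneg S t
  have c2 : C ≤ C ^ 2 := by nlinarith
  have c3 : C ^ 2 ≤ C ^ 3 := by nlinarith [sq_nonneg C]
  have jl := JL_ge p hC
  have e : S.J x t = p.K (S.θ.f x t) + 1/2 * (S.w.f x t ^ 2 + S.v.f x t ^ 2) := rfl
  set X := XJ S t
  set k := p.K (S.θ.f x t)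
  have k2 : k ^ 2 ≤ C + 8 * C ^ 3 + 2 * C * X := by
    have := mul_le_mul_of_nonneg_left i (by linarith : 0 ≤ C)
    linarith
  have cX : C * X ≤ C ^ 3 * X := mul_le_mul_of_nonneg_right (by linarith) X0
  have hwv0 : 0 ≤ 1/2 * (S.w.f x t ^ 2 + S.v.f x t ^ 2) := by positivity
  have hwv : (1/2 * (S.w.f x t ^ 2 + S.v.f x t ^ 2)) ^ 2 ≤ C ^ 2 := pow_le_pow_left₀ hwv0 (by linarith) 2
  have up : 20 * C ^ 3 * (1 + X) ≤ JL p C * (1 + X) := mul_le_mul_of_nonneg_right jl.1 (by linarith)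
  have cX0 : 0 ≤ C ^ 3 * X := by positivity
  refine ⟨by rw [e]; linarith, ?_, ?_, ?_⟩
  · rw [e]
    have := sq2 k (1/2 * (S.w.f x t ^ 2 + S.v.f x t ^ 2))
    linarith
  · have k1 : k ≤ 1 + 20 * C ^ 3 * (1 + X) := by linarith [sq_nonneg (k - 1)]
    have := mul_le_mul_of_nonneg_left k1 (by positivity : 0 ≤ p.C₀ ^ 2 * (p.q + 1))
    have e1 : JL p C * (1 + X) = 20 * C ^ 3 * (1 + X) + 2 * p.C₀ * (1 + X) + p.C₀ ^ 2 * (p.q + 1) * (1 + 20 * C ^ 3) * (1 + X) := by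
      unfold JL; ring
    rw [e1]
    have : 0 ≤ 20 * C ^ 3 * (1 + X) := by positivity
    have : 0 ≤ p.C₀ * X := by positivity
    have : 0 ≤ p.C₀ ^ 2 * (p.q + 1) * X := by positivity
    linarith
  · have : X ≤ C ^ 3 * X := by
      have := mul_le_mul_of_nonneg_right (one_le_pow₀ hC : 1 ≤ C ^ 3) X0
      linarith
    linarith

theorem j2 (r κ Td z c0 : ℝ) (hr : 0 ≤ r) (hκ : 0 ≤ κ) (h0 : 0 ≤ c0) (h1 : 1 ≤ c0 * κ) :
    -(r * (Td + z) * (κ * Td + z)) ≤ -(3/4) * (r * κ * Td ^ 2) + (1 + c0) ^ 2 * κ * (r * z ^ 2) := by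
  have e : -((1 + κ) * (Td * z)) ≤ κ * (1/4 * Td ^ 2 + (1 + c0) ^ 2 * z ^ 2) := by
    have a1 : -((1 + κ) * (Td * z)) ≤ (1 + κ) * |Td * z| := by
      have := mul_le_mul_of_nonneg_left (neg_abs_le (Td * z)) (by linarith : 0 ≤ 1 + κ)
      linarith
    have a2 : (1 + κ) * |Td * z| ≤ ((1 + c0) * κ) * |Td * z| := mul_le_mul_of_nonneg_right (by linarith) (abs_nonneg _)
    have a3 : (1 + c0) * |Td * z| ≤ 1/4 * Td ^ 2 + (1 + c0) ^ 2 * z ^ 2 := by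
      rw [abs_mul]
      have := sq_nonneg (1/2 * |Td| - (1 + c0) * |z|)
      have := sq_abs Td
      have := sq_abs z
      nlinarith
    have := mul_le_mul_of_nonneg_left a3 hκ
    linarith
  have := mul_le_mul_of_nonneg_left e hr
  have : 0 ≤ r * z ^ 2 := by positivity
  linarith

theorem j3 (r κ Td z θ y : ℝ) (hr : 0 ≤ r) (hκ : 0 ≤ κ) :
    -(r * θ * y * (κ * Td + z)) ≤ 1/4 * (r * κ * Td ^ 2) + (κ + 1) * y ^ 2 * (r * θ ^ 2) + r * z ^ 2 := by
  have := mul_nonneg (mul_nonneg hr hκ) (sq_nonneg (1/2 * Td + θ * y))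
  have := mul_nonneg hr (sq_nonneg (1/2 * (θ * y) + z))
  have : 0 ≤ r * (θ * y) ^ 2 := by positivity
  linarith

theorem j4 (y Y J ε : ℝ) (hε : 0 < ε) : -(2 * y * Y * J) ≤ ε * Y ^ 2 + ε⁻¹ * (y ^ 2 * J ^ 2) := by
  have := mul_nonneg hε.le (sq_nonneg (Y + ε⁻¹ * (y * J)))
  have e : ε * (Y + ε⁻¹ * (y * J)) ^ 2 = ε * Y ^ 2 + 2 * y * Y * J + ε⁻¹ * (y ^ 2 * J ^ 2) := by field_simp; ring
  linarith

/-- one half of the magnetic terms -/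
theorem j7 (B bxx wx bx w J Jx P R c : ℝ) (hJ : 0 ≤ J) (hP : J ≤ P) (hb : bx ^ 2 ≤ R) (hw : w ^ 2 ≤ c) :
    B * ((2 * bxx + wx) * J + (2 * bx + w) * Jx) ≤ (2 * P + 2) * B ^ 2 + P * bxx ^ 2 + P * wx ^ 2 + (R + c) * Jx ^ 2 := by
  have a1 := mul_nonneg hJ (sq_nonneg (B - bxx))
  have a2 := mul_nonneg hJ (sq_nonneg (B - wx))
  have a3 := mul_le_mul_of_nonneg_right hP (sq_nonneg B)
  have a4 := mul_le_mul_of_nonneg_right hP (sq_nonneg bxx)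
  have a5 := mul_le_mul_of_nonneg_right hP (sq_nonneg wx)
  have a6 := mul_le_mul_of_nonneg_right hb (sq_nonneg Jx)
  have a7 := mul_le_mul_of_nonneg_right hw (sq_nonneg Jx)
  have a8 := mul_nonneg (hJ.trans hP) (sq_nonneg B)
  have a9 := mul_nonneg (hJ.trans hP) (sq_nonneg wx)
  have b1 := mul_nonneg hJ (sq_nonneg B)
  have b2 := mul_nonneg hJ (sq_nonneg wx)
  linarith [sq_nonneg (B - bx * Jx), sq_nonneg (B - w * Jx), sq_nonneg (w * Jx), sq_nonneg (bx * Jx), sq_nonneg B]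

theorem j5 (y J bx cx P : ℝ) (hP : y ^ 2 + J ^ 2 ≤ 2 * P) :
    (y ^ 3 + y * (bx ^ 2 + cx ^ 2)) * J ≤ P * (y ^ 2 + bx ^ 2 + cx ^ 2) := by
  have h1 : y * J ≤ P := by linarith [sq_nonneg (y - J)]
  have := mul_le_mul_of_nonneg_right h1 (by positivity : 0 ≤ y ^ 2 + bx ^ 2 + cx ^ 2)
  linarith

theorem j6 (W bx J Γ : ℝ) (hJ : 0 ≤ J) (hΓ : J ≤ Γ) : -(W * bx * J) ≤ Γ * |W * bx| := by
  have := mul_le_mul_of_nonneg_right (neg_abs_le (W * bx)) hJ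
  have := mul_le_mul_of_nonneg_right hΓ (abs_nonneg (W * bx))
  linarith

theorem jz (w W v V r c : ℝ) (hr : 0 ≤ r) (hw : w ^ 2 ≤ c) (hv : v ^ 2 ≤ c) :
    r * (w * W + v * V) ^ 2 ≤ 2 * c * (r * W ^ 2 + r * V ^ 2) := by
  have := sq2 (w * W) (v * V)
  have := mul_le_mul_of_nonneg_right hw (sq_nonneg W)
  have := mul_le_mul_of_nonneg_right hv (sq_nonneg V)
  have e : (w * W + v * V) ^ 2 ≤ 2 * c * W ^ 2 + 2 * c * V ^ 2 := by linarith
  have := mul_le_mul_of_nonneg_left e hr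
  linarith

end MHD

namespace MHD

variable {p : Par}

set_option maxHeartbeats 1000000 in
theorem jpt (y Jx r Td κ θ Y bx cx W V J B D bxx cxx wx vx w v C L m E c0 ε Γ : ℝ)
    (hC : 1 ≤ C) (hL : 1 ≤ L) (hm : 1 ≤ m) (hE : 1 ≤ E) (hc0 : 1 ≤ c0) (hε : 0 < ε) (hr : 0 ≤ r) (hκ : 0 ≤ κ)
    (h1 : 1 ≤ c0 * κ) (hκL : κ ≤ L * E) (hJ : 0 ≤ J) (hJL : J ^ 2 ≤ L * E) (hΓ : J ≤ Γ)
    (hy : y ^ 2 ≤ C * m) (hb : bx ^ 2 ≤ C * m) (hc : cx ^ 2 ≤ C * m) (hw : w ^ 2 ≤ C) (hv : v ^ 2 ≤ C) :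
    -(1/2) * (y * Jx ^ 2) - r * (Td + (w * W + v * V)) * (κ * Td + (w * W + v * V)) - r * θ * y * (κ * Td + (w * W + v * V))
    - (2 * y * Y - y ^ 3 - y * (bx ^ 2 + cx ^ 2) + W * bx + V * cx) * J
    + B * ((2 * bxx + wx) * J + (2 * bx + w) * Jx) + D * ((2 * cxx + vx) * J + (2 * cx + v) * Jx)
    ≤ -(1/2) * (r * κ * Td ^ 2) + ε * Y ^ 2 + 5 * C * m * Jx ^ 2
      + 4 * (1 + c0) ^ 2 * C * L * E * (r * W ^ 2 + r * V ^ 2 + B ^ 2 + D ^ 2 + bxx ^ 2 + cxx ^ 2)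
      + (2 + ε⁻¹) * C * L * m * E * (r * θ ^ 2 + y ^ 2 + bx ^ 2 + cx ^ 2 + wx ^ 2 + vx ^ 2 + 1)
      + Γ * |W * bx| + Γ * |V * cx| := by
  have hCm : 1 ≤ C * m := one_le_mul_of_one_le_of_one_le hC hm
  have hLE : 1 ≤ L * E := one_le_mul_of_one_le_of_one_le hL hE
  have hP : J ≤ L * E := by linarith [sq_nonneg (J - 1)]
  have q1 : C * 1 ≤ C * m := mul_le_mul_of_nonneg_left hm (by linarith)
  set P := L * E with hPdef
  set R := C * m with hR
  have hε' : 0 < ε⁻¹ := by positivity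
  -- the scalar comparisons
  have s1 : R ≤ R * P := by have := mul_le_mul_of_nonneg_left hLE (by linarith : 0 ≤ R); linarith
  have s2 : P ≤ R * P := by have := mul_le_mul_of_nonneg_right hCm (by linarith : 0 ≤ P); linarith
  have s3 : C ≤ C * P := by have := mul_le_mul_of_nonneg_left hLE (by linarith : 0 ≤ C); linarith
  have s4 : P ≤ C * P := by have := mul_le_mul_of_nonneg_right hC (by linarith : 0 ≤ P); linarith
  have s5 : (1:ℝ) ≤ (1 + c0) ^ 2 := one_le_pow₀ (by linarith)
  have s6 : C * P ≤ (1 + c0) ^ 2 * (C * P) := by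
    have := mul_le_mul_of_nonneg_right s5 (by linarith : 0 ≤ C * P); linarith
  have G0 : 0 ≤ ε⁻¹ * (R * P) := by have : 0 ≤ R * P := by linarith
                                    positivity
  have e1 : 4 * (1 + c0) ^ 2 * C * L * E = 4 * ((1 + c0) ^ 2 * (C * P)) := by rw [hPdef]; ring
  have e2 : (2 + ε⁻¹) * C * L * m * E = 2 * (R * P) + ε⁻¹ * (R * P) := by rw [hPdef, hR]; ring
  rw [e1, e2]
  set A := (1 + c0) ^ 2 * (C * P) with hA
  set Z := R * P with hZ
  have t1 : -(1/2) * (y * Jx ^ 2) ≤ R * Jx ^ 2 := by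
    have h : -(1/2) * y ≤ R := by linarith [sq_nonneg (y + 1)]
    have := mul_le_mul_of_nonneg_right h (sq_nonneg Jx)
    linarith
  have zz := jz w W v V r C hr hw hv
  have t2 := j2 r κ Td (w * W + v * V) c0 hr hκ (by linarith) h1
  have t2' : (1 + c0) ^ 2 * κ * (r * (w * W + v * V) ^ 2) ≤ 2 * A * (r * W ^ 2 + r * V ^ 2) := by
    have a1 : (1 + c0) ^ 2 * κ ≤ (1 + c0) ^ 2 * P := mul_le_mul_of_nonneg_left hκL (by positivity)
    have a2 := mul_le_mul a1 zz (by positivity) (by positivity)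
    refine a2.trans (le_of_eq ?_)
    rw [hA]; ring
  have t3 := j3 r κ Td (w * W + v * V) θ y hr hκ
  have t3' : (κ + 1) * y ^ 2 * (r * θ ^ 2) ≤ 2 * Z * (r * θ ^ 2) := by
    have a1 : (κ + 1) * y ^ 2 ≤ (2 * P) * R := mul_le_mul (by linarith) hy (sq_nonneg _) (by linarith)
    have := mul_le_mul_of_nonneg_right a1 (by positivity : 0 ≤ r * θ ^ 2)
    refine this.trans (le_of_eq ?_)
    rw [hZ]; ring
  have t4 := j4 y Y J ε hε
  have t4' : ε⁻¹ * (y ^ 2 * J ^ 2) ≤ ε⁻¹ * Z := mul_le_mul_of_nonneg_left (mul_le_mul hy hJL (sq_nonneg _) (by linarith)) hε'.le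
  have t5 := j5 y J bx cx Z (by linarith)
  have t6 := j6 W bx J Γ hJ hΓ
  have t6' := j6 V cx J Γ hJ hΓ
  have t7 := j7 B bxx wx bx w J Jx P R C hJ hP hb hw
  have t8 := j7 D cxx vx cx v J Jx P R C hJ hP hc hv
  have t9 : (R + C) * Jx ^ 2 ≤ 2 * R * Jx ^ 2 := mul_le_mul_of_nonneg_right (by linarith) (sq_nonneg _)
  have gB : (2 * P + 2) * B ^ 2 ≤ 4 * A * B ^ 2 := mul_le_mul_of_nonneg_right (by linarith) (sq_nonneg _)
  have gD : (2 * P + 2) * D ^ 2 ≤ 4 * A * D ^ 2 := mul_le_mul_of_nonneg_right (by linarith) (sq_nonneg _)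
  have gb : P * bxx ^ 2 ≤ 4 * A * bxx ^ 2 := mul_le_mul_of_nonneg_right (by linarith) (sq_nonneg _)
  have gc : P * cxx ^ 2 ≤ 4 * A * cxx ^ 2 := mul_le_mul_of_nonneg_right (by linarith) (sq_nonneg _)
  have gW : 2 * C * (r * W ^ 2 + r * V ^ 2) ≤ 2 * A * (r * W ^ 2 + r * V ^ 2) := mul_le_mul_of_nonneg_right (by linarith) (by positivity)
  have gw1 : P * wx ^ 2 ≤ 2 * Z * wx ^ 2 := mul_le_mul_of_nonneg_right (by linarith) (sq_nonneg _)
  have gv1 : P * vx ^ 2 ≤ 2 * Z * vx ^ 2 := mul_le_mul_of_nonneg_right (by linarith) (sq_nonneg _)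
  have Z0 : 0 ≤ Z := by linarith
  have n1 : 0 ≤ Z * (y ^ 2 + bx ^ 2 + cx ^ 2) := by positivity
  have n2 : 0 ≤ ε⁻¹ * Z * (r * θ ^ 2 + y ^ 2 + bx ^ 2 + cx ^ 2 + wx ^ 2 + vx ^ 2) := by positivity
  linarith

set_option maxHeartbeats 1000000 in
theorem rJ_rate {S : Flow p} {C : ℝ} (h : H2 S C) {t : ℝ} (ht : t ∈ Icc (0:ℝ) p.T) {ε Γ : ℝ} (hε : 0 < ε)
    (hΓ : ∀ x ∈ Icc (0:ℝ) 1, S.J x t ≤ Γ) :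
    Ix S.rJ t ≤ -(1/2) * ID S t + ε * I2 (dx S.U) t
      + (5 * C + 4 * (1 + p.C₀) ^ 2 * C * JL p C * (4 + 2 * C) + (2 + ε⁻¹) * C * JL p C * (7 * C)) * H1.m S t * (1 + XJ S t)
      + Γ * Ix (fun x t => |S.W.f x t * (dx S.b).f x t|) t + Γ * Ix (fun x t => |S.V.f x t * (dx S.c).f x t|) t := by
  have hC := h.h1.one
  have hC0 := p.hC₀
  have hκc := κe_cont p
  obtain ⟨m1, -, mW, mV, mB, mC, -, -⟩ := H1.m_ge S ht
  have X0 := XJ_nonneg S t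
  have hL := (JL_ge p hC).2.1
  have a := Ix_le7 (t := t) (f := S.rJ) (g₁ := fun x t => S.ρ.f x t * κe p.κ (S.θ.f x t) * S.Td.f x t ^ 2)
    (g₂ := fun x t => (dx S.U).f x t ^ 2) (g₃ := fun x t => S.Jx x t ^ 2)
    (g₄ := fun x t => S.ρ.f x t * S.W.f x t ^ 2 + S.ρ.f x t * S.V.f x t ^ 2 + S.Bd.f x t ^ 2 + S.Cd.f x t ^ 2
      + (dx (dx S.b)).f x t ^ 2 + (dx (dx S.c)).f x t ^ 2)
    (g₅ := fun x t => S.ρ.f x t * S.θ.f x t ^ 2 + (dx S.u).f x t ^ 2 + (dx S.b).f x t ^ 2 + (dx S.c).f x t ^ 2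
      + (dx S.w).f x t ^ 2 + (dx S.v).f x t ^ 2 + 1)
    (g₆ := fun x t => |S.W.f x t * (dx S.b).f x t|) (g₇ := fun x t => |S.V.f x t * (dx S.c).f x t|)
    (-(1/2)) ε (5 * C * H1.m S t) (4 * (1 + p.C₀) ^ 2 * C * JL p C * (1 + XJ S t))
    ((2 + ε⁻¹) * C * JL p C * H1.m S t * (1 + XJ S t)) Γ Γ (fun x hx => by
      obtain ⟨b1, b2, b3, -⟩ := J_bd h.h1 hx ht
      exact jpt _ _ _ _ _ _ _ _ _ _ _ _ _ _ _ _ _ _ _ _ C (JL p C) (H1.m S t) (1 + XJ S t) p.C₀ ε Γ hC (by linarith) m1 (by linarith)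
        hC0 hε (S.ρp x hx t ht).le (p.κ_pos _).le (S.one_le_κ x t) b3 b1 b2 (hΓ x hx) (h.ux x hx t ht) (h.bx x hx t ht)
        (h.cx x hx t ht) (h.h1.ws hx ht) (h.h1.vs hx ht))
  have i4 := Ix_le6 (t := t) (f := fun x t => S.ρ.f x t * S.W.f x t ^ 2 + S.ρ.f x t * S.V.f x t ^ 2 + S.Bd.f x t ^ 2 + S.Cd.f x t ^ 2
      + (dx (dx S.b)).f x t ^ 2 + (dx (dx S.c)).f x t ^ 2) (g₁ := fun x t => S.ρ.f x t * S.W.f x t ^ 2)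
      (g₂ := fun x t => S.ρ.f x t * S.V.f x t ^ 2) (g₃ := fun x t => S.Bd.f x t ^ 2) (g₄ := fun x t => S.Cd.f x t ^ 2)
      (g₅ := fun x t => (dx (dx S.b)).f x t ^ 2) (g₆ := fun x t => (dx (dx S.c)).f x t ^ 2) 1 1 1 1 1 1 (fun x hx => by linarith)
  have i5 := Ix_le7 (t := t) (f := fun x t => S.ρ.f x t * S.θ.f x t ^ 2 + (dx S.u).f x t ^ 2 + (dx S.b).f x t ^ 2 + (dx S.c).f x t ^ 2
      + (dx S.w).f x t ^ 2 + (dx S.v).f x t ^ 2 + 1) (g₁ := fun x t => S.ρ.f x t * S.θ.f x t ^ 2) (g₂ := fun x t => (dx S.u).f x t ^ 2)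
      (g₃ := fun x t => (dx S.b).f x t ^ 2) (g₄ := fun x t => (dx S.c).f x t ^ 2) (g₅ := fun x t => (dx S.w).f x t ^ 2)
      (g₆ := fun x t => (dx S.v).f x t ^ 2) (g₇ := fun x t => 1) 1 1 1 1 1 1 1 (fun x hx => by linarith)
  have o1 : Ix (fun _ _ => (1:ℝ)) t = 1 := Ix_one 1 t
  have u := h.h1.Ux ht
  have rθ := h.h1.ρθ t ht
  have hb := h.bxx t ht
  have hc := h.cxx t ht
  have i4' := i4.trans (by simp only [I2, IR] at *; nlinarith : _ ≤ (4 + 2 * C) * H1.m S t)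
  have i5' := i5.trans (by simp only [I2, IR] at *; linarith : _ ≤ 7 * C)
  have hε' : 0 < ε⁻¹ := by positivity
  have w4 := mul_le_mul_of_nonneg_left i4' (by positivity : 0 ≤ 4 * (1 + p.C₀) ^ 2 * C * JL p C * (1 + XJ S t))
  have w5 := mul_le_mul_of_nonneg_left i5' (by positivity : 0 ≤ (2 + ε⁻¹) * C * JL p C * H1.m S t * (1 + XJ S t))
  have w3 : 5 * C * H1.m S t * XJ S t ≤ 5 * C * H1.m S t * (1 + XJ S t) := mul_le_mul_of_nonneg_left (by linarith) (by positivity)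
  refine a.trans ?_
  simp only [ID, I2, XJ] at *
  linarith

end MHD

namespace MHD

variable {p : Par}

theorem f1_int {S : Flow p} {C : ℝ} (h : H1 S C) {t P : ℝ} (ht : t ∈ Icc (0:ℝ) p.T) (hP : ∀ x ∈ Icc (0:ℝ) 1, S.J x t ≤ P) :
    Ix (fun x t => S.f1.f x t * S.J x t) t ≤ 6 * C * P ∧ -(Ix (fun x t => S.f1.f x t * S.J x t) t) ≤ 6 * C * P := by
  have hC := h.one
  have key : ∀ x ∈ Icc (0:ℝ) 1, |S.f1.f x t * S.J x t| ≤ P * (dx S.u).f x t ^ 2 + 3/2 * P * (dx S.b).f x t ^ 2 + 3/2 * P * (dx S.c).f x t ^ 2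
      + P * C * 1 := fun x hx => by
    have J0 := (J_bd h hx ht).1
    have hw := h.ws hx ht
    have hv := h.vs hx ht
    have e : S.f1.f x t = (dx S.u).f x t ^ 2 + (dx S.b).f x t ^ 2 + (dx S.c).f x t ^ 2 + S.w.f x t * (dx S.b).f x t + S.v.f x t * (dx S.c).f x t := by
      simp only [Flow.f1, add_f, sub_f, mul_f, neg_f, cst_f, xx_f, dx_add, dt_add, dx_sub, dt_sub, dx_neg, dt_neg, dx_mul, dt_mul, dx_cst, dt_cst, dx_xx, dt_xx, dt_dx]; ring
    rw [abs_mul, abs_of_nonneg J0]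
    have : |S.f1.f x t| ≤ (dx S.u).f x t ^ 2 + 3/2 * (dx S.b).f x t ^ 2 + 3/2 * (dx S.c).f x t ^ 2 + C := by
      rw [e, abs_le]
      constructor <;> linarith [sq_nonneg (S.w.f x t + (dx S.b).f x t), sq_nonneg (S.v.f x t + (dx S.c).f x t),
        sq_nonneg (S.w.f x t - (dx S.b).f x t), sq_nonneg (S.v.f x t - (dx S.c).f x t), sq_nonneg ((dx S.u).f x t),
        sq_nonneg ((dx S.b).f x t), sq_nonneg ((dx S.c).f x t)]
    have := mul_le_mul this (hP x hx) J0 (by positivity)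
    linarith
  have P0 : 0 ≤ P := (J_bd h (left_mem_Icc.mpr zero_le_one) ht).1.trans (hP 0 (left_mem_Icc.mpr zero_le_one))
  have u := h.Ux ht
  have o1 : Ix (fun _ _ => (1:ℝ)) t = 1 := Ix_one 1 t
  have fin : P * I2 (dx S.u) t + 3/2 * P * I2 (dx S.b) t + 3/2 * P * I2 (dx S.c) t + P * C * 1 ≤ 6 * C * P := by
    have := mul_le_mul_of_nonneg_left u.1 P0
    have := mul_le_mul_of_nonneg_left u.2.2.2.1 P0
    have := mul_le_mul_of_nonneg_left u.2.2.2.2 P0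
    have : 0 ≤ P * C := by positivity
    linarith
  constructor
  · have a := Ix_le4 (t := t) (f := fun x t => S.f1.f x t * S.J x t) (g₁ := fun x t => (dx S.u).f x t ^ 2)
      (g₂ := fun x t => (dx S.b).f x t ^ 2) (g₃ := fun x t => (dx S.c).f x t ^ 2) (g₄ := fun x t => 1) P (3/2*P) (3/2*P) (P * C)
      (fun x hx => (le_abs_self _).trans (key x hx))
    rw [o1] at a
    exact a.trans fin
  · rw [← Ix_neg]
    have a := Ix_le4 (t := t) (f := fun x t => -(S.f1.f x t * S.J x t)) (g₁ := fun x t => (dx S.u).f x t ^ 2)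
      (g₂ := fun x t => (dx S.b).f x t ^ 2) (g₃ := fun x t => (dx S.c).f x t ^ 2) (g₄ := fun x t => 1) P (3/2*P) (3/2*P) (P * C)
      (fun x hx => (neg_le_abs _).trans (key x hx))
    rw [o1] at a
    exact a.trans fin

theorem J_le {S : Flow p} {C : ℝ} (h : H1 S C) {x t η : ℝ} (hη : 0 < η) (hx : x ∈ Icc (0:ℝ) 1) (ht : t ∈ Icc (0:ℝ) p.T) :
    S.J x t ≤ η⁻¹ + η * (JL p C * (1 + XJ S t)) := by
  have b := (J_bd h hx ht).2.1
  have := mul_le_mul_of_nonneg_left b hη.le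
  have h2 := mul_nonneg hη.le (sq_nonneg (S.J x t - η⁻¹))
  have e : η * (S.J x t - η⁻¹) ^ 2 = η * S.J x t ^ 2 - 2 * S.J x t + η⁻¹ := by field_simp; ring
  have h3 := mul_nonneg hη.le (sq_nonneg (S.J x t))
  have : 0 < η⁻¹ := by positivity
  linarith

theorem XJ_init (p : Par) : ∃ D, 0 ≤ D ∧ ∀ S : Flow p, XJ S 0 ≤ D := by
  set k := 2 * p.C₀ + p.C₀ ^ 2 * (p.q + 1) * p.K p.N with hk
  refine ⟨2 * (k ^ 2 * p.N ^ 2) + 8 * p.N ^ 4, by positivity, fun S => ?_⟩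
  refine Ix_le_const _ (fun x hx => ?_)
  obtain ⟨a1, a2⟩ := S.iθ x hx
  obtain ⟨w1, w2⟩ := S.iw x hx
  obtain ⟨v1, v2⟩ := S.iv x hx
  have θp := S.θp x hx 0 p.h0
  have hC0 := p.hC₀
  have hq := p.hq
  have h1 := p.κ_le θp.le
  have h2 := p.K_mono.monotone ((le_abs_self _).trans a1)
  have κ0 := p.κ_pos (S.θ.f x 0)
  have h3 : κe p.κ (S.θ.f x 0) ≤ k := by
    have := mul_le_mul_of_nonneg_left h2 (by positivity : 0 ≤ p.C₀ ^ 2 * (p.q + 1))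
    linarith
  have h4 := mul_le_mul (pow_le_pow_left₀ κ0.le h3 2) (sqbd a2) (sq_nonneg _) (by positivity)
  have e : S.Jx x 0 = κe p.κ (S.θ.f x 0) * (dx S.θ).f x 0 + (S.w.f x 0 * (dx S.w).f x 0 + S.v.f x 0 * (dx S.v).f x 0) := rfl
  have := sq2 (κe p.κ (S.θ.f x 0) * (dx S.θ).f x 0) (S.w.f x 0 * (dx S.w).f x 0 + S.v.f x 0 * (dx S.v).f x 0)
  have := sq2 (S.w.f x 0 * (dx S.w).f x 0) (S.v.f x 0 * (dx S.v).f x 0)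
  have := mul_le_mul (sqbd w1) (sqbd w2) (sq_nonneg _) (sq_nonneg _)
  have := mul_le_mul (sqbd v1) (sqbd v2) (sq_nonneg _) (sq_nonneg _)
  rw [e]
  linarith

structure H5 (S : Flow p) (C : ℝ) : Prop where
  h2 : H2 S C
  X : ∀ t ∈ Icc (0:ℝ) p.T, XJ S t ≤ C
  D : ∫ s in (0:ℝ)..p.T, ID S s ≤ C
  U : ∀ t ∈ Icc (0:ℝ) p.T, IR S S.U t ≤ C
  Ux : ∫ s in (0:ℝ)..p.T, I2 (dx S.U) s ≤ C

set_option maxHeartbeats 1000000 in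
/-- the differential inequality for `XJ` -/
theorem D5ineq (p : Par) : ∃ C A a0 : ℝ, 1 ≤ C ∧ 0 ≤ A ∧ 0 ≤ a0 ∧ ∀ S : Flow p, H2 S C ∧ ∀ Γ, (∀ x ∈ Icc (0:ℝ) 1, ∀ t ∈ Icc (0:ℝ) p.T, S.J x t ≤ Γ) →
    ∀ t ∈ Icc (0:ℝ) p.T, XJ S t + ∫ s in (0:ℝ)..t, ID S s ≤ a0 + 8 * C * Γ + ∫ s in (0:ℝ)..t, A * H1.m S s * (1 + XJ S s) := by
  obtain ⟨C, hC, hH⟩ := stepD4 p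
  obtain ⟨D0, hD0, hD⟩ := XJ_init p
  have hC0 := p.hC₀
  have hL := (JL_ge p hC).2.1
  have hN := p.hN
  set L := JL p C with hLdef
  set ε := (20 * (C * p.C₀))⁻¹ with hε
  have ε0 : 0 < ε := by positivity
  have εe : ε * (20 * (C * p.C₀)) = 1 := inv_mul_cancel₀ (by positivity)
  set η := (24 * (C * L))⁻¹ with hη
  have η0 : 0 < η := by positivity
  have ηe : η * (24 * (C * L)) = 1 := inv_mul_cancel₀ (by positivity)
  set A := (5 * C + 4 * (1 + p.C₀) ^ 2 * C * L * (4 + 2 * C) + (2 + ε⁻¹) * C * L * (7 * C)) with hA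
  have A0 : 0 ≤ A := by positivity
  set e0 := ε * (p.N + 5 * (C ^ 2 + C ^ 3 + 2 * C) * C) with he0
  have e00 : 0 ≤ e0 := by positivity
  have η1 : 0 ≤ C * η⁻¹ := by positivity
  refine ⟨C, 4 * A, 4 * (12 * C * η⁻¹ + 1 + D0 + e0), hC, by linarith, by linarith, fun S => ⟨(hH S).h2, fun Γ hΓ t ht => ?_⟩⟩
  have h4 := hH S
  have h := h4.h2
  have en : ∀ t ∈ Icc (0:ℝ) p.T, Ix (fun x t => S.f1.f x t * S.J x t) t ≤ 6 * C * η⁻¹ + 1/4 * (1 + XJ S t) ∧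
      -(Ix (fun x t => S.f1.f x t * S.J x t) t) ≤ 6 * C * η⁻¹ + 1/4 * (1 + XJ S t) := fun t ht => by
    have a := f1_int h.h1 ht (P := η⁻¹ + η * (L * (1 + XJ S t))) (fun x hx => J_le h.h1 η0 hx ht)
    have e : 6 * C * (η⁻¹ + η * (L * (1 + XJ S t))) = 6 * C * η⁻¹ + 1/4 * (1 + XJ S t) := by
      linear_combination (1/4) * (1 + XJ S t) * ηe
    rwa [e] at a
  have sp : ∀ t, Ix (fun x t => 1/2 * S.Jx x t ^ 2 - S.f1.f x t * S.J x t) t = 1/2 * XJ S t - Ix (fun x t => S.f1.f x t * S.J x t) t := fun t => by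
    rw [Ix_sub, Ix_mul]
  have id := S.Jid ht
  rw [sp, sp] at id
  have i1 := (en t ht).1
  have i2 := (en 0 p.h0).2
  have i3 := hD S
  have main := int_le5 ht.1 (f := Ix S.rJ) (g₁ := ID S) (g₂ := fun s => I2 (dx S.U) s) (g₃ := fun s => A * H1.m S s * (1 + XJ S s))
    (g₄ := Ix (fun x t => |S.W.f x t * (dx S.b).f x t|)) (g₅ := Ix (fun x t => |S.V.f x t * (dx S.c).f x t|)) (-(1/2)) ε 1 Γ Γ (fun s hs' => by
      have hs : s ∈ Icc (0:ℝ) p.T := ⟨hs'.1, hs'.2.trans ht.2⟩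
      have := rJ_rate h hs ε0 (fun x hx => hΓ x hx s hs)
      rw [← hLdef, ← hA] at this
      linarith)
  have d := D5u h ht
  have u0 : 0 ≤ IR S S.U t := H1.IR0 ht
  have d' : ε * ∫ s in (0:ℝ)..t, I2 (dx S.U) s ≤ e0 + 1/4 * ∫ s in (0:ℝ)..t, ID S s := by
    have d1 : ∫ s in (0:ℝ)..t, I2 (dx S.U) s ≤ p.N + 5 * (C ^ 2 + C ^ 3 + 2 * C) * C + 5 * (C * p.C₀) * ∫ s in (0:ℝ)..t, ID S s := by linarith
    have := mul_le_mul_of_nonneg_left d1 ε0.le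
    refine this.trans (le_of_eq ?_)
    rw [he0]
    linear_combination (1/4) * (∫ s in (0:ℝ)..t, ID S s) * εe
  have Γ0 : 0 ≤ Γ := (J_bd h.h1 (left_mem_Icc.mpr zero_le_one) ht).1.trans (hΓ 0 (left_mem_Icc.mpr zero_le_one) t ht)
  have w1 := (int_ext ht (f := Ix (fun x t => |S.W.f x t * (dx S.b).f x t|)) (fun s hs => int_nonneg zero_le_one fun x _ => abs_nonneg _)).trans h4.gw
  have w2 := (int_ext ht (f := Ix (fun x t => |S.V.f x t * (dx S.c).f x t|)) (fun s hs => int_nonneg zero_le_one fun x _ => abs_nonneg _)).trans h4.gv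
  have w1' := mul_le_mul_of_nonneg_left w1 Γ0
  have w2' := mul_le_mul_of_nonneg_left w2 Γ0
  have X0 := XJ_nonneg S 0
  have e3 : ∫ s in (0:ℝ)..t, 4 * A * H1.m S s * (1 + XJ S s) = 4 * ∫ s in (0:ℝ)..t, A * H1.m S s * (1 + XJ S s) := by
    rw [← intervalIntegral.integral_const_mul]; congr 1; ext s; ring
  rw [e3]
  linarith

set_option maxHeartbeats 1000000 in
theorem stepD5 (p : Par) : ∃ C, ∀ S : Flow p, H5 S C := by
  obtain ⟨C, A, a0, hC, hA, ha0, hH⟩ := D5ineq p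
  have hC0 := p.hC₀
  have hL := (JL_ge p hC).2.1
  have hN := p.hN
  have hT := p.hT
  set L := JL p C with hLdef
  set E := 1 + Real.exp (A * C) * (1 + A * C) with hE
  have E0 : 1 ≤ E := by
    have : 0 ≤ Real.exp (A * C) * (1 + A * C) := by positivity
    linarith
  set δ := (16 * (C * L * E))⁻¹ with hδ
  have δ0 : 0 < δ := by positivity
  have δe : δ * (16 * (C * L * E)) = 1 := inv_mul_cancel₀ (by positivity)
  set R := 2 * (a0 + 8 * C * δ⁻¹ + 1 + 1) * E with hR
  have R0 : 0 ≤ R := by positivity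
  have key : ∀ S : Flow p, ∀ t ∈ Icc (0:ℝ) p.T, XJ S t ≤ R ∧ ∫ s in (0:ℝ)..t, ID S s ≤ R := fun S => by
    obtain ⟨h, hS⟩ := hH S
    obtain ⟨s0, hs0, hmax⟩ := (isCompact_Icc (a := (0:ℝ)) (b := p.T)).exists_isMaxOn (nonempty_Icc.mpr hT.le)
      (f := XJ S) (by have : Continuous (fun t => XJ S t) := by fun_prop
                      exact this.continuousOn)
    have Y0 := XJ_nonneg S s0
    set Y := XJ S s0 with hY
    have hmax' : ∀ t ∈ Icc (0:ℝ) p.T, XJ S t ≤ Y := fun t ht => hmax ht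
    set Γ := δ⁻¹ + δ * (L * (1 + Y)) with hΓ
    have hS' := hS Γ (fun x hx t ht => by
      refine (J_le h.h1 δ0 hx ht).trans ?_
      have := mul_le_mul_of_nonneg_left (hmax' t ht) (by positivity : 0 ≤ δ * L)
      rw [← hLdef]
      linarith)
    have Γ0 : 0 ≤ Γ := by positivity
    have g := gw (T := p.T) (c := A) (M := C) (a := a0 + 8 * C * Γ) (X := XJ S) (D := ID S) (m := H1.m S) hA (by positivity) hT.le
      (fun t ht => XJ_nonneg S t) (fun t ht => ID_nonneg S ht) (fun t ht => by linarith [(H1.m_ge S ht).1]) h.mI hS'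
    rw [← hE] at g
    have e : (a0 + 8 * C * Γ + 1) * E = (a0 + 8 * C * δ⁻¹ + 1) * E + 1/2 * (1 + Y) := by
      rw [hΓ]; linear_combination (1/2) * (1 + Y) * δe
    have hYR : Y ≤ R - 1 := by
      have := (g s0 hs0).1
      rw [e] at this
      rw [hR]
      linarith
    intro t ht
    have g1 := g t ht
    rw [e] at g1
    have : (a0 + 8 * C * Γ + 1) * E ≤ R := by
      rw [e]
      have : R = 2 * ((a0 + 8 * C * δ⁻¹ + 1) * E) + 2 * E := by rw [hR]; ring
      have : 0 ≤ (a0 + 8 * C * δ⁻¹ + 1) * E := by positivity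
      linarith
    rw [e] at this
    exact ⟨g1.1.trans this, g1.2.trans this⟩
  set B := p.N + 5 * (C ^ 2 + C ^ 3 + 2 * C) * C + 5 * (C * p.C₀) * R with hB
  have B0 : 0 ≤ B := by positivity
  refine ⟨C + R + B, fun S => ?_⟩
  have h := (hH S).1
  have d5 : ∀ t ∈ Icc (0:ℝ) p.T, IR S S.U t + ∫ s in (0:ℝ)..t, I2 (dx S.U) s ≤ B := fun t ht => by
    have d := D5u h ht
    have := mul_le_mul_of_nonneg_left (key S t ht).2 (by positivity : 0 ≤ 5 * (C * p.C₀))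
    linarith
  have hh := p.h1
  exact
  { h2 := h.mono (by linarith)
    X := fun t ht => by linarith [(key S t ht).1]
    D := by linarith [(key S p.T p.h1).2]
    U := fun t ht => by
      have : 0 ≤ ∫ s in (0:ℝ)..t, I2 (dx S.U) s := int_nonneg ht.1 fun s _ => I2_nonneg _ s
      linarith [d5 t ht]
    Ux := by
      have : 0 ≤ IR S S.U p.T := H1.IR0 p.h1
      linarith [d5 p.T p.h1] }

end MHD

namespace MHD

variable {p : Par}

def nn (S : Flow p) (t : ℝ) : ℝ := H1.m S t + I2 (dx S.U) t + I2 S.kx t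

@[fun_prop] theorem nn_cont (S : Flow p) : Continuous (nn S) := by unfold nn; fun_prop

theorem nn_ge (S : Flow p) {t : ℝ} (ht : t ∈ Icc (0:ℝ) p.T) : 1 ≤ nn S t ∧ H1.m S t ≤ nn S t ∧ I2 (dx S.U) t ≤ nn S t ∧ I2 S.kx t ≤ nn S t := by
  have a1 := (H1.m_ge S ht).1
  have a2 := I2_nonneg (dx S.U) t
  have a3 := I2_nonneg S.kx t
  unfold nn
  refine ⟨?_, ?_, ?_, ?_⟩ <;> linarith

structure H6 (S : Flow p) (C : ℝ) : Prop where
  one : 1 ≤ C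
  ρ : ∀ x ∈ Icc (0:ℝ) 1, ∀ t ∈ Icc (0:ℝ) p.T, S.ρ.f x t ≤ C
  us : ∀ x ∈ Icc (0:ℝ) 1, ∀ t ∈ Icc (0:ℝ) p.T, S.u.f x t ^ 2 ≤ C
  bs : ∀ x ∈ Icc (0:ℝ) 1, ∀ t ∈ Icc (0:ℝ) p.T, S.b.f x t ^ 2 ≤ C
  cs : ∀ x ∈ Icc (0:ℝ) 1, ∀ t ∈ Icc (0:ℝ) p.T, S.c.f x t ^ 2 ≤ C
  θ : ∀ x ∈ Icc (0:ℝ) 1, ∀ t ∈ Icc (0:ℝ) p.T, S.θ.f x t ^ 2 ≤ C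
  ux : ∀ x ∈ Icc (0:ℝ) 1, ∀ t ∈ Icc (0:ℝ) p.T, (dx S.u).f x t ^ 2 ≤ C
  bx : ∀ x ∈ Icc (0:ℝ) 1, ∀ t ∈ Icc (0:ℝ) p.T, (dx S.b).f x t ^ 2 ≤ C * nn S t
  cx : ∀ x ∈ Icc (0:ℝ) 1, ∀ t ∈ Icc (0:ℝ) p.T, (dx S.c).f x t ^ 2 ≤ C * nn S t
  θx : ∀ x ∈ Icc (0:ℝ) 1, ∀ t ∈ Icc (0:ℝ) p.T, (dx S.θ).f x t ^ 2 ≤ C * nn S t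
  U : ∀ x ∈ Icc (0:ℝ) 1, ∀ t ∈ Icc (0:ℝ) p.T, S.U.f x t ^ 2 ≤ nn S t
  rx : ∀ t ∈ Icc (0:ℝ) p.T, I2 (dx S.ρ) t ≤ C
  Iux : ∀ t ∈ Icc (0:ℝ) p.T, I2 (dx S.u) t ≤ C
  Ibx : ∀ t ∈ Icc (0:ℝ) p.T, I2 (dx S.b) t ≤ C
  Icx : ∀ t ∈ Icc (0:ℝ) p.T, I2 (dx S.c) t ≤ C
  uxx : ∀ t ∈ Icc (0:ℝ) p.T, I2 (dx (dx S.u)) t ≤ C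
  bxx : ∀ t ∈ Icc (0:ℝ) p.T, I2 (dx (dx S.b)) t ≤ C * nn S t
  cxx : ∀ t ∈ Icc (0:ℝ) p.T, I2 (dx (dx S.c)) t ≤ C * nn S t
  θxx : ∀ t ∈ Icc (0:ℝ) p.T, I2 (dx (dx S.θ)) t ≤ C * nn S t
  nI : ∫ s in (0:ℝ)..p.T, nn S s ≤ C

theorem kx_aux {S : Flow p} {C c2 : ℝ} (h : H2 S C) {t : ℝ} (ht : t ∈ Icc (0:ℝ) p.T) (hθ : ∀ x ∈ Icc (0:ℝ) 1, S.θ.f x t ^ 2 ≤ c2)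
    (hc2 : 0 ≤ c2) :
    I2 S.kx t ≤ 3 * (C * p.C₀) * ID S t + (3 * C ^ 3 * c2 + 15 * C ^ 2) * H1.m S t := by
  have hC := h.h1.one
  have hC0 := p.hC₀
  have hκc := κe_cont p
  have m1 := (H1.m_ge S ht).1
  have a := Ix_le3 (t := t) (f := fun x t => S.kx.f x t ^ 2) (g₁ := fun x t => S.ρ.f x t * κe p.κ (S.θ.f x t) * S.Td.f x t ^ 2)
    (g₂ := fun x t => (dx S.u).f x t ^ 2) (g₃ := S.Q.f) (3 * (C * p.C₀)) (3 * C ^ 2 * c2) (15 * C * H1.m S t) (fun x hx => by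
      have r := S.ρp x hx t ht
      have r1 := h.h1.ρ x hx t ht
      have k1 := S.one_le_κ x t
      have hκ := p.κ_pos (S.θ.f x t)
      have e : S.kx.f x t = S.ρ.f x t * S.Td.f x t + S.ρ.f x t * S.θ.f x t * (dx S.u).f x t + -S.Q.f x t := by
        simp only [Flow.kx, Flow.Td, add_f, sub_f, mul_f, neg_f, cst_f, xx_f, dx_add, dt_add, dx_sub, dt_sub, dx_neg, dt_neg, dx_mul, dt_mul, dx_cst, dt_cst, dx_xx, dt_xx, dt_dx]; ring
      have eQ : S.Q.f x t = (dx S.u).f x t ^ 2 + (dx S.w).f x t ^ 2 + (dx S.v).f x t ^ 2 + (dx S.b).f x t ^ 2 + (dx S.c).f x t ^ 2 := by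
        simp only [Flow.Q, add_f, sub_f, mul_f, neg_f, cst_f, xx_f, dx_add, dt_add, dx_sub, dt_sub, dx_neg, dt_neg, dx_mul, dt_mul, dx_cst, dt_cst, dx_xx, dt_xx, dt_dx]; ring
      have Q0 : 0 ≤ S.Q.f x t := by rw [eQ]; positivity
      have Q1 : S.Q.f x t ≤ 5 * C * H1.m S t := by
        rw [eQ]
        linarith [h.ux x hx t ht, h.wx x hx t ht, h.vx x hx t ht, h.bx x hx t ht, h.cx x hx t ht]
      have q1 := mul_le_mul_of_nonneg_right Q1 Q0
      have q2 := sq3 (S.ρ.f x t * S.Td.f x t) (S.ρ.f x t * S.θ.f x t * (dx S.u).f x t) (-S.Q.f x t)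
      have q3 := mul_le_mul r1 k1 zero_le_one (by linarith)
      have q3' := mul_le_mul_of_nonneg_right r1 (by positivity : 0 ≤ S.ρ.f x t * S.Td.f x t ^ 2)
      have q8 := mul_le_mul_of_nonneg_left k1 (by positivity : 0 ≤ C * (S.ρ.f x t * S.Td.f x t ^ 2))
      have r2 := pow_le_pow_left₀ r.le r1 2
      have q4 := mul_le_mul r2 (hθ x hx) (sq_nonneg _) (by positivity)
      have q5 := mul_le_mul_of_nonneg_right q4 (sq_nonneg ((dx S.u).f x t))
      rw [e]
      linarith)
  have u := (h.h1.Ux ht).1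
  have Q := h.h1.Q t ht
  have p1 := mul_le_mul_of_nonneg_left u (by positivity : 0 ≤ 3 * C ^ 2 * c2)
  have p2 := mul_le_mul_of_nonneg_left Q (by positivity : 0 ≤ 15 * C * H1.m S t)
  have p3 := mul_le_mul_of_nonneg_left m1 (by positivity : 0 ≤ 3 * C ^ 3 * c2)
  simp only [I2, ID] at *
  linarith

theorem θxx_aux {S : Flow p} {D c1 : ℝ} {t : ℝ} (ht : t ∈ Icc (0:ℝ) p.T) (hθ : ∀ x ∈ Icc (0:ℝ) 1, p.κd (S.θ.f x t) ^ 2 ≤ D)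
    (hD : 0 ≤ D) (hc1 : Ik S t ≤ c1) : (∀ x ∈ Icc (0:ℝ) 1, (dx S.θ).f x t ^ 2 ≤ p.C₀ ^ 2 * nn S t) ∧
    I2 (dx (dx S.θ)) t ≤ (2 * p.C₀ ^ 2 + 2 * p.C₀ ^ 6 * D * c1) * nn S t := by
  have hC0 := p.hC₀
  obtain ⟨n1, -, -, n4⟩ := nn_ge S ht
  have hk : ∀ x ∈ Icc (0:ℝ) 1, S.k x t ^ 2 ≤ nn S t := fun x hx => by
    refine (sob0 (g := fun x => S.k x t) (g' := fun x => S.kx.f x t) (fun z hz => S.hk z hz t ht) (by fun_prop) (S.k0 ht) hx).trans n4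
  have hθx : ∀ x ∈ Icc (0:ℝ) 1, (dx S.θ).f x t ^ 2 ≤ p.C₀ ^ 2 * nn S t := fun x hx => 
    (S.θx_le x t).trans (mul_le_mul_of_nonneg_left (hk x hx) (by positivity))
  refine ⟨hθx, ?_⟩
  have a := Ix_le2 (t := t) (f := fun x t => (dx (dx S.θ)).f x t ^ 2) (g₁ := fun x t => S.kx.f x t ^ 2) (g₂ := fun x t => S.k x t ^ 2)
    (2 * p.C₀ ^ 2) (2 * p.C₀ ^ 6 * D * nn S t) (fun x hx => by
      have e := S.kx_eq hx ht
      have k1 := S.one_le_κ x t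
      have k2 := one_le_pow₀ k1 (n := 2)
      have q1 := mul_le_mul_of_nonneg_right k2 (sq_nonneg ((dx (dx S.θ)).f x t))
      have e2 : (κe p.κ (S.θ.f x t) * (dx (dx S.θ)).f x t) ^ 2 = (S.kx.f x t + -(p.κd (S.θ.f x t) * (dx S.θ).f x t ^ 2)) ^ 2 := by rw [e]; ring
      have q2 := sq2 (S.kx.f x t) (-(p.κd (S.θ.f x t) * (dx S.θ).f x t ^ 2))
      rw [← e2] at q2
      have q3 := mul_le_mul_of_nonneg_left q2 (by positivity : 0 ≤ p.C₀ ^ 2)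
      have q4 := mul_le_mul (hθx x hx) (S.θx_le x t) (sq_nonneg _) (by positivity)
      have q5 := mul_le_mul (hθ x hx) q4 (by positivity) hD
      have q6 := mul_le_mul_of_nonneg_left q5 (by positivity : 0 ≤ p.C₀ ^ 2)
      linarith)
  have p1 := mul_le_mul_of_nonneg_left n4 (by positivity : 0 ≤ 2 * p.C₀ ^ 2)
  have p2 := mul_le_mul_of_nonneg_left hc1 (by positivity : 0 ≤ 2 * p.C₀ ^ 6 * D * nn S t)
  simp only [I2, Ik] at *
  linarith

set_option maxHeartbeats 1000000 in
theorem stepH6 (p : Par) : ∃ C, ∀ S : Flow p, H6 S C := by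
  obtain ⟨C', hH'⟩ := stepD5 p
  by_cases hne : Nonempty (Flow p)
  swap
  · exact ⟨0, fun S => (hne ⟨S⟩).elim⟩
  obtain ⟨S0⟩ := hne
  obtain ⟨C, hC, hH⟩ : ∃ C, 1 ≤ C ∧ ∀ S : Flow p, H5 S C := ⟨C', (hH' S0).h2.h1.one, hH'⟩
  have hC0 := p.hC₀
  set c1 := 2 * C + 8 * C ^ 2 with hc1
  set c2 := p.C₀ ^ 2 * (C * (1 + c1)) with hc2
  set c3 := 5 * C * C + 5 * c2 * C + 5 * (C ^ 2 * p.C₀ ^ 2) * c1 + 5 * C * C + 5 * C * C with hc3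
  set c4 := 2 * C + 2 * c3 with hc4
  set c6 := 3 * (C * p.C₀) * C + (3 * C ^ 3 * c2 + 15 * C ^ 2) * C with hc6
  obtain ⟨d, hd⟩ := (isCompact_Icc (a := (0:ℝ)) (b := 1 + c2)).exists_bound_of_continuousOn (f := p.κd)
    (by have : Continuous p.κd := by fun_prop
        exact this.continuousOn)
  set c7 := 2 * p.C₀ ^ 2 + 2 * p.C₀ ^ 6 * d ^ 2 * c1 with hc7
  have c10 : 0 ≤ c1 := by positivity
  have c20 : 0 ≤ c2 := by positivity
  have c30 : 0 ≤ c3 := by positivity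
  have c40 : 0 ≤ c4 := by positivity
  have c60 : 0 ≤ c6 := by positivity
  have c70 : 0 ≤ c7 := by positivity
  have c80 : 0 ≤ p.C₀ ^ 2 := by positivity
  set R := 2 * C + c2 + c3 + c4 + c6 + c7 + p.C₀ ^ 2 with hR
  refine ⟨R, fun S => ?_⟩
  have h5 := hH S
  have h2 := h5.h2
  have h1 := h2.h1
  have ik : ∀ t ∈ Icc (0:ℝ) p.T, Ik S t ≤ c1 := fun t ht => by
    have := Ik_le h1 ht
    have := h5.X t ht
    linarith
  have hθ : ∀ x ∈ Icc (0:ℝ) 1, ∀ t ∈ Icc (0:ℝ) p.T, S.θ.f x t ^ 2 ≤ c2 := fun x hx t ht => by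
    refine (h1.θs hx ht).trans (mul_le_mul_of_nonneg_left (mul_le_mul_of_nonneg_left ?_ h1.nn) c80)
    linarith [ik t ht]
  have huxx : ∀ t ∈ Icc (0:ℝ) p.T, I2 (dx (dx S.u)) t ≤ c3 := fun t ht => by
    have a := uxx_aux h1 ht (R := c2) (fun x hx => hθ x hx t ht)
    obtain ⟨-, -, -, b1, b2⟩ := h1.Ux ht
    have := mul_le_mul_of_nonneg_left (h5.U t ht) (by positivity : 0 ≤ 5 * C)
    have := mul_le_mul_of_nonneg_left (h2.rx t ht) (by positivity : 0 ≤ 5 * c2)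
    have := mul_le_mul_of_nonneg_left (ik t ht) (by positivity : 0 ≤ 5 * (C ^ 2 * p.C₀ ^ 2))
    have := mul_le_mul_of_nonneg_left b1 (by positivity : 0 ≤ 5 * C)
    have := mul_le_mul_of_nonneg_left b2 (by positivity : 0 ≤ 5 * C)
    linarith
  have θa : ∀ t ∈ Icc (0:ℝ) p.T, _ := fun t ht => θxx_aux (S := S) (D := d ^ 2) ht (fun x hx => by
    have θp := S.θp x hx t ht
    have := hθ x hx t ht
    exact sqbd (hd (S.θ.f x t) ⟨θp.le, by nlinarith⟩)) (sq_nonneg _) (ik t ht)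
  have up : ∀ a, a ≤ R → ∀ t ∈ Icc (0:ℝ) p.T, a * nn S t ≤ R * nn S t := fun a ha t ht =>
    mul_le_mul_of_nonneg_right ha (by linarith [(nn_ge S ht).1])
  have up2 : ∀ t ∈ Icc (0:ℝ) p.T, C * H1.m S t ≤ R * nn S t := fun t ht =>
    (mul_le_mul_of_nonneg_left (nn_ge S ht).2.1 h1.nn).trans (up C (by linarith) t ht)
  exact
  { one := by linarith
    ρ := fun x hx t ht => (h1.ρ x hx t ht).trans (by linarith)
    us := fun x hx t ht => (h1.us hx ht).trans (by linarith)
    bs := fun x hx t ht => (h1.bs hx ht).trans (by linarith)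
    cs := fun x hx t ht => (h1.cs hx ht).trans (by linarith)
    θ := fun x hx t ht => (hθ x hx t ht).trans (by linarith)
    ux := fun x hx t ht => by
      have := supf (f := dx S.u) (A := C) (B := c3) (m := 1) (h1.Ux ht).1 (by linarith [huxx t ht]) hx h1.nn le_rfl
      linarith
    bx := fun x hx t ht => (h2.bx x hx t ht).trans (up2 t ht)
    cx := fun x hx t ht => (h2.cx x hx t ht).trans (up2 t ht)
    θx := fun x hx t ht => ((θa t ht).1 x hx).trans (up _ (by linarith) t ht)
    U := fun x hx t ht => H1.sup0 (S.U0 ht) (nn_ge S ht).2.2.1 hx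
    rx := fun t ht => (h2.rx t ht).trans (by linarith)
    Iux := fun t ht => (h1.Ux ht).1.trans (by linarith)
    Ibx := fun t ht => (h1.Ux ht).2.2.2.1.trans (by linarith)
    Icx := fun t ht => (h1.Ux ht).2.2.2.2.trans (by linarith)
    uxx := fun t ht => (huxx t ht).trans (by linarith)
    bxx := fun t ht => (h2.bxx t ht).trans (up2 t ht)
    cxx := fun t ht => (h2.cxx t ht).trans (up2 t ht)
    θxx := fun t ht => (θa t ht).2.trans (up _ (by linarith) t ht)
    nI := by
      have a := int_le4 p.hT.le (f := nn S) (g₁ := H1.m S) (g₂ := fun s => I2 (dx S.U) s) (g₃ := ID S) (g₄ := H1.m S) 1 1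
        (3 * (C * p.C₀)) (3 * C ^ 3 * c2 + 15 * C ^ 2) (fun s hs => by
          have := kx_aux h2 hs (fun x hx => hθ x hx s hs) c20
          unfold nn
          linarith)
      have := mul_le_mul_of_nonneg_left h5.D (by positivity : 0 ≤ 3 * (C * p.C₀))
      have := mul_le_mul_of_nonneg_left h2.mI (by positivity : 0 ≤ 3 * C ^ 3 * c2 + 15 * C ^ 2)
      have := h2.mI
      have := h5.Ux
      linarith }

end MHD

namespace MHD

variable {p : Par}

theorem Flow.uxxx_eq (S : Flow p) {x t : ℝ} (hx : x ∈ Icc (0:ℝ) 1) (ht : t ∈ Icc (0:ℝ) p.T) :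
    (dx (dx (dx S.u))).f x t = ((dx S.ρ).f x t * S.U.f x t + S.ρ.f x t * (dx S.U).f x t + (dx (dx S.ρ)).f x t * S.θ.f x t)
      + (2 * ((dx S.ρ).f x t * (dx S.θ).f x t) + S.ρ.f x t * (dx (dx S.θ)).f x t + (dx S.b).f x t ^ 2)
      + (S.b.f x t * (dx (dx S.b)).f x t + (dx S.c).f x t ^ 2 + S.c.f x t * (dx (dx S.c)).f x t) := by
  have h := dx_congr (T := p.T) (F := dx (dx S.u)) (G := S.ρ * S.U + dx S.ρ * S.θ + S.ρ * dx S.θ + S.b * dx S.b + S.c * dx S.c)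
    (fun x hx t ht => by rw [S.uxx_eq hx ht]; rfl) x hx t ht
  rw [h]
  simp only [add_f, mul_f, dx_add, dx_mul]
  ring

theorem sq9 (a b c d e f g h i : ℝ) : ((a + b + c) + (d + e + f) + (g + h + i)) ^ 2 ≤
    9 * (a ^ 2 + b ^ 2 + c ^ 2 + d ^ 2 + e ^ 2 + f ^ 2 + g ^ 2 + h ^ 2 + i ^ 2) := by
  have := sq3 (a + b + c) (d + e + f) (g + h + i)
  have := sq3 a b c
  have := sq3 d e f
  have := sq3 g h i
  linarith

set_option maxHeartbeats 1000000 in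
theorem uxxx_aux {S : Flow p} {C : ℝ} (h : H6 S C) {t : ℝ} (ht : t ∈ Icc (0:ℝ) p.T) :
    I2 (dx (dx (dx S.u))) t ≤ 99 * C ^ 3 * (nn S t + I2 (dx (dx S.ρ)) t) := by
  have hC := h.one
  obtain ⟨n1, -, n3, -⟩ := nn_ge S ht
  have a := Ix_le8 (t := t) (f := fun x t => (dx (dx (dx S.u))).f x t ^ 2) (g₁ := fun x t => (dx S.ρ).f x t ^ 2)
    (g₂ := fun x t => (dx S.U).f x t ^ 2) (g₃ := fun x t => (dx (dx S.ρ)).f x t ^ 2) (g₄ := fun x t => (dx (dx S.θ)).f x t ^ 2)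
    (g₅ := fun x t => (dx S.b).f x t ^ 2) (g₆ := fun x t => (dx (dx S.b)).f x t ^ 2) (g₇ := fun x t => (dx S.c).f x t ^ 2)
    (g₈ := fun x t => (dx (dx S.c)).f x t ^ 2) (9 * (nn S t + 4 * (C * nn S t))) (9 * C ^ 2) (9 * C) (9 * C ^ 2) (9 * (C * nn S t)) (9 * C)
    (9 * (C * nn S t)) (9 * C) (fun x hx => by
      have r := S.ρp x hx t ht
      have r1 := h.ρ x hx t ht
      have r2 := pow_le_pow_left₀ r.le r1 2
      rw [S.uxxx_eq hx ht]
      have q0 := sq9 ((dx S.ρ).f x t * S.U.f x t) (S.ρ.f x t * (dx S.U).f x t) ((dx (dx S.ρ)).f x t * S.θ.f x t)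
        (2 * ((dx S.ρ).f x t * (dx S.θ).f x t)) (S.ρ.f x t * (dx (dx S.θ)).f x t) ((dx S.b).f x t ^ 2)
        (S.b.f x t * (dx (dx S.b)).f x t) ((dx S.c).f x t ^ 2) (S.c.f x t * (dx (dx S.c)).f x t)
      have q1 := mul_le_mul_of_nonneg_left (h.U x hx t ht) (sq_nonneg ((dx S.ρ).f x t))
      have q2 := mul_le_mul_of_nonneg_right r2 (sq_nonneg ((dx S.U).f x t))
      have q3 := mul_le_mul_of_nonneg_left (h.θ x hx t ht) (sq_nonneg ((dx (dx S.ρ)).f x t))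
      have q4 := mul_le_mul_of_nonneg_left (h.θx x hx t ht) (sq_nonneg ((dx S.ρ).f x t))
      have q5 := mul_le_mul_of_nonneg_right r2 (sq_nonneg ((dx (dx S.θ)).f x t))
      have q6 := mul_le_mul_of_nonneg_right (h.bx x hx t ht) (sq_nonneg ((dx S.b).f x t))
      have q7 := mul_le_mul_of_nonneg_right (h.bs x hx t ht) (sq_nonneg ((dx (dx S.b)).f x t))
      have q8 := mul_le_mul_of_nonneg_right (h.cx x hx t ht) (sq_nonneg ((dx S.c).f x t))
      have q9 := mul_le_mul_of_nonneg_right (h.cs x hx t ht) (sq_nonneg ((dx (dx S.c)).f x t))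
      linarith)
  have Z0 := I2_nonneg (dx (dx S.ρ)) t
  have p1 := mul_le_mul_of_nonneg_left (h.rx t ht) (by positivity : 0 ≤ 9 * (nn S t + 4 * (C * nn S t)))
  have p2 := mul_le_mul_of_nonneg_left n3 (by positivity : 0 ≤ 9 * C ^ 2)
  have p4 := mul_le_mul_of_nonneg_left (h.θxx t ht) (by positivity : 0 ≤ 9 * C ^ 2)
  have p5 := mul_le_mul_of_nonneg_left (h.Ibx t ht) (by positivity : 0 ≤ 9 * (C * nn S t))
  have p6 := mul_le_mul_of_nonneg_left (h.bxx t ht) (by positivity : 0 ≤ 9 * C)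
  have p7 := mul_le_mul_of_nonneg_left (h.Icx t ht) (by positivity : 0 ≤ 9 * (C * nn S t))
  have p8 := mul_le_mul_of_nonneg_left (h.cxx t ht) (by positivity : 0 ≤ 9 * C)
  have c2 : C ≤ C ^ 2 := by nlinarith
  have c3 : C ^ 2 ≤ C ^ 3 := by nlinarith [sq_nonneg C]
  have c1 : C ≤ C ^ 3 := by linarith
  have s1 := mul_le_mul_of_nonneg_right c1 (by linarith : 0 ≤ nn S t)
  have s2 := mul_le_mul_of_nonneg_right c3 (by linarith : 0 ≤ nn S t)
  have s3 := mul_le_mul_of_nonneg_right c1 Z0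
  have s4 : 0 ≤ C ^ 3 * I2 (dx (dx S.ρ)) t := by positivity
  simp only [I2] at *
  linarith

set_option maxHeartbeats 1000000 in
theorem Zid (S : Flow p) {t : ℝ} (ht : t ∈ Icc (0:ℝ) p.T) :
    1/2 * I2 (dx (dx S.ρ)) t = 1/2 * I2 (dx (dx S.ρ)) 0 + ∫ s in (0:ℝ)..t, Ix (fun x t => -(5/2) * ((dx S.u).f x t * (dx (dx S.ρ)).f x t ^ 2)
      - 3 * ((dx (dx S.u)).f x t * (dx S.ρ).f x t * (dx (dx S.ρ)).f x t) - S.ρ.f x t * (dx (dx (dx S.u))).f x t * (dx (dx S.ρ)).f x t) s := by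
  have id := masterI (T := p.T) (cst (1/2) * (dx (dx S.ρ) * dx (dx S.ρ))) (cst (1/2) * (S.u * (dx (dx S.ρ) * dx (dx S.ρ))))
    (fun x t => -(5/2) * ((dx S.u).f x t * (dx (dx S.ρ)).f x t ^ 2)
      - 3 * ((dx (dx S.u)).f x t * (dx S.ρ).f x t * (dx (dx S.ρ)).f x t) - S.ρ.f x t * (dx (dx (dx S.u))).f x t * (dx (dx S.ρ)).f x t)
    (fun x hx t ht => by
      have m1 : ∀ x ∈ Icc (0:ℝ) 1, ∀ t ∈ Icc (0:ℝ) p.T, (dt S.ρ).f x t = (-(dx S.ρ * S.u + S.ρ * dx S.u)).f x t := fun x hx t ht => by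
        have := S.mass x hx t ht
        simp only [add_f, sub_f, mul_f, neg_f, cst_f, xx_f, dx_add, dt_add, dx_sub, dt_sub, dx_neg, dt_neg, dx_mul, dt_mul, dx_cst, dt_cst, dx_xx, dt_xx, dt_dx]
        linarith
      have m2 := dx_congr (T := p.T) m1
      have m3 := dx_congr (T := p.T) m2 x hx t ht
      simp only [add_f, sub_f, mul_f, neg_f, cst_f, xx_f, dx_add, dt_add, dx_sub, dt_sub, dx_neg, dt_neg, dx_mul, dt_mul, dx_cst, dt_cst, dx_xx, dt_xx, dt_dx] at m3 ⊢
      rw [m3]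
      ring)
    (fun t ht => by simp only [add_f, sub_f, mul_f, neg_f, cst_f, xx_f, dx_add, dt_add, dx_sub, dt_sub, dx_neg, dt_neg, dx_mul, dt_mul, dx_cst, dt_cst, dx_xx, dt_xx, dt_dx]; rw [S.u0 t ht]; ring)
    (fun t ht => by simp only [add_f, sub_f, mul_f, neg_f, cst_f, xx_f, dx_add, dt_add, dx_sub, dt_sub, dx_neg, dt_neg, dx_mul, dt_mul, dx_cst, dt_cst, dx_xx, dt_xx, dt_dx]; rw [S.u1 t ht]; ring)
  replace id := id t ht
  have hX : ∀ t, Ix (cst (1/2) * (dx (dx S.ρ) * dx (dx S.ρ))).f t = 1/2 * I2 (dx (dx S.ρ)) t := fun t => by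
    rw [← Ix_mul]; apply Ix_congr; intro x hx; simp only [add_f, sub_f, mul_f, neg_f, cst_f, xx_f, dx_add, dt_add, dx_sub, dt_sub, dx_neg, dt_neg, dx_mul, dt_mul, dx_cst, dt_cst, dx_xx, dt_xx, dt_dx]; ring
  rw [hX, hX] at id
  exact id

end MHD

namespace MHD

variable {p : Par}

set_option maxHeartbeats 1000000 in
theorem Z_rate {S : Flow p} {C : ℝ} (h : H6 S C) {t : ℝ} (ht : t ∈ Icc (0:ℝ) p.T) :
    Ix (fun x t => -(5/2) * ((dx S.u).f x t * (dx (dx S.ρ)).f x t ^ 2)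
      - 3 * ((dx (dx S.u)).f x t * (dx S.ρ).f x t * (dx (dx S.ρ)).f x t) - S.ρ.f x t * (dx (dx (dx S.u))).f x t * (dx (dx S.ρ)).f x t) t
    ≤ 60 * C ^ 5 * nn S t * (1 + I2 (dx (dx S.ρ)) t) := by
  have hC := h.one
  obtain ⟨n1, -, -, -⟩ := nn_ge S ht
  have Z0 := I2_nonneg (dx (dx S.ρ)) t
  have a := Ix_le3 (t := t) (f := fun x t => -(5/2) * ((dx S.u).f x t * (dx (dx S.ρ)).f x t ^ 2)
      - 3 * ((dx (dx S.u)).f x t * (dx S.ρ).f x t * (dx (dx S.ρ)).f x t) - S.ρ.f x t * (dx (dx (dx S.u))).f x t * (dx (dx S.ρ)).f x t)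
    (g₁ := fun x t => (dx (dx S.ρ)).f x t ^ 2) (g₂ := fun x t => (dx (dx S.u)).f x t ^ 2) (g₃ := fun x t => (dx (dx (dx S.u))).f x t ^ 2)
    (5/2 * C + 2) (3/2 * (2 * C + 2 * I2 (dx (dx S.ρ)) t)) (1/2 * C ^ 2) (fun x hx => by
      have r := S.ρp x hx t ht
      have r1 := h.ρ x hx t ht
      have r2 := pow_le_pow_left₀ r.le r1 2
      have ux := h.ux x hx t ht
      have rx : (dx S.ρ).f x t ^ 2 ≤ 2 * C + 2 * I2 (dx (dx S.ρ)) t := by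
        have := supf (f := dx S.ρ) (A := C) (B := I2 (dx (dx S.ρ)) t) (m := 1) (h.rx t ht) (by linarith) hx (by linarith) le_rfl
        linarith
      have u1 : -(dx S.u).f x t ≤ C := by linarith [sq_nonneg ((dx S.u).f x t + 1)]
      have q1 := mul_le_mul_of_nonneg_right u1 (sq_nonneg ((dx (dx S.ρ)).f x t))
      have q2 := mul_le_mul_of_nonneg_right rx (sq_nonneg ((dx (dx S.u)).f x t))
      have q3 := mul_le_mul_of_nonneg_right r2 (sq_nonneg ((dx (dx (dx S.u))).f x t))
      linarith [sq_nonneg ((dx (dx S.u)).f x t * (dx S.ρ).f x t + (dx (dx S.ρ)).f x t),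
        sq_nonneg (S.ρ.f x t * (dx (dx (dx S.u))).f x t + (dx (dx S.ρ)).f x t)])
  have b := uxxx_aux h ht
  have b' := mul_le_mul_of_nonneg_left b (by positivity : 0 ≤ 1/2 * C ^ 2)
  have d' := mul_le_mul_of_nonneg_left (h.uxx t ht) (by positivity : 0 ≤ 3/2 * (2 * C + 2 * I2 (dx (dx S.ρ)) t))
  have c1 : 1 ≤ C ^ 5 := one_le_pow₀ hC
  have c2 : C ≤ C ^ 5 := by
    calc C = C ^ 1 := (pow_one C).symm
      _ ≤ C ^ 5 := pow_le_pow_right₀ hC (by norm_num)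
  have c3 : C ^ 2 ≤ C ^ 5 := pow_le_pow_right₀ hC (by norm_num)
  simp only [I2] at *
  set Z := Ix (fun x t => (dx (dx S.ρ)).f x t ^ 2) t
  set n := nn S t
  have s1 := mul_le_mul_of_nonneg_right c1 Z0
  have s2 := mul_le_mul_of_nonneg_right c2 Z0
  have s3 : n + Z ≤ n * (1 + Z) := by nlinarith
  have s4 := mul_le_mul_of_nonneg_left s3 (by positivity : 0 ≤ C ^ 5)
  have s5 : 1 + Z ≤ n * (1 + Z) := by nlinarith
  have s6 := mul_le_mul_of_nonneg_left s5 (by positivity : 0 ≤ C ^ 5)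
  have s7 : 0 ≤ C ^ 5 * Z := by positivity
  have s8 : 0 ≤ C ^ 5 * (n * (1 + Z)) := by positivity
  linarith

theorem rt_aux {S : Flow p} {C R : ℝ} (h : H6 S C) {t : ℝ} (ht : t ∈ Icc (0:ℝ) p.T) (hR : I2 (dx (dx S.ρ)) t ≤ R) :
    I2 (dt S.ρ) t ≤ 4 * C ^ 3 ∧ I2 (dx (dt S.ρ)) t ≤ 3 * C * R + 15 * C ^ 3 := by
  have hC := h.one
  have c2 : C ^ 2 ≤ C ^ 3 := pow_le_pow_right₀ hC (by norm_num)
  have m1 : ∀ x ∈ Icc (0:ℝ) 1, ∀ t ∈ Icc (0:ℝ) p.T, (dt S.ρ).f x t = (-(dx S.ρ * S.u + S.ρ * dx S.u)).f x t := fun x hx t ht => by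
    have := S.mass x hx t ht
    simp only [add_f, sub_f, mul_f, neg_f, cst_f, xx_f, dx_add, dt_add, dx_sub, dt_sub, dx_neg, dt_neg, dx_mul, dt_mul, dx_cst, dt_cst, dx_xx, dt_xx, dt_dx]
    linarith
  constructor
  · have a := Ix_le2 (t := t) (f := fun x t => (dt S.ρ).f x t ^ 2) (g₁ := fun x t => (dx S.ρ).f x t ^ 2) (g₂ := fun x t => (dx S.u).f x t ^ 2)
      (2 * C) (2 * C ^ 2) (fun x hx => by
        have r2 := pow_le_pow_left₀ (S.ρp x hx t ht).le (h.ρ x hx t ht) 2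
        have := sq2 ((dx S.ρ).f x t * S.u.f x t) (S.ρ.f x t * (dx S.u).f x t)
        have := mul_le_mul_of_nonneg_left (h.us x hx t ht) (sq_nonneg ((dx S.ρ).f x t))
        have := mul_le_mul_of_nonneg_right r2 (sq_nonneg ((dx S.u).f x t))
        rw [S.mass x hx t ht]
        linarith)
    have := mul_le_mul_of_nonneg_left (h.rx t ht) (by positivity : 0 ≤ 2 * C)
    have := mul_le_mul_of_nonneg_left (h.Iux t ht) (by positivity : 0 ≤ 2 * C ^ 2)
    simp only [I2] at *
    linarith
  · have a := Ix_le3 (t := t) (f := fun x t => (dx (dt S.ρ)).f x t ^ 2) (g₁ := fun x t => (dx (dx S.ρ)).f x t ^ 2)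
      (g₂ := fun x t => (dx S.ρ).f x t ^ 2) (g₃ := fun x t => (dx (dx S.u)).f x t ^ 2)
      (3 * C) (12 * C) (3 * C ^ 2) (fun x hx => by
        have r2 := pow_le_pow_left₀ (S.ρp x hx t ht).le (h.ρ x hx t ht) 2
        have m2 := dx_congr (T := p.T) m1 x hx t ht
        have e : (dx (dt S.ρ)).f x t = -((dx (dx S.ρ)).f x t * S.u.f x t + 2 * ((dx S.ρ).f x t * (dx S.u).f x t) + S.ρ.f x t * (dx (dx S.u)).f x t) := by
          rw [m2]; simp only [add_f, sub_f, mul_f, neg_f, cst_f, xx_f, dx_add, dt_add, dx_sub, dt_sub, dx_neg, dt_neg, dx_mul, dt_mul, dx_cst, dt_cst, dx_xx, dt_xx, dt_dx]; ring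
        have := sq3 ((dx (dx S.ρ)).f x t * S.u.f x t) (2 * ((dx S.ρ).f x t * (dx S.u).f x t)) (S.ρ.f x t * (dx (dx S.u)).f x t)
        have := mul_le_mul_of_nonneg_left (h.us x hx t ht) (sq_nonneg ((dx (dx S.ρ)).f x t))
        have := mul_le_mul_of_nonneg_left (h.ux x hx t ht) (sq_nonneg ((dx S.ρ).f x t))
        have := mul_le_mul_of_nonneg_right r2 (sq_nonneg ((dx (dx S.u)).f x t))
        rw [e]
        linarith)
    have := mul_le_mul_of_nonneg_left (h.rx t ht) (by positivity : 0 ≤ 12 * C)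
    have := mul_le_mul_of_nonneg_left (h.uxx t ht) (by positivity : 0 ≤ 3 * C ^ 2)
    have := mul_le_mul_of_nonneg_left hR (by positivity : 0 ≤ 3 * C)
    simp only [I2] at *
    linarith

set_option maxHeartbeats 1000000 in
theorem rtt_aux {S : Flow p} {C R : ℝ} (h : H6 S C) {t : ℝ} (ht : t ∈ Icc (0:ℝ) p.T) (hR : I2 (dx (dx S.ρ)) t ≤ R) (hR0 : 0 ≤ R) :
    I2 (dt (dt S.ρ)) t ≤ (5 * C * (3 * C * R + 15 * C ^ 3) + 20 * C ^ 4 + 10 * C + 10 * C ^ 3 + 15 * C ^ 2 + 30 * C ^ 4) * nn S t := by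
  have hC := h.one
  obtain ⟨n1, -, n3, -⟩ := nn_ge S ht
  obtain ⟨r1, r2⟩ := rt_aux h ht hR
  have m1 : ∀ x ∈ Icc (0:ℝ) 1, ∀ t ∈ Icc (0:ℝ) p.T, (dt S.ρ).f x t = (-(dx S.ρ * S.u + S.ρ * dx S.u)).f x t := fun x hx t ht => by
    have := S.mass x hx t ht
    simp only [add_f, sub_f, mul_f, neg_f, cst_f, xx_f, dx_add, dt_add, dx_sub, dt_sub, dx_neg, dt_neg, dx_mul, dt_mul, dx_cst, dt_cst, dx_xx, dt_xx, dt_dx]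
    linarith
  have a := Ix_le6 (t := t) (f := fun x t => (dt (dt S.ρ)).f x t ^ 2) (g₁ := fun x t => (dx (dt S.ρ)).f x t ^ 2)
      (g₂ := fun x t => (dt S.ρ).f x t ^ 2) (g₃ := fun x t => (dx S.ρ).f x t ^ 2) (g₄ := fun x t => (dx S.U).f x t ^ 2)
      (g₅ := fun x t => (dx S.u).f x t ^ 2) (g₆ := fun x t => (dx (dx S.u)).f x t ^ 2)
      (5 * C) (5 * C) (5 * (2 * nn S t + 2 * C ^ 2)) (15 * C ^ 2) (15 * C ^ 3) (15 * C ^ 3) (fun x hx => by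
        have r2 := pow_le_pow_left₀ (S.ρp x hx t ht).le (h.ρ x hx t ht) 2
        have us := h.us x hx t ht
        have ux := h.ux x hx t ht
        have m2 := dt_congr p.hT m1 x hx t ht
        have e : (dt (dt S.ρ)).f x t = -((dx (dt S.ρ)).f x t * S.u.f x t + (dt S.ρ).f x t * (dx S.u).f x t
          + (dx S.ρ).f x t * (dt S.u).f x t + S.ρ.f x t * (dx (dt S.u)).f x t + 0) := by
          rw [m2]; simp only [add_f, sub_f, mul_f, neg_f, cst_f, xx_f, dx_add, dt_add, dx_sub, dt_sub, dx_neg, dt_neg, dx_mul, dt_mul, dx_cst, dt_cst, dx_xx, dt_xx, dt_dx]; ring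
        have e1 : (dt S.u).f x t = S.U.f x t + -(S.u.f x t * (dx S.u).f x t) := by
          simp only [Flow.U, add_f, sub_f, mul_f, neg_f, cst_f, xx_f, dx_add, dt_add, dx_sub, dt_sub, dx_neg, dt_neg, dx_mul, dt_mul, dx_cst, dt_cst, dx_xx, dt_xx, dt_dx]; ring
        have e2 : (dx (dt S.u)).f x t = (dx S.U).f x t + -((dx S.u).f x t * (dx S.u).f x t) + -(S.u.f x t * (dx (dx S.u)).f x t) := by
          simp only [Flow.U, add_f, sub_f, mul_f, neg_f, cst_f, xx_f, dx_add, dt_add, dx_sub, dt_sub, dx_neg, dt_neg, dx_mul, dt_mul, dx_cst, dt_cst, dx_xx, dt_xx, dt_dx]; ring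
        have q0 := sq5 ((dx (dt S.ρ)).f x t * S.u.f x t) ((dt S.ρ).f x t * (dx S.u).f x t)
          ((dx S.ρ).f x t * (dt S.u).f x t) (S.ρ.f x t * (dx (dt S.u)).f x t) 0
        have u1 : (dt S.u).f x t ^ 2 ≤ 2 * nn S t + 2 * C ^ 2 := by
          rw [e1]
          have := sq2 (S.U.f x t) (-(S.u.f x t * (dx S.u).f x t))
          have := h.U x hx t ht
          have := mul_le_mul us ux (sq_nonneg _) (by linarith)
          linarith
        have u2 : (dx (dt S.u)).f x t ^ 2 ≤ 3 * (dx S.U).f x t ^ 2 + 3 * C * (dx S.u).f x t ^ 2 + 3 * C * (dx (dx S.u)).f x t ^ 2 := by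
          rw [e2]
          have := sq3 ((dx S.U).f x t) (-((dx S.u).f x t * (dx S.u).f x t)) (-(S.u.f x t * (dx (dx S.u)).f x t))
          have := mul_le_mul_of_nonneg_right ux (sq_nonneg ((dx S.u).f x t))
          have := mul_le_mul_of_nonneg_right us (sq_nonneg ((dx (dx S.u)).f x t))
          linarith
        have q1 := mul_le_mul_of_nonneg_left us (sq_nonneg ((dx (dt S.ρ)).f x t))
        have q2 := mul_le_mul_of_nonneg_left ux (sq_nonneg ((dt S.ρ).f x t))
        have q3 := mul_le_mul_of_nonneg_left u1 (sq_nonneg ((dx S.ρ).f x t))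
        have q4 := mul_le_mul r2 u2 (sq_nonneg _) (by positivity)
        rw [e]
        linarith)
  have p1 := mul_le_mul_of_nonneg_left r2 (by positivity : 0 ≤ 5 * C)
  have p2 := mul_le_mul_of_nonneg_left r1 (by positivity : 0 ≤ 5 * C)
  have p3 := mul_le_mul_of_nonneg_left (h.rx t ht) (by positivity : 0 ≤ 5 * (2 * nn S t + 2 * C ^ 2))
  have p4 := mul_le_mul_of_nonneg_left n3 (by positivity : 0 ≤ 15 * C ^ 2)
  have p5 := mul_le_mul_of_nonneg_left (h.Iux t ht) (by positivity : 0 ≤ 15 * C ^ 3)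
  have p6 := mul_le_mul_of_nonneg_left (h.uxx t ht) (by positivity : 0 ≤ 15 * C ^ 3)
  have p7 := mul_le_mul_of_nonneg_left n1 (by positivity : 0 ≤ 5 * C * (3 * C * R + 15 * C ^ 3) + 20 * C ^ 4 + 10 * C ^ 3 + 30 * C ^ 4)
  simp only [I2] at *
  linarith

set_option maxHeartbeats 1000000 in
theorem final (p : Par) : ∃ R > 0, ∀ S : Flow p, ∀ t ∈ Icc (0:ℝ) p.T,
    Ix (fun x t => (dx (dx S.ρ)).f x t ^ 2 + (dx (dt S.ρ)).f x t ^ 2) t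
      + ∫ s in (0:ℝ)..p.T, Ix (fun x t => (dt (dt S.ρ)).f x t ^ 2 + (dx (dx (dx S.u))).f x t ^ 2) s ≤ R := by
  obtain ⟨C', hH'⟩ := stepH6 p
  by_cases hne : Nonempty (Flow p)
  swap
  · exact ⟨1, one_pos, fun S => (hne ⟨S⟩).elim⟩
  obtain ⟨S0⟩ := hne
  obtain ⟨C, hC, hH⟩ : ∃ C, 1 ≤ C ∧ ∀ S : Flow p, H6 S C := ⟨C', (hH' S0).one, hH'⟩
  have hT := p.hT
  have hN := p.hN
  set A := 120 * C ^ 5 with hA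
  set Z := (p.N + 1) * (1 + Real.exp (A * C) * (1 + A * C)) with hZ
  have N0 : 0 ≤ p.N := by linarith
  have A0 : 0 ≤ A := by positivity
  have Z0 : 0 ≤ Z := by positivity
  set B := 5 * C * (3 * C * Z + 15 * C ^ 3) + 20 * C ^ 4 + 10 * C + 10 * C ^ 3 + 15 * C ^ 2 + 30 * C ^ 4 with hB
  have B0 : 0 ≤ B := by positivity
  refine ⟨1 + Z + (3 * C * Z + 15 * C ^ 3) + (B + 99 * C ^ 3 * (1 + Z)) * C, by positivity, fun S t ht => ?_⟩
  have h := hH S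
  have hz : ∀ t ∈ Icc (0:ℝ) p.T, I2 (dx (dx S.ρ)) t ≤ Z := fun t ht => by
    have g := gw (T := p.T) (c := A) (M := C) (a := p.N) (X := I2 (dx (dx S.ρ))) (D := fun _ => 0) (m := nn S) A0 N0 hT.le
      (fun t _ => I2_nonneg _ t) (fun t _ => le_rfl) (fun t ht => by linarith [(nn_ge S ht).1]) h.nI (fun t ht => by
        have id := Zid S ht
        have j := S.jρ
        have a := int_le1 ht.1 (f := Ix (fun x t => -(5/2) * ((dx S.u).f x t * (dx (dx S.ρ)).f x t ^ 2)
          - 3 * ((dx (dx S.u)).f x t * (dx S.ρ).f x t * (dx (dx S.ρ)).f x t) - S.ρ.f x t * (dx (dx (dx S.u))).f x t * (dx (dx S.ρ)).f x t))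
          (g₁ := fun s => A * nn S s * (1 + I2 (dx (dx S.ρ)) s)) (1/2) (fun s hs => by
            have := Z_rate h ⟨hs.1, hs.2.trans ht.2⟩
            rw [hA]
            linarith)
        simp only [intervalIntegral.integral_zero]
        simp only [I2] at *
        linarith)
    exact (g t ht).1
  have e1 : Ix (fun x t => (dx (dx S.ρ)).f x t ^ 2 + (dx (dt S.ρ)).f x t ^ 2) t ≤ Z + (3 * C * Z + 15 * C ^ 3) := by
    rw [Ix_add]
    have := hz t ht
    have := (rt_aux h ht (hz t ht)).2
    simp only [I2] at *
    linarith
  have e2 := int_le1 hT.le (f := Ix (fun x t => (dt (dt S.ρ)).f x t ^ 2 + (dx (dx (dx S.u))).f x t ^ 2)) (g₁ := nn S)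
    (B + 99 * C ^ 3 * (1 + Z)) (fun s hs => by
      rw [Ix_add]
      have a1 := rtt_aux h hs (hz s hs) Z0
      have a2 := uxxx_aux h hs
      have n1 := (nn_ge S hs).1
      have a3 : nn S s + I2 (dx (dx S.ρ)) s ≤ nn S s * (1 + Z) := by
        have := hz s hs
        have := mul_le_mul_of_nonneg_right n1 Z0
        linarith
      have a4 := mul_le_mul_of_nonneg_left a3 (by positivity : 0 ≤ 99 * C ^ 3)
      rw [← hB] at a1
      simp only [I2] at *
      linarith)
  have e3 := mul_le_mul_of_nonneg_left h.nI (by positivity : 0 ≤ B + 99 * C ^ 3 * (1 + Z))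
  linarith

end MHD

end MHDProof

/-- Lemma 2.8: there is a constant `C` depending only on `T, q, C₀`
and on the initial data (upper bound `A` for the `H²` norms, upper bound `B` for
`∫₀¹ ρ₀(|ln ρ₀| + |ln θ₀|) dx`, positive lower bound `M` for `∫₀¹ ρ₀ dx`, and upper
bound `G` for the `L²` norms of the compatibility functions `g₁, g₂, g₃`), but not on
the pointwise lower bounds of `ρ₀` and `θ₀`, such that every smooth solution satisfies
`sup_{t∈[0,T]} ∫₀¹ (ρ_{xx}² + ρ_{xt}²) dx + ∬_{Q_T} (ρ_{tt}² + u_{xxx}²) dx dt ≤ C`. -/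
theorem stmt17 (T q C₀ : ℝ) (hT : 0 < T) (hq : 0 < q) (hC₀ : 1 ≤ C₀)
    (κ : ℝ → ℝ) (hκ : KappaHyp q C₀ κ) (A B M G : ℝ) (hM : 0 < M) :
    ∃ C : ℝ, 0 < C ∧ ∀ sol : MHDSol T κ, InitBounds sol A B M → CompatBounds sol G →
      ∀ t ∈ Set.Icc (0:ℝ) T,
        (∫ x in (0:ℝ)..1,
            (pdx (pdx sol.ρ) x t) ^ 2 + (pdx (pdt sol.ρ) x t) ^ 2)
        + (∫ s in (0:ℝ)..T, ∫ y in (0:ℝ)..1,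
            (pdt (pdt sol.ρ) y s) ^ 2 + (pdx (pdx (pdx sol.u)) y s) ^ 2) ≤ C := by
  obtain ⟨p, hpT, hp⟩ := MHD.of_sol hT hq hC₀ κ hκ A B M G hM
  obtain ⟨R, hR, hfin⟩ := MHD.final p
  refine ⟨R, hR, fun sol hI hG t ht => ?_⟩
  obtain ⟨S, hρ, hu⟩ := hp sol hI hG
  have h := hfin S t (by rw [hpT]; exact ht)
  simp only [MHD.dx_f, MHD.dt_f] at h
  rw [← hρ, ← hu, ← hpT]
  exact h
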